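/- Assume that the conjugacy class c_{p+1} has n distinct eigenvalues and that there exists an irreducible (p+1)-tuple (A₁,…,A_{p+1}) with A_j ∈ c_j and A₁+…+A_{p+1} = 0. Then: (a) the topological closure of V(c₁,…,c_{p+1}) in (gl(n,ℂ))^{p+1} is connected; (b) this closure equals the topological closure of the subset of V(c₁,…,c_{p+1}) consisting of irreducible tuples; (c) the subset of irreducible tuples of V(c₁,…,c_{p+1}) is connected; (d) the topological closure of V(c₁,…,c_{p+1}) equals the set {(B₁,…,B_{p+1}) : B_j lies in the topological closure of c_j for each j and B₁+…+B_{p+1} = 0} (so the algebraic closure of V coincides with its topological closure). -/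

import Mathlib

open Matrix Polynomial BigOperators Finset

noncomputable section

def commSubmodule (N : Type*) [Fintype N] (A : Matrix N N ℂ) :
    Submodule ℂ (Matrix N N ℂ) where
  carrier := {X | X * A = A * X}
  add_mem' := by
    intro X Y hX hY
    simp only [Set.mem_setOf_eq] at *
    rw [Matrix.add_mul, Matrix.mul_add, hX, hY]
  zero_mem' := by
    simp only [Set.mem_setOf_eq, Matrix.zero_mul, Matrix.mul_zero]
  smul_mem' := by
    intro c X hX
    simp only [Set.mem_setOf_eq] at *
    rw [Matrix.smul_mul, Matrix.mul_smul, hX]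

/-- `d` of a matrix: `n² - dim of centralizer`. -/
def dQ {N : Type*} [Fintype N] (A : Matrix N N ℂ) : ℕ :=
  Fintype.card N ^ 2 - Module.finrank ℂ (commSubmodule N A)

/-- `r` of a matrix: the minimum over `μ` of `rank (A - μ • 1)`. -/
def rQ {N : Type*} [Fintype N] [DecidableEq N] (A : Matrix N N ℂ) : ℕ :=
  sInf {k | ∃ μ : ℂ, (A - μ • (1 : Matrix N N ℂ)).rank = k}

/-- The conjugacy class of a matrix under `GL(n, ℂ)`-conjugation. -/
def conjClass {n : ℕ} (A : Matrix (Fin n) (Fin n) ℂ) : Set (Matrix (Fin n) (Fin n) ℂ) :=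
  {B | ∃ g : (Matrix (Fin n) (Fin n) ℂ)ˣ, B = (g : Matrix (Fin n) (Fin n) ℂ) * A * (↑g⁻¹ : Matrix (Fin n) (Fin n) ℂ)}

/-- The conjugacy class of an element of `GL(n, ℂ)`. -/
def conjClassU {n : ℕ} (M : (Matrix (Fin n) (Fin n) ℂ)ˣ) : Set ((Matrix (Fin n) (Fin n) ℂ)ˣ) :=
  {N | ∃ g, N = g * M * g⁻¹}

/-- Irreducibility of a tuple: no common invariant subspace other than `⊥` and `⊤`. -/
def IrredTuple {N : Type*} [Fintype N] {q : ℕ} (A : Fin q → Matrix N N ℂ) : Prop :=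
  ∀ U : Submodule ℂ (N → ℂ), (∀ j, ∀ v ∈ U, (A j).mulVec v ∈ U) → U = ⊥ ∨ U = ⊤

/-- Trivial centralizer of a tuple: only scalar matrices commute with all members. -/
def TrivCent {N : Type*} [Fintype N] [DecidableEq N] {q : ℕ} (A : Fin q → Matrix N N ℂ) : Prop :=
  ∀ X : Matrix N N ℂ, (∀ j, X * A j = A j * X) → ∃ κ : ℂ, X = κ • (1 : Matrix N N ℂ)

/-- A matrix has `n` distinct eigenvalues. -/
def HasDistinctEigen {n : ℕ} (A : Matrix (Fin n) (Fin n) ℂ) : Prop :=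
  ∃ ev : Fin n → ℂ, Function.Injective ev ∧
    A.charpoly = ∏ i, (Polynomial.X - Polynomial.C (ev i))

/-- The variety 𝒱(c₁,…,c_{q}) where `c_j` is the conjugacy class of `A j`. -/
def Vset {n q : ℕ} (A : Fin q → Matrix (Fin n) (Fin n) ℂ) :
    Set (Fin q → Matrix (Fin n) (Fin n) ℂ) :=
  {B | (∀ j, B j ∈ conjClass (A j)) ∧ ∑ j, B j = 0}

/-- The variety 𝒲(C₁,…,C_q) where `C_j` is the conjugacy class of `M j` in `GL(n,ℂ)`. -/
def Wset {n q : ℕ} (M : Fin q → (Matrix (Fin n) (Fin n) ℂ)ˣ) :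
    Set (Fin q → (Matrix (Fin n) (Fin n) ℂ)ˣ) :=
  {B | (∀ j, B j ∈ conjClassU (M j)) ∧ (List.ofFn B).prod = 1}

set_option linter.unusedSectionVars false

section LinearAlgebra

open Filter Topology

/-- Pointwise convergent linear maps on a finite-dimensional space converge jointly. -/
lemma tendsto_linearMap_apply {α V W : Type*} [AddCommGroup V] [Module ℂ V] [TopologicalSpace V]
    [IsTopologicalAddGroup V] [ContinuousSMul ℂ V] [T2Space V] [FiniteDimensional ℂ V]
    [AddCommGroup W] [Module ℂ W] [TopologicalSpace W] [IsTopologicalAddGroup W]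
    [ContinuousSMul ℂ W] {l : Filter α} {L : α → V →ₗ[ℂ] W} {L0 : V →ₗ[ℂ] W}
    (hL : ∀ v, Tendsto (fun a => L a v) l (𝓝 (L0 v))) {v : α → V} {v0 : V}
    (hv : Tendsto v l (𝓝 v0)) : Tendsto (fun a => L a (v a)) l (𝓝 (L0 v0)) := by
  let b := Module.finBasis ℂ V
  have hexp : ∀ (T : V →ₗ[ℂ] W) (u : V), T u = ∑ i, b.equivFunL u i • T (b i) := by
    intro T u
    conv_lhs => rw [← b.sum_repr u, map_sum]
    simp only [map_smul, Module.Basis.equivFunL_apply]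
  have h1 : Tendsto (fun a => ∑ i, b.equivFunL (v a) i • L a (b i)) l
      (𝓝 (∑ i, b.equivFunL v0 i • L0 (b i))) := by
    refine tendsto_finsetSum _ fun i _ => Tendsto.smul ?_ (hL _)
    have hc : Continuous fun u : V => b.equivFunL u i :=
      (continuous_apply i).comp b.equivFunL.continuous
    exact (hc.tendsto v0).comp hv
  rw [hexp L0 v0]
  exact h1.congr fun a => (hexp _ _).symm

lemma tendsto_mulVec {α m n : Type*} [Fintype n] {l : Filter α} {M : α → Matrix m n ℂ}
    {M0 : Matrix m n ℂ} {v : α → n → ℂ} {v0 : n → ℂ} (hM : Tendsto M l (𝓝 M0))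
    (hv : Tendsto v l (𝓝 v0)) : Tendsto (fun a => M a *ᵥ v a) l (𝓝 (M0 *ᵥ v0)) := by
  refine tendsto_pi_nhds.2 fun i => ?_
  simp only [Matrix.mulVec, dotProduct]
  refine tendsto_finsetSum _ fun j _ => Tendsto.mul ?_ (tendsto_pi_nhds.1 hv j)
  exact tendsto_pi_nhds.1 (tendsto_pi_nhds.1 hM i) j

lemma exists_compression {α V W : Type*} [AddCommGroup V] [Module ℂ V]
    [AddCommGroup W] [Module ℂ W] [TopologicalSpace W] [IsTopologicalAddGroup W]
    [ContinuousSMul ℂ W] [T2Space W] [FiniteDimensional ℂ W]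
    {l : Filter α} {L : α → V →ₗ[ℂ] W} {L0 : V →ₗ[ℂ] W}
    (hL : ∀ v, Tendsto (fun a => L a v) l (𝓝 (L0 v))) :
    ∃ (r : ℕ) (S : (Fin r → ℂ) →ₗ[ℂ] V) (P : W →ₗ[ℂ] (Fin r → ℂ)),
      Module.finrank ℂ (LinearMap.range L0) = r ∧ Tendsto (fun a => LinearMap.toMatrix' (P ∘ₗ L a ∘ₗ S)) l (𝓝 1) ∧
      Tendsto (fun a => (LinearMap.toMatrix' (P ∘ₗ L a ∘ₗ S)).det) l (𝓝 1) := by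
  classical
  let b := Module.finBasis ℂ (LinearMap.range L0)
  set r := Module.finrank ℂ (LinearMap.range L0) with hrdef
  have hb : ∀ i, ∃ v, L0 v = b i := fun i => (b i).2
  choose s hs using hb
  let S : (Fin r → ℂ) →ₗ[ℂ] V := Fintype.linearCombination ℂ s
  have hSapp : ∀ c, S c = ∑ i, c i • s i := fun c => Fintype.linearCombination_apply ..
  have hinj : LinearMap.ker (L0 ∘ₗ S) = ⊥ := by
    rw [LinearMap.ker_eq_bot']
    intro c hc
    have h2 : ((∑ i, c i • b i : LinearMap.range L0) : W) = 0 := by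
      rw [← hc]; simp [hSapp, hs]
    have h3 : ∑ i, c i • b i = 0 := Subtype.ext h2
    funext i
    exact Fintype.linearIndependent_iff.1 b.linearIndependent c h3 i
  obtain ⟨P, hP⟩ := (L0 ∘ₗ S).exists_leftInverse_of_injective hinj
  let G : α → Matrix (Fin r) (Fin r) ℂ := fun a => LinearMap.toMatrix' (P ∘ₗ L a ∘ₗ S)
  have hPc : Continuous P := P.continuous_of_finiteDimensional
  have hG : Tendsto G l (𝓝 1) := by
    have h1 : (1 : Matrix (Fin r) (Fin r) ℂ) = LinearMap.toMatrix' (P ∘ₗ L0 ∘ₗ S) := by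
      rw [hP, LinearMap.toMatrix'_id]
    rw [h1]
    refine tendsto_pi_nhds.2 fun i => tendsto_pi_nhds.2 fun j => ?_
    simp only [G, LinearMap.toMatrix'_apply, LinearMap.comp_apply]
    exact ((continuous_apply i).tendsto _).comp ((hPc.tendsto _).comp (hL _))
  have hdet : Tendsto (fun a => (G a).det) l (𝓝 1) := by
    have := ((continuous_id.matrix_det).tendsto (1 : Matrix (Fin r) (Fin r) ℂ)).comp hG
    simpa [Function.comp_def] using this
  exact ⟨r, S, P, hrdef.symm, hG, hdet⟩

lemma eventually_finrank_range_le {α V W : Type*} [AddCommGroup V] [Module ℂ V]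
    [AddCommGroup W] [Module ℂ W] [TopologicalSpace W] [IsTopologicalAddGroup W]
    [ContinuousSMul ℂ W] [T2Space W] [FiniteDimensional ℂ W]
    {l : Filter α} {L : α → V →ₗ[ℂ] W} {L0 : V →ₗ[ℂ] W}
    (hL : ∀ v, Tendsto (fun a => L a v) l (𝓝 (L0 v))) :
    ∀ᶠ a in l, Module.finrank ℂ (LinearMap.range L0) ≤ Module.finrank ℂ (LinearMap.range (L a)) := by
  obtain ⟨r, S, P, hr, -, hdet⟩ := exists_compression hL
  filter_upwards [hdet.eventually_ne one_ne_zero] with a hd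
  have hGu := isUnit_iff_ne_zero.2 hd
  have hsurj : Function.Surjective (P ∘ₗ (LinearMap.range (L a)).subtype) := by
    intro c
    refine ⟨⟨L a (S ((LinearMap.toMatrix' (P ∘ₗ L a ∘ₗ S))⁻¹ *ᵥ c)), LinearMap.mem_range_self _ _⟩, ?_⟩
    have h1 : ∀ c, P (L a (S c)) = (LinearMap.toMatrix' (P ∘ₗ L a ∘ₗ S)) *ᵥ c := by
      intro c
      have : (P ∘ₗ L a ∘ₗ S) c = Matrix.toLin' (LinearMap.toMatrix' (P ∘ₗ L a ∘ₗ S)) c := by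
        simp only [Matrix.toLin'_toMatrix']
      exact this
    change P (L a (S _)) = c
    rw [h1, Matrix.mulVec_mulVec, Matrix.mul_nonsing_inv _ hGu, Matrix.one_mulVec]
  have h2 := LinearMap.finrank_le_finrank_of_surjective hsurj
  rwa [Module.finrank_fin_fun, ← hr] at h2

/-- If the ranks of `L a` do not exceed that of the limit `L0`, there are convergent right inverses
of `L a` on the ranges. -/
lemma exists_tendsto_rightInverse {α V W : Type*} [AddCommGroup V] [Module ℂ V] [TopologicalSpace V]
    [IsTopologicalAddGroup V] [ContinuousSMul ℂ V]
    [AddCommGroup W] [Module ℂ W] [TopologicalSpace W] [IsTopologicalAddGroup W]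
    [ContinuousSMul ℂ W] [T2Space W] [FiniteDimensional ℂ W]
    {l : Filter α} {L : α → V →ₗ[ℂ] W} {L0 : V →ₗ[ℂ] W}
    (hL : ∀ v, Tendsto (fun a => L a v) l (𝓝 (L0 v)))
    (hr : ∀ᶠ a in l, Module.finrank ℂ (LinearMap.range (L a)) ≤
      Module.finrank ℂ (LinearMap.range L0)) :
    ∃ (K : α → W →ₗ[ℂ] V) (K0 : W →ₗ[ℂ] V),
      (∀ (w : α → W) (w0 : W), Tendsto w l (𝓝 w0) →
        Tendsto (fun a => K a (w a)) l (𝓝 (K0 w0))) ∧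
      ∀ᶠ a in l, ∀ w ∈ LinearMap.range (L a), L a (K a w) = w := by
  classical
  obtain ⟨r, S, P, hrdef, hG, hdet⟩ := exists_compression hL
  have hPc : Continuous P := P.continuous_of_finiteDimensional
  rw [hrdef] at hr
  set G : α → Matrix (Fin r) (Fin r) ℂ := fun a => LinearMap.toMatrix' (P ∘ₗ L a ∘ₗ S) with hGdef
  have hinv : Tendsto (fun a => (G a)⁻¹) l (𝓝 1) := by
    have h1 : Tendsto (fun a => ((G a).det)⁻¹ • (G a).adjugate) l
        (𝓝 ((1 : ℂ)⁻¹ • (1 : Matrix (Fin r) (Fin r) ℂ).adjugate)) := by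
      refine Tendsto.smul (hdet.inv₀ one_ne_zero) ?_
      exact ((continuous_id.matrix_adjugate).tendsto (1 : Matrix (Fin r) (Fin r) ℂ)).comp hG
    rw [Matrix.adjugate_one, inv_one, one_smul] at h1
    refine h1.congr fun a => ?_
    rw [Matrix.inv_def, Ring.inverse_eq_inv']
  refine ⟨fun a => S ∘ₗ Matrix.toLin' (G a)⁻¹ ∘ₗ P, S ∘ₗ P, ?_, ?_⟩
  · intro w w0 hw
    have hSc : Continuous S := S.continuous_of_finiteDimensional
    have h1 : Tendsto (fun a => (G a)⁻¹ *ᵥ P (w a)) l (𝓝 ((1 : Matrix (Fin r) (Fin r) ℂ) *ᵥ P w0)) := by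
      have h2 : Tendsto (fun a => P (w a)) l (𝓝 (P w0)) := (hPc.tendsto w0).comp hw
      exact tendsto_mulVec hinv h2
    rw [Matrix.one_mulVec] at h1
    exact (hSc.tendsto _).comp h1
  · have hne : ∀ᶠ a in l, (G a).det ≠ 0 := hdet.eventually_ne one_ne_zero
    filter_upwards [hr, hne] with a ha hd w hw
    have hGu : IsUnit (G a).det := isUnit_iff_ne_zero.2 hd
    have hPL : ∀ c, P (L a (S c)) = G a *ᵥ c := by
      intro c
      have : (P ∘ₗ L a ∘ₗ S) c = Matrix.toLin' (G a) c := by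
        simp only [G, Matrix.toLin'_toMatrix']
      simpa using this
    have hinjr : Function.Injective (P ∘ₗ (LinearMap.range (L a)).subtype) := by
      have hsurj : Function.Surjective (P ∘ₗ (LinearMap.range (L a)).subtype) := by
        intro c
        refine ⟨⟨L a (S ((G a)⁻¹ *ᵥ c)), LinearMap.mem_range_self _ _⟩, ?_⟩
        simp [hPL, Matrix.mulVec_mulVec, Matrix.mul_nonsing_inv _ hGu]
      have hle := LinearMap.finrank_le_finrank_of_injective (f := (LinearMap.range (L a)).subtype)
        (Submodule.injective_subtype _)
      have h2 := (P ∘ₗ (LinearMap.range (L a)).subtype).finrank_range_add_finrank_ker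
      rw [LinearMap.range_eq_top.2 hsurj, finrank_top, Module.finrank_fin_fun] at h2
      rw [← LinearMap.ker_eq_bot]
      apply Submodule.finrank_eq_zero.1
      omega
    have key : (⟨L a (S ((G a)⁻¹ *ᵥ P w)), LinearMap.mem_range_self _ _⟩ : LinearMap.range (L a))
        = ⟨w, hw⟩ := by
      apply hinjr
      simp [hPL, Matrix.mulVec_mulVec, Matrix.mul_nonsing_inv _ hGu]
    exact congrArg Subtype.val key

/-- First-order consequence of upper bounded rank. -/
lemma exists_ker_extension {α V W : Type*} [AddCommGroup V] [Module ℂ V] [TopologicalSpace V]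
    [IsTopologicalAddGroup V] [ContinuousSMul ℂ V] [T2Space V] [FiniteDimensional ℂ V]
    [AddCommGroup W] [Module ℂ W] [TopologicalSpace W] [IsTopologicalAddGroup W]
    [ContinuousSMul ℂ W] [T2Space W] [FiniteDimensional ℂ W]
    {l : Filter α} [l.NeBot] {L : α → V →ₗ[ℂ] W} {L0 : V →ₗ[ℂ] W}
    (hL : ∀ v, Tendsto (fun a => L a v) l (𝓝 (L0 v)))
    (hr : ∀ᶠ a in l, Module.finrank ℂ (LinearMap.range (L a)) ≤
      Module.finrank ℂ (LinearMap.range L0))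
    {t : α → ℂ} (ht : ∀ᶠ a in l, t a ≠ 0) {v : V} {w' : W}
    (hw : Tendsto (fun a => (t a)⁻¹ • L a v) l (𝓝 w')) :
    ∃ (d : α → V) (d0 : V), Tendsto d l (𝓝 d0) ∧ (∀ᶠ a in l, L a (v + t a • d a) = 0) ∧
      L0 d0 + w' = 0 := by
  obtain ⟨K, K0, hK, hK'⟩ := exists_tendsto_rightInverse hL hr
  have h1 := hK _ _ hw
  refine ⟨fun a => - K a ((t a)⁻¹ • L a v), - K0 w', h1.neg, ?_, ?_⟩
  · filter_upwards [hK', ht] with a ha hta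
    have := ha _ (LinearMap.mem_range_self (L a) ((t a)⁻¹ • v))
    rw [map_smul] at this
    rw [map_add, map_smul, map_neg, this, smul_neg, smul_smul, mul_inv_cancel₀ hta, one_smul,
      add_neg_cancel]
  · have h2 := tendsto_linearMap_apply hL h1
    have h3 : Tendsto (fun a => (t a)⁻¹ • L a v) l (𝓝 (L0 (K0 w'))) := by
      refine h2.congr' ?_
      filter_upwards [hK'] with a ha
      have := ha _ (LinearMap.mem_range_self (L a) ((t a)⁻¹ • v))
      rwa [map_smul] at this
    rw [map_neg, ← tendsto_nhds_unique hw h3, neg_add_cancel]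

lemma mem_range_of_rank_le {α V W : Type*} [AddCommGroup V] [Module ℂ V] [TopologicalSpace V]
    [IsTopologicalAddGroup V] [ContinuousSMul ℂ V] [T2Space V] [FiniteDimensional ℂ V]
    [AddCommGroup W] [Module ℂ W] [TopologicalSpace W] [IsTopologicalAddGroup W]
    [ContinuousSMul ℂ W] [T2Space W] [FiniteDimensional ℂ W]
    {l : Filter α} [l.NeBot] {L : α → V →ₗ[ℂ] W} {L0 : V →ₗ[ℂ] W}
    (hL : ∀ v, Tendsto (fun a => L a v) l (𝓝 (L0 v)))
    (hr : ∀ᶠ a in l, Module.finrank ℂ (LinearMap.range (L a)) ≤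
      Module.finrank ℂ (LinearMap.range L0))
    {t : α → ℂ} (ht : ∀ᶠ a in l, t a ≠ 0) {v : V} {w' : W}
    (hw : Tendsto (fun a => (t a)⁻¹ • L a v) l (𝓝 w')) :
    w' ∈ LinearMap.range L0 := by
  obtain ⟨d, d0, -, -, h⟩ := exists_ker_extension hL hr ht hw
  refine ⟨-d0, ?_⟩
  rw [map_neg]
  exact neg_eq_of_add_eq_zero_right h

/-- Tangent directions integrate for quadratic equations whose linear part is onto. -/
lemma eventually_exists_quadratic {E F : Type*} [NormedAddCommGroup E] [NormedSpace ℂ E]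
    [FiniteDimensional ℂ E] [AddCommGroup F] [Module ℂ F]
    (L : E →ₗ[ℂ] F) (q : E →ₗ[ℂ] E →ₗ[ℂ] F) (hq : ∀ u, q u u ∈ LinearMap.range L) {v : E}
    (hv : L v = 0) {U : Set E} (hU : U ∈ 𝓝 v) :
    ∀ᶠ t : ℂ in 𝓝 0, ∃ u ∈ U, L u + t • q u u = 0 := by
  obtain ⟨R, hR⟩ := L.rangeRestrict.exists_rightInverse_of_surjective
    (LinearMap.range_rangeRestrict L)
  obtain ⟨P, hP⟩ := (LinearMap.range L).exists_isCompl
  let π : F →ₗ[ℂ] LinearMap.range L := Submodule.projectionOnto _ _ hP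
  let B : E →ₗ[ℂ] E →ₗ[ℂ] E := q.compr₂ (R ∘ₗ π)
  have hB : ∀ u, L (B u u) = q u u := by
    intro u
    have h1 : π (q u u) = ⟨q u u, hq u⟩ := Submodule.projectionOnto_apply_left hP ⟨q u u, hq u⟩
    have h2 := congrArg Subtype.val (LinearMap.congr_fun hR ⟨q u u, hq u⟩)
    simpa [B, h1] using h2
  let Bc : E →L[ℂ] E →L[ℂ] E :=
    (LinearMap.toContinuousLinearMap.toLinearMap ∘ₗ B).toContinuousLinearMap
  have hBc : ∀ u w, Bc u w = B u w := fun u w => rfl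
  let Ψ : ℂ × E → ℂ × E := fun p => (p.1, p.2 + p.1 • Bc (v + p.2) (v + p.2))
  have hΨ0 : Ψ (0, 0) = (0, 0) := by simp [Ψ]
  have hcd : ContDiff ℂ 1 Ψ := by
    refine contDiff_fst.prodMk (contDiff_snd.add (contDiff_fst.smul ?_))
    have h1 : ContDiff ℂ 1 fun p : ℂ × E => v + p.2 := contDiff_const.add contDiff_snd
    exact (Bc.contDiff.comp h1).clm_apply h1
  have hstrict := hcd.contDiffAt.hasStrictFDerivAt (x := ((0 : ℂ), (0 : E))) one_ne_zero
  have hder : HasFDerivAt Ψ ((ContinuousLinearMap.fst ℂ ℂ E).prod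
      (ContinuousLinearMap.snd ℂ ℂ E +
        (ContinuousLinearMap.fst ℂ ℂ E).smulRight (Bc v v))) ((0 : ℂ), (0 : E)) := by
    have h1 : HasFDerivAt (fun p : ℂ × E => p.1) (ContinuousLinearMap.fst ℂ ℂ E) ((0 : ℂ), (0 : E)) :=
      hasFDerivAt_fst
    have h2 : HasFDerivAt (fun p : ℂ × E => p.2) (ContinuousLinearMap.snd ℂ ℂ E) ((0 : ℂ), (0 : E)) :=
      hasFDerivAt_snd
    have h4 : DifferentiableAt ℂ (fun p : ℂ × E => Bc (v + p.2) (v + p.2)) ((0 : ℂ), (0 : E)) := by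
      have h1 : ContDiff ℂ 1 fun p : ℂ × E => v + p.2 := contDiff_const.add contDiff_snd
      exact ((Bc.contDiff.comp h1).clm_apply h1).contDiffAt.differentiableAt one_ne_zero
    have h5 := h1.prodMk (h2.add (h1.smul h4.hasFDerivAt))
    refine HasFDerivAt.congr_fderiv h5 ?_
    ext <;> simp
  rw [hder.fderiv] at hstrict
  have hsurj : ((ContinuousLinearMap.fst ℂ ℂ E).prod
      (ContinuousLinearMap.snd ℂ ℂ E +
        (ContinuousLinearMap.fst ℂ ℂ E).smulRight (Bc v v))).range = ⊤ := by
    rw [LinearMap.range_eq_top]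
    rintro ⟨a, b⟩
    refine ⟨(a, b - a • Bc v v), ?_⟩
    simp
  have hmap := hstrict.map_nhds_eq_of_surj hsurj
  rw [hΨ0] at hmap
  have hN : {p : ℂ × E | v + p.2 ∈ U} ∈ 𝓝 ((0 : ℂ), (0 : E)) := by
    have hc : Continuous fun p : ℂ × E => v + p.2 := by fun_prop
    exact hc.continuousAt.preimage_mem_nhds (by simpa using hU)
  have him : Ψ '' {p : ℂ × E | v + p.2 ∈ U} ∈ 𝓝 ((0 : ℂ), (0 : E)) := by
    rw [← hmap]; exact image_mem_map hN
  have hc2 : Continuous fun t : ℂ => (t, (0 : E)) := by fun_prop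
  have := hc2.continuousAt.preimage_mem_nhds (x := 0) him
  filter_upwards [this] with t ht
  obtain ⟨⟨s, w⟩, hw, he⟩ := ht
  simp only [Ψ, Prod.mk.injEq] at he
  obtain ⟨rfl, he⟩ := he
  refine ⟨v + w, hw, ?_⟩
  have h6 := congrArg L he
  rw [map_add, map_smul, map_zero, hBc, hB] at h6
  rw [map_add, hv, zero_add]
  exact h6

end LinearAlgebra

section Intertwiners

lemma rank_nullity {V W : Type*} [AddCommGroup V] [Module ℂ V] [AddCommGroup W] [Module ℂ W]
    [FiniteDimensional ℂ V] (f : V →ₗ[ℂ] W) :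
    Module.finrank ℂ (LinearMap.range f) + Module.finrank ℂ (LinearMap.ker f) =
      Module.finrank ℂ V := f.finrank_range_add_finrank_ker

/-- Linear maps intertwining two endomorphisms. -/
def homComm {U W : Type*} [AddCommGroup U] [Module ℂ U] [AddCommGroup W] [Module ℂ W]
    (Z : U →ₗ[ℂ] U) (Y : W →ₗ[ℂ] W) : Submodule ℂ (U →ₗ[ℂ] W) where
  carrier := {f | f ∘ₗ Z = Y ∘ₗ f}
  add_mem' := by
    intro f g hf hg
    simp only [Set.mem_ofPred_eq] at *
    rw [LinearMap.add_comp, LinearMap.comp_add, hf, hg]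
  zero_mem' := by simp
  smul_mem' := by
    intro c f hf
    simp only [Set.mem_ofPred_eq] at *
    rw [LinearMap.smul_comp, LinearMap.comp_smul, hf]

lemma mem_homComm {U W : Type*} [AddCommGroup U] [Module ℂ U] [AddCommGroup W] [Module ℂ W]
    {Z : U →ₗ[ℂ] U} {Y : W →ₗ[ℂ] W} {f : U →ₗ[ℂ] W} :
    f ∈ homComm Z Y ↔ ∀ u, f (Z u) = Y (f u) := by
  constructor
  · intro h u; exact LinearMap.congr_fun h u
  · intro h; exact LinearMap.ext h

/-- The number of Jordan blocks of size larger than `s` of a nilpotent endomorphism. -/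
def jordanDim {U : Type*} [AddCommGroup U] [Module ℂ U] (Z : U →ₗ[ℂ] U) (s : ℕ) : ℕ :=
  Module.finrank ℂ ↥(LinearMap.ker Z ⊓ LinearMap.range (Z ^ s))

lemma jordanDim_add_finrank {U : Type*} [AddCommGroup U] [Module ℂ U] [FiniteDimensional ℂ U]
    (Z : U →ₗ[ℂ] U) (s : ℕ) :
    jordanDim Z s + Module.finrank ℂ (LinearMap.range (Z ^ (s + 1))) =
      Module.finrank ℂ (LinearMap.range (Z ^ s)) := by
  have h := (Z.domRestrict (LinearMap.range (Z ^ s))).finrank_range_add_finrank_ker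
  have h1 : LinearMap.range (Z.domRestrict (LinearMap.range (Z ^ s))) =
      LinearMap.range (Z ^ (s + 1)) := by
    rw [pow_succ', Module.End.mul_eq_comp, LinearMap.range_comp, LinearMap.range_domRestrict]
  have h2 : Module.finrank ℂ (LinearMap.ker (Z.domRestrict (LinearMap.range (Z ^ s)))) =
      jordanDim Z s := by
    rw [LinearMap.ker_domRestrict, jordanDim, inf_comm, ← Submodule.map_comap_subtype]
    exact (LinearEquiv.finrank_eq (Submodule.equivMapOfInjective _
      (Submodule.injective_subtype _) _))
  rw [h1, h2] at h
  omega

/-- The restriction of an endomorphism to its range. -/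
def rangeRestr {U : Type*} [AddCommGroup U] [Module ℂ U] (Z : U →ₗ[ℂ] U) :
    LinearMap.range Z →ₗ[ℂ] LinearMap.range Z := Z.rangeRestrict ∘ₗ (LinearMap.range Z).subtype

lemma rangeRestr_pow_coe {U : Type*} [AddCommGroup U] [Module ℂ U] (Z : U →ₗ[ℂ] U) (s : ℕ)
    (u : LinearMap.range Z) : (((rangeRestr Z) ^ s) u : U) = (Z ^ s) u := by
  induction s generalizing u with
  | zero => simp
  | succ s ih =>
    rw [pow_succ, pow_succ, Module.End.mul_apply, Module.End.mul_apply, ih]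
    rfl

lemma jordanDim_rangeRestr {U : Type*} [AddCommGroup U] [Module ℂ U] (Z : U →ₗ[ℂ] U) (s : ℕ) :
    jordanDim (rangeRestr Z) s = jordanDim Z (s + 1) := by
  have : (LinearMap.ker (rangeRestr Z) ⊓ LinearMap.range (rangeRestr Z ^ s)).map
      (LinearMap.range Z).subtype = LinearMap.ker Z ⊓ LinearMap.range (Z ^ (s + 1)) := by
    ext u
    simp only [Submodule.mem_map, Submodule.mem_inf, LinearMap.mem_ker, LinearMap.mem_range]
    constructor
    · rintro ⟨w, ⟨hw, ⟨v, hv⟩⟩, rfl⟩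
      obtain ⟨⟨v, ⟨v', rfl⟩⟩, rfl⟩ := (⟨v, hv⟩ : ∃ v, (rangeRestr Z ^ s) v = w)
      refine ⟨congrArg Subtype.val hw, v', ?_⟩
      rw [Submodule.subtype_apply, rangeRestr_pow_coe, pow_succ]
      rfl
    · rintro ⟨hu, v, rfl⟩
      refine ⟨(rangeRestr Z ^ s) ⟨Z v, LinearMap.mem_range_self _ _⟩, ⟨?_, ⟨_, rfl⟩⟩, ?_⟩
      · apply Subtype.ext
        rw [pow_succ] at hu
        change Z _ = 0
        have h1 := rangeRestr_pow_coe Z s ⟨Z v, LinearMap.mem_range_self _ _⟩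
        exact (congrArg Z h1).trans hu
      · rw [Submodule.subtype_apply, rangeRestr_pow_coe, pow_succ]
        rfl
  rw [jordanDim, jordanDim, ← this]
  exact (LinearEquiv.finrank_eq (Submodule.equivMapOfInjective _
      (Submodule.injective_subtype _) _))

/-- Restriction of intertwiners to the ranges. -/
def homCommRestr {U W : Type*} [AddCommGroup U] [Module ℂ U] [AddCommGroup W] [Module ℂ W]
    (Z : U →ₗ[ℂ] U) (Y : W →ₗ[ℂ] W) :
    homComm Z Y →ₗ[ℂ] homComm (rangeRestr Z) (rangeRestr Y) where
  toFun f := ⟨((f : U →ₗ[ℂ] W) ∘ₗ (LinearMap.range Z).subtype).codRestrict (LinearMap.range Y) (by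
      rintro ⟨_, ⟨u, rfl⟩⟩
      exact ⟨f.1 u, (mem_homComm.1 f.2 u).symm⟩), by
      rw [mem_homComm]
      rintro ⟨u, hu⟩
      exact Subtype.ext (mem_homComm.1 f.2 u)⟩
  map_add' f g := rfl
  map_smul' c f := rfl

lemma homCommRestr_surjective {U W : Type*} [AddCommGroup U] [Module ℂ U] [AddCommGroup W]
    [Module ℂ W] (Z : U →ₗ[ℂ] U) (Y : W →ₗ[ℂ] W) : Function.Surjective (homCommRestr Z Y) := by
  intro g
  obtain ⟨P, hP⟩ := (LinearMap.range Z).subtype.exists_leftInverse_of_injective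
    (Submodule.ker_subtype _)
  obtain ⟨σ, hσ⟩ := Y.rangeRestrict.exists_rightInverse_of_surjective
    (LinearMap.range_rangeRestrict Y)
  have hP' : ∀ u (hu : u ∈ LinearMap.range Z), P u = ⟨u, hu⟩ :=
    fun u hu => LinearMap.congr_fun hP ⟨u, hu⟩
  have hσ' : ∀ w, Y (σ w) = w := fun w => congrArg Subtype.val (LinearMap.congr_fun hσ w)
  let f : U →ₗ[ℂ] W := (LinearMap.range Y).subtype ∘ₗ g.1 ∘ₗ P +
    σ ∘ₗ g.1 ∘ₗ Z.rangeRestrict ∘ₗ (LinearMap.id - (LinearMap.range Z).subtype ∘ₗ P)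
  have hf : ∀ u (hu : u ∈ LinearMap.range Z), f u = g.1 ⟨u, hu⟩ := by
    intro u hu
    have h1 : Z.rangeRestrict (u - P u) = 0 := by
      rw [hP' u hu, sub_self, map_zero]
    change (g.1 (P u) : W) + σ (g.1 (Z.rangeRestrict (u - P u))) = _
    rw [h1, map_zero, map_zero, add_zero, hP' u hu]
  have hmem : f ∈ homComm Z Y := by
    rw [mem_homComm]
    intro u
    rw [hf _ (LinearMap.mem_range_self Z u)]
    have h1 : Y (f u) = Y (g.1 (P u)) + g.1 (Z.rangeRestrict (u - P u)) := by
      simp only [f, LinearMap.add_apply, LinearMap.comp_apply, map_add, hσ']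
      rfl
    have h2 : Y (g.1 (P u)) = g.1 (rangeRestr Z (P u)) :=
      (congrArg Subtype.val (mem_homComm.1 g.2 (P u))).symm
    rw [h1, h2, ← Submodule.coe_add, ← map_add]
    congr 2
    apply Subtype.ext
    change Z u = Z (P u) + Z (u - P u)
    rw [← map_add, add_sub_cancel]
  refine ⟨⟨f, hmem⟩, ?_⟩
  apply Subtype.ext
  ext u
  exact hf u.1 u.2

lemma finrank_ker_homCommRestr {U W : Type*} [AddCommGroup U] [Module ℂ U] [AddCommGroup W]
    [Module ℂ W] [FiniteDimensional ℂ U] [FiniteDimensional ℂ W]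
    (Z : U →ₗ[ℂ] U) (Y : W →ₗ[ℂ] W) :
    Module.finrank ℂ (LinearMap.ker (homCommRestr Z Y)) =
      Module.finrank ℂ (LinearMap.ker Z) * Module.finrank ℂ (LinearMap.ker Y) := by
  let Θ : ((U ⧸ LinearMap.range Z) →ₗ[ℂ] LinearMap.ker Y) →ₗ[ℂ] homComm Z Y :=
    { toFun := fun g => ⟨(LinearMap.ker Y).subtype ∘ₗ g ∘ₗ (LinearMap.range Z).mkQ, by
        rw [mem_homComm]
        intro u
        have h1 : (LinearMap.range Z).mkQ (Z u) = 0 :=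
          (Submodule.Quotient.mk_eq_zero _).2 (LinearMap.mem_range_self _ _)
        rw [LinearMap.comp_apply, LinearMap.comp_apply, h1, map_zero, map_zero]
        exact (g ((LinearMap.range Z).mkQ u)).2.symm⟩
      map_add' := fun f g => by apply Subtype.ext; ext; simp
      map_smul' := fun c g => by apply Subtype.ext; ext; simp }
  have hΘ : Function.Injective Θ := by
    intro g g' h
    ext u
    exact LinearMap.congr_fun (congrArg Subtype.val h) u
  have hr : LinearMap.range Θ = LinearMap.ker (homCommRestr Z Y) := by
    ext f
    rw [LinearMap.mem_range, LinearMap.mem_ker]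
    constructor
    · rintro ⟨g, rfl⟩
      apply Subtype.ext
      ext ⟨u, hu⟩
      have h1 : (LinearMap.range Z).mkQ u = 0 := (Submodule.Quotient.mk_eq_zero _).2 hu
      change (g ((LinearMap.range Z).mkQ u) : W) = 0
      rw [h1, map_zero]; rfl
    · intro h
      have h0 : ∀ u, f.1 (Z u) = 0 := by
        intro u
        have := LinearMap.congr_fun (congrArg Subtype.val h) ⟨Z u, LinearMap.mem_range_self _ _⟩
        exact congrArg Subtype.val this
      have h1 : ∀ u, Y (f.1 u) = 0 := fun u => by rw [← mem_homComm.1 f.2, h0]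
      refine ⟨(LinearMap.range Z).liftQ (f.1.codRestrict (LinearMap.ker Y) h1) ?_, ?_⟩
      · rintro _ ⟨u, rfl⟩
        exact Subtype.ext (h0 u)
      · apply Subtype.ext
        ext u
        rfl
  rw [← hr, LinearMap.finrank_range_of_inj hΘ, Module.finrank_linearMap]
  congr 1
  have h1 := (LinearMap.range Z).finrank_quotient_add_finrank
  have h2 := Z.finrank_range_add_finrank_ker
  omega

theorem finrank_homComm {U W : Type*} [AddCommGroup U] [Module ℂ U] [AddCommGroup W]
    [Module ℂ W] [FiniteDimensional ℂ U] [FiniteDimensional ℂ W]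
    (Z : U →ₗ[ℂ] U) (Y : W →ₗ[ℂ] W) (M : ℕ) (hZ : Z ^ M = 0) :
    Module.finrank ℂ (homComm Z Y) = ∑ s ∈ Finset.range M, jordanDim Z s * jordanDim Y s := by
  induction M generalizing U W with
  | zero =>
    have : Subsingleton U := by
      refine ⟨fun a b => ?_⟩
      have h : ∀ u : U, u = 0 := fun u => by
        have := LinearMap.congr_fun hZ u
        simpa using this
      rw [h a, h b]
    rw [Finset.range_zero, Finset.sum_empty]
    have : Subsingleton (homComm Z Y) := by
      refine ⟨fun f g => Subtype.ext (LinearMap.ext fun u => ?_)⟩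
      rw [Subsingleton.elim u 0, map_zero, map_zero]
    exact Module.finrank_zero_of_subsingleton
  | succ M ih =>
    have h := rank_nullity (V := homComm Z Y) (W := homComm (rangeRestr Z) (rangeRestr Y))
      (homCommRestr Z Y)
    rw [LinearMap.range_eq_top.2 (homCommRestr_surjective Z Y), finrank_top,
      finrank_ker_homCommRestr, ih] at h
    · rw [← h, Finset.sum_range_succ']
      congr 1
      · exact Finset.sum_congr rfl fun s _ => by rw [jordanDim_rangeRestr, jordanDim_rangeRestr]
      · have h0 : ∀ {V : Type _} [AddCommGroup V] [Module ℂ V] (T : V →ₗ[ℂ] V),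
            LinearMap.ker T ⊓ LinearMap.range (T ^ 0) = LinearMap.ker T := by
          intro V _ _ T
          rw [pow_zero, Module.End.one_eq_id, LinearMap.range_id, inf_top_eq]
        have h1 : LinearMap.ker Y ⊓ LinearMap.range (Y ^ 0) = LinearMap.ker Y := by
          rw [pow_zero, Module.End.one_eq_id, LinearMap.range_id, inf_top_eq]
        rw [jordanDim, jordanDim, h0, h1]
    · ext ⟨_, ⟨u, rfl⟩⟩
      rw [rangeRestr_pow_coe]
      have := LinearMap.congr_fun hZ u
      rw [pow_succ, Module.End.mul_apply] at this
      simpa using this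

/-- The derivative of `Z ^ s` in direction `Z'`. -/
def powDeriv {R : Type*} [Ring R] (Z Z' : R) : ℕ → R
  | 0 => 0
  | s + 1 => Z' * Z ^ s + Z * powDeriv Z Z' s

/-- A first order deformation of a nilpotent endomorphism that does not increase the ranks of powers
is a commutator. -/
theorem exists_commutator_of_powDeriv {U : Type*} [AddCommGroup U] [Module ℂ U]
    [FiniteDimensional ℂ U] (Z Z' : Module.End ℂ U) {M : ℕ} (hZ : Z ^ M = 0)
    (h : ∀ s, ∀ v ∈ LinearMap.ker (Z ^ s), powDeriv Z Z' s v ∈ LinearMap.range (Z ^ s)) :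
    ∃ X : Module.End ℂ U, Z' = X * Z - Z * X := by
  let Zh : (U × U) →ₗ[ℂ] (U × U) :=
    (Z ∘ₗ LinearMap.fst ℂ U U).prod (Z' ∘ₗ LinearMap.fst ℂ U U + Z ∘ₗ LinearMap.snd ℂ U U)
  have hpow : ∀ s a b, (Zh ^ s) (a, b) = ((Z ^ s) a, powDeriv Z Z' s a + (Z ^ s) b) := by
    intro s
    induction s with
    | zero => intro a b; simp [powDeriv]
    | succ s ih =>
      intro a b
      rw [pow_succ', Module.End.mul_apply, ih]
      simp [Zh, powDeriv, pow_succ', add_assoc]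
  have hker : ∀ s, Module.finrank ℂ (LinearMap.ker (Zh ^ s)) =
      2 * Module.finrank ℂ (LinearMap.ker (Z ^ s)) := by
    intro s
    let ρ : LinearMap.ker (Zh ^ s) →ₗ[ℂ] U := LinearMap.fst ℂ U U ∘ₗ Submodule.subtype _
    have h1 : LinearMap.range ρ = LinearMap.ker (Z ^ s) := by
      ext a
      rw [LinearMap.mem_range, LinearMap.mem_ker]
      constructor
      · rintro ⟨⟨⟨a, b⟩, hab⟩, rfl⟩
        rw [LinearMap.mem_ker, hpow] at hab
        exact (Prod.mk.inj hab).1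
      · intro ha
        obtain ⟨b, hb⟩ := h s a ha
        refine ⟨⟨(a, -b), ?_⟩, rfl⟩
        rw [LinearMap.mem_ker, hpow, ha, map_neg, hb, add_neg_cancel]; rfl
    have h2 : Module.finrank ℂ (LinearMap.ker ρ) = Module.finrank ℂ (LinearMap.ker (Z ^ s)) := by
      let Θ : LinearMap.ker (Z ^ s) →ₗ[ℂ] LinearMap.ker (Zh ^ s) :=
        (LinearMap.inr ℂ U U ∘ₗ Submodule.subtype _).codRestrict _ (by
          rintro ⟨b, hb⟩
          rw [LinearMap.mem_ker] at hb
          rw [LinearMap.mem_ker]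
          simp [hpow, hb])
      have hΘ : Function.Injective Θ := by
        intro b b' hb
        have := congrArg (fun q => (q.1 : U × U).2) hb
        exact Subtype.ext this
      have hr : LinearMap.range Θ = LinearMap.ker ρ := by
        ext ⟨⟨a, b⟩, hab⟩
        rw [LinearMap.mem_range, LinearMap.mem_ker]
        constructor
        · rintro ⟨b', hb'⟩
          have := congrArg (fun q => (q.1 : U × U).1) hb'
          exact this.symm
        · intro ha
          change a = 0 at ha
          subst ha
          rw [LinearMap.mem_ker, hpow, map_zero, map_zero, zero_add] at hab
          exact ⟨⟨b, (Prod.mk.inj hab).2⟩, rfl⟩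
      rw [← hr, LinearMap.finrank_range_of_inj hΘ]
    have h3 := ρ.finrank_range_add_finrank_ker
    rw [h1, h2] at h3
    omega
  have hrk : ∀ s, Module.finrank ℂ (LinearMap.range (Zh ^ s)) =
      2 * Module.finrank ℂ (LinearMap.range (Z ^ s)) := by
    intro s
    have h1 := (Zh ^ s).finrank_range_add_finrank_ker
    have h2 := (Z ^ s).finrank_range_add_finrank_ker
    rw [hker, Module.finrank_prod] at h1
    omega
  have hjd : ∀ s, jordanDim Zh s = 2 * jordanDim Z s := by
    intro s
    have h1 := jordanDim_add_finrank Zh s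
    have h2 := jordanDim_add_finrank Z s
    rw [hrk, hrk] at h1
    omega
  have hd1 := finrank_homComm Z Zh M hZ
  have hd2 := finrank_homComm Z Z M hZ
  have hdd : Module.finrank ℂ (homComm Z Zh) = 2 * Module.finrank ℂ (homComm Z Z) := by
    rw [hd1, hd2, Finset.mul_sum]
    exact Finset.sum_congr rfl fun s _ => by rw [hjd]; ring
  let ρ : homComm Z Zh →ₗ[ℂ] homComm Z Z :=
    { toFun := fun f => ⟨LinearMap.fst ℂ U U ∘ₗ f.1, by
        rw [mem_homComm]; intro u
        rw [LinearMap.comp_apply, mem_homComm.1 f.2]; rfl⟩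
      map_add' := fun f g => rfl
      map_smul' := fun c f => rfl }
  have hkerρ : Module.finrank ℂ (LinearMap.ker ρ) ≤ Module.finrank ℂ (homComm Z Z) := by
    let Θ : LinearMap.ker ρ →ₗ[ℂ] homComm Z Z :=
      { toFun := fun f => ⟨LinearMap.snd ℂ U U ∘ₗ f.1.1, by
          rw [mem_homComm]; intro u
          have h1 := LinearMap.congr_fun (congrArg Subtype.val f.2) u
          change (f.1.1 u).1 = 0 at h1
          rw [LinearMap.comp_apply, mem_homComm.1 f.1.2]
          simp [Zh, h1]⟩
        map_add' := fun f g => rfl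
        map_smul' := fun c f => rfl }
    apply LinearMap.finrank_le_finrank_of_injective (f := Θ)
    intro f g hfg
    apply Subtype.ext; apply Subtype.ext
    ext u
    · have h1 := LinearMap.congr_fun (congrArg Subtype.val f.2) u
      have h2 := LinearMap.congr_fun (congrArg Subtype.val g.2) u
      exact h1.trans h2.symm
    · exact LinearMap.congr_fun (congrArg Subtype.val hfg) u
  have hrn := rank_nullity (V := homComm Z Zh) (W := homComm Z Z) ρ
  have htop : LinearMap.range ρ = ⊤ := by
    apply Submodule.eq_top_of_finrank_eq
    have := (LinearMap.range ρ).finrank_le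
    omega
  have hid : (LinearMap.id : U →ₗ[ℂ] U) ∈ homComm Z Z := by
    rw [mem_homComm]; intro u; rfl
  obtain ⟨F, hF⟩ := LinearMap.range_eq_top.1 htop ⟨LinearMap.id, hid⟩
  refine ⟨LinearMap.snd ℂ U U ∘ₗ F.1, ?_⟩
  ext u
  have h1 : ∀ u, (F.1 u).1 = u := fun u => LinearMap.congr_fun (congrArg Subtype.val hF) u
  have h2 := mem_homComm.1 F.2 u
  have h3 := congrArg Prod.snd h2
  have h4 : (F.1 (Z u)).2 = Z' (F.1 u).1 + Z (F.1 u).2 := h3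
  rw [h1] at h4
  simp [h4]

end Intertwiners

section Masks

variable {N I : Type} [Fintype N] [DecidableEq N] (vt : N → I)

/-- Matrices supported on the blocks `(v, w)` with `S v w`. -/
def maskSub (S : I → I → Prop) : Submodule ℂ (Matrix N N ℂ) where
  carrier := {M | ∀ k l, ¬ S (vt k) (vt l) → M k l = 0}
  add_mem' := by
    intro a b ha hb k l h
    rw [Matrix.add_apply, ha k l h, hb k l h, add_zero]
  zero_mem' := by intro k l _; rfl
  smul_mem' := by
    intro c a ha k l h
    rw [Matrix.smul_apply, ha k l h, smul_zero]

/-- Block diagonal matrices. -/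
abbrev diagSub : Submodule ℂ (Matrix N N ℂ) := maskSub vt fun v w => v = w

open Classical in
/-- The projection onto `maskSub vt S` that erases entries. -/
def maskPr (S : I → I → Prop) : Matrix N N ℂ →ₗ[ℂ] Matrix N N ℂ where
  toFun M := Matrix.of fun k l => if S (vt k) (vt l) then M k l else 0
  map_add' := by intro a b; ext k l; by_cases h : S (vt k) (vt l) <;> simp [h]
  map_smul' := by intro c a; ext k l; by_cases h : S (vt k) (vt l) <;> simp [h]

/-- The projection onto the block diagonal. -/
abbrev diagPr : Matrix N N ℂ →ₗ[ℂ] Matrix N N ℂ := maskPr vt fun v w => v = w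

variable {vt} {S : I → I → Prop}

open Classical in
lemma maskPr_apply (M : Matrix N N ℂ) (k l : N) :
    maskPr vt S M k l = if S (vt k) (vt l) then M k l else 0 := rfl

lemma maskPr_mem (M : Matrix N N ℂ) : maskPr vt S M ∈ maskSub vt S := by
  intro k l h; rw [maskPr_apply, if_neg h]

lemma maskPr_of_mem {M : Matrix N N ℂ} (h : M ∈ maskSub vt S) : maskPr vt S M = M := by
  ext k l
  rw [maskPr_apply]
  split_ifs with h1
  · rfl
  · exact (h k l h1).symm

lemma one_mem_diagSub : (1 : Matrix N N ℂ) ∈ diagSub vt := by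
  intro k l h
  exact Matrix.one_apply_ne fun e => h (by rw [e])

lemma diag_mul_apply_eq {Z A : Matrix N N ℂ} (hZ : Z ∈ diagSub vt) (k l : N) :
    (Z * maskPr vt S A) k l = maskPr vt S (Z * A) k l := by
  classical
  rw [maskPr_apply, Matrix.mul_apply, Matrix.mul_apply]
  split_ifs with h
  · refine Finset.sum_congr rfl fun j _ => ?_
    by_cases hj : vt k = vt j
    · rw [maskPr_apply, ← hj, if_pos h]
    · rw [hZ k j hj, zero_mul, zero_mul]
  · refine Finset.sum_eq_zero fun j _ => ?_
    by_cases hj : vt k = vt j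
    · rw [maskPr_apply, ← hj, if_neg h, mul_zero]
    · rw [hZ k j hj, zero_mul]

lemma maskPr_diag_mul {Z : Matrix N N ℂ} (hZ : Z ∈ diagSub vt) (A : Matrix N N ℂ) :
    maskPr vt S (Z * A) = Z * maskPr vt S A := by
  ext k l; exact (diag_mul_apply_eq hZ k l).symm

lemma maskPr_transpose (A : Matrix N N ℂ) :
    maskPr vt S Aᵀ = (maskPr vt (fun v w => S w v) A)ᵀ := by
  ext k l; simp [maskPr_apply]

lemma transpose_mem_diagSub {Z : Matrix N N ℂ} (hZ : Z ∈ diagSub vt) : Zᵀ ∈ diagSub vt :=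
  fun k l h => hZ l k fun e => h e.symm

lemma maskPr_mul_diag {Z : Matrix N N ℂ} (hZ : Z ∈ diagSub vt) (A : Matrix N N ℂ) :
    maskPr vt S (A * Z) = maskPr vt S A * Z := by
  have h := maskPr_diag_mul (S := fun v w => S w v) (transpose_mem_diagSub hZ) Aᵀ
  rw [← Matrix.transpose_mul, maskPr_transpose, maskPr_transpose, ← Matrix.transpose_mul] at h
  exact Matrix.transpose_injective h

lemma diag_mul_mem {Z A : Matrix N N ℂ} (hZ : Z ∈ diagSub vt) (hA : A ∈ maskSub vt S) :
    Z * A ∈ maskSub vt S := by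
  rw [← maskPr_of_mem hA, ← maskPr_diag_mul hZ]; exact maskPr_mem _

lemma mul_diag_mem {Z A : Matrix N N ℂ} (hZ : Z ∈ diagSub vt) (hA : A ∈ maskSub vt S) :
    A * Z ∈ maskSub vt S := by
  rw [← maskPr_of_mem hA, ← maskPr_mul_diag hZ]; exact maskPr_mem _

lemma trace_maskPr_mul (A B : Matrix N N ℂ) :
    (maskPr vt S A * B).trace = (A * maskPr vt (fun v w => S w v) B).trace := by
  classical
  simp only [Matrix.trace, Matrix.diag_apply, Matrix.mul_apply, maskPr_apply]
  refine Finset.sum_congr rfl fun k _ => Finset.sum_congr rfl fun l _ => ?_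
  split_ifs <;> simp

lemma trace_diagPr_mul (A B : Matrix N N ℂ) :
    (diagPr vt A * B).trace = (A * diagPr vt B).trace := by
  have h : (fun v w : I => w = v) = fun v w => v = w := by ext v w; exact eq_comm
  rw [trace_maskPr_mul, h]

lemma maskSub_flip_eq : (maskSub vt fun v w : I => w = v) = diagSub vt := by
  congr 1; ext v w; exact eq_comm

end Masks

section TraceDuality

variable {N : Type} [Fintype N] [DecidableEq N]

/-- The trace form on matrices. -/
def trForm : Matrix N N ℂ →ₗ[ℂ] Matrix N N ℂ →ₗ[ℂ] ℂ :=
  LinearMap.mk₂ ℂ (fun A B => (A * B).trace)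
    (by intro a b c; rw [Matrix.add_mul, Matrix.trace_add])
    (by intro c a b; rw [Matrix.smul_mul, Matrix.trace_smul])
    (by intro a b c; rw [Matrix.mul_add, Matrix.trace_add])
    (by intro c a b; rw [Matrix.mul_smul, Matrix.trace_smul])

lemma eq_zero_of_trace_mul {A : Matrix N N ℂ} (h : ∀ B : Matrix N N ℂ, (A * B).trace = 0) :
    A = 0 := by
  ext i j
  have := h (Matrix.single j i 1)
  rw [Matrix.trace_mul_single] at this
  simpa using this

lemma exists_trace_eq (φ : Matrix N N ℂ →ₗ[ℂ] ℂ) :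
    ∃ Y : Matrix N N ℂ, ∀ A, φ A = (Y * A).trace := by
  have hinj : Function.Injective (trForm (N := N)) := by
    rw [← LinearMap.ker_eq_bot, LinearMap.ker_eq_bot']
    intro A hA
    exact eq_zero_of_trace_mul fun B => LinearMap.congr_fun hA B
  have hs : Function.Surjective (trForm (N := N)) :=
    (LinearMap.injective_iff_surjective_of_finrank_eq_finrank
      (Subspace.dual_finrank_eq (K := ℂ) (V := Matrix N N ℂ)).symm).1 hinj
  obtain ⟨Y, hY⟩ := hs φ
  exact ⟨Y, fun A => by rw [← hY]; rfl⟩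

/-- The double orthogonal of a subspace is itself. -/
lemma mem_of_trace_orthogonal (S : Submodule ℂ (Matrix N N ℂ)) {A : Matrix N N ℂ}
    (h : ∀ Y : Matrix N N ℂ, (∀ B ∈ S, (Y * B).trace = 0) → (Y * A).trace = 0) : A ∈ S := by
  by_contra hA
  obtain ⟨φ, hφ, hS⟩ := Submodule.exists_le_ker_of_notMem hA
  obtain ⟨Y, hY⟩ := exists_trace_eq φ
  apply hφ
  rw [hY]
  exact h Y fun B hB => by rw [← hY]; exact hS hB

/-- Orthogonal complements with respect to a perfect pairing cut out by adjoint projections. -/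
lemma finrank_orthogonal_add (X Y : Submodule ℂ (Matrix N N ℂ))
    (pX pY : Matrix N N ℂ → Matrix N N ℂ) (hX : ∀ A ∈ X, pX A = A)
    (hY : ∀ A, pY A ∈ Y)
    (hadj : ∀ A B, (pY A * B).trace = (A * pX B).trace)
    (S : Submodule ℂ (Matrix N N ℂ)) (hS : S ≤ X) (T : Submodule ℂ (Matrix N N ℂ))
    (hT : ∀ A, A ∈ T ↔ A ∈ Y ∧ ∀ B ∈ S, (A * B).trace = 0) :
    Module.finrank ℂ T + Module.finrank ℂ S = Module.finrank ℂ Y := by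
  let f : Y →ₗ[ℂ] (S →ₗ[ℂ] ℂ) := (trForm.domRestrict₁₂ Y S)
  have hf : ∀ a b, f a b = (a.1 * b.1).trace := fun a b => rfl
  have hsurj : Function.Surjective f := by
    intro φ
    obtain ⟨ψ, hψ⟩ := φ.exists_extend
    obtain ⟨A, hA⟩ := exists_trace_eq ψ
    refine ⟨⟨pY A, hY A⟩, ?_⟩
    ext b
    rw [hf, ← hψ]
    change (pY A * b.1).trace = ψ b.1
    rw [hadj, hX _ (hS b.2), hA]
  have h1 := rank_nullity f
  rw [LinearMap.range_eq_top.2 hsurj, finrank_top] at h1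
  have h2 : Module.finrank ℂ (S →ₗ[ℂ] ℂ) = Module.finrank ℂ S := Subspace.dual_finrank_eq
  have h3 : (LinearMap.ker f).map Y.subtype = T := by
    ext A
    rw [hT, Submodule.mem_map]
    constructor
    · rintro ⟨a, ha, rfl⟩
      refine ⟨a.2, fun B hB => ?_⟩
      exact LinearMap.congr_fun (LinearMap.mem_ker.1 ha) ⟨B, hB⟩
    · rintro ⟨hA, h⟩
      exact ⟨⟨A, hA⟩, LinearMap.ext fun b => h b.1 b.2, rfl⟩
  have h4 : Module.finrank ℂ (LinearMap.ker f) = Module.finrank ℂ T := by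
    rw [← h3]
    exact LinearEquiv.finrank_eq (Submodule.equivMapOfInjective _ Y.injective_subtype _)
  omega

end TraceDuality

section Moment

open Filter Topology

lemma finrank_map_add {V W : Type*} [AddCommGroup V] [Module ℂ V] [AddCommGroup W] [Module ℂ W]
    [FiniteDimensional ℂ V] (f : V →ₗ[ℂ] W) (S : Submodule ℂ V) :
    Module.finrank ℂ (S.map f) + Module.finrank ℂ ↥(S ⊓ LinearMap.ker f) =
      Module.finrank ℂ S := by
  have h := rank_nullity (f.domRestrict S)
  rw [LinearMap.range_domRestrict] at h
  have h2 : Module.finrank ℂ (LinearMap.ker (f.domRestrict S)) =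
      Module.finrank ℂ ↥(S ⊓ LinearMap.ker f) := by
    rw [LinearMap.ker_domRestrict, ← Submodule.map_comap_subtype]
    exact (LinearEquiv.finrank_eq (Submodule.equivMapOfInjective _
      (Submodule.injective_subtype _) _))
  rw [h2] at h
  exact h

/-- The topological version of `eventually_exists_quadratic`. -/
lemma eventually_exists_quadratic' {E F : Type*} [AddCommGroup E] [Module ℂ E] [TopologicalSpace E]
    [IsTopologicalAddGroup E] [ContinuousSMul ℂ E] [T2Space E]
    [FiniteDimensional ℂ E] [AddCommGroup F] [Module ℂ F]
    (L : E →ₗ[ℂ] F) (q : E →ₗ[ℂ] E →ₗ[ℂ] F) (hq : ∀ u, q u u ∈ LinearMap.range L) {v : E}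
    (hv : L v = 0) {U : Set E} (hU : U ∈ 𝓝 v) :
    ∀ᶠ t : ℂ in 𝓝 0, ∃ u ∈ U, L u + t • q u u = 0 := by
  let e := (Module.finBasis ℂ E).equivFunL
  have hUe : e.symm ⁻¹' U ∈ 𝓝 (e v) := by
    apply e.symm.continuous.continuousAt.preimage_mem_nhds
    rwa [e.symm_apply_apply]
  have := eventually_exists_quadratic (L ∘ₗ e.symm.toLinearEquiv.toLinearMap)
    (q.compl₁₂ e.symm.toLinearEquiv.toLinearMap e.symm.toLinearEquiv.toLinearMap)
    (by
      intro u
      obtain ⟨w, hw⟩ := hq (e.symm u)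
      exact ⟨e w, by simp [hw]⟩) (v := e v) (by simp [hv]) hUe
  filter_upwards [this] with t ht
  obtain ⟨u, hu, h⟩ := ht
  exact ⟨e.symm u, hu, h⟩

variable {N I : Type} [Fintype N] [DecidableEq N]

/-- Pairs of matrices. -/
abbrev MatPair (N : Type) : Type := Matrix N N ℂ × Matrix N N ℂ

/-- `Z ↦ Z x - x Z`. -/
def adMap (x : Matrix N N ℂ) : Matrix N N ℂ →ₗ[ℂ] Matrix N N ℂ where
  toFun Z := Z * x - x * Z
  map_add' := by intro a b; noncomm_ring
  map_smul' := by intro c a; simp [smul_sub]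

lemma adMap_apply (x Z : Matrix N N ℂ) : adMap x Z = Z * x - x * Z := rfl

/-- The elements of `S` commuting with `x`. -/
def commIn (S : Submodule ℂ (Matrix N N ℂ)) (x : Matrix N N ℂ) : Submodule ℂ (Matrix N N ℂ) :=
  S ⊓ LinearMap.ker (adMap x)

lemma mem_commIn {S : Submodule ℂ (Matrix N N ℂ)} {x Z : Matrix N N ℂ} :
    Z ∈ commIn S x ↔ Z ∈ S ∧ Z * x = x * Z := by
  rw [commIn, Submodule.mem_inf, LinearMap.mem_ker, adMap_apply, sub_eq_zero]

lemma finrank_map_adMap (S : Submodule ℂ (Matrix N N ℂ)) (x : Matrix N N ℂ) :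
    Module.finrank ℂ (S.map (adMap x)) + Module.finrank ℂ (commIn S x) = Module.finrank ℂ S :=
  finrank_map_add _ _

variable (vt : N → I) (R : I → I → Prop)

/-- The block diagonal matrices commuting with both members of a pair. -/
def endSub (z : MatPair N) : Submodule ℂ (Matrix N N ℂ) := commIn (commIn (diagSub vt) z.1) z.2

variable {vt R}

lemma mem_endSub {z : MatPair N} {Z : Matrix N N ℂ} :
    Z ∈ endSub vt z ↔ Z ∈ diagSub vt ∧ Z * z.1 = z.1 * Z ∧ Z * z.2 = z.2 * Z := by
  rw [endSub, mem_commIn, mem_commIn, and_assoc]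

lemma one_mem_endSub (z : MatPair N) : (1 : Matrix N N ℂ) ∈ endSub vt z :=
  mem_endSub.2 ⟨one_mem_diagSub, by simp, by simp⟩

variable (vt R)

/-- Pairs whose only endomorphisms are scalar. -/
def IsBrick (z : MatPair N) : Prop := ∀ Z ∈ endSub vt z, ∃ c : ℂ, Z = c • 1

/-- Representations of the double of the graph `R` satisfying the moment map equation. -/
def momentSet (Λ : Matrix N N ℂ) : Set (MatPair N) :=
  {z | z.1 ∈ maskSub vt R ∧ z.2 ∈ maskSub vt (fun v w => R w v) ∧
    diagPr vt (z.1 * z.2 - z.2 * z.1) = Λ}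

/-- The linearized moment map. -/
def linM (z : MatPair N) : MatPair N →ₗ[ℂ] Matrix N N ℂ where
  toFun u := diagPr vt (z.1 * u.2 + u.1 * z.2 - z.2 * u.1 - u.2 * z.1)
  map_add' := by
    intro a b; rw [← map_add]; congr 1; simp only [Prod.fst_add, Prod.snd_add]; noncomm_ring
  map_smul' := by
    intro c a
    simp only [Prod.smul_fst, Prod.smul_snd, RingHom.id_apply, ← map_smul]
    congr 1
    simp [smul_sub, smul_add]

/-- The infinitesimal action on pairs. -/
def adPair (z : MatPair N) : Matrix N N ℂ →ₗ[ℂ] MatPair N := (adMap z.1).prod (adMap z.2)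

variable {vt R}

lemma linM_apply (z u : MatPair N) :
    linM vt z u = diagPr vt (z.1 * u.2 + u.1 * z.2 - z.2 * u.1 - u.2 * z.1) := rfl

lemma adPair_apply (z : MatPair N) (Z : Matrix N N ℂ) :
    adPair z Z = (Z * z.1 - z.1 * Z, Z * z.2 - z.2 * Z) := rfl

lemma ker_adPair (z : MatPair N) : diagSub vt ⊓ LinearMap.ker (adPair z) = endSub vt z := by
  ext Z
  rw [Submodule.mem_inf, LinearMap.mem_ker, adPair_apply, mem_endSub, Prod.mk_eq_zero, sub_eq_zero,
    sub_eq_zero]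

lemma eq_zero_of_pairing {S : I → I → Prop} {A : Matrix N N ℂ} (hA : A ∈ maskSub vt S)
    (h : ∀ B ∈ maskSub vt (fun v w => S w v), (A * B).trace = 0) : A = 0 := by
  apply eq_zero_of_trace_mul
  intro B
  rw [← maskPr_of_mem hA, trace_maskPr_mul]
  exact h _ (maskPr_mem _)

lemma ad_mem {S : I → I → Prop} {Z A : Matrix N N ℂ} (hZ : Z ∈ diagSub vt)
    (hA : A ∈ maskSub vt S) : Z * A - A * Z ∈ maskSub vt S :=
  Submodule.sub_mem _ (diag_mul_mem hZ hA) (mul_diag_mem hZ hA)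

lemma trace_linM {z u : MatPair N} {Y : Matrix N N ℂ} (hY : Y ∈ diagSub vt) :
    (Y * linM vt z u).trace =
      ((Y * z.1 - z.1 * Y) * u.2).trace - ((Y * z.2 - z.2 * Y) * u.1).trace := by
  rw [linM_apply, ← trace_diagPr_mul, maskPr_of_mem hY]
  have h1 : (Y * u.1 * z.2).trace = (z.2 * Y * u.1).trace := by
    rw [Matrix.trace_mul_comm, ← Matrix.mul_assoc]
  have h2 : (Y * u.2 * z.1).trace = (z.1 * Y * u.2).trace := by
    rw [Matrix.trace_mul_comm, ← Matrix.mul_assoc]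
  simp only [Matrix.mul_sub, Matrix.mul_add, Matrix.sub_mul, Matrix.trace_sub, Matrix.trace_add,
    ← Matrix.mul_assoc, h1, h2]
  ring

/-- The linearized moment map of a brick is onto the trace zero block diagonal matrices. -/
lemma mem_range_linM {z : MatPair N} (hz : IsBrick vt z) (hx : z.1 ∈ maskSub vt R)
    (hy : z.2 ∈ maskSub vt (fun v w => R w v)) {D : Matrix N N ℂ} (hD : D ∈ diagSub vt)
    (htr : D.trace = 0) :
    ∃ u : MatPair N, u.1 ∈ maskSub vt R ∧ u.2 ∈ maskSub vt (fun v w => R w v) ∧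
      linM vt z u = D := by
  have : D ∈ ((maskSub vt R).prod (maskSub vt fun v w => R w v)).map (linM vt z) := by
    apply mem_of_trace_orthogonal
    intro Y hY
    have hY' : ∀ u : MatPair N, u.1 ∈ maskSub vt R → u.2 ∈ maskSub vt (fun v w => R w v) →
        (diagPr vt Y * linM vt z u).trace = 0 := by
      intro u h1 h2
      have := hY _ (Submodule.mem_map_of_mem (f := linM vt z) (⟨h1, h2⟩ :
        u ∈ (maskSub vt R).prod (maskSub vt fun v w => R w v)))
      rw [trace_diagPr_mul, linM_apply, maskPr_of_mem (maskPr_mem _)]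
      exact this
    have hg : diagPr vt Y ∈ diagSub vt := maskPr_mem _
    have e1 : diagPr vt Y * z.1 - z.1 * diagPr vt Y = 0 := by
      apply eq_zero_of_pairing (S := R) (ad_mem hg hx)
      intro B hB
      have := hY' (0, B) (Submodule.zero_mem _) hB
      rw [trace_linM hg] at this
      simpa using this
    have e2 : diagPr vt Y * z.2 - z.2 * diagPr vt Y = 0 := by
      apply eq_zero_of_pairing (S := fun v w => R w v) (ad_mem hg hy)
      intro B hB
      have := hY' (B, 0) hB (Submodule.zero_mem _)
      rw [trace_linM hg] at this
      simpa using this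
    obtain ⟨c, hc⟩ := hz _ (mem_endSub.2 ⟨hg, sub_eq_zero.1 e1, sub_eq_zero.1 e2⟩)
    rw [← maskPr_of_mem hD, ← trace_diagPr_mul, hc, Matrix.smul_mul, Matrix.one_mul,
      Matrix.trace_smul, htr, smul_zero]
  obtain ⟨u, hu, h⟩ := this
  exact ⟨u, hu.1, hu.2, h⟩

lemma trace_diagPr (A : Matrix N N ℂ) : (diagPr vt A).trace = A.trace := by
  simp [Matrix.trace, maskPr_apply]

lemma moment_add_smul (z u : MatPair N) (t : ℂ) :
    diagPr vt ((z + t • u).1 * (z + t • u).2 - (z + t • u).2 * (z + t • u).1) =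
      diagPr vt (z.1 * z.2 - z.2 * z.1) +
        t • (linM vt z u + t • diagPr vt (u.1 * u.2 - u.2 * u.1)) := by
  rw [linM_apply, ← map_smul, ← map_add, ← map_smul, ← map_add]
  congr 1
  simp only [Prod.fst_add, Prod.snd_add, Prod.smul_fst, Prod.smul_snd, Matrix.add_mul,
    Matrix.mul_add, Matrix.smul_mul, Matrix.mul_smul, smul_sub, smul_add, smul_smul]
  abel

/-- Every solution of the linearized equation at a brick is a limit of difference quotients. -/
lemma exists_seq_tangent {Λ : Matrix N N ℂ} {z : MatPair N} (hz : z ∈ momentSet vt R Λ)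
    (hb : IsBrick vt z) {v : MatPair N} (hv1 : v.1 ∈ maskSub vt R)
    (hv2 : v.2 ∈ maskSub vt (fun v w => R w v)) (hv : linM vt z v = 0) :
    ∃ (t : ℕ → ℂ) (u : ℕ → MatPair N), Tendsto t atTop (𝓝 0) ∧ (∀ n, t n ≠ 0) ∧
      Tendsto u atTop (𝓝 v) ∧ ∀ n, z + t n • u n ∈ momentSet vt R Λ := by
  let E : Submodule ℂ (MatPair N) := (maskSub vt R).prod (maskSub vt fun v w => R w v)
  let L : E →ₗ[ℂ] Matrix N N ℂ := linM vt z ∘ₗ E.subtype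
  let q0 : MatPair N →ₗ[ℂ] MatPair N →ₗ[ℂ] Matrix N N ℂ :=
    LinearMap.mk₂ ℂ (fun a b => diagPr vt (a.1 * b.2 - b.2 * a.1))
      (by intro a b c; rw [← map_add]; congr 1; simp only [Prod.fst_add]; noncomm_ring)
      (by intro c a b; rw [← map_smul]; simp [smul_sub])
      (by intro a b c; rw [← map_add]; congr 1; simp only [Prod.snd_add]; noncomm_ring)
      (by intro c a b; rw [← map_smul]; simp [smul_sub])
  let q : E →ₗ[ℂ] E →ₗ[ℂ] Matrix N N ℂ := q0.compl₁₂ E.subtype E.subtype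
  have hqv : ∀ u : E, q u u = diagPr vt (u.1.1 * u.1.2 - u.1.2 * u.1.1) := fun u => rfl
  have hq : ∀ u, q u u ∈ LinearMap.range L := by
    intro u
    obtain ⟨w, h1, h2, h3⟩ := mem_range_linM hb hz.1 hz.2.1 (D := q u u) (maskPr_mem _) (by
      rw [hqv, trace_diagPr, Matrix.trace_sub, Matrix.trace_mul_comm, sub_self])
    exact ⟨⟨w, h1, h2⟩, h3⟩
  let v' : E := ⟨v, hv1, hv2⟩
  have : FirstCountableTopology (Matrix N N ℂ) :=
    inferInstanceAs (FirstCountableTopology (N → N → ℂ))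
  have : FirstCountableTopology E := Topology.IsInducing.subtypeVal.firstCountableTopology
  obtain ⟨U, hU⟩ := (𝓝 v').exists_antitone_basis
  have key : ∀ n : ℕ, ∃ t : ℂ, t ≠ 0 ∧ ‖t‖ < 1 / ((n : ℝ) + 1) ∧ ∃ u ∈ U n,
      L u + t • q u u = 0 := by
    intro n
    have h1 := eventually_exists_quadratic' L q hq (v := v') hv (hU.1.mem_of_mem (i := n) trivial)
    have h2 : ∀ᶠ t : ℂ in 𝓝 0, ‖t‖ < 1 / ((n : ℝ) + 1) := by
      have : Metric.ball (0 : ℂ) (1 / ((n : ℝ) + 1)) ∈ 𝓝 (0 : ℂ) :=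
        Metric.ball_mem_nhds _ (by positivity)
      filter_upwards [this] with t ht
      simpa using ht
    have h3 : ∀ᶠ t : ℂ in 𝓝[≠] 0, ‖t‖ < 1 / ((n : ℝ) + 1) ∧ ∃ u ∈ U n, L u + t • q u u = 0 :=
      (h2.and h1).filter_mono nhdsWithin_le_nhds
    obtain ⟨t, ht, ht'⟩ := (h3.and eventually_mem_nhdsWithin).exists
    exact ⟨t, ht', ht.1, ht.2⟩
  choose t ht0 htn u hu hq' using key
  refine ⟨t, fun n => (u n).1, ?_, ht0, ?_, ?_⟩
  · rw [tendsto_zero_iff_norm_tendsto_zero]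
    exact squeeze_zero (fun n => norm_nonneg _) (fun n => (htn n).le)
      tendsto_one_div_add_atTop_nhds_zero_nat
  · have : Tendsto u atTop (𝓝 v') := hU.tendsto hu
    exact (continuous_subtype_val.tendsto v').comp this
  · intro n
    refine ⟨Submodule.add_mem _ hz.1 (Submodule.smul_mem _ _ (u n).2.1),
      Submodule.add_mem _ hz.2.1 (Submodule.smul_mem _ _ (u n).2.2), ?_⟩
    rw [moment_add_smul, hz.2.2]
    have := hq' n
    rw [hqv] at this
    change linM vt z (u n).1 + _ = 0 at this
    rw [this, smul_zero, add_zero]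

end Moment

section BrickDensity

open Filter Topology

lemma exists_forall_le_of_nonempty {α : Type*} (f : α → ℕ) {S : Set α} (hS : S.Nonempty) :
    ∃ z ∈ S, ∀ w ∈ S, f z ≤ f w := by
  classical
  have h : ∃ m, ∃ z ∈ S, f z = m := by
    obtain ⟨z, hz⟩ := hS
    exact ⟨f z, z, hz, rfl⟩
  obtain ⟨z, hz, hfz⟩ := Nat.find_spec h
  refine ⟨z, hz, fun w hw => ?_⟩
  rw [hfz]
  exact Nat.find_min' h ⟨w, hw, rfl⟩

variable {N I : Type} [Fintype N] [DecidableEq N]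

/-- The Peirce corner `e S f`. -/
def corner (S : Submodule ℂ (Matrix N N ℂ)) (e f : Matrix N N ℂ) : Submodule ℂ (Matrix N N ℂ) :=
  S.map (LinearMap.mulLeft ℂ e ∘ₗ LinearMap.mulRight ℂ f)

lemma mem_corner {S : Submodule ℂ (Matrix N N ℂ)} {e f A : Matrix N N ℂ} :
    A ∈ corner S e f ↔ ∃ B ∈ S, e * (B * f) = A := Iff.rfl

lemma finrank_submodule_prod {V W : Type*} [AddCommGroup V] [Module ℂ V] [AddCommGroup W]
    [Module ℂ W] [FiniteDimensional ℂ V] [FiniteDimensional ℂ W]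
    (p : Submodule ℂ V) (q : Submodule ℂ W) :
    Module.finrank ℂ (p.prod q) = Module.finrank ℂ p + Module.finrank ℂ q := by
  have h : p.prod q = LinearMap.range (p.subtype.prodMap q.subtype) := by
    rw [LinearMap.range_prodMap, Submodule.range_subtype, Submodule.range_subtype]
  have hinj : Function.Injective (p.subtype.prodMap q.subtype) :=
    Function.Injective.prodMap p.injective_subtype q.injective_subtype
  rw [h, ← (LinearEquiv.ofInjective _ hinj).finrank_eq, Module.finrank_prod]

variable {vt : N → I} {R : I → I → Prop}

lemma corner_le {S : I → I → Prop} {e f : Matrix N N ℂ} (he : e ∈ diagSub vt)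
    (hf : f ∈ diagSub vt) : corner (maskSub vt S) e f ≤ maskSub vt S := by
  rintro _ ⟨B, hB, rfl⟩
  exact diag_mul_mem he (mul_diag_mem hf hB)

lemma tendsto_adPair (z u : MatPair N) (Z : Matrix N N ℂ) {l : Filter ℂ} (hl : l ≤ 𝓝 0) :
    Tendsto (fun t : ℂ => adPair (z + t • u) Z) l (𝓝 (adPair z Z)) := by
  have h : (fun t : ℂ => adPair (z + t • u) Z) = fun t => adPair z Z + t • adPair u Z := by
    funext t
    simp only [adPair_apply, Prod.ext_iff, Prod.fst_add, Prod.snd_add, Prod.smul_fst,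
      Prod.smul_snd, Matrix.mul_add, Matrix.add_mul, Matrix.mul_smul, Matrix.smul_mul, smul_sub]
    constructor <;> abel
  rw [h]
  have : Tendsto (fun t : ℂ => adPair z Z + t • adPair u Z) (𝓝 0)
      (𝓝 (adPair z Z + (0 : ℂ) • adPair u Z)) :=
    tendsto_const_nhds.add (tendsto_id.smul tendsto_const_nhds)
  rw [zero_smul, add_zero] at this
  exact this.mono_left hl

lemma finrank_range_adPair (z : MatPair N) :
    Module.finrank ℂ (LinearMap.range (adPair z ∘ₗ (diagSub vt).subtype)) +
      Module.finrank ℂ (endSub vt z) = Module.finrank ℂ (diagSub vt) := by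
  have := finrank_map_add (adPair z) (diagSub vt)
  rw [ker_adPair] at this
  rwa [LinearMap.range_comp, Submodule.range_subtype]

/-- A first order deformation that is not along the orbit, produced by an idempotent
endomorphism. -/
lemma exists_corner_deformation {z : MatPair N} {e : Matrix N N ℂ} (he : e ∈ endSub vt z)
    (hee : e * e = e)
    (hdim : 2 * Module.finrank ℂ (corner (diagSub vt) e (1 - e)) <
      Module.finrank ℂ (corner (maskSub vt R) e (1 - e)) +
        Module.finrank ℂ (corner (maskSub vt fun v w => R w v) e (1 - e))) :
    ∃ u : MatPair N, u.1 ∈ corner (maskSub vt R) e (1 - e) ∧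
      u.2 ∈ corner (maskSub vt fun v w => R w v) e (1 - e) ∧ linM vt z u = 0 ∧
      u ∉ (diagSub vt).map (adPair z) := by
  obtain ⟨heg, he1, he2⟩ := mem_endSub.1 he
  set f := 1 - e with hf
  have hfg : f ∈ diagSub vt := Submodule.sub_mem _ one_mem_diagSub heg
  have hf1 : f * z.1 = z.1 * f := by rw [hf, Matrix.sub_mul, Matrix.mul_sub, he1]; simp
  have hf2 : f * z.2 = z.2 * f := by rw [hf, Matrix.sub_mul, Matrix.mul_sub, he2]; simp
  have hff : f * f = f := by rw [hf]; simp [Matrix.sub_mul, Matrix.mul_sub, hee]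
  let U : Submodule ℂ (MatPair N) :=
    (corner (maskSub vt R) e f).prod (corner (maskSub vt fun v w => R w v) e f)
  have hU : U.map (linM vt z) ≤ corner (diagSub vt) e f := by
    rintro _ ⟨⟨_, _⟩, ⟨⟨A, hA, rfl⟩, ⟨B, hB, rfl⟩⟩, rfl⟩
    refine mem_corner.2 ⟨diagPr vt (z.1 * B + A * z.2 - z.2 * A - B * z.1), maskPr_mem _, ?_⟩
    rw [← maskPr_mul_diag hfg, ← maskPr_diag_mul heg, linM_apply]
    congr 1
    simp only [LinearMap.comp_apply, LinearMap.mulLeft_apply, LinearMap.mulRight_apply,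
      Matrix.mul_sub, Matrix.mul_add, Matrix.sub_mul, Matrix.add_mul, Matrix.mul_assoc, ← hf1,
      ← hf2]
    simp only [← Matrix.mul_assoc, he1, he2, hf1, hf2]
  have h1 := finrank_map_add (linM vt z) U
  have h2 := Submodule.finrank_mono hU
  have h3 : Module.finrank ℂ U = Module.finrank ℂ (corner (maskSub vt R) e f) +
      Module.finrank ℂ (corner (maskSub vt fun v w => R w v) e f) :=
    finrank_submodule_prod _ _
  have h4 := finrank_map_add (adPair z) (corner (diagSub vt) e f)
  have h5 : ¬ U ⊓ LinearMap.ker (linM vt z) ≤ (corner (diagSub vt) e f).map (adPair z) := by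
    intro h
    have := Submodule.finrank_mono h
    omega
  obtain ⟨u, hu, hu'⟩ := SetLike.not_le_iff_exists.1 h5
  refine ⟨u, hu.1.1, hu.1.2, hu.2, ?_⟩
  rintro ⟨Z, hZ, hZu⟩
  apply hu'
  refine ⟨e * (Z * f), mem_corner.2 ⟨Z, hZ, rfl⟩, ?_⟩
  obtain ⟨A, -, hA⟩ := mem_corner.1 hu.1.1
  obtain ⟨B, -, hB⟩ := mem_corner.1 hu.1.2
  have key : ∀ M : Matrix N N ℂ, e * (e * (M * f) * f) = e * (M * f) := by
    intro M
    rw [Matrix.mul_assoc e, Matrix.mul_assoc M, hff, ← Matrix.mul_assoc, hee]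
  have hu1 : e * (u.1 * f) = u.1 := by rw [← hA, key]
  have hu2 : e * (u.2 * f) = u.2 := by rw [← hB, key]
  rw [← Prod.mk.eta (p := u), ← hu1, ← hu2, ← hZu, adPair_apply, adPair_apply]
  refine Prod.ext ?_ ?_
  · simp only [Matrix.sub_mul, Matrix.mul_sub, Matrix.mul_assoc, hf1]
    simp only [← Matrix.mul_assoc, he1]
  · simp only [Matrix.sub_mul, Matrix.mul_sub, Matrix.mul_assoc, hf2]
    simp only [← Matrix.mul_assoc, he2]

/-- Bricks are dense in the solutions of the moment map equation, under numerical conditions. -/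
theorem exists_brick {Λ : Matrix N N ℂ} {Inj : Set (Matrix N N ℂ)} (hInj : IsOpen Inj)
    (h1A : ∀ z ∈ momentSet vt R Λ, z.1 ∈ Inj → ¬ IsBrick vt z →
      ∃ e ∈ endSub vt z, e * e = e ∧
        2 * Module.finrank ℂ (corner (diagSub vt) e (1 - e)) <
          Module.finrank ℂ (corner (maskSub vt R) e (1 - e)) +
          Module.finrank ℂ (corner (maskSub vt fun v w => R w v) e (1 - e)))
    {O : Set (MatPair N)} (hO : IsOpen O) {z0 : MatPair N} (hz0 : z0 ∈ momentSet vt R Λ)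
    (hz0' : z0.1 ∈ Inj) (hz0O : z0 ∈ O) :
    ∃ z ∈ momentSet vt R Λ, z.1 ∈ Inj ∧ z ∈ O ∧ IsBrick vt z := by
  obtain ⟨z, ⟨hz, hzI, hzO⟩, hmin⟩ := exists_forall_le_of_nonempty
    (fun z : MatPair N => Module.finrank ℂ (endSub vt z))
    (S := {z | z ∈ momentSet vt R Λ ∧ z.1 ∈ Inj ∧ z ∈ O}) ⟨z0, hz0, hz0', hz0O⟩
  refine ⟨z, hz, hzI, hzO, ?_⟩
  by_contra hb
  obtain ⟨e, he, hee, hdim⟩ := h1A z hz hzI hb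
  obtain ⟨u, hu1, hu2, hlin, hu⟩ := exists_corner_deformation he hee hdim
  obtain ⟨heg, he1, he2⟩ := mem_endSub.1 he
  have hfg : 1 - e ∈ diagSub vt := Submodule.sub_mem _ one_mem_diagSub heg
  obtain ⟨A, -, hA⟩ := mem_corner.1 hu1
  obtain ⟨B, -, hB⟩ := mem_corner.1 hu2
  have hfe : (1 - e) * e = 0 := by rw [Matrix.sub_mul, hee, Matrix.one_mul, sub_self]
  have key : ∀ M M' : Matrix N N ℂ, e * (M * (1 - e)) * (e * (M' * (1 - e))) = 0 := by
    intro M M'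
    rw [Matrix.mul_assoc e, Matrix.mul_assoc M, ← Matrix.mul_assoc (1 - e), hfe, Matrix.zero_mul,
      Matrix.mul_zero, Matrix.mul_zero]
  have hmom : ∀ t : ℂ, z + t • u ∈ momentSet vt R Λ := by
    intro t
    refine ⟨Submodule.add_mem _ hz.1 (Submodule.smul_mem _ _ (corner_le heg hfg hu1)),
      Submodule.add_mem _ hz.2.1 (Submodule.smul_mem _ _ (corner_le heg hfg hu2)), ?_⟩
    rw [moment_add_smul, hz.2.2, hlin, ← hA, ← hB, key, key]
    simp
  apply hu
  have hlim : Tendsto (fun t : ℂ => z + t • u) (𝓝 0) (𝓝 z) := by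
    have : Tendsto (fun t : ℂ => z + t • u) (𝓝 0) (𝓝 (z + (0 : ℂ) • u)) :=
      tendsto_const_nhds.add (tendsto_id.smul tendsto_const_nhds)
    rwa [zero_smul, add_zero] at this
  have hnear : ∀ᶠ t : ℂ in 𝓝[≠] 0, (z + t • u).1 ∈ Inj ∧ z + t • u ∈ O := by
    refine (hlim.mono_left nhdsWithin_le_nhds).eventually
      (Filter.Eventually.and (p := fun z : MatPair N => z.1 ∈ Inj)
        ((hInj.preimage continuous_fst).mem_nhds hzI) (hO.mem_nhds hzO))
  have := mem_range_of_rank_le (l := 𝓝[≠] (0 : ℂ))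
    (L := fun t => adPair (z + t • u) ∘ₗ (diagSub vt).subtype)
    (L0 := adPair z ∘ₗ (diagSub vt).subtype)
    (fun v => tendsto_adPair z u v nhdsWithin_le_nhds)
    (by
      filter_upwards [hnear] with t ht
      have h1 := hmin (z + t • u) ⟨hmom t, ht.1, ht.2⟩
      have h2 := finrank_range_adPair (vt := vt) z
      have h3 := finrank_range_adPair (vt := vt) (z + t • u)
      omega)
    (t := fun t => t) eventually_mem_nhdsWithin (v := ⟨e, heg⟩) (w' := u) (by
      refine tendsto_const_nhds.congr' ?_
      filter_upwards [eventually_mem_nhdsWithin] with t ht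
      have ht0 : t ≠ 0 := ht
      have k1 : ∀ M : Matrix N N ℂ, e * (e * (M * (1 - e))) = e * (M * (1 - e)) := by
        intro M; rw [← Matrix.mul_assoc, hee]
      have k2 : ∀ M : Matrix N N ℂ, e * (M * (1 - e)) * e = 0 := by
        intro M; rw [Matrix.mul_assoc, Matrix.mul_assoc, hfe, Matrix.mul_zero, Matrix.mul_zero]
      have : adPair (z + t • u) e = t • u := by
        rw [adPair_apply]
        refine Prod.ext ?_ ?_
        · simp only [Prod.fst_add, Prod.smul_fst, ← hA, Matrix.mul_add, Matrix.add_mul,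
            Matrix.mul_smul, Matrix.smul_mul, k1, k2, he1]
          simp
        · simp only [Prod.snd_add, Prod.smul_snd, ← hB, Matrix.mul_add, Matrix.add_mul,
            Matrix.mul_smul, Matrix.smul_mul, k1, k2, he2]
          simp
      change u = t⁻¹ • adPair (z + t • u) e
      rw [this, smul_smul, inv_mul_cancel₀ ht0, one_smul])
  rwa [LinearMap.range_comp, Submodule.range_subtype] at this

end BrickDensity

section CommutantTools

open Filter Topology

variable {N I : Type} [Fintype N] [DecidableEq N] {vt : N → I} {R : I → I → Prop}

lemma trace_mul_commutator (A B C : Matrix N N ℂ) :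
    (A * (B * C - C * B)).trace = ((C * A - A * C) * B).trace := by
  rw [Matrix.mul_sub, Matrix.sub_mul, Matrix.trace_sub, Matrix.trace_sub, ← Matrix.mul_assoc,
    Matrix.trace_mul_comm, ← Matrix.mul_assoc, ← Matrix.mul_assoc]

lemma finrank_maskSub_flip (S : I → I → Prop) :
    Module.finrank ℂ (maskSub vt fun v w => S w v) = Module.finrank ℂ (maskSub vt S) := by
  have := finrank_orthogonal_add (maskSub vt S) (maskSub vt fun v w => S w v) (maskPr vt S)
    (maskPr vt fun v w => S w v) (fun A hA => maskPr_of_mem hA) (fun A => maskPr_mem _)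
    (fun A B => trace_maskPr_mul _ _) _ le_rfl ⊥ (by
      intro A
      rw [Submodule.mem_bot]
      constructor
      · rintro rfl
        exact ⟨Submodule.zero_mem _, by simp⟩
      · rintro ⟨h1, h2⟩
        exact eq_zero_of_pairing (S := fun v w => S w v) h1 h2)
  rw [finrank_bot] at this
  omega

lemma isBrick_of_finrank_le {z : MatPair N} (h : Module.finrank ℂ (endSub vt z) ≤ 1) :
    IsBrick vt z := by
  intro Z hZ
  rcases isEmpty_or_nonempty N with hN | hN
  · exact ⟨0, Subsingleton.elim _ _⟩
  · have h1 : (⟨1, one_mem_endSub z⟩ : endSub vt z) ≠ 0 := by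
      intro h
      exact one_ne_zero (congrArg Subtype.val h)
    obtain ⟨c, hc⟩ := (finrank_le_one_iff.1 h).imp fun v hv => hv
    obtain ⟨a, ha⟩ := hc ⟨1, one_mem_endSub z⟩
    obtain ⟨b, hb⟩ := hc ⟨Z, hZ⟩
    have ha0 : a ≠ 0 := by rintro rfl; rw [zero_smul] at ha; exact h1 ha.symm
    refine ⟨b * a⁻¹, ?_⟩
    have e1 : (1 : Matrix N N ℂ) = a • c.1 := (congrArg Subtype.val ha).symm
    have e2 : Z = b • c.1 := (congrArg Subtype.val hb).symm
    rw [e1, e2, smul_smul, mul_assoc, inv_mul_cancel₀ ha0, mul_one]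

lemma finrank_endSub_of_isBrick [Nonempty N] {z : MatPair N} (h : IsBrick vt z) :
    Module.finrank ℂ (endSub vt z) = 1 := by
  have : endSub vt z = ℂ ∙ (1 : Matrix N N ℂ) := by
    ext Z
    rw [Submodule.mem_span_singleton]
    constructor
    · intro hZ; obtain ⟨c, hc⟩ := h Z hZ; exact ⟨c, hc.symm⟩
    · rintro ⟨c, rfl⟩; exact Submodule.smul_mem _ _ (one_mem_endSub z)
  rw [this]
  exact finrank_span_singleton one_ne_zero

lemma aeval_mem_commIn {x Z : Matrix N N ℂ} (hZ : Z ∈ commIn (diagSub vt) x) (p : ℂ[X]) :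
    aeval Z p ∈ commIn (diagSub vt) x := by
  have hmul : ∀ {A B}, A ∈ commIn (diagSub vt) x → B ∈ commIn (diagSub vt) x →
      A * B ∈ commIn (diagSub vt) x := by
    intro A B hA hB
    rw [mem_commIn] at *
    exact ⟨diag_mul_mem hA.1 hB.1, by
      rw [Matrix.mul_assoc, hB.2, ← Matrix.mul_assoc, hA.2, Matrix.mul_assoc]⟩
  have h1 : (1 : Matrix N N ℂ) ∈ commIn (diagSub vt) x :=
    mem_commIn.2 ⟨one_mem_diagSub, by simp⟩
  induction p using Polynomial.induction_on with
  | C a => rw [aeval_C, Algebra.algebraMap_eq_smul_one]; exact Submodule.smul_mem _ _ h1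
  | add p q hp hq => rw [map_add]; exact Submodule.add_mem _ hp hq
  | monomial n a h =>
    rw [pow_succ, ← mul_assoc, map_mul, aeval_X]
    exact hmul h hZ

/-- A matrix generating an algebra without nontrivial idempotents is scalar plus nilpotent. -/
lemma exists_isNilpotent_sub [Nonempty N] {Z : Matrix N N ℂ}
    (h : ∀ p : ℂ[X], aeval Z p * aeval Z p = aeval Z p → aeval Z p = 0 ∨ aeval Z p = 1) :
    ∃ c : ℂ, IsNilpotent (Z - c • 1) := by
  obtain ⟨c, hc⟩ : ∃ c, Z.charpoly.IsRoot c :=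
    IsAlgClosed.exists_root _ (by
      rw [Matrix.charpoly_degree_eq_dim]
      exact_mod_cast Fintype.card_ne_zero)
  refine ⟨c, ?_⟩
  obtain ⟨q, hq, hqc⟩ := exists_eq_pow_rootMultiplicity_mul_and_not_dvd Z.charpoly
    Z.charpoly_monic.ne_zero c
  set m := rootMultiplicity c Z.charpoly
  have hcop : IsCoprime ((X - C c) ^ m) q :=
    ((Polynomial.irreducible_X_sub_C c).coprime_iff_not_dvd.2 hqc).pow_left
  obtain ⟨a, b, hab⟩ := hcop
  have hZc : aeval Z (X - C c) = Z - c • 1 := by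
    rw [map_sub, aeval_X, aeval_C, Algebra.algebraMap_eq_smul_one]
  have hCH : aeval Z ((X - C c) ^ m * q) = 0 := by
    rw [← hq]; exact Matrix.aeval_self_charpoly Z
  have hidem : aeval Z (b * q) * aeval Z (b * q) = aeval Z (b * q) := by
    have : b * q * (b * q) = b * q - a * b * ((X - C c) ^ m * q) := by
      linear_combination (b * q) * hab
    rw [← map_mul, this, map_sub, map_mul (aeval Z) (a * b), hCH, mul_zero, sub_zero]
  rcases h _ hidem with h0 | h1
  · exfalso
    have h2 : aeval Z (a * (X - C c) ^ m) = 1 := by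
      have := congrArg (aeval Z) hab
      rwa [map_add, h0, add_zero, map_one] at this
    have hm : m ≠ 0 := by
      have := (rootMultiplicity_pos Z.charpoly_monic.ne_zero).2 hc
      exact this.ne'
    obtain ⟨m', hm'⟩ := Nat.exists_eq_succ_of_ne_zero hm
    rw [hm', pow_succ, ← mul_assoc, map_mul, hZc] at h2
    have hdet : (Z - c • 1).det ≠ 0 := by
      intro h0
      have := congrArg Matrix.det h2
      rw [Matrix.det_mul, h0, mul_zero, Matrix.det_one] at this
      exact zero_ne_one this
    apply hdet
    have : (Matrix.scalar N c - Z).det = 0 := by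
      rw [← Matrix.eval_charpoly]; exact hc
    have e : Z - c • 1 = -(Matrix.scalar N c - Z) := by
      rw [neg_sub, Matrix.scalar_apply, ← Matrix.smul_one_eq_diagonal]
    rw [e, Matrix.det_neg, this, mul_zero]
  · refine ⟨m, ?_⟩
    have : aeval Z ((X - C c) ^ m * (b * q)) = 0 := by
      rw [show (X - C c) ^ m * (b * q) = b * ((X - C c) ^ m * q) by ring, map_mul, hCH, mul_zero]
    rwa [map_mul, h1, mul_one, map_pow, hZc] at this

lemma eq_zero_of_trace_of_isNilpotent_sub [Nonempty N] {Z : Matrix N N ℂ} {c : ℂ}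
    (h : IsNilpotent (Z - c • 1)) (htr : Z.trace = 0) : IsNilpotent Z := by
  have h1 := (Matrix.isNilpotent_trace_of_isNilpotent h).eq_zero
  rw [Matrix.trace_sub, htr, Matrix.trace_smul, Matrix.trace_one, zero_sub, neg_eq_zero, smul_eq_mul,
    mul_eq_zero] at h1
  have hc : c = 0 := h1.resolve_right (by exact_mod_cast Fintype.card_ne_zero)
  rwa [hc, zero_smul, sub_zero] at h

/-- A first order deformation of a nilpotent matrix along which no rank of a power drops is a
commutator. -/
lemma exists_commutator_of_rank_le {α : Type*} {l : Filter α} [l.NeBot] {Z d0 : Matrix N N ℂ}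
    (hZ : IsNilpotent Z) {t : α → ℂ} {d : α → Matrix N N ℂ} (ht : Tendsto t l (𝓝 0))
    (ht0 : ∀ᶠ a in l, t a ≠ 0) (hd : Tendsto d l (𝓝 d0))
    (hr : ∀ s, ∀ᶠ a in l, ((Z + t a • d a) ^ s).rank ≤ (Z ^ s).rank) :
    ∃ X : Matrix N N ℂ, d0 = X * Z - Z * X := by
  obtain ⟨M, hM⟩ := hZ
  have key : ∀ s, ∃ P : α → Matrix N N ℂ, Tendsto P l (𝓝 (powDeriv Z d0 s)) ∧
      ∀ a, (Z + t a • d a) ^ s = Z ^ s + t a • P a := by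
    intro s
    induction s with
    | zero => exact ⟨fun _ => 0, tendsto_const_nhds, fun a => by simp⟩
    | succ s ih =>
      obtain ⟨P, hP, hP'⟩ := ih
      refine ⟨fun a => d a * Z ^ s + Z * P a + t a • (d a * P a), ?_, ?_⟩
      · have h1 : Tendsto (fun a => d a * Z ^ s + Z * P a + t a • (d a * P a)) l
            (𝓝 (d0 * Z ^ s + Z * powDeriv Z d0 s + (0 : ℂ) • (d0 * powDeriv Z d0 s))) :=
          ((hd.mul tendsto_const_nhds).add (tendsto_const_nhds.mul hP)).add (ht.smul (hd.mul hP))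
        rwa [zero_smul, add_zero] at h1
      · intro a
        rw [pow_succ', hP', pow_succ']
        simp only [Matrix.add_mul, Matrix.mul_add, Matrix.smul_mul, Matrix.mul_smul, smul_add,
          smul_smul]
        abel
  let φ := Matrix.toLinAlgEquiv' (R := ℂ) (n := N)
  have hφ : ∀ s, φ (powDeriv Z d0 s) = powDeriv (φ Z) (φ d0) s := by
    intro s
    induction s with
    | zero => exact map_zero _
    | succ s ih => simp only [powDeriv, map_add, map_mul, map_pow, ih]
  have happ : ∀ (A : Matrix N N ℂ) v, φ A v = A.mulVec v := fun A v => rfl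
  obtain ⟨X, hX⟩ := exists_commutator_of_powDeriv (φ Z) (φ d0) (M := M)
    (by rw [← map_pow, hM, map_zero]) (by
      intro s v hv
      obtain ⟨P, hP, hP'⟩ := key s
      rw [LinearMap.mem_ker, ← map_pow, happ] at hv
      refine mem_range_of_rank_le (l := l) (L := fun a => φ ((Z + t a • d a) ^ s))
        (L0 := (φ Z) ^ s) (t := t) (v := v) ?_ ?_ ht0 ?_
      · intro v
        rw [← map_pow]
        refine tendsto_mulVec ?_ tendsto_const_nhds
        have h1 : Tendsto (fun a => Z ^ s + t a • P a) l
            (𝓝 (Z ^ s + (0 : ℂ) • powDeriv Z d0 s)) := tendsto_const_nhds.add (ht.smul hP)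
        rw [zero_smul, add_zero] at h1
        exact h1.congr fun a => (hP' a).symm
      · filter_upwards [hr s] with a ha
        rw [← map_pow]
        exact ha
      · rw [← hφ]
        refine (tendsto_mulVec hP tendsto_const_nhds).congr' ?_
        filter_upwards [ht0] with a ha
        rw [happ, hP', Matrix.add_mulVec, hv, zero_add, Matrix.smul_mulVec, smul_smul,
          inv_mul_cancel₀ ha, one_smul])
  refine ⟨φ.symm X, φ.injective ?_⟩
  rw [hX, map_sub, map_mul, map_mul, AlgEquiv.apply_symm_apply]

end CommutantTools

section IdempotentFamilies

variable {N I : Type} [Fintype N] [DecidableEq N] {vt : N → I} {R : I → I → Prop} {k : ℕ}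

/-- Complete families of orthogonal block diagonal idempotents. -/
structure IsIdemFam (vt : N → I) (e : Fin k → Matrix N N ℂ) : Prop where
  mem : ∀ a, e a ∈ diagSub vt
  mul : ∀ a b, e a * e b = if a = b then e a else 0
  sum : ∑ a, e a = 1

/-- A matrix whose commutant is the commutant of the family. -/
def famGen (e : Fin k → Matrix N N ℂ) : Matrix N N ℂ := ∑ a : Fin k, ((a : ℕ) : ℂ) • e a

/-- The projection onto the commutant of the family. -/
def peircePr (e : Fin k → Matrix N N ℂ) (A : Matrix N N ℂ) : Matrix N N ℂ := ∑ a, e a * A * e a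

variable {e : Fin k → Matrix N N ℂ}

namespace IsIdemFam

lemma mul_famGen (he : IsIdemFam vt e) (a : Fin k) : e a * famGen e = ((a : ℕ) : ℂ) • e a := by
  simp [famGen, Finset.mul_sum, he.mul]

lemma famGen_mul (he : IsIdemFam vt e) (a : Fin k) : famGen e * e a = ((a : ℕ) : ℂ) • e a := by
  rw [famGen, Finset.sum_mul, Finset.sum_eq_single a]
  · rw [Matrix.smul_mul, he.mul, if_pos rfl]
  · intro b _ hb
    rw [Matrix.smul_mul, he.mul, if_neg hb, smul_zero]
  · simp

lemma famGen_mem_diagSub (he : IsIdemFam vt e) : famGen e ∈ diagSub vt :=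
  Submodule.sum_mem _ fun a _ => Submodule.smul_mem _ _ (he.mem a)

lemma commute_famGen {A : Matrix N N ℂ} (h : ∀ a, A * e a = e a * A) :
    A * famGen e = famGen e * A := by
  simp only [famGen, Finset.mul_sum, Finset.sum_mul, Matrix.mul_smul, Matrix.smul_mul, h]

lemma corner_eq_zero (he : IsIdemFam vt e) {A : Matrix N N ℂ} (h : A * famGen e = famGen e * A)
    {a b : Fin k} (hab : a ≠ b) : e a * A * e b = 0 := by
  have h1 : e a * (A * famGen e) * e b = e a * (famGen e * A) * e b := by rw [h]
  rw [← Matrix.mul_assoc, Matrix.mul_assoc (e a * A), he.famGen_mul, ← Matrix.mul_assoc (e a),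
    he.mul_famGen, Matrix.mul_smul, Matrix.smul_mul, Matrix.smul_mul] at h1
  have h2 : (((b : ℕ) : ℂ) - ((a : ℕ) : ℂ)) • (e a * A * e b) = 0 := by
    rw [sub_smul, h1, sub_self]
  rcases smul_eq_zero.1 h2 with h3 | h3
  · exfalso
    rw [sub_eq_zero] at h3
    exact hab (Fin.ext (by exact_mod_cast h3.symm))
  · exact h3

lemma peirce_eq (he : IsIdemFam vt e) {A : Matrix N N ℂ} (h : A * famGen e = famGen e * A) :
    peircePr e A = A := by
  have : A = ∑ a, ∑ b, e a * A * e b := by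
    conv_lhs => rw [← Matrix.one_mul A, ← Matrix.mul_one (1 * A), ← he.sum]
    simp only [Finset.sum_mul, Finset.mul_sum, Matrix.mul_assoc]
    exact Finset.sum_comm
  conv_rhs => rw [this]
  refine Finset.sum_congr rfl fun a _ => ?_
  rw [Finset.sum_eq_single a]
  · intro b _ hb
    exact he.corner_eq_zero h hb.symm
  · simp

lemma peirce_commute (he : IsIdemFam vt e) (A : Matrix N N ℂ) :
    peircePr e A * famGen e = famGen e * peircePr e A := by
  rw [peircePr, Finset.sum_mul, Finset.mul_sum]
  refine Finset.sum_congr rfl fun a _ => ?_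
  rw [Matrix.mul_assoc, he.mul_famGen, ← Matrix.mul_assoc, ← Matrix.mul_assoc, he.famGen_mul,
    Matrix.mul_smul, Matrix.smul_mul, Matrix.smul_mul]

lemma peirce_commutator (he : IsIdemFam vt e) (A : Matrix N N ℂ) :
    peircePr e (A * famGen e - famGen e * A) = 0 := by
  refine Finset.sum_eq_zero fun a _ => ?_
  rw [Matrix.mul_sub, Matrix.sub_mul, Matrix.mul_assoc, Matrix.mul_assoc A, he.famGen_mul,
    ← Matrix.mul_assoc (e a) (famGen e), he.mul_famGen]
  simp [Matrix.mul_assoc]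

lemma trace_peirce_mul (A B : Matrix N N ℂ) :
    (peircePr e A * B).trace = (A * peircePr e B).trace := by
  simp only [peircePr, Finset.sum_mul, Finset.mul_sum, Matrix.trace_sum]
  refine Finset.sum_congr rfl fun a _ => ?_
  rw [Matrix.mul_assoc, Matrix.mul_assoc, Matrix.trace_mul_comm]
  simp only [Matrix.mul_assoc]

lemma peirce_mem (he : IsIdemFam vt e) {S : I → I → Prop} {A : Matrix N N ℂ}
    (hA : A ∈ maskSub vt S) : peircePr e A ∈ maskSub vt S :=
  Submodule.sum_mem _ fun a _ => mul_diag_mem (he.mem a) (diag_mul_mem (he.mem a) hA)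

/-- Orthogonal complements inside commutants. -/
lemma finrank_orthogonal_add (he : IsIdemFam vt e) (S : I → I → Prop)
    (B : Submodule ℂ (Matrix N N ℂ)) (hB : B ≤ commIn (maskSub vt S) (famGen e))
    (T : Submodule ℂ (Matrix N N ℂ))
    (hT : ∀ A, A ∈ T ↔ A ∈ commIn (maskSub vt fun v w => S w v) (famGen e) ∧
      ∀ C ∈ B, (A * C).trace = 0) :
    Module.finrank ℂ T + Module.finrank ℂ B =
      Module.finrank ℂ (commIn (maskSub vt fun v w => S w v) (famGen e)) := by
  refine _root_.finrank_orthogonal_add (commIn (maskSub vt S) (famGen e)) _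
    (fun A => maskPr vt S (peircePr e A)) (fun A => peircePr e (maskPr vt (fun v w => S w v) A))
    ?_ ?_ ?_ B hB T hT
  · intro A hA
    rw [mem_commIn] at hA
    rw [he.peirce_eq hA.2, maskPr_of_mem hA.1]
  · intro A
    exact mem_commIn.2 ⟨he.peirce_mem (maskPr_mem _), he.peirce_commute _⟩
  · intro A C
    rw [trace_peirce_mul, trace_maskPr_mul]

lemma finrank_commIn_flip (he : IsIdemFam vt e) (S : I → I → Prop) :
    Module.finrank ℂ (commIn (maskSub vt fun v w => S w v) (famGen e)) =
      Module.finrank ℂ (commIn (maskSub vt S) (famGen e)) := by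
  have := he.finrank_orthogonal_add S _ le_rfl ⊥ (by
    intro A
    rw [Submodule.mem_bot]
    constructor
    · rintro rfl
      exact ⟨Submodule.zero_mem _, by simp⟩
    · rintro ⟨h1, h2⟩
      rw [mem_commIn] at h1
      refine eq_zero_of_pairing (S := fun v w => S w v) h1.1 fun C hC => ?_
      rw [← he.peirce_eq h1.2, trace_peirce_mul]
      exact h2 _ (mem_commIn.2 ⟨he.peirce_mem hC, he.peirce_commute _⟩))
  rw [finrank_bot] at this
  omega

end IsIdemFam

end IdempotentFamilies

section SchurOrthogonality

open Filter Topology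

variable {N I : Type} [Fintype N] [DecidableEq N] {vt : N → I} {R : I → I → Prop}
  {Λ : Matrix N N ℂ} {Inj : Set (Matrix N N ℂ)} {O : Set (MatPair N)}

/-- Bricks satisfying the moment map equation, with first component in `Inj`, in the set `O`. -/
def brickSet (vt : N → I) (R : I → I → Prop) (Λ : Matrix N N ℂ) (Inj : Set (Matrix N N ℂ))
    (O : Set (MatPair N)) : Set (MatPair N) :=
  {z | z ∈ momentSet vt R Λ ∧ z.1 ∈ Inj ∧ z ∈ O ∧ IsBrick vt z}

lemma tendsto_adMap {α : Type*} {l : Filter α} {x : α → Matrix N N ℂ} {x0 : Matrix N N ℂ}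
    (hx : Tendsto x l (𝓝 x0)) (Z : Matrix N N ℂ) :
    Tendsto (fun a => adMap (x a) Z) l (𝓝 (adMap x0 Z)) :=
  (tendsto_const_nhds.mul hx).sub (hx.mul tendsto_const_nhds)

lemma eventually_mem_brickSet (hInj : IsOpen Inj) (hO : IsOpen O) {z : MatPair N}
    (hz : z ∈ brickSet vt R Λ Inj O) {α : Type*} {l : Filter α} {w : α → MatPair N}
    (hw : Tendsto w l (𝓝 z)) (hm : ∀ᶠ a in l, w a ∈ momentSet vt R Λ) :
    ∀ᶠ a in l, w a ∈ brickSet vt R Λ Inj O := by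
  obtain ⟨hz1, hz2, hz3, hz4⟩ := hz
  have h1 : ∀ᶠ a in l, (w a).1 ∈ Inj :=
    hw.eventually (p := fun z : MatPair N => z.1 ∈ Inj)
      ((hInj.preimage continuous_fst).mem_nhds hz2)
  have h2 : ∀ᶠ a in l, w a ∈ O := hw.eventually (hO.mem_nhds hz3)
  have hw1 : Tendsto (fun a => (w a).1) l (𝓝 z.1) := (continuous_fst.tendsto z).comp hw
  have hw2 : Tendsto (fun a => (w a).2) l (𝓝 z.2) := (continuous_snd.tendsto z).comp hw
  have h3 := eventually_finrank_range_le (l := l)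
    (L := fun a => adPair (w a) ∘ₗ (diagSub vt).subtype)
    (L0 := adPair z ∘ₗ (diagSub vt).subtype)
    (fun v => (tendsto_adMap hw1 v.1).prodMk_nhds (tendsto_adMap hw2 v.1))
  filter_upwards [h1, h2, h3, hm] with a e1 e2 e3 e4
  refine ⟨e4, e1, e2, ?_⟩
  rcases isEmpty_or_nonempty N with hN | hN
  · intro Z _
    exact ⟨0, Subsingleton.elim _ _⟩
  · apply isBrick_of_finrank_le
    have k1 := finrank_range_adPair (vt := vt) z
    have k2 := finrank_range_adPair (vt := vt) (w a)
    have k3 := finrank_endSub_of_isBrick hz4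
    omega

lemma exists_seq_brickSet (hInj : IsOpen Inj) (hO : IsOpen O) {z : MatPair N}
    (hz : z ∈ brickSet vt R Λ Inj O) {v : MatPair N} (hv1 : v.1 ∈ maskSub vt R)
    (hv2 : v.2 ∈ maskSub vt (fun v w => R w v)) (hv : linM vt z v = 0) :
    ∃ (t : ℕ → ℂ) (u : ℕ → MatPair N), Tendsto t atTop (𝓝 0) ∧ (∀ n, t n ≠ 0) ∧
      Tendsto u atTop (𝓝 v) ∧ ∀ᶠ n in atTop, z + t n • u n ∈ brickSet vt R Λ Inj O := by
  obtain ⟨t, u, ht, ht0, hu, hm⟩ := exists_seq_tangent hz.1 hz.2.2.2 hv1 hv2 hv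
  refine ⟨t, u, ht, ht0, hu, eventually_mem_brickSet hInj hO hz ?_ (Eventually.of_forall hm)⟩
  have : Tendsto (fun n => z + t n • u n) atTop (𝓝 (z + (0 : ℂ) • v)) :=
    tendsto_const_nhds.add (ht.smul hu)
  rwa [zero_smul, add_zero] at this

lemma finrank_range_adMap (x : Matrix N N ℂ) :
    Module.finrank ℂ (LinearMap.range (adMap x ∘ₗ (diagSub vt).subtype)) +
      Module.finrank ℂ (commIn (diagSub vt) x) = Module.finrank ℂ (diagSub vt) := by
  have := finrank_map_adMap (diagSub vt) x
  rwa [LinearMap.range_comp, Submodule.range_subtype]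

/-- The first order condition for a deformation of the first component to extend. -/
lemma exists_linM_eq_zero {z : MatPair N} (hx : z.1 ∈ maskSub vt R) {x' : Matrix N N ℂ}
    (h : ∀ W ∈ commIn (diagSub vt) z.1, (x' * adMap z.2 W).trace = 0) :
    ∃ y' ∈ maskSub vt (fun v w => R w v), linM vt z (x', y') = 0 := by
  let f : Matrix N N ℂ →ₗ[ℂ] Matrix N N ℂ := linM vt z ∘ₗ LinearMap.inr ℂ _ _
  have hf : ∀ B, f B = linM vt z (0, B) := fun B => rfl
  have key : linM vt z (x', 0) ∈ (maskSub vt fun v w => R w v).map f := by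
    apply mem_of_trace_orthogonal
    intro Y hY
    have hg : diagPr vt Y ∈ diagSub vt := maskPr_mem _
    have e0 : ∀ u, (Y * linM vt z u).trace = (diagPr vt Y * linM vt z u).trace := by
      intro u
      rw [trace_diagPr_mul, linM_apply, maskPr_of_mem (maskPr_mem _)]
    have e1 : diagPr vt Y * z.1 - z.1 * diagPr vt Y = 0 := by
      apply eq_zero_of_pairing (S := R) (ad_mem hg hx)
      intro B hB
      have := hY _ (Submodule.mem_map_of_mem hB)
      rw [hf, e0, trace_linM hg] at this
      simpa using this
    rw [e0, trace_linM hg]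
    have := h _ (mem_commIn.2 ⟨hg, sub_eq_zero.1 e1⟩)
    rw [adMap_apply, Matrix.trace_mul_comm] at this
    simp [this]
  obtain ⟨B, hB, hB'⟩ := key
  refine ⟨-B, Submodule.neg_mem _ hB, ?_⟩
  have : ((x', -B) : MatPair N) = (x', 0) - (0, B) := by simp
  rw [this, map_sub, ← hf, hB', sub_self]

/-- At a brick minimizing the number of endomorphisms of the first component, infinitesimal
deformations of the first component do not change its endomorphisms to first order. -/
lemma commutator_mem_of_minimal (hInj : IsOpen Inj) (hO : IsOpen O) {z : MatPair N}
    (hz : z ∈ brickSet vt R Λ Inj O)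
    (hmin : ∀ w ∈ brickSet vt R Λ Inj O, Module.finrank ℂ (commIn (diagSub vt) z.1) ≤
      Module.finrank ℂ (commIn (diagSub vt) w.1))
    {x' : Matrix N N ℂ} (hx' : x' ∈ maskSub vt R)
    (h : ∀ W ∈ commIn (diagSub vt) z.1, (x' * adMap z.2 W).trace = 0)
    {Z : Matrix N N ℂ} (hZ : Z ∈ commIn (diagSub vt) z.1) :
    adMap x' Z ∈ (diagSub vt).map (adMap z.1) := by
  obtain ⟨y', hy', hlin⟩ := exists_linM_eq_zero hz.1.1 h
  obtain ⟨t, u, ht, ht0, hu, hm⟩ := exists_seq_brickSet hInj hO hz hx' hy' hlin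
  have hu1 : Tendsto (fun n => (u n).1) atTop (𝓝 x') := (continuous_fst.tendsto _).comp hu
  have hlim : Tendsto (fun n => z.1 + t n • (u n).1) atTop (𝓝 z.1) := by
    have : Tendsto (fun n => z.1 + t n • (u n).1) atTop (𝓝 (z.1 + (0 : ℂ) • x')) :=
      tendsto_const_nhds.add (ht.smul hu1)
    rwa [zero_smul, add_zero] at this
  have := mem_range_of_rank_le (l := atTop)
    (L := fun n => adMap (z.1 + t n • (u n).1) ∘ₗ (diagSub vt).subtype)
    (L0 := adMap z.1 ∘ₗ (diagSub vt).subtype)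
    (fun v => tendsto_adMap hlim v.1)
    (by
      filter_upwards [hm] with n hn
      have h1 := hmin _ hn
      have h2 := finrank_range_adMap (vt := vt) z.1
      have h3 := finrank_range_adMap (vt := vt) (z.1 + t n • (u n).1)
      simp only [Prod.fst_add, Prod.smul_fst] at h1
      omega)
    (t := t) (Eventually.of_forall ht0) (v := ⟨Z, (mem_commIn.1 hZ).1⟩) (w' := adMap x' Z) (by
      refine (tendsto_adMap hu1 Z).congr fun n => ?_
      change adMap (u n).1 Z = (t n)⁻¹ • adMap (z.1 + t n • (u n).1) Z
      have : adMap (z.1 + t n • (u n).1) Z = t n • adMap (u n).1 Z := by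
        simp only [adMap_apply, Matrix.mul_add, Matrix.add_mul, (mem_commIn.1 hZ).2,
          Matrix.mul_smul, Matrix.smul_mul, smul_sub]
        abel
      rw [this, smul_smul, inv_mul_cancel₀ (ht0 n), one_smul])
  rwa [LinearMap.range_comp, Submodule.range_subtype] at this

/-- The dual statement of `commutator_mem_of_minimal`. -/
lemma commutator_dual_mem_of_minimal (hInj : IsOpen Inj) (hO : IsOpen O) {z : MatPair N}
    (hz : z ∈ brickSet vt R Λ Inj O)
    (hmin : ∀ w ∈ brickSet vt R Λ Inj O, Module.finrank ℂ (commIn (diagSub vt) z.1) ≤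
      Module.finrank ℂ (commIn (diagSub vt) w.1))
    {κ : Matrix N N ℂ} (hκ : κ ∈ maskSub vt fun v w => R w v)
    (hκ' : ∀ B ∈ (diagSub vt).map (adMap z.1), (κ * B).trace = 0)
    {Z : Matrix N N ℂ} (hZ : Z ∈ commIn (diagSub vt) z.1) :
    adMap κ Z ∈ (commIn (diagSub vt) z.1).map (adMap z.2) := by
  apply mem_of_trace_orthogonal
  intro Y hY
  have hZg := (mem_commIn.1 hZ).1
  have e0 : ∀ B ∈ maskSub vt (fun v w => R w v), (Y * B).trace = (maskPr vt R Y * B).trace := by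
    intro B hB
    rw [trace_maskPr_mul, maskPr_of_mem hB]
  have h1 := commutator_mem_of_minimal hInj hO hz hmin (x' := maskPr vt R Y) (maskPr_mem _)
    (by
      intro W hW
      rw [adMap_apply, ← e0 _ (ad_mem (mem_commIn.1 hW).1 hz.1.2.1)]
      exact hY _ (Submodule.mem_map_of_mem hW)) hZ
  have h2 := hκ' _ h1
  rw [adMap_apply, trace_mul_commutator] at h2
  rw [adMap_apply, e0 _ (ad_mem hZg hκ), trace_mul_commutator, ← neg_eq_zero, ← Matrix.trace_neg,
    ← Matrix.neg_mul, neg_sub]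
  exact h2

end SchurOrthogonality

section SchurNilpotent

open Filter Topology

variable {N I : Type} [Fintype N] [DecidableEq N] {vt : N → I} {R : I → I → Prop}
  {Λ : Matrix N N ℂ} {Inj : Set (Matrix N N ℂ)} {O : Set (MatPair N)}

/-- The numerical condition used to bound endomorphisms of non-bricks. -/
def FamilyCondition (vt : N → I) (R : I → I → Prop) (Λ : Matrix N N ℂ)
    (Inj : Set (Matrix N N ℂ)) : Prop :=
  ∀ z ∈ momentSet vt R Λ, z.1 ∈ Inj → ¬ IsBrick vt z →
    ∃ (k : ℕ) (e : Fin k → Matrix N N ℂ), IsIdemFam vt e ∧ (∀ a, e a ∈ endSub vt z) ∧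
      Module.finrank ℂ (endSub vt z) ≤ k ∧
      Module.finrank ℂ (commIn (maskSub vt R) (famGen e)) + Module.finrank ℂ (diagSub vt) + k ≤
        Module.finrank ℂ (maskSub vt R) + Module.finrank ℂ (commIn (diagSub vt) (famGen e))

/-- The directions of the fibre of the moment map over the first component. -/
def fibreDir (vt : N → I) (R : I → I → Prop) (x : Matrix N N ℂ) : Submodule ℂ (Matrix N N ℂ) where
  carrier := {κ | κ ∈ maskSub vt (fun v w => R w v) ∧
    ∀ B ∈ (diagSub vt).map (adMap x), (κ * B).trace = 0}
  add_mem' := by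
    rintro a b ⟨ha, ha'⟩ ⟨hb, hb'⟩
    exact ⟨Submodule.add_mem _ ha hb, fun B hB => by
      rw [Matrix.add_mul, Matrix.trace_add, ha' B hB, hb' B hB, add_zero]⟩
  zero_mem' := ⟨Submodule.zero_mem _, fun B _ => by simp⟩
  smul_mem' := by
    rintro c a ⟨ha, ha'⟩
    exact ⟨Submodule.smul_mem _ _ ha, fun B hB => by
      rw [Matrix.smul_mul, Matrix.trace_smul, ha' B hB, smul_zero]⟩

lemma mem_fibreDir {x κ : Matrix N N ℂ} : κ ∈ fibreDir vt R x ↔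
    κ ∈ maskSub vt (fun v w => R w v) ∧ ∀ B ∈ (diagSub vt).map (adMap x), (κ * B).trace = 0 :=
  Iff.rfl

lemma mem_fibreDir_iff {x κ : Matrix N N ℂ} : κ ∈ fibreDir vt R x ↔
    κ ∈ maskSub vt (fun v w => R w v) ∧ diagPr vt (x * κ - κ * x) = 0 := by
  have key : ∀ W, (κ * adMap x W).trace = (W * (x * κ - κ * x)).trace := by
    intro W
    rw [adMap_apply, trace_mul_commutator, Matrix.trace_mul_comm]
  rw [mem_fibreDir]
  refine and_congr_right fun hκ => ⟨fun h => ?_, ?_⟩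
  · apply eq_zero_of_trace_mul
    intro W
    rw [trace_diagPr_mul, Matrix.trace_mul_comm, ← key]
    exact h _ (Submodule.mem_map_of_mem (maskPr_mem _))
  · rintro h _ ⟨W, hW, rfl⟩
    rw [key, ← maskPr_of_mem hW, trace_diagPr_mul, h, Matrix.mul_zero, Matrix.trace_zero]

lemma finrank_fibreDir {x : Matrix N N ℂ} (hx : x ∈ maskSub vt R) :
    Module.finrank ℂ (fibreDir vt R x) + Module.finrank ℂ (diagSub vt) =
      Module.finrank ℂ (maskSub vt R) + Module.finrank ℂ (commIn (diagSub vt) x) := by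
  have h1 := finrank_orthogonal_add (maskSub vt R) (maskSub vt fun v w => R w v) (maskPr vt R)
    (maskPr vt fun v w => R w v) (fun A hA => maskPr_of_mem hA) (fun A => maskPr_mem _)
    (fun A B => trace_maskPr_mul _ _) ((diagSub vt).map (adMap x)) (by
      rintro _ ⟨W, hW, rfl⟩
      exact ad_mem hW hx) (fibreDir vt R x) (fun A => Iff.rfl)
  have h2 := finrank_map_adMap (diagSub vt) x
  rw [finrank_maskSub_flip] at h1
  omega

lemma finrank_fibreDir_comm_le {k : ℕ} {e : Fin k → Matrix N N ℂ} (he : IsIdemFam vt e)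
    {x : Matrix N N ℂ} (hx : x ∈ maskSub vt R) (hex : x * famGen e = famGen e * x) :
    Module.finrank ℂ (commIn (fibreDir vt R x) (famGen e)) +
        Module.finrank ℂ (commIn (diagSub vt) (famGen e)) ≤
      Module.finrank ℂ (commIn (maskSub vt R) (famGen e)) +
        Module.finrank ℂ (commIn (commIn (diagSub vt) x) (famGen e)) := by
  let B := (commIn (diagSub vt) (famGen e)).map (adMap x)
  have hB : B ≤ commIn (maskSub vt R) (famGen e) := by
    rintro _ ⟨W, hW, rfl⟩
    have hW := mem_commIn.1 hW
    refine mem_commIn.2 ⟨ad_mem hW.1 hx, ?_⟩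
    rw [adMap_apply, Matrix.sub_mul, Matrix.mul_sub, Matrix.mul_assoc, hex, ← Matrix.mul_assoc,
      hW.2, Matrix.mul_assoc x, hW.2, ← Matrix.mul_assoc x, hex]
    simp only [Matrix.mul_assoc]
  let T : Submodule ℂ (Matrix N N ℂ) :=
    { carrier := {A | A ∈ commIn (maskSub vt fun v w => R w v) (famGen e) ∧
        ∀ C ∈ B, (A * C).trace = 0}
      add_mem' := by
        rintro a b ⟨ha, ha'⟩ ⟨hb, hb'⟩
        exact ⟨Submodule.add_mem _ ha hb, fun B hB => by
          rw [Matrix.add_mul, Matrix.trace_add, ha' B hB, hb' B hB, add_zero]⟩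
      zero_mem' := ⟨Submodule.zero_mem _, fun B _ => by simp⟩
      smul_mem' := by
        rintro c a ⟨ha, ha'⟩
        exact ⟨Submodule.smul_mem _ _ ha, fun B hB => by
          rw [Matrix.smul_mul, Matrix.trace_smul, ha' B hB, smul_zero]⟩ }
  have h1 := he.finrank_orthogonal_add R B hB T (fun A => Iff.rfl)
  have h2 := finrank_map_adMap (commIn (diagSub vt) (famGen e)) x
  have h3 : commIn (commIn (diagSub vt) (famGen e)) x =
      commIn (commIn (diagSub vt) x) (famGen e) := by
    ext Z; simp only [mem_commIn]; tauto
  have h4 : commIn (fibreDir vt R x) (famGen e) ≤ T := by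
    intro A hA
    obtain ⟨⟨h1, h2⟩, h3⟩ := mem_commIn.1 hA
    refine ⟨mem_commIn.2 ⟨h1, h3⟩, ?_⟩
    rintro _ ⟨W, hW, rfl⟩
    exact h2 _ (Submodule.mem_map_of_mem (mem_commIn.1 hW).1)
  have h5 := Submodule.finrank_mono h4
  rw [he.finrank_commIn_flip] at h1
  rw [h3] at h2
  change Module.finrank ℂ B + _ = _ at h2
  omega

/-- The hypotheses on a brick with minimal number of endomorphisms of the first component. -/
def IsMinimalBrick (vt : N → I) (R : I → I → Prop) (Λ : Matrix N N ℂ)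
    (Inj : Set (Matrix N N ℂ)) (O : Set (MatPair N)) (z : MatPair N) : Prop :=
  z ∈ brickSet vt R Λ Inj O ∧ ∀ w ∈ brickSet vt R Λ Inj O,
    Module.finrank ℂ (commIn (diagSub vt) z.1) ≤ Module.finrank ℂ (commIn (diagSub vt) w.1)

/-- All points in the fibre through a minimal brick are bricks. -/
lemma isBrick_fibre [Nonempty N] (hF : FamilyCondition vt R Λ Inj) (hInj : IsOpen Inj)
    (hO : IsOpen O) {z : MatPair N} (hz : IsMinimalBrick vt R Λ Inj O z) {y0 : Matrix N N ℂ}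
    (hy0 : y0 - z.2 ∈ fibreDir vt R z.1) : IsBrick vt ((z.1, y0) : MatPair N) := by
  by_contra hb
  obtain ⟨hzb, hmin⟩ := hz
  have hx := hzb.1.1
  have hy := hzb.1.2.1
  have hy0' := mem_fibreDir_iff.1 hy0
  have hmom : ((z.1, y0) : MatPair N) ∈ momentSet vt R Λ := by
    refine ⟨hx, ?_, ?_⟩
    · have := Submodule.add_mem _ hy0'.1 hy
      rwa [sub_add_cancel] at this
    · have h1 : z.1 * y0 - y0 * z.1 =
          (z.1 * z.2 - z.2 * z.1) + (z.1 * (y0 - z.2) - (y0 - z.2) * z.1) := by noncomm_ring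
      change diagPr vt (z.1 * y0 - y0 * z.1) = Λ
      rw [h1, map_add, hzb.1.2.2, hy0'.2, add_zero]
  obtain ⟨k, e, he, hez, hk, hnum⟩ := hF _ hmom hzb.2.1 hb
  set H := famGen e with hH
  have hex : z.1 * H = H * z.1 :=
    IsIdemFam.commute_famGen fun a => (mem_endSub.1 (hez a)).2.1.symm
  have hey : y0 * H = H * y0 :=
    IsIdemFam.commute_famGen fun a => (mem_endSub.1 (hez a)).2.2.symm
  have hHE : H ∈ commIn (diagSub vt) z.1 := mem_commIn.2 ⟨he.famGen_mem_diagSub, hex.symm⟩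
  set E := commIn (diagSub vt) z.1 with hE
  set K := fibreDir vt R z.1 with hK
  let T := E.map (adMap z.2)
  have hKE : ∀ κ ∈ K, ∀ Z ∈ E, adMap κ Z ∈ T := fun κ hκ Z hZ =>
    commutator_dual_mem_of_minimal hInj hO hzb hmin hκ.1 hκ.2 hZ
  let T1 := (commIn E H).map (adMap y0)
  let T2 := K.map (adMap H)
  have hT1 : T1 ≤ T := by
    rintro _ ⟨Z, hZ, rfl⟩
    have hZE := (mem_commIn.1 hZ).1
    have h1 : adMap y0 Z = adMap z.2 Z + adMap (y0 - z.2) Z := by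
      simp only [adMap_apply]; noncomm_ring
    rw [h1]
    exact Submodule.add_mem _ (Submodule.mem_map_of_mem hZE) (hKE _ hy0 _ hZE)
  have hT2 : T2 ≤ T := by
    rintro _ ⟨κ, hκ, rfl⟩
    have h1 : adMap H κ = - adMap κ H := by simp [adMap_apply]
    rw [h1]
    exact Submodule.neg_mem _ (hKE _ hκ _ hHE)
  have hT12 : T1 ⊓ T2 = ⊥ := by
    rw [eq_bot_iff]
    rintro B ⟨⟨Z, hZ, rfl⟩, ⟨κ, hκ, h⟩⟩
    have hZH := (mem_commIn.1 hZ).2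
    have hc : adMap y0 Z * H = H * adMap y0 Z := by
      rw [adMap_apply, Matrix.sub_mul, Matrix.mul_sub, Matrix.mul_assoc, hey, ← Matrix.mul_assoc,
        hZH, Matrix.mul_assoc y0, hZH, ← Matrix.mul_assoc y0, hey]
      simp only [Matrix.mul_assoc]
    rw [Submodule.mem_bot, ← he.peirce_eq hc, ← h]
    exact he.peirce_commutator κ
  have e1 := Submodule.finrank_sup_add_finrank_inf_eq T1 T2
  rw [hT12, finrank_bot] at e1
  have e2 := Submodule.finrank_mono (sup_le hT1 hT2)
  have e3 : Module.finrank ℂ T + Module.finrank ℂ (endSub vt z) = Module.finrank ℂ E :=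
    finrank_map_adMap E z.2
  have e4 : Module.finrank ℂ T1 + Module.finrank ℂ (commIn (commIn E H) y0) =
    Module.finrank ℂ (commIn E H) := finrank_map_adMap _ _
  have e5 : Module.finrank ℂ T2 + Module.finrank ℂ (commIn K H) = Module.finrank ℂ K :=
    finrank_map_adMap _ _
  have e6 : commIn (commIn E H) y0 ≤ endSub vt ((z.1, y0) : MatPair N) := by
    intro Z hZ
    rw [mem_commIn, mem_commIn] at hZ
    exact mem_commIn.2 ⟨hZ.1.1, hZ.2⟩
  have e7 := Submodule.finrank_mono e6
  have e8 := finrank_endSub_of_isBrick hzb.2.2.2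
  have e9 : Module.finrank ℂ K + Module.finrank ℂ (diagSub vt) =
      Module.finrank ℂ (maskSub vt R) + Module.finrank ℂ E := finrank_fibreDir (vt := vt) hx
  have e10 : Module.finrank ℂ (commIn K H) + Module.finrank ℂ (commIn (diagSub vt) H) ≤
      Module.finrank ℂ (commIn (maskSub vt R) H) + Module.finrank ℂ (commIn E H) :=
    finrank_fibreDir_comm_le he hx hex
  omega

lemma exists_isNilpotent_of_minimal [Nonempty N] (hF : FamilyCondition vt R Λ Inj)
    (hInj : IsOpen Inj) (hO : IsOpen O) (hΛ : ∀ Z ∈ diagSub vt, Z * Λ = Λ * Z) {z : MatPair N}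
    (hz : IsMinimalBrick vt R Λ Inj O z) {Z : Matrix N N ℂ} (hZ : Z ∈ commIn (diagSub vt) z.1) :
    ∃ c : ℂ, IsNilpotent (Z - c • 1) := by
  apply exists_isNilpotent_sub
  intro p hp
  set e := aeval Z p with he
  obtain ⟨hg, hex⟩ := mem_commIn.1 (aeval_mem_commIn hZ p)
  rw [← he] at hg hex
  set f := 1 - e with hf
  have hfg : f ∈ diagSub vt := Submodule.sub_mem _ one_mem_diagSub hg
  have hfx : f * z.1 = z.1 * f := by rw [hf, Matrix.sub_mul, Matrix.mul_sub, hex]; simp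
  have hff : f * f = f := by rw [hf]; simp [Matrix.sub_mul, Matrix.mul_sub, hp]
  have hef : e * f = 0 := by rw [hf, Matrix.mul_sub, hp, Matrix.mul_one, sub_self]
  have hfe : f * e = 0 := by rw [hf, Matrix.sub_mul, hp, Matrix.one_mul, sub_self]
  let y0 := e * z.2 * e + f * z.2 * f
  have hΛe : ∀ e' ∈ diagSub vt, e' * z.1 = z.1 * e' → e' * e' = e' →
      diagPr vt (z.1 * (e' * z.2 * e') - (e' * z.2 * e') * z.1) = e' * Λ := by
    intro e' hg' hx' hi'
    have : z.1 * (e' * z.2 * e') - (e' * z.2 * e') * z.1 =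
        e' * (z.1 * z.2 - z.2 * z.1) * e' := by
      simp only [Matrix.mul_sub, Matrix.sub_mul, Matrix.mul_assoc, hx']
      simp only [← Matrix.mul_assoc, hx']
    rw [this, maskPr_mul_diag hg', maskPr_diag_mul hg', hz.1.1.2.2, Matrix.mul_assoc, ← hΛ _ hg',
      ← Matrix.mul_assoc, hi']
  have hbr : IsBrick vt ((z.1, y0) : MatPair N) := by
    apply isBrick_fibre hF hInj hO hz
    rw [mem_fibreDir_iff]
    refine ⟨Submodule.sub_mem _ (Submodule.add_mem _
      (mul_diag_mem hg (diag_mul_mem hg hz.1.1.2.1))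
      (mul_diag_mem hfg (diag_mul_mem hfg hz.1.1.2.1))) hz.1.1.2.1, ?_⟩
    have h1 : z.1 * (y0 - z.2) - (y0 - z.2) * z.1 =
        (z.1 * (e * z.2 * e) - (e * z.2 * e) * z.1) + (z.1 * (f * z.2 * f) - (f * z.2 * f) * z.1)
          - (z.1 * z.2 - z.2 * z.1) := by
      simp only [y0]; noncomm_ring
    rw [h1, map_sub, map_add, hΛe e hg hex hp, hΛe f hfg hfx hff, hz.1.1.2.2, ← Matrix.add_mul, hf,
      add_sub_cancel, Matrix.one_mul, sub_self]
  obtain ⟨c, hc⟩ := hbr e (mem_endSub.2 ⟨hg, hex, by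
    change e * (e * z.2 * e + f * z.2 * f) = (e * z.2 * e + f * z.2 * f) * e
    rw [Matrix.mul_add, Matrix.add_mul, ← Matrix.mul_assoc, ← Matrix.mul_assoc, hp,
      ← Matrix.mul_assoc, ← Matrix.mul_assoc, hef, Matrix.mul_assoc (e * z.2), hp,
      Matrix.mul_assoc (f * z.2), hfe]
    simp⟩)
  have h1 : c * c = c := by
    have h2 := hp
    rw [hc, Matrix.smul_mul, Matrix.one_mul, smul_smul] at h2
    obtain ⟨i⟩ := ‹Nonempty N›
    simpa using congrFun (congrFun h2 i) i
  rw [hc]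
  rcases mul_eq_zero.1 (show c * (c - 1) = 0 by linear_combination h1) with h | h
  · left; rw [h, zero_smul]
  · right; rw [sub_eq_zero.1 h, one_smul]

end SchurNilpotent

section MaximalNilpotent

open Filter Topology

variable {N I : Type} [Fintype N] [DecidableEq N] {vt : N → I} {R : I → I → Prop}
  {Λ : Matrix N N ℂ} {Inj : Set (Matrix N N ℂ)} {O : Set (MatPair N)}

lemma add_finrank_le_of_fst {V W : Type*} [AddCommGroup V] [Module ℂ V] [AddCommGroup W]
    [Module ℂ W] [FiniteDimensional ℂ V] [FiniteDimensional ℂ W] (J : Submodule ℂ (V × W))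
    {S : Submodule ℂ V} {T : Submodule ℂ W} (hS : ∀ v ∈ S, ∃ w, (v, w) ∈ J)
    (hT : ∀ w ∈ T, ((0, w) : V × W) ∈ J) :
    Module.finrank ℂ S + Module.finrank ℂ T ≤ Module.finrank ℂ J := by
  have h4 := finrank_map_add (LinearMap.fst ℂ V W) J
  have h5 : S ≤ J.map (LinearMap.fst ℂ V W) := by
    intro v hv
    obtain ⟨w, hw⟩ := hS v hv
    exact ⟨_, hw, rfl⟩
  have h6 : (⊥ : Submodule ℂ V).prod T ≤ J ⊓ LinearMap.ker (LinearMap.fst ℂ V W) := by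
    rintro ⟨v, w⟩ ⟨hu1, hu2⟩
    have hu1 : v = 0 := hu1
    subst hu1
    exact ⟨hT w hu2, rfl⟩
  have h7 := Submodule.finrank_mono h5
  have h8 := Submodule.finrank_mono h6
  rw [finrank_submodule_prod, finrank_bot] at h8
  omega

/-- The trace zero block diagonal matrices commuting with `x`. -/
def tracelessComm (vt : N → I) (x : Matrix N N ℂ) : Submodule ℂ (Matrix N N ℂ) :=
  commIn (diagSub vt) x ⊓ LinearMap.ker (Matrix.traceLinearMap N ℂ ℂ)

lemma mem_tracelessComm {x Z : Matrix N N ℂ} :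
    Z ∈ tracelessComm vt x ↔ (Z ∈ diagSub vt ∧ Z * x = x * Z) ∧ Z.trace = 0 := by
  rw [tracelessComm, Submodule.mem_inf, mem_commIn, LinearMap.mem_ker, Matrix.traceLinearMap_apply]

lemma finrank_tracelessComm (x : Matrix N N ℂ) :
    Module.finrank ℂ (commIn (diagSub vt) x) ≤ Module.finrank ℂ (tracelessComm vt x) + 1 := by
  have h := finrank_map_add (Matrix.traceLinearMap N ℂ ℂ) (commIn (diagSub vt) x)
  have h2 := Submodule.finrank_le ((commIn (diagSub vt) x).map (Matrix.traceLinearMap N ℂ ℂ))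
  rw [Module.finrank_self] at h2
  rw [tracelessComm]
  omega

/-- The sum of the ranks of the powers of a matrix. -/
def rankSum (Z : Matrix N N ℂ) : ℕ := ∑ s ∈ range (Fintype.card N + 1), (Z ^ s).rank

lemma pow_card_eq_zero_of_isNilpotent {Z : Matrix N N ℂ} (h : IsNilpotent Z) :
    Z ^ Fintype.card N = 0 := by
  have h1 := Matrix.isNilpotent_charpoly_sub_pow_of_isNilpotent h
  have h2 := sub_eq_zero.1 h1.eq_zero
  have h3 := Matrix.aeval_self_charpoly Z
  rwa [h2, map_pow, aeval_X] at h3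

/-- A minimal brick together with a traceless endomorphism of its first component whose powers
have maximal ranks. -/
structure IsMaximalPair (vt : N → I) (R : I → I → Prop) (Λ : Matrix N N ℂ)
    (Inj : Set (Matrix N N ℂ)) (O : Set (MatPair N)) (z : MatPair N) (Z : Matrix N N ℂ) :
    Prop where
  minimal : IsMinimalBrick vt R Λ Inj O z
  mem : Z ∈ tracelessComm vt z.1
  le : ∀ z' Z', IsMinimalBrick vt R Λ Inj O z' → Z' ∈ tracelessComm vt z'.1 →
    rankSum Z' ≤ rankSum Z

lemma isNilpotent_of_mem_tracelessComm [Nonempty N] (hF : FamilyCondition vt R Λ Inj)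
    (hInj : IsOpen Inj) (hO : IsOpen O) (hΛ : ∀ Z ∈ diagSub vt, Z * Λ = Λ * Z) {z : MatPair N}
    (hz : IsMinimalBrick vt R Λ Inj O z) {Z : Matrix N N ℂ} (hZ : Z ∈ tracelessComm vt z.1) :
    IsNilpotent Z := by
  obtain ⟨h1, h2⟩ := mem_tracelessComm.1 hZ
  obtain ⟨c, hc⟩ := exists_isNilpotent_of_minimal hF hInj hO hΛ hz (mem_commIn.2 h1)
  exact eq_zero_of_trace_of_isNilpotent_sub hc h2

lemma exists_isMaximalPair {z : MatPair N} (hz : IsMinimalBrick vt R Λ Inj O z) :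
    ∃ z Z, IsMaximalPair vt R Λ Inj O z Z := by
  have hb : ∀ Z : Matrix N N ℂ, rankSum Z ≤ (Fintype.card N + 1) * Fintype.card N := by
    intro Z
    refine (Finset.sum_le_card_nsmul _ _ (Fintype.card N) fun s _ => Matrix.rank_le_card_width _).trans ?_
    simp
  obtain ⟨⟨w, Z⟩, ⟨h1, h2⟩, h3⟩ := exists_forall_le_of_nonempty
    (fun q : MatPair N × Matrix N N ℂ => (Fintype.card N + 1) * Fintype.card N - rankSum q.2)
    (S := {q | IsMinimalBrick vt R Λ Inj O q.1 ∧ q.2 ∈ tracelessComm vt q.1.1})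
    ⟨(z, 0), hz, Submodule.zero_mem _⟩
  refine ⟨w, Z, h1, h2, fun z' Z' hz' hZ' => ?_⟩
  have := h3 (z', Z') ⟨hz', hZ'⟩
  have h4 := hb Z
  have h5 := hb Z'
  simp only at this
  omega

lemma IsMaximalPair.ne_zero [Nonempty N] {z : MatPair N} {Z : Matrix N N ℂ}
    (h : IsMaximalPair vt R Λ Inj O z Z)
    (h2 : 2 ≤ Module.finrank ℂ (commIn (diagSub vt) z.1)) : Z ≠ 0 := by
  rintro rfl
  have h3 := finrank_tracelessComm (vt := vt) z.1
  have h4 : tracelessComm vt z.1 ≠ ⊥ := by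
    intro h5; rw [h5, finrank_bot] at h3; omega
  obtain ⟨W, hW, hW0⟩ := Submodule.exists_mem_ne_zero_of_ne_bot h4
  have h5 := h.le z W h.minimal hW
  have h6 : ∀ s ∈ range (Fintype.card N + 1), ((0 : Matrix N N ℂ) ^ s).rank ≤ (W ^ s).rank := by
    intro s _
    rcases Nat.eq_zero_or_pos s with rfl | hs
    · simp
    · rw [zero_pow hs.ne', Matrix.rank_zero]; exact Nat.zero_le _
  have h7 : rankSum (0 : Matrix N N ℂ) < rankSum W := by
    refine Finset.sum_lt_sum h6 ⟨1, ?_, ?_⟩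
    · rw [Finset.mem_range]
      have := Fintype.card_pos (α := N)
      omega
    · rw [pow_one, pow_one, Matrix.rank_zero]
      rw [Nat.pos_iff_ne_zero]
      intro h8
      have h9 := LinearMap.range_eq_bot.1 (Submodule.finrank_eq_zero.1 h8)
      exact hW0 (Matrix.toLin'.injective (by rw [map_zero]; exact h9))
  omega

/-- First order variations of the endomorphism of a maximal pair are commutators. -/
lemma IsMaximalPair.exists_adMap [Nonempty N] (hF : FamilyCondition vt R Λ Inj)
    (hInj : IsOpen Inj) (hO : IsOpen O) (hΛ : ∀ Z ∈ diagSub vt, Z * Λ = Λ * Z) {z : MatPair N}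
    {Z : Matrix N N ℂ} (h : IsMaximalPair vt R Λ Inj O z Z) {α : Type*} {l : Filter α} [l.NeBot]
    {t : α → ℂ} {w : α → MatPair N} {d : α → Matrix N N ℂ} {d0 : Matrix N N ℂ}
    (ht : Tendsto t l (𝓝 0)) (ht0 : ∀ᶠ a in l, t a ≠ 0) (hd : Tendsto d l (𝓝 d0))
    (hd0 : d0 ∈ diagSub vt) (hw : ∀ᶠ a in l, IsMinimalBrick vt R Λ Inj O (w a))
    (hZ : ∀ᶠ a in l, Z + t a • d a ∈ commIn (diagSub vt) (w a).1) :
    ∃ c : ℂ, d0 - c • 1 ∈ (diagSub vt).map (adMap Z) ∧ (d0.trace = 0 → c = 0) := by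
  have hZt := (mem_tracelessComm.1 h.mem).2
  set m : ℂ := (Fintype.card N : ℂ) with hm
  have hm0 : m ≠ 0 := by rw [hm]; exact_mod_cast Fintype.card_ne_zero
  let c : Matrix N N ℂ → ℂ := fun A => A.trace / m
  have hc : Tendsto (fun a => d a - c (d a) • (1 : Matrix N N ℂ)) l (𝓝 (d0 - c d0 • 1)) := by
    have h1 : Tendsto (fun a => (d a).trace) l (𝓝 d0.trace) :=
      ((continuous_id.matrix_trace).tendsto d0).comp hd
    exact hd.sub ((h1.div_const m).smul_const _)
  set D := fun a => d a - c (d a) • (1 : Matrix N N ℂ) with hD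
  have hmem : ∀ᶠ a in l, Z + t a • D a ∈ tracelessComm vt (w a).1 := by
    filter_upwards [hZ] with a ha
    have e1 : Z + t a • D a = (Z + t a • d a) - (t a * c (d a)) • 1 := by
      rw [hD]; simp only [smul_sub, smul_smul]; abel
    refine Submodule.mem_inf.2 ⟨?_, ?_⟩
    · rw [e1]
      exact Submodule.sub_mem _ ha (Submodule.smul_mem _ _
        (mem_commIn.2 ⟨one_mem_diagSub, by simp⟩))
    · rw [LinearMap.mem_ker, Matrix.traceLinearMap_apply, Matrix.trace_add, hZt, Matrix.trace_smul,
        hD]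
      simp only [Matrix.trace_sub, Matrix.trace_smul, Matrix.trace_one, c]
      rw [← hm, smul_eq_mul, smul_eq_mul, div_mul_cancel₀ _ hm0]; simp
  have hlim : Tendsto (fun a => Z + t a • D a) l (𝓝 Z) := by
    have : Tendsto (fun a => Z + t a • D a) l (𝓝 (Z + (0 : ℂ) • (d0 - c d0 • 1))) :=
      tendsto_const_nhds.add (ht.smul hc)
    rwa [zero_smul, add_zero] at this
  have hlow : ∀ s, ∀ᶠ a in l, (Z ^ s).rank ≤ ((Z + t a • D a) ^ s).rank := by
    intro s
    have := eventually_finrank_range_le (l := l) (L := fun a => Matrix.toLin' ((Z + t a • D a) ^ s))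
      (L0 := Matrix.toLin' (Z ^ s)) (fun v => by
        simp only [Matrix.toLin'_apply]
        exact tendsto_mulVec (hlim.pow s) tendsto_const_nhds)
    exact this
  have hlow' : ∀ᶠ a in l, ∀ s ∈ range (Fintype.card N + 1),
      (Z ^ s).rank ≤ ((Z + t a • D a) ^ s).rank :=
    (Filter.eventually_all_finset _).2 fun s _ => hlow s
  have hr : ∀ s, ∀ᶠ a in l, ((Z + t a • D a) ^ s).rank ≤ (Z ^ s).rank := by
    intro s
    filter_upwards [hlow', hmem, hw] with a h1 h2 h3
    by_cases hs : s ∈ range (Fintype.card N + 1)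
    · by_contra hlt
      have := Finset.sum_lt_sum h1 ⟨s, hs, not_le.1 hlt⟩
      exact absurd (h.le _ _ h3 h2) (not_le.2 this)
    · rw [Finset.mem_range, not_lt] at hs
      have hn := pow_card_eq_zero_of_isNilpotent
        (isNilpotent_of_mem_tracelessComm hF hInj hO hΛ h3 h2)
      rw [show s = Fintype.card N + (s - Fintype.card N) by omega, pow_add, hn, Matrix.zero_mul,
        Matrix.rank_zero]
      exact Nat.zero_le _
  obtain ⟨X, hX⟩ := exists_commutator_of_rank_le
    (isNilpotent_of_mem_tracelessComm hF hInj hO hΛ h.minimal h.mem) ht ht0 hc hr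
  refine ⟨c d0, ⟨diagPr vt X, maskPr_mem _, ?_⟩, fun h0 => by simp [c, h0]⟩
  have hZd := (mem_tracelessComm.1 h.mem).1.1
  have h1 : diagPr vt (d0 - c d0 • 1) = d0 - c d0 • 1 :=
    maskPr_of_mem (Submodule.sub_mem _ hd0 (Submodule.smul_mem _ _ one_mem_diagSub))
  rw [← h1, hX, map_sub, maskPr_mul_diag hZd, maskPr_diag_mul hZd, adMap_apply]

/-- The pairs of first order variations of `x` and of a commuting matrix `Z`, where `Z` varies in
its conjugacy class. -/
def jointDir (vt : N → I) (R : I → I → Prop) (x Z : Matrix N N ℂ) : Submodule ℂ (MatPair N) :=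
  ((maskSub vt R).prod ((diagSub vt).map (adMap Z)) : Submodule ℂ (MatPair N)) ⊓
    LinearMap.ker ((adMap x ∘ₗ LinearMap.snd ℂ (Matrix N N ℂ) (Matrix N N ℂ) -
      adMap Z ∘ₗ LinearMap.fst ℂ (Matrix N N ℂ) (Matrix N N ℂ) : MatPair N →ₗ[ℂ] Matrix N N ℂ))

lemma mem_jointDir {x Z : Matrix N N ℂ} {u : MatPair N} : u ∈ jointDir vt R x Z ↔
    (u.1 ∈ maskSub vt R ∧ u.2 ∈ (diagSub vt).map (adMap Z)) ∧ adMap x u.2 - adMap Z u.1 = 0 :=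
  Iff.rfl

lemma finrank_jointDir_le (x Z : Matrix N N ℂ) :
    Module.finrank ℂ (jointDir vt R x Z) + Module.finrank ℂ (commIn (diagSub vt) Z) ≤
      Module.finrank ℂ (commIn (maskSub vt R) Z) + Module.finrank ℂ (diagSub vt) := by
  have h1 := finrank_map_add (V := MatPair N) (LinearMap.snd ℂ (Matrix N N ℂ) (Matrix N N ℂ))
    (jointDir vt R x Z)
  have h2 : (jointDir vt R x Z).map (LinearMap.snd ℂ (Matrix N N ℂ) (Matrix N N ℂ)) ≤
      (diagSub vt).map (adMap Z) := by
    rintro _ ⟨u, hu, rfl⟩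
    exact (mem_jointDir.1 hu).1.2
  have h3 : jointDir vt R x Z ⊓ LinearMap.ker (LinearMap.snd ℂ (Matrix N N ℂ) (Matrix N N ℂ)) ≤
      ((commIn (maskSub vt R) Z).prod ⊥ : Submodule ℂ (MatPair N)) := by
    rintro u ⟨hu, hu2⟩
    obtain ⟨h4, h5⟩ := mem_jointDir.1 hu
    have hu2 : u.2 = 0 := hu2
    refine ⟨mem_commIn.2 ⟨h4.1, ?_⟩, hu2⟩
    rw [hu2, map_zero, zero_sub, neg_eq_zero, adMap_apply, sub_eq_zero] at h5
    exact h5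
  have h4 := Submodule.finrank_mono h2
  have h5 := Submodule.finrank_mono h3
  rw [finrank_submodule_prod, finrank_bot] at h5
  have h6 := finrank_map_adMap (diagSub vt) Z
  omega

/-- The subspace of first components of first order deformations of a point. -/
def fstDir (vt : N → I) (R : I → I → Prop) (z : MatPair N) : Submodule ℂ (Matrix N N ℂ) where
  carrier := {κ | κ ∈ maskSub vt R ∧
    ∀ B ∈ (commIn (diagSub vt) z.1).map (adMap z.2), (κ * B).trace = 0}
  add_mem' := by
    rintro a b ⟨ha, ha'⟩ ⟨hb, hb'⟩
    exact ⟨Submodule.add_mem _ ha hb, fun B hB => by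
      rw [Matrix.add_mul, Matrix.trace_add, ha' B hB, hb' B hB, add_zero]⟩
  zero_mem' := ⟨Submodule.zero_mem _, fun B _ => by simp⟩
  smul_mem' := by
    rintro c a ⟨ha, ha'⟩
    exact ⟨Submodule.smul_mem _ _ ha, fun B hB => by
      rw [Matrix.smul_mul, Matrix.trace_smul, ha' B hB, smul_zero]⟩

lemma finrank_fstDir {z : MatPair N} (hy : z.2 ∈ maskSub vt (fun v w => R w v)) :
    Module.finrank ℂ (fstDir vt R z) + Module.finrank ℂ (commIn (diagSub vt) z.1) =
      Module.finrank ℂ (maskSub vt R) + Module.finrank ℂ (endSub vt z) := by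
  have h1 := finrank_orthogonal_add (maskSub vt fun v w => R w v) (maskSub vt R)
    (maskPr vt fun v w => R w v) (maskPr vt R) (fun A hA => maskPr_of_mem hA) (fun A => maskPr_mem _)
    (fun A B => trace_maskPr_mul _ _) ((commIn (diagSub vt) z.1).map (adMap z.2)) (by
      rintro _ ⟨W, hW, rfl⟩
      exact ad_mem (mem_commIn.1 hW).1 hy) (fstDir vt R z) (fun A => Iff.rfl)
  have h2 : _ + Module.finrank ℂ (endSub vt z) = _ :=
    finrank_map_adMap (commIn (diagSub vt) z.1) z.2
  omega

lemma IsMaximalPair.tracelessComm_le [Nonempty N] (hF : FamilyCondition vt R Λ Inj)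
    (hInj : IsOpen Inj) (hO : IsOpen O) (hΛ : ∀ Z ∈ diagSub vt, Z * Λ = Λ * Z) {z : MatPair N}
    {Z : Matrix N N ℂ} (h : IsMaximalPair vt R Λ Inj O z Z) :
    tracelessComm vt z.1 ≤ (diagSub vt).map (adMap Z) := by
  intro W hW
  obtain ⟨hW1, hW2⟩ := mem_tracelessComm.1 hW
  obtain ⟨c, hc, hc0⟩ := h.exists_adMap hF hInj hO hΛ (l := 𝓝[≠] (0 : ℂ)) (t := id)
    (w := fun _ => z) (d := fun _ => W) (d0 := W) (tendsto_id.mono_left nhdsWithin_le_nhds)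
    (eventually_mem_nhdsWithin) tendsto_const_nhds hW1.1
    (Eventually.of_forall fun _ => h.minimal) (Eventually.of_forall fun t =>
      Submodule.add_mem _ (mem_commIn.2 (mem_tracelessComm.1 h.mem).1)
        (Submodule.smul_mem _ _ (mem_commIn.2 hW1)))
  rwa [hc0 hW2, zero_smul, sub_zero] at hc

lemma IsMaximalPair.fstDir_le [Nonempty N] (hF : FamilyCondition vt R Λ Inj)
    (hInj : IsOpen Inj) (hO : IsOpen O) (hΛ : ∀ Z ∈ diagSub vt, Z * Λ = Λ * Z) {z : MatPair N}
    {Z : Matrix N N ℂ} (h : IsMaximalPair vt R Λ Inj O z Z) {x' : Matrix N N ℂ}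
    (hx' : x' ∈ fstDir vt R z) : ∃ Z', ((x', Z') : MatPair N) ∈ jointDir vt R z.1 Z := by
  have hzb := h.minimal.1
  have hZE := mem_commIn.2 (mem_tracelessComm.1 h.mem).1
  have hZc := (mem_commIn.1 hZE).2
  obtain ⟨y', hy', hlin⟩ := exists_linM_eq_zero hzb.1.1
    (fun W hW => hx'.2 _ (Submodule.mem_map_of_mem hW))
  obtain ⟨t, u, ht, ht0, hu, hm⟩ := exists_seq_brickSet hInj hO hzb hx'.1 hy' hlin
  have hu1 : Tendsto (fun n => (u n).1) atTop (𝓝 x') := (continuous_fst.tendsto _).comp hu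
  have hxlim : Tendsto (fun n => z.1 + t n • (u n).1) atTop (𝓝 z.1) := by
    have : Tendsto (fun n => z.1 + t n • (u n).1) atTop (𝓝 (z.1 + (0 : ℂ) • x')) :=
      tendsto_const_nhds.add (ht.smul hu1)
    rwa [zero_smul, add_zero] at this
  let L : ℕ → diagSub vt →ₗ[ℂ] Matrix N N ℂ :=
    fun n => adMap (z.1 + t n • (u n).1) ∘ₗ (diagSub vt).subtype
  let L0 : diagSub vt →ₗ[ℂ] Matrix N N ℂ := adMap z.1 ∘ₗ (diagSub vt).subtype
  have hLlim : ∀ v, Tendsto (fun n => L n v) atTop (𝓝 (L0 v)) := fun v => tendsto_adMap hxlim _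
  have hminb : ∀ᶠ n in atTop, IsMinimalBrick vt R Λ Inj O (z + t n • u n) := by
    filter_upwards [hm, eventually_finrank_range_le hLlim] with n hn hn2
    refine ⟨hn, fun w hw => le_trans ?_ (h.minimal.2 w hw)⟩
    have h2 := finrank_range_adMap (vt := vt) z.1
    have h3 := finrank_range_adMap (vt := vt) (z.1 + t n • (u n).1)
    change Module.finrank ℂ (commIn (diagSub vt) (z.1 + t n • (u n).1)) ≤ _
    change Module.finrank ℂ (LinearMap.range (adMap z.1 ∘ₗ _)) ≤
      Module.finrank ℂ (LinearMap.range (adMap (z.1 + t n • (u n).1) ∘ₗ _)) at hn2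
    omega
  obtain ⟨d, d0, hd, hd1, hd2⟩ := exists_ker_extension (L := L) (L0 := L0) (l := atTop)
    hLlim (by
      filter_upwards [hm] with n hn
      have h1 := h.minimal.2 _ hn
      have h2 := finrank_range_adMap (vt := vt) z.1
      have h3 := finrank_range_adMap (vt := vt) (z.1 + t n • (u n).1)
      change _ ≤ Module.finrank ℂ (commIn (diagSub vt) (z.1 + t n • (u n).1)) at h1
      change Module.finrank ℂ (LinearMap.range (adMap (z.1 + t n • (u n).1) ∘ₗ _)) ≤
        Module.finrank ℂ (LinearMap.range (adMap z.1 ∘ₗ _))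
      omega) (Eventually.of_forall ht0) (v := ⟨Z, (mem_commIn.1 hZE).1⟩) (w' := adMap x' Z) (by
      refine (tendsto_adMap hu1 Z).congr fun n => ?_
      change adMap (u n).1 Z = (t n)⁻¹ • adMap (z.1 + t n • (u n).1) Z
      rw [adMap_apply, adMap_apply, Matrix.mul_add, Matrix.add_mul, hZc, Matrix.mul_smul,
        Matrix.smul_mul, add_sub_add_left_eq_sub, ← smul_sub, smul_smul, inv_mul_cancel₀ (ht0 n),
        one_smul])
  obtain ⟨c, hc, -⟩ := h.exists_adMap hF hInj hO hΛ (w := fun n => z + t n • u n)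
    (d := fun n => (d n : Matrix N N ℂ)) (d0 := d0) ht (Eventually.of_forall ht0)
    ((continuous_subtype_val.tendsto _).comp hd) d0.2 hminb (by
      filter_upwards [hd1] with n hn
      refine mem_commIn.2 ⟨Submodule.add_mem _ (mem_commIn.1 hZE).1
        (Submodule.smul_mem _ _ (d n).2), ?_⟩
      exact sub_eq_zero.1 hn)
  refine ⟨d0 - c • 1, mem_jointDir.2 ⟨⟨hx'.1, hc⟩, ?_⟩⟩
  have hd3 : adMap z.1 (d0 : Matrix N N ℂ) + adMap x' Z = 0 := hd2
  rw [← hd3]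
  simp only [adMap_apply, Matrix.sub_mul, Matrix.mul_sub, Matrix.smul_mul, Matrix.mul_smul,
    Matrix.one_mul, Matrix.mul_one]
  abel

/-- If no nilpotent endomorphism satisfies the numerical inequality, the first component of some
brick has only scalar endomorphisms. -/
theorem exists_brick_fst [Nonempty N] (hF : FamilyCondition vt R Λ Inj)
    (hInj : IsOpen Inj) (hO : IsOpen O) (hΛ : ∀ Z ∈ diagSub vt, Z * Λ = Λ * Z)
    (hnil : ∀ x ∈ Inj, x ∈ maskSub vt R → ∀ Z ∈ commIn (diagSub vt) x, IsNilpotent Z → Z ≠ 0 →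
      Module.finrank ℂ (commIn (maskSub vt R) Z) + Module.finrank ℂ (diagSub vt) <
        Module.finrank ℂ (maskSub vt R) + Module.finrank ℂ (commIn (diagSub vt) Z))
    (hne : (brickSet vt R Λ Inj O).Nonempty) :
    ∃ z ∈ brickSet vt R Λ Inj O, Module.finrank ℂ (commIn (diagSub vt) z.1) ≤ 1 := by
  by_contra! hcon
  obtain ⟨z, hz, hmin⟩ := exists_forall_le_of_nonempty
    (fun z : MatPair N => Module.finrank ℂ (commIn (diagSub vt) z.1)) hne
  obtain ⟨z, Z, h⟩ := exists_isMaximalPair (vt := vt) ⟨hz, hmin⟩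
  have hzb := h.minimal.1
  have h2 := hcon z hzb
  have hZ0 := h.ne_zero h2
  have hZE := mem_commIn.2 (mem_tracelessComm.1 h.mem).1
  have hnum := hnil z.1 hzb.2.1 hzb.1.1 Z hZE
    (isNilpotent_of_mem_tracelessComm hF hInj hO hΛ h.minimal h.mem) hZ0
  have h3 := finrank_jointDir_le (vt := vt) (R := R) z.1 Z
  have h4 : Module.finrank ℂ (fstDir vt R z) + Module.finrank ℂ (tracelessComm vt z.1) ≤
      Module.finrank ℂ (jointDir vt R z.1 Z) := by
    refine add_finrank_le_of_fst _ (fun x' hx' => h.fstDir_le hF hInj hO hΛ hx') fun W hW => ?_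
    refine mem_jointDir.2 ⟨⟨Submodule.zero_mem _, h.tracelessComm_le hF hInj hO hΛ hW⟩, ?_⟩
    rw [map_zero, sub_zero, adMap_apply, sub_eq_zero]
    exact (mem_tracelessComm.1 hW).1.2
  have h9 := finrank_fstDir (vt := vt) hzb.1.2.1
  have h10 := finrank_endSub_of_isBrick hzb.2.2.2
  have h11 := finrank_tracelessComm (vt := vt) z.1
  omega

end MaximalNilpotent

section StarForm

variable {J T : Type} [Fintype J] [Fintype T]

/-- A dimension vector of a star: the dimension at the centre and the successive drops of the
dimension along the arms. -/
abbrev StarVec (J T : Type) : Type := ℤ × (J → T → ℤ)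

/-- The symmetric form on dimension vectors of a star with one additional arm. -/
def starForm (u v : StarVec J T) : ℤ :=
  ((Fintype.card J : ℤ) - 1) * (u.1 * v.1) - ∑ j, ∑ i, u.2 j i * v.2 j i

lemma starForm_comm (u v : StarVec J T) : starForm u v = starForm v u := by
  simp only [starForm, mul_comm]

lemma starForm_add_right (u v w : StarVec J T) :
    starForm u (v + w) = starForm u v + starForm u w := by
  simp only [starForm, Prod.fst_add, Prod.snd_add, Pi.add_apply, mul_add, Finset.sum_add_distrib]
  ring

lemma starForm_smul_right (c : ℤ) (u v : StarVec J T) :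
    starForm u (c • v) = c * starForm u v := by
  simp only [starForm, Prod.smul_fst, Prod.smul_snd, Pi.smul_apply, smul_eq_mul, mul_sub,
    Finset.mul_sum]
  congr 1
  · ring
  · exact Finset.sum_congr rfl fun j _ => Finset.sum_congr rfl fun i _ => by ring

lemma starForm_sub_right (u v w : StarVec J T) :
    starForm u (v - w) = starForm u v - starForm u w := by
  have h := starForm_add_right u (v - w) w
  rw [sub_add_cancel] at h
  omega

lemma starForm_sum_right {S : Type*} (s : Finset S) (u : StarVec J T) (v : S → StarVec J T) :
    starForm u (∑ a ∈ s, v a) = ∑ a ∈ s, starForm u (v a) := by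
  classical
  induction s using Finset.induction_on with
  | empty => simp [starForm]
  | insert a s ha ih => rw [Finset.sum_insert ha, Finset.sum_insert ha, starForm_add_right, ih]

/-- The squared length of the arm components. -/
lemma sq_sum_mul_le (u v : J → T → ℤ) :
    (∑ j, ∑ i, u j i * v j i) ^ 2 ≤ (∑ j, ∑ i, u j i * u j i) * ∑ j, ∑ i, v j i * v j i := by
  have h := Finset.sum_mul_sq_le_sq_mul_sq (Finset.univ : Finset (J × T))
    (fun q => u q.1 q.2) (fun q => v q.1 q.2)
  simpa only [Fintype.sum_prod_type, sq] using h

/-- A nonzero vector orthogonal to a positive vector is negative. -/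
lemma starForm_self_neg {a w : StarVec J T} (ha : 0 < starForm a a) (haw : starForm a w = 0)
    (hw : w.2 ≠ 0) : starForm w w < 0 := by
  unfold starForm at *
  set c : ℤ := (Fintype.card J : ℤ) - 1
  have h1 := sq_sum_mul_le a.2 w.2
  set A := ∑ j, ∑ i, a.2 j i * a.2 j i with hA
  set W := ∑ j, ∑ i, w.2 j i * w.2 j i with hW
  have hA0 : 0 ≤ A := Finset.sum_nonneg fun j _ => Finset.sum_nonneg fun i _ => mul_self_nonneg _
  have hW0 : 0 < W := by
    obtain ⟨j, hj⟩ := Function.ne_iff.1 hw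
    obtain ⟨i, hi⟩ := Function.ne_iff.1 hj
    have h2 : ∀ j, 0 ≤ ∑ i, w.2 j i * w.2 j i :=
      fun j => Finset.sum_nonneg fun i _ => mul_self_nonneg _
    refine Finset.sum_pos' (fun j _ => h2 j) ⟨j, Finset.mem_univ _, ?_⟩
    exact Finset.sum_pos' (fun i _ => mul_self_nonneg _)
      ⟨i, Finset.mem_univ _, mul_self_pos.2 hi⟩
  have h3 : ∑ j, ∑ i, a.2 j i * w.2 j i = c * (a.1 * w.1) := by omega
  rw [h3] at h1
  have h4 : A < c * (a.1 * a.1) := by omega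
  by_contra h5
  have h6 : W ≤ c * (w.1 * w.1) := by omega
  have h7 : A * W < (c * (a.1 * a.1)) * W := mul_lt_mul_of_pos_right h4 hW0
  have h8 : (c * (a.1 * a.1)) * W ≤ (c * (a.1 * a.1)) * (c * (w.1 * w.1)) :=
    mul_le_mul_of_nonneg_left h6 (by omega)
  nlinarith

lemma starForm_mul_le_sq {a : StarVec J T} (ha : 0 < starForm a a) (v : StarVec J T)
    (hv : ∀ j, ∑ i, v.2 j i = v.1) (hav : ∀ j, ∑ i, a.2 j i = a.1) [Nonempty J] :
    starForm a a * starForm v v ≤ starForm a v ^ 2 := by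
  set q := starForm a a with hq
  set x := starForm a v with hx
  let w : StarVec J T := q • v - x • a
  have h1 : starForm a w = 0 := by
    simp only [w]
    rw [starForm_sub_right, starForm_smul_right, starForm_smul_right, ← hq, ← hx]; ring
  have h2 : starForm w w = q * (q * starForm v v - x ^ 2) := by
    have e1 : starForm w w = q * starForm w v - x * starForm w a := by
      conv_lhs => rw [show w = q • v - x • a from rfl]
      rw [starForm_sub_right, starForm_smul_right, starForm_smul_right]
    rw [e1, starForm_comm w a, h1, starForm_comm w v]
    simp only [w]
    rw [starForm_sub_right, starForm_smul_right, starForm_smul_right, starForm_comm v a, ← hx]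
    ring
  have h3 : starForm w w ≤ 0 := by
    by_cases hw : w.2 = 0
    · have hw1 : w.1 = 0 := by
        obtain ⟨j⟩ := ‹Nonempty J›
        have : w.1 = ∑ i, w.2 j i := by
          simp only [w, Prod.fst_sub, Prod.smul_fst, Prod.snd_sub, Prod.smul_snd, Pi.sub_apply,
            Pi.smul_apply, Finset.sum_sub_distrib, ← Finset.smul_sum, hv, hav]
        rw [this, hw]; simp
      simp [starForm, hw, hw1]
    · exact (starForm_self_neg ha h1 hw).le
  rw [h2] at h3
  nlinarith

/-- Admissible dimension vectors: nonnegative, with arms adding up to the central dimension. -/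
def IsDimVec (v : StarVec J T) : Prop := (∀ j i, 0 ≤ v.2 j i) ∧ ∀ j, ∑ i, v.2 j i = v.1

lemma starForm_self_of_le_one {v : StarVec J T} (hv : IsDimVec v) (h : v.1 ≤ 1) [Nonempty J] :
    starForm v v = - v.1 := by
  have hle : ∀ j i, v.2 j i ≤ v.1 := fun j i => by
    rw [← hv.2 j]
    exact Finset.single_le_sum (f := fun i => v.2 j i) (fun i _ => hv.1 j i) (Finset.mem_univ i)
  have h0 : 0 ≤ v.1 := by
    obtain ⟨j⟩ := ‹Nonempty J›
    rw [← hv.2 j]; exact Finset.sum_nonneg fun i _ => hv.1 j i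
  have h1 : ∀ j i, v.2 j i * v.2 j i = v.2 j i := fun j i => by
    have := hv.1 j i
    have := hle j i
    have h3 : v.2 j i = 0 ∨ v.2 j i = 1 := by omega
    rcases h3 with h3 | h3 <;> rw [h3] <;> rfl
  have h2 : v.1 * v.1 = v.1 := by
    have h3 : v.1 = 0 ∨ v.1 = 1 := by omega
    rcases h3 with h3 | h3 <;> rw [h3] <;> rfl
  simp only [starForm, h1, h2, hv.2, Finset.sum_const, Finset.card_univ, nsmul_eq_mul]
  ring

lemma starForm_self_modEq {v : StarVec J T} (hv : IsDimVec v) : Even (starForm v v + v.1) := by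
  have h : starForm v v + v.1 = ((Fintype.card J : ℤ) - 1) * (v.1 * v.1 - v.1) -
      ∑ j, ∑ i, (v.2 j i * v.2 j i - v.2 j i) + 2 * 0 := by
    simp only [starForm, Finset.sum_sub_distrib, hv.2, Finset.sum_const, Finset.card_univ,
      nsmul_eq_mul]
    ring
  have he : ∀ a : ℤ, Even (a * a - a) := fun a => by
    have := Int.even_mul_pred_self a
    rwa [mul_sub, mul_one] at this
  rw [h]
  simp only [mul_zero, add_zero]
  refine Even.sub ((he _).mul_left _) ?_
  exact Finset.even_sum _ fun j _ => Finset.even_sum _ fun i _ => he _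

lemma two_le_starForm {u v : StarVec J T} [Nonempty J] (hu : IsDimVec u) (hv : IsDimVec v)
    (hu1 : 1 ≤ u.1) (hv1 : 1 ≤ v.1) (hXu : u.1 ≤ starForm (u + v) u)
    (hXv : v.1 ≤ starForm (u + v) v) : 2 ≤ starForm u v := by
  have e1 : starForm (u + v) u = starForm u u + starForm u v := by
    rw [starForm_comm, starForm_add_right]
  have e2 : starForm (u + v) v = starForm v v + starForm u v := by
    rw [starForm_comm, starForm_add_right, starForm_comm v u]; ring
  have e3 : starForm (u + v) (u + v) = starForm (u + v) u + starForm (u + v) v :=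
    starForm_add_right _ _ _
  rcases hu1.eq_or_lt with h | hu2
  · have := starForm_self_of_le_one hu (by omega); omega
  rcases hv1.eq_or_lt with h | hv2
  · have := starForm_self_of_le_one hv (by omega); omega
  have h1 := starForm_mul_le_sq (a := u + v) (by omega) u hu.2 (fun j => by
    simp [Finset.sum_add_distrib, hu.2, hv.2])
  rw [e3] at h1
  set X := starForm (u + v) u
  set Y := starForm (u + v) v
  set m := starForm u v
  have e4 : starForm u u = X - m := by omega
  rw [e4] at h1
  by_contra hm
  have h2 : X * Y ≤ m * (X + Y) := by nlinarith
  have h3 : m * (X + Y) ≤ 1 * (X + Y) := mul_le_mul_of_nonneg_right (by omega) (by omega)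
  have h4 : (X - 1) * (Y - 1) ≤ 1 := by nlinarith
  have hX : X = 2 := by nlinarith
  have hY : Y = 2 := by nlinarith
  rw [hX, hY] at h2
  have hm1 : m = 1 := by omega
  have hpar := starForm_self_modEq hu
  rw [e4, hX, hm1, show u.1 = 2 by omega] at hpar
  exact absurd hpar (by decide)

/-- The sum of the values of the form on a nontrivial decomposition is smaller than the value on
the sum. -/
lemma sum_starForm_lt [Nonempty J] {S : Type*} (s : Finset S) {κ : S → StarVec J T}
    {α : StarVec J T} (hκ : ∀ a ∈ s, IsDimVec (κ a)) (hsum : ∑ a ∈ s, κ a = α)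
    (hlt : ∀ a ∈ s, (κ a).1 < α.1) (hα : 1 ≤ α.1)
    (hpos : 2 ≤ α.1 → ∀ v, IsDimVec v → 0 ≤ starForm α v) (hq : α.1 - 2 ≤ starForm α α) :
    ∑ a ∈ s, starForm (κ a) (κ a) < starForm α α := by
  have hn : ∑ a ∈ s, (κ a).1 = α.1 := by rw [← hsum, Prod.fst_sum]
  have hαv : ∀ j, ∑ i, α.2 j i = α.1 := fun j => by
    rw [← hsum, Prod.fst_sum, Prod.snd_sum]
    simp only [Finset.sum_apply]
    rw [Finset.sum_comm]
    exact Finset.sum_congr rfl fun a ha => (hκ a ha).2 j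
  have h0 : ∀ a ∈ s, 0 ≤ (κ a).1 := fun a ha => by
    obtain ⟨j⟩ := ‹Nonempty J›
    rw [← (hκ a ha).2 j]; exact Finset.sum_nonneg fun i _ => (hκ a ha).1 j i
  have hex : ∃ a ∈ s, 0 < (κ a).1 := by
    by_contra! h
    have := Finset.sum_nonpos h
    omega
  obtain ⟨b, hb, hb0⟩ := hex
  have h2 : 2 ≤ α.1 := by have := hlt b hb; omega
  have hx : ∑ a ∈ s, starForm α (κ a) = starForm α α := by
    rw [← starForm_sum_right, hsum]
  have hx0 : ∀ a ∈ s, 0 ≤ starForm α (κ a) := fun a ha => hpos h2 _ (hκ a ha)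
  by_cases hq0 : 0 < starForm α α
  · have hxq : ∀ a ∈ s, starForm α (κ a) ≤ starForm α α := fun a ha => by
      rw [← hx]; exact Finset.single_le_sum (f := fun a => starForm α (κ a)) hx0 ha
    have hL : ∀ a ∈ s, starForm α α * starForm (κ a) (κ a) ≤ starForm α (κ a) ^ 2 :=
      fun a ha => starForm_mul_le_sq hq0 _ (hκ a ha).2 hαv
    have hle : ∀ a ∈ s, starForm (κ a) (κ a) ≤ starForm α (κ a) := fun a ha => by
      have e1 := hL a ha
      have e2 : starForm α (κ a) ^ 2 ≤ starForm α α * starForm α (κ a) := by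
        rw [sq]; exact mul_le_mul_of_nonneg_right (hxq a ha) (hx0 a ha)
      exact le_of_mul_le_mul_left (e1.trans e2) hq0
    obtain ⟨d, hd, hd0⟩ : ∃ a ∈ s, 0 < starForm α (κ a) := by
      by_contra! h
      have := Finset.sum_nonpos h
      omega
    refine (Finset.sum_lt_sum hle ⟨d, hd, ?_⟩).trans_eq hx
    refine lt_of_le_of_ne (hle d hd) fun heq => ?_
    have e1 := hL d hd
    rw [heq, sq] at e1
    have e2 : starForm α α ≤ starForm α (κ d) := le_of_mul_le_mul_right e1 hd0
    have e3 : starForm α (κ d) = starForm α α := le_antisymm (hxq d hd) e2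
    let w := κ d - α
    have e4 : starForm α w = 0 := by rw [starForm_sub_right, e3, sub_self]
    have e5 : starForm w w = 0 := by
      rw [starForm_sub_right, starForm_comm w α, e4, sub_zero, starForm_comm w, starForm_sub_right,
        starForm_comm _ α, heq, sub_self]
    by_cases hw : w.2 = 0
    · obtain ⟨j⟩ := ‹Nonempty J›
      have e6 : (κ d).2 j = α.2 j := by
        have := congrFun hw j
        exact sub_eq_zero.1 this
      have e7 := (hκ d hd).2 j
      rw [e6, hαv j] at e7
      have := hlt d hd
      omega
    · have := starForm_self_neg hq0 e4 hw
      omega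
  · have hα2 : α.1 = 2 := by omega
    have e1 : ∀ a ∈ s, starForm (κ a) (κ a) = - (κ a).1 := fun a ha =>
      starForm_self_of_le_one (hκ a ha) (by have := hlt a ha; omega)
    rw [Finset.sum_congr rfl e1, Finset.sum_neg_distrib, hn]
    omega

/-- Positivity of the form from the absence of common eigenvectors. -/
lemma starForm_nonneg [Nonempty T] {α v : StarVec J T}
    (hα : ∀ i : J → T, ∑ j, α.2 j (i j) ≤ ((Fintype.card J : ℤ) - 1) * α.1) (hv : IsDimVec v)
    [Nonempty J] : 0 ≤ starForm α v := by
  have hmax : ∀ j, ∃ i, ∀ i', α.2 j i' ≤ α.2 j i := fun j => by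
    obtain ⟨i, -, hi⟩ := Finset.exists_max_image (Finset.univ : Finset T) (α.2 j)
      Finset.univ_nonempty
    exact ⟨i, fun i' => hi i' (Finset.mem_univ _)⟩
  choose i hi using hmax
  have h0 : 0 ≤ v.1 := by
    obtain ⟨j⟩ := ‹Nonempty J›
    rw [← hv.2 j]; exact Finset.sum_nonneg fun i _ => hv.1 j i
  have h1 : ∑ j, ∑ i, α.2 j i * v.2 j i ≤ ∑ j, α.2 j (i j) * v.1 := by
    refine Finset.sum_le_sum fun j _ => ?_
    rw [← hv.2 j, Finset.mul_sum]
    exact Finset.sum_le_sum fun i' _ => mul_le_mul_of_nonneg_right (hi j i') (hv.1 j i')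
  rw [← Finset.sum_mul] at h1
  have h2 := mul_le_mul_of_nonneg_right (hα i) h0
  rw [starForm]
  linarith [mul_assoc ((Fintype.card J : ℤ) - 1) α.1 v.1]

end StarForm

section TraceDimension

lemma finrank_eq_trace_of_proj {V : Type} [AddCommGroup V] [Module ℂ V] [FiniteDimensional ℂ V]
    (W : Submodule ℂ V) (Φ : V →ₗ[ℂ] V) (h1 : ∀ x, Φ x ∈ W) (h2 : ∀ x ∈ W, Φ x = x) :
    ((Module.finrank ℂ W : ℕ) : ℂ) = LinearMap.trace ℂ V Φ :=
  (LinearMap.IsProj.trace (p := W) ⟨h1, h2⟩).symm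

lemma trace_matrix_endo {N : Type} [Fintype N] [DecidableEq N]
    (Φ : Matrix N N ℂ →ₗ[ℂ] Matrix N N ℂ) :
    LinearMap.trace ℂ _ Φ = ∑ k, ∑ l, Φ (Matrix.single k l 1) k l := by
  rw [LinearMap.trace_eq_matrix_trace ℂ (Matrix.stdBasis ℂ N N), Matrix.trace,
    Fintype.sum_prod_type]
  refine Finset.sum_congr rfl fun k _ => Finset.sum_congr rfl fun l _ => ?_
  rw [Matrix.diag_apply, LinearMap.toMatrix_apply, Matrix.stdBasis_eq_single]
  simp [Matrix.stdBasis, Matrix.ofLinearEquiv]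

variable {N I : Type} [Fintype N] [DecidableEq N] (vt : N → I)

open Classical in
/-- The diagonal indicator of the entries over a vertex. -/
def vertPr (v : I) : Matrix N N ℂ := Matrix.diagonal fun k => if vt k = v then 1 else 0

/-- The rank of the block over a vertex. -/
def vdim (e : Matrix N N ℂ) (v : I) : ℕ := (vertPr vt v * e).rank

variable {vt}

lemma vertPr_mul_self (v : I) : vertPr vt v * vertPr vt v = vertPr vt v := by
  rw [vertPr, Matrix.diagonal_mul_diagonal]
  congr 1; ext k; split_ifs <;> simp

lemma vertPr_comm {e : Matrix N N ℂ} (he : e ∈ diagSub vt) (v : I) :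
    vertPr vt v * e = e * vertPr vt v := by
  ext k l
  rw [vertPr, Matrix.diagonal_mul, Matrix.mul_diagonal]
  by_cases h : vt k = vt l
  · rw [h, mul_comm]
  · rw [he k l h]; simp

lemma rank_eq_trace_of_idem {e : Matrix N N ℂ} (he : e * e = e) : (e.rank : ℂ) = e.trace := by
  have h := finrank_eq_trace_of_proj (LinearMap.range (Matrix.toLin' e)) (Matrix.toLin' e)
    (fun x => ⟨x, rfl⟩) (by
      rintro _ ⟨x, rfl⟩
      rw [← LinearMap.comp_apply, ← Matrix.toLin'_mul, he])
  rw [Matrix.trace_toLin'_eq] at h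
  rw [← h]; rfl

open Classical in
lemma vdim_eq_sum {e : Matrix N N ℂ} (hd : e ∈ diagSub vt) (he : e * e = e) (v : I) :
    (vdim vt e v : ℂ) = ∑ k, if vt k = v then e k k else 0 := by
  rw [vdim, rank_eq_trace_of_idem, Matrix.trace]
  · refine Finset.sum_congr rfl fun k _ => ?_
    rw [Matrix.diag_apply, vertPr, Matrix.diagonal_mul]
    split_ifs <;> simp
  · rw [Matrix.mul_assoc, ← Matrix.mul_assoc e, ← vertPr_comm hd, Matrix.mul_assoc, he,
      ← Matrix.mul_assoc, vertPr_mul_self]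

lemma sum_mask [Fintype I] (S : I → I → Prop) [DecidableRel S] [DecidableEq I] (f g : N → ℂ) :
    (∑ k, ∑ l, if S (vt k) (vt l) then f k * g l else 0) =
      ∑ v, ∑ w, if S v w then (∑ k, if vt k = v then f k else 0) *
        (∑ l, if vt l = w then g l else 0) else 0 := by
  have h : ∀ k l, (if S (vt k) (vt l) then f k * g l else 0) =
      ∑ v, ∑ w, if S v w then (if vt k = v then f k else 0) * (if vt l = w then g l else 0)
        else 0 := by
    intro k l
    rw [Finset.sum_eq_single (vt k), Finset.sum_eq_single (vt l)]
    · simp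
    · intro w _ hw; simp [hw.symm]
    · simp
    · intro v _ hv; simp [hv.symm]
    · simp
  simp_rw [h]
  have h2 : ∀ v w, (if S v w then (∑ k, if vt k = v then f k else 0) *
        (∑ l, if vt l = w then g l else 0) else 0) =
      ∑ k, ∑ l, if S v w then (if vt k = v then f k else 0) * (if vt l = w then g l else 0)
        else 0 := by
    intro v w
    split_ifs with hs
    · rw [Finset.sum_mul_sum]
    · simp
  simp_rw [h2]
  calc _ = ∑ k, ∑ v, ∑ l, ∑ w, _ := Finset.sum_congr rfl fun k _ => Finset.sum_comm
    _ = ∑ v, ∑ k, ∑ l, ∑ w, _ := Finset.sum_comm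
    _ = ∑ v, ∑ k, ∑ w, ∑ l, _ := Finset.sum_congr rfl fun v _ =>
        Finset.sum_congr rfl fun k _ => Finset.sum_comm
    _ = _ := Finset.sum_congr rfl fun v _ => Finset.sum_comm

open Classical in
lemma finrank_corner [Fintype I] (S : I → I → Prop) {e f : Matrix N N ℂ}
    (hd : e ∈ diagSub vt) (he : e * e = e) (hd' : f ∈ diagSub vt) (hf : f * f = f) :
    Module.finrank ℂ (corner (maskSub vt S) e f) =
      ∑ v, ∑ w, if S v w then vdim vt e v * vdim vt f w else 0 := by
  have h := finrank_eq_trace_of_proj (corner (maskSub vt S) e f)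
    (LinearMap.mulLeft ℂ e ∘ₗ LinearMap.mulRight ℂ f ∘ₗ maskPr vt S)
    (fun M => mem_corner.2 ⟨maskPr vt S M, maskPr_mem _, rfl⟩) (by
      intro M hM
      obtain ⟨B, hB, rfl⟩ := mem_corner.1 hM
      have h1 : maskPr vt S (e * (B * f)) = e * (B * f) :=
        maskPr_of_mem (diag_mul_mem hd (mul_diag_mem hd' hB))
      simp only [LinearMap.comp_apply, LinearMap.mulLeft_apply, LinearMap.mulRight_apply]
      rw [h1, Matrix.mul_assoc e, Matrix.mul_assoc B, hf, ← Matrix.mul_assoc e e, he])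
  rw [trace_matrix_endo] at h
  have h2 : ∀ k l, (LinearMap.mulLeft ℂ e ∘ₗ LinearMap.mulRight ℂ f ∘ₗ maskPr vt S)
      (Matrix.single k l 1) k l = if S (vt k) (vt l) then e k k * f l l else 0 := by
    intro k l
    simp only [LinearMap.comp_apply, LinearMap.mulLeft_apply, LinearMap.mulRight_apply]
    have : maskPr vt S (Matrix.single k l 1) =
        if S (vt k) (vt l) then Matrix.single k l 1 else 0 := by
      ext a b
      rw [maskPr_apply]
      by_cases hab : a = k ∧ b = l
      · rw [hab.1, hab.2]; split_ifs <;> simp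
      · have : Matrix.single k l (1 : ℂ) a b = 0 :=
          Matrix.single_apply_of_ne _ _ _ _ _ fun h => hab ⟨h.1.symm, h.2.symm⟩
        split_ifs <;> simp [this]
    rw [this]
    split_ifs
    · simp [Matrix.mul_apply, Matrix.single_apply, ite_and, Finset.sum_ite_eq]
    · simp
  simp_rw [h2] at h
  rw [sum_mask S (fun k => e k k) fun l => f l l] at h
  simp_rw [← vdim_eq_sum hd he, ← vdim_eq_sum hd' hf] at h
  exact_mod_cast h

lemma vdim_add_of_sum {ι : Type} (s : Finset ι) {e : ι → Matrix N N ℂ} {f : Matrix N N ℂ}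
    (hd : ∀ a ∈ s, e a ∈ diagSub vt) (he : ∀ a ∈ s, e a * e a = e a) (hd' : f ∈ diagSub vt)
    (hf : f * f = f) (hsum : ∑ a ∈ s, e a = f) (v : I) :
    ∑ a ∈ s, vdim vt (e a) v = vdim vt f v := by
  classical
  have h : (∑ a ∈ s, (vdim vt (e a) v : ℂ)) = vdim vt f v := by
    rw [vdim_eq_sum hd' hf, ← hsum, Finset.sum_congr rfl fun a ha => vdim_eq_sum (hd a ha) (he a ha) v,
      Finset.sum_comm]
    refine Finset.sum_congr rfl fun k _ => ?_
    split_ifs <;> simp [Matrix.sum_apply]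
  exact_mod_cast h

lemma vdim_one_sub {e : Matrix N N ℂ} (hd : e ∈ diagSub vt) (he : e * e = e) (v : I) :
    vdim vt e v + vdim vt (1 - e) v = vdim vt 1 v := by
  classical
  have h : (vdim vt e v : ℂ) + vdim vt (1 - e) v = vdim vt (1 : Matrix N N ℂ) v := by
    rw [vdim_eq_sum hd he, vdim_eq_sum one_mem_diagSub (one_mul 1),
      vdim_eq_sum (Submodule.sub_mem _ one_mem_diagSub hd)
        (by simp [Matrix.mul_sub, Matrix.sub_mul, he]), ← Finset.sum_add_distrib]
    refine Finset.sum_congr rfl fun k _ => ?_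
    split_ifs <;> simp
  exact_mod_cast h

lemma corner_eq_self (S : I → I → Prop) : corner (maskSub vt S) 1 1 = maskSub vt S := by
  ext A; rw [mem_corner]; simp

lemma finrank_commIn_famGen {k : ℕ} {e : Fin k → Matrix N N ℂ} (he : IsIdemFam vt e)
    (S : I → I → Prop) : Module.finrank ℂ (commIn (maskSub vt S) (famGen e)) =
      ∑ a, Module.finrank ℂ (corner (maskSub vt S) (e a) (e a)) := by
  have hid : ∀ a, e a * e a = e a := fun a => by rw [he.mul, if_pos rfl]
  let Ψ : Fin k → Matrix N N ℂ →ₗ[ℂ] Matrix N N ℂ := fun a =>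
    LinearMap.mulLeft ℂ (e a) ∘ₗ LinearMap.mulRight ℂ (e a) ∘ₗ maskPr vt S
  have hΨ : ∀ M, (∑ a, Ψ a) M = peircePr e (maskPr vt S M) := by
    intro M
    simp [Ψ, peircePr, Matrix.mul_assoc, LinearMap.sum_apply]
  have h := finrank_eq_trace_of_proj (commIn (maskSub vt S) (famGen e)) (∑ a, Ψ a)
    (fun M => by
      rw [hΨ]; exact mem_commIn.2 ⟨he.peirce_mem (maskPr_mem _), he.peirce_commute _⟩)
    (fun M hM => by
      rw [mem_commIn] at hM
      rw [hΨ, maskPr_of_mem hM.1, he.peirce_eq hM.2])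
  rw [map_sum] at h
  have h2 : ∀ a, ((Module.finrank ℂ (corner (maskSub vt S) (e a) (e a)) : ℕ) : ℂ) =
      LinearMap.trace ℂ _ (Ψ a) := by
    intro a
    refine finrank_eq_trace_of_proj _ _
      (fun M => mem_corner.2 ⟨maskPr vt S M, maskPr_mem _, rfl⟩) ?_
    intro M hM
    obtain ⟨B, hB, rfl⟩ := mem_corner.1 hM
    have h1 : maskPr vt S (e a * (B * e a)) = e a * (B * e a) :=
      maskPr_of_mem (diag_mul_mem (he.mem a) (mul_diag_mem (he.mem a) hB))
    simp only [Ψ, LinearMap.comp_apply, LinearMap.mulLeft_apply, LinearMap.mulRight_apply]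
    rw [h1, Matrix.mul_assoc (e a), Matrix.mul_assoc B, hid, ← Matrix.mul_assoc (e a) (e a), hid]
  simp_rw [← h2] at h
  exact_mod_cast h

end TraceDimension

section StarShape

variable {q p n : ℕ}

/-- The parent of a vertex on an arm of a star. -/
def starPar : Fin q × Fin n → Option (Fin q × Fin n)
  | (_, ⟨0, _⟩) => none
  | (j, ⟨i + 1, h⟩) => some (j, ⟨i, Nat.lt_of_succ_lt h⟩)

/-- The relation "parent of". -/
def starRel (v w : Option (Fin q × Fin n)) : Prop := ∃ a, w = some a ∧ v = starPar a

/-- The values of a function along an arm. -/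
def armVal (b : Option (Fin q × Fin n) → ℤ) (j : Fin q) : ℕ → ℤ
  | 0 => b none
  | i + 1 => if h : i < n then b (some (j, ⟨i, h⟩)) else 0

lemma armVal_par (b : Option (Fin q × Fin n) → ℤ) (j : Fin q) (i : Fin n) :
    b (starPar (j, i)) = armVal b j i := by
  obtain ⟨_ | i, hi⟩ := i
  · rfl
  · simp [starPar, armVal, Nat.lt_of_succ_lt hi]

lemma armVal_some (b : Option (Fin q × Fin n) → ℤ) (j : Fin q) (i : Fin n) :
    b (some (j, i)) = armVal b j (i + 1) := by
  simp [armVal]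

/-- The drops along the arms. -/
def starDrop (b : Option (Fin q × Fin n) → ℤ) (j : Fin q) (i : Fin n) : ℤ :=
  b (starPar (j, i)) - b (some (j, i))

/-- The function vanishes at the ends of the arms. -/
def EndsZero (b : Option (Fin q × Fin n) → ℤ) : Prop :=
  ∀ j (i : Fin n), (i : ℕ) + 1 = n → b (some (j, i)) = 0

lemma EndsZero.armVal_eq {b : Option (Fin q × Fin n) → ℤ} (hb : EndsZero b) (hn : 1 ≤ n)
    (j : Fin q) : armVal b j n = 0 := by
  obtain ⟨m, rfl⟩ : ∃ m, n = m + 1 := ⟨n - 1, by omega⟩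
  exact (armVal_some b j ⟨m, by omega⟩).symm.trans (hb _ _ rfl)

lemma sum_starDrop {b : Option (Fin q × Fin n) → ℤ} (hb : EndsZero b) (hn : 1 ≤ n) (j : Fin q) :
    ∑ i, starDrop b j i = b none := by
  simp only [starDrop, armVal_par, armVal_some]
  rw [Fin.sum_univ_eq_sum_range (fun i => armVal b j i - armVal b j (i + 1)) n,
    Finset.sum_range_sub', hb.armVal_eq hn]
  simp [armVal]

open Classical in
lemma sum_starRel (f : Option (Fin q × Fin n) → Option (Fin q × Fin n) → ℤ) :
    (∑ v, ∑ w, if starRel v w then f v w else 0) =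
      ∑ j, ∑ i, f (starPar (j, i)) (some (j, i)) := by
  rw [Finset.sum_comm, Fintype.sum_option,
    ← Fintype.sum_prod_type' fun j i => f (starPar (j, i)) (some (j, i))]
  have h0 : (∑ v, if starRel v (none : Option (Fin q × Fin n)) then f v none else 0) = 0 :=
    Finset.sum_eq_zero fun v _ => if_neg (by rintro ⟨a, h, _⟩; cases h)
  rw [h0, zero_add]
  refine Finset.sum_congr rfl fun a _ => ?_
  rw [Finset.sum_eq_single (starPar a)]
  · rw [if_pos ⟨a, rfl, rfl⟩]
  · intro v _ hv
    refine if_neg ?_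
    rintro ⟨a', h1, h2⟩
    cases h1
    exact hv h2
  · simp

lemma sum_mul_star {b c : Option (Fin q × Fin n) → ℤ} (hb : EndsZero b) (hn : 1 ≤ n) :
    2 * (∑ v, b v * c v) - ∑ j : Fin q, ∑ i : Fin n,
        (b (starPar (j, i)) * c (some (j, i)) + c (starPar (j, i)) * b (some (j, i))) =
      (∑ j : Fin q, ∑ i, starDrop b j i * starDrop c j i) - ((q : ℤ) - 2) * (b none * c none) := by
  have h1 : ∀ j : Fin q, (∑ i : Fin n, b (starPar (j, i)) * c (starPar (j, i))) =
      b none * c none + ∑ i : Fin n, b (some (j, i)) * c (some (j, i)) := by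
    intro j
    simp only [armVal_par, armVal_some]
    have := Finset.sum_range_sub' (fun i => armVal b j i * armVal c j i) n
    rw [hb.armVal_eq hn, Finset.sum_sub_distrib] at this
    rw [Fin.sum_univ_eq_sum_range (fun i => armVal b j i * armVal c j i) n,
      Fin.sum_univ_eq_sum_range (fun i => armVal b j (i + 1) * armVal c j (i + 1)) n]
    have h0 : armVal b j 0 * armVal c j 0 = b none * c none := rfl
    rw [h0] at this
    linarith
  have h2 : (∑ j : Fin q, ∑ i : Fin n, b (starPar (j, i)) * c (starPar (j, i))) =
      (q : ℤ) * (b none * c none) + ∑ j : Fin q, ∑ i : Fin n, b (some (j, i)) * c (some (j, i)) := by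
    rw [Finset.sum_congr rfl fun j _ => h1 j, Finset.sum_add_distrib]
    simp
  have h3 : (∑ v, b v * c v) = b none * c none +
      ∑ j : Fin q, ∑ i : Fin n, b (some (j, i)) * c (some (j, i)) := by
    rw [Fintype.sum_option, Fintype.sum_prod_type]
  have h4 : (∑ j : Fin q, ∑ i, starDrop b j i * starDrop c j i) =
      (∑ j : Fin q, ∑ i : Fin n, b (starPar (j, i)) * c (starPar (j, i))) +
      (∑ j : Fin q, ∑ i : Fin n, b (some (j, i)) * c (some (j, i))) -
      ∑ j : Fin q, ∑ i : Fin n,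
        (b (starPar (j, i)) * c (some (j, i)) + c (starPar (j, i)) * b (some (j, i))) := by
    simp only [← Finset.sum_add_distrib, ← Finset.sum_sub_distrib]
    refine Finset.sum_congr rfl fun j _ => Finset.sum_congr rfl fun i _ => ?_
    simp only [starDrop]; ring
  rw [h4, h3, h2]; ring

/-- The centre value and the drops along all arms but the last. -/
def toStar (b : Option (Fin (p + 1) × Fin n) → ℤ) : StarVec (Fin p) (Fin n) :=
  (b none, fun j i => starDrop b j.castSucc i)

lemma isDimVec_toStar {b : Option (Fin (p + 1) × Fin n) → ℤ} (hb : EndsZero b) (hn : 1 ≤ n)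
    (h : ∀ j i, 0 ≤ starDrop b j i) : IsDimVec (toStar b) :=
  ⟨fun _ i => h _ i, fun _ => sum_starDrop hb hn _⟩

open Classical in
lemma star_pairing {b c : Option (Fin (p + 1) × Fin n) → ℤ} (hb : EndsZero b) (hn : 1 ≤ n) :
    2 * (∑ v, b v * c v) - ((∑ v, ∑ w, if starRel v w then b v * c w else 0) +
      ∑ v, ∑ w, if starRel w v then b v * c w else 0) =
    (∑ i, starDrop b (Fin.last p) i * starDrop c (Fin.last p) i) -
      starForm (toStar b) (toStar c) := by
  rw [sum_starRel fun v w => b v * c w, Finset.sum_comm (f := fun v w => if starRel w v then _ else _),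
    sum_starRel fun w v => b v * c w]
  have h := sum_mul_star (c := c) hb hn
  simp only [Finset.sum_add_distrib] at h
  rw [Fin.sum_univ_castSucc (f := fun j => ∑ i, starDrop b j i * starDrop c j i)] at h
  simp only [starForm, toStar, Fintype.card_fin]
  have h5 : (∑ j : Fin (p + 1), ∑ i : Fin n, b (some (j, i)) * c (starPar (j, i))) =
      ∑ j : Fin (p + 1), ∑ i : Fin n, c (starPar (j, i)) * b (some (j, i)) :=
    Finset.sum_congr rfl fun j _ => Finset.sum_congr rfl fun i _ => mul_comm _ _
  rw [h5, h]
  push_cast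
  ring

end StarShape

section Blocks

variable {I : Type} [Fintype I] [DecidableEq I] {a : I → ℕ}

/-- The index type of matrices with blocks of sizes `a`. -/
abbrev BlkIdx (a : I → ℕ) : Type := Σ v : I, Fin (a v)

/-- The vertex below an index. -/
abbrev blkVert (a : I → ℕ) : BlkIdx a → I := Sigma.fst

/-- A block of a matrix. -/
def blk (M : Matrix (BlkIdx a) (BlkIdx a) ℂ) (v w : I) : Matrix (Fin (a v)) (Fin (a w)) ℂ :=
  Matrix.of fun k l => M ⟨v, k⟩ ⟨w, l⟩

lemma blk_apply (M : Matrix (BlkIdx a) (BlkIdx a) ℂ) (v w : I) (k : Fin (a v)) (l : Fin (a w)) :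
    blk M v w k l = M ⟨v, k⟩ ⟨w, l⟩ := rfl

lemma blk_ext {M M' : Matrix (BlkIdx a) (BlkIdx a) ℂ} (h : ∀ v w, blk M v w = blk M' v w) :
    M = M' := by
  ext ⟨v, k⟩ ⟨w, l⟩
  exact congrFun (congrFun (h v w) k) l

lemma blk_mul (M M' : Matrix (BlkIdx a) (BlkIdx a) ℂ) (v w : I) :
    blk (M * M') v w = ∑ u, blk M v u * blk M' u w := by
  ext k l
  rw [blk_apply, Matrix.mul_apply, Fintype.sum_sigma, Matrix.sum_apply]
  rfl

lemma blk_add (M M' : Matrix (BlkIdx a) (BlkIdx a) ℂ) (v w : I) :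
    blk (M + M') v w = blk M v w + blk M' v w := rfl

lemma blk_sub (M M' : Matrix (BlkIdx a) (BlkIdx a) ℂ) (v w : I) :
    blk (M - M') v w = blk M v w - blk M' v w := rfl

lemma blk_smul (c : ℂ) (M : Matrix (BlkIdx a) (BlkIdx a) ℂ) (v w : I) :
    blk (c • M) v w = c • blk M v w := rfl

lemma blk_zero (v w : I) : blk (0 : Matrix (BlkIdx a) (BlkIdx a) ℂ) v w = 0 := rfl

lemma blk_one (v : I) : blk (1 : Matrix (BlkIdx a) (BlkIdx a) ℂ) v v = 1 := by
  ext k l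
  simp [blk_apply, Matrix.one_apply]

lemma mem_maskSub_iff_blk {S : I → I → Prop} {M : Matrix (BlkIdx a) (BlkIdx a) ℂ} :
    M ∈ maskSub (blkVert a) S ↔ ∀ v w, ¬ S v w → blk M v w = 0 := by
  constructor
  · intro h v w hvw
    ext k l
    exact h _ _ hvw
  · rintro h ⟨v, k⟩ ⟨w, l⟩ hvw
    exact congrFun (congrFun (h v w hvw) k) l

lemma blk_diagPr (M : Matrix (BlkIdx a) (BlkIdx a) ℂ) (v : I) :
    blk (diagPr (blkVert a) M) v v = blk M v v := by
  ext k l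
  rw [blk_apply, maskPr_apply, if_pos rfl]; rfl

lemma blk_mul_diag {Z : Matrix (BlkIdx a) (BlkIdx a) ℂ} (hZ : Z ∈ diagSub (blkVert a))
    (M : Matrix (BlkIdx a) (BlkIdx a) ℂ) (v w : I) :
    blk (M * Z) v w = blk M v w * blk Z w w := by
  rw [blk_mul, Finset.sum_eq_single w]
  · intro u _ hu
    rw [mem_maskSub_iff_blk.1 hZ u w hu, Matrix.mul_zero]
  · simp

lemma blk_diag_mul {Z : Matrix (BlkIdx a) (BlkIdx a) ℂ} (hZ : Z ∈ diagSub (blkVert a))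
    (M : Matrix (BlkIdx a) (BlkIdx a) ℂ) (v w : I) :
    blk (Z * M) v w = blk Z v v * blk M v w := by
  rw [blk_mul, Finset.sum_eq_single v]
  · intro u _ hu
    rw [mem_maskSub_iff_blk.1 hZ v u hu.symm, Matrix.zero_mul]
  · simp

lemma blk_pow_diag {Z : Matrix (BlkIdx a) (BlkIdx a) ℂ} (hZ : Z ∈ diagSub (blkVert a)) (s : ℕ)
    (v : I) : blk (Z ^ s) v v = blk Z v v ^ s := by
  induction s with
  | zero => rw [pow_zero, pow_zero, blk_one]
  | succ s ih => rw [pow_succ, blk_mul_diag hZ, ih, pow_succ]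

lemma diag_ext {Z Z' : Matrix (BlkIdx a) (BlkIdx a) ℂ} (hZ : Z ∈ diagSub (blkVert a))
    (hZ' : Z' ∈ diagSub (blkVert a)) (h : ∀ v, blk Z v v = blk Z' v v) : Z = Z' := by
  refine blk_ext fun v w => ?_
  by_cases hvw : v = w
  · subst hvw; exact h v
  · rw [mem_maskSub_iff_blk.1 hZ v w hvw, mem_maskSub_iff_blk.1 hZ' v w hvw]

lemma mulVec_injective_mul {l m k : Type} [Fintype l] [Fintype m] {M : Matrix l m ℂ}
    (hM : Function.Injective M.mulVec) {A B : Matrix m k ℂ} (h : M * A = M * B) : A = B := by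
  ext i j
  have : M *ᵥ (fun i => A i j) = M *ᵥ (fun i => B i j) := by
    ext r
    exact congrFun (congrFun h r) j
  exact congrFun (hM this) i

lemma rank_mul_of_injective {l m k : Type} [Fintype l] [Fintype m] [Fintype k] {M : Matrix l m ℂ}
    (hM : Function.Injective M.mulVec) (A : Matrix m k ℂ) : (M * A).rank = A.rank := by
  rw [Matrix.rank, Matrix.mulVecLin_mul, LinearMap.range_comp, Matrix.rank]
  exact (Submodule.equivMapOfInjective M.mulVecLin hM _).finrank_eq.symm

lemma vdim_eq_rank_blk {e : Matrix (BlkIdx a) (BlkIdx a) ℂ} (hd : e ∈ diagSub (blkVert a))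
    (he : e * e = e) (v : I) : vdim (blkVert a) e v = (blk e v v).rank := by
  classical
  have h1 : blk e v v * blk e v v = blk e v v := by rw [← blk_mul_diag hd, he]
  have h : (vdim (blkVert a) e v : ℂ) = (blk e v v).rank := by
    rw [vdim_eq_sum hd he, rank_eq_trace_of_idem h1, Fintype.sum_sigma, Finset.sum_eq_single v]
    · simp [Matrix.trace, blk_apply]
    · intro w _ hw
      simp [hw]
    · simp
  exact_mod_cast h

lemma isOpen_injective_mulVec (l m : Type) [Fintype l] [Fintype m] :
    IsOpen {M : Matrix l m ℂ | Function.Injective M.mulVec} := by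
  have h2 : IsOpen {f : m → l → ℂ | LinearIndependent ℂ f} := isOpen_setOfPred_linearIndependent
  have hc : Continuous fun (M : Matrix l m ℂ) (j : m) (i : l) => M i j :=
    continuous_pi fun j => continuous_pi fun i => continuous_id.matrix_elem i j
  have h := h2.preimage hc
  convert h using 1
  ext M
  exact Matrix.mulVec_injective_iff

lemma continuous_blk (v w : I) :
    Continuous fun M : Matrix (BlkIdx a) (BlkIdx a) ℂ => blk M v w :=
  continuous_matrix fun _ _ => continuous_id.matrix_elem _ _

end Blocks

section StarBlocks

variable {q n : ℕ} {a : Option (Fin q × Fin n) → ℕ}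

/-- Matrices all of whose arrows towards the centre are injective. -/
def starInj (a : Option (Fin q × Fin n) → ℕ) : Set (Matrix (BlkIdx a) (BlkIdx a) ℂ) :=
  {x | ∀ α, Function.Injective (blk x (starPar α) (some α)).mulVec}

lemma isOpen_starInj : IsOpen (starInj a) := by
  have : starInj a = ⋂ α, (fun M => blk M (starPar α) (some α)) ⁻¹'
      {M | Function.Injective M.mulVec} := by
    ext x; simp [starInj]
  rw [this]
  exact isOpen_iInter_of_finite fun α => (isOpen_injective_mulVec _ _).preimage (continuous_blk _ _)

lemma starVert_induction {P : Option (Fin q × Fin n) → Prop} (h0 : P none)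
    (h : ∀ α, P (starPar α) → P (some α)) (v : Option (Fin q × Fin n)) : P v := by
  obtain _ | ⟨j, ⟨i, hi⟩⟩ := v
  · exact h0
  · induction i with
    | zero => exact h _ h0
    | succ i ih => exact h _ (ih _)

/-- An intertwiner into an injective representation is determined at the centre. -/
lemma eq_zero_of_root {x x' ψ : Matrix (BlkIdx a) (BlkIdx a) ℂ} (hψ : ψ ∈ diagSub (blkVert a))
    (hx' : x' ∈ starInj a) (h : ψ * x = x' * ψ) (h0 : blk ψ none none = 0) : ψ = 0 := by
  refine diag_ext hψ (Submodule.zero_mem _) fun v => ?_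
  induction v using starVert_induction with
  | h0 => exact h0
  | h α ih =>
    rw [blk_zero] at ih ⊢
    refine mulVec_injective_mul (hx' α) ?_
    rw [← blk_mul_diag hψ, ← h, blk_diag_mul hψ, ih, Matrix.zero_mul, Matrix.mul_zero]

lemma vdim_antitone {x e : Matrix (BlkIdx a) (BlkIdx a) ℂ} (hd : e ∈ diagSub (blkVert a))
    (he : e * e = e) (hx : x ∈ starInj a) (h : e * x = x * e) (α : Fin q × Fin n) :
    vdim (blkVert a) e (some α) ≤ vdim (blkVert a) e (starPar α) := by
  rw [vdim_eq_rank_blk hd he, vdim_eq_rank_blk hd he, ← rank_mul_of_injective (hx α),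
    ← blk_mul_diag hd, ← h, blk_diag_mul hd]
  exact Matrix.rank_mul_le_left _ _

end StarBlocks

section HomComplex

variable {N I : Type} [Fintype N] [DecidableEq N] {vt : N → I} {R : I → I → Prop}
  {Λ : Matrix N N ℂ}

/-- The first map of the complex computing homomorphisms. -/
def homPair (z z' : MatPair N) : Matrix N N ℂ →ₗ[ℂ] MatPair N where
  toFun φ := (z'.1 * φ - φ * z.1, z'.2 * φ - φ * z.2)
  map_add' := by
    intro a b
    simp only [Matrix.mul_add, Matrix.add_mul, Prod.mk_add_mk]
    congr 1 <;> abel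
  map_smul' := by
    intro c a
    simp only [Matrix.mul_smul, Matrix.smul_mul, smul_sub, RingHom.id_apply, Prod.smul_mk]

/-- The second map of the complex computing homomorphisms. -/
def homMoment (vt : N → I) (z z' : MatPair N) : MatPair N →ₗ[ℂ] Matrix N N ℂ where
  toFun u := diagPr vt (z'.1 * u.2 + u.1 * z.2 - z'.2 * u.1 - u.2 * z.1)
  map_add' := by
    intro a b
    rw [← map_add]
    congr 1
    simp only [Prod.fst_add, Prod.snd_add, Matrix.mul_add, Matrix.add_mul]
    abel
  map_smul' := by
    intro c a
    rw [← map_smul]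
    congr 1
    simp only [Prod.smul_fst, Prod.smul_snd, Matrix.mul_smul, Matrix.smul_mul, smul_sub, smul_add,
      RingHom.id_apply]

lemma homMoment_homPair {z z' : MatPair N} (hz : z ∈ momentSet vt R Λ)
    (hz' : z' ∈ momentSet vt R Λ) (hΛ : ∀ Z ∈ diagSub vt, Z * Λ = Λ * Z) {φ : Matrix N N ℂ}
    (hφ : φ ∈ diagSub vt) : homMoment vt z z' (homPair z z' φ) = 0 := by
  have h : homMoment vt z z' (homPair z z' φ) =
      diagPr vt (z'.1 * z'.2 - z'.2 * z'.1) * φ - φ * diagPr vt (z.1 * z.2 - z.2 * z.1) := by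
    rw [← maskPr_mul_diag hφ, ← maskPr_diag_mul hφ, ← map_sub]
    change diagPr vt _ = _
    congr 1
    simp only [homPair, LinearMap.coe_mk, AddHom.coe_mk]
    noncomm_ring
  rw [h, hz.2.2, hz'.2.2, hΛ _ hφ, sub_self]

lemma finrank_corner_flip {e f : Matrix N N ℂ} (S : I → I → Prop) [Fintype I] (hd : e ∈ diagSub vt)
    (he : e * e = e) (hd' : f ∈ diagSub vt) (hf : f * f = f) :
    Module.finrank ℂ (corner (maskSub vt S) e f) =
      Module.finrank ℂ (corner (maskSub vt fun v w => S w v) f e) := by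
  classical
  rw [finrank_corner S hd he hd' hf, finrank_corner _ hd' hf hd he, Finset.sum_comm]
  simp only [mul_comm]

lemma finrank_orthogonal_corner {e : Matrix N N ℂ} (hd : e ∈ diagSub vt) (he : e * e = e)
    (W : Submodule ℂ (Matrix N N ℂ)) (hW : W ≤ corner (diagSub vt) 1 e)
    (h : ∀ ψ ∈ diagSub vt, e * ψ = ψ → (∀ B ∈ W, (ψ * B).trace = 0) → ψ = 0) :
    Module.finrank ℂ W = Module.finrank ℂ (corner (diagSub vt) e 1) := by
  have := finrank_orthogonal_add (corner (diagSub vt) 1 e) (corner (diagSub vt) e 1)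
    (fun A => diagPr vt A * e) (fun A => e * diagPr vt A) (by
      intro A hA
      obtain ⟨B, hB, rfl⟩ := mem_corner.1 hA
      rw [Matrix.one_mul, maskPr_of_mem (mul_diag_mem hd hB), Matrix.mul_assoc, he])
    (fun A => mem_corner.2 ⟨diagPr vt A, maskPr_mem _, by rw [Matrix.mul_one]⟩) (by
      intro A B
      rw [Matrix.mul_assoc, Matrix.trace_mul_comm, Matrix.mul_assoc, trace_diagPr_mul,
        maskPr_mul_diag hd])
    W hW ⊥ (by
      intro A
      rw [Submodule.mem_bot]
      constructor
      · rintro rfl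
        exact ⟨Submodule.zero_mem _, by simp⟩
      · rintro ⟨hA, hA'⟩
        obtain ⟨B, hB, rfl⟩ := mem_corner.1 hA
        refine h _ (diag_mul_mem hd (mul_diag_mem one_mem_diagSub hB)) ?_ hA'
        rw [← Matrix.mul_assoc, he])
  rw [finrank_bot] at this
  omega

/-- The Euler form bound given by the vanishing of homomorphisms in both directions. -/
lemma two_mul_finrank_corner_le [Fintype I] {z z' : MatPair N} (hz : z ∈ momentSet vt R Λ)
    (hz' : z' ∈ momentSet vt R Λ) (hΛ : ∀ Z ∈ diagSub vt, Z * Λ = Λ * Z) {e : Matrix N N ℂ}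
    (hend : e ∈ endSub vt z) (he : e * e = e)
    (hφ : ∀ φ ∈ diagSub vt, φ * e = φ → z'.1 * φ = φ * z.1 → z'.2 * φ = φ * z.2 → φ = 0)
    (hψ : ∀ ψ ∈ diagSub vt, e * ψ = ψ → ψ * z'.1 = z.1 * ψ → ψ * z'.2 = z.2 * ψ → ψ = 0) :
    2 * Module.finrank ℂ (corner (diagSub vt) 1 e) ≤
      Module.finrank ℂ (corner (maskSub vt R) 1 e) +
        Module.finrank ℂ (corner (maskSub vt fun v w => R w v) 1 e) := by
  obtain ⟨hd, he1, he2⟩ := mem_endSub.1 hend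
  let U : Submodule ℂ (MatPair N) :=
    (corner (maskSub vt R) 1 e).prod (corner (maskSub vt fun v w => R w v) 1 e)
  have hmem : ∀ {S : I → I → Prop} {A : Matrix N N ℂ}, A ∈ maskSub vt S → A * e ∈
      corner (maskSub vt S) 1 e := fun {S A} h => mem_corner.2 ⟨A, h, Matrix.one_mul _⟩
  have hmem' : ∀ {S : I → I → Prop} {A : Matrix N N ℂ}, A ∈ corner (maskSub vt S) 1 e →
      A ∈ maskSub vt S ∧ A * e = A := by
    intro S A h
    obtain ⟨B, hB, rfl⟩ := mem_corner.1 h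
    rw [Matrix.one_mul]
    exact ⟨mul_diag_mem hd hB, by rw [Matrix.mul_assoc, he]⟩
  have hP : (corner (diagSub vt) 1 e).map (homPair z z') ≤ U ⊓ LinearMap.ker (homMoment vt z z') := by
    rintro _ ⟨φ, hφ, rfl⟩
    obtain ⟨h1, h2⟩ := hmem' hφ
    refine ⟨⟨?_, ?_⟩, LinearMap.mem_ker.2 (homMoment_homPair hz hz' hΛ h1)⟩
    · have : (homPair z z' φ).1 = (z'.1 * φ - φ * z.1) * e := by
        rw [Matrix.sub_mul, Matrix.mul_assoc, h2, Matrix.mul_assoc, ← he1, ← Matrix.mul_assoc, h2]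
        rfl
      rw [SetLike.mem_coe, this]
      exact hmem (Submodule.sub_mem _ (mul_diag_mem h1 hz'.1) (diag_mul_mem h1 hz.1))
    · have : (homPair z z' φ).2 = (z'.2 * φ - φ * z.2) * e := by
        rw [Matrix.sub_mul, Matrix.mul_assoc, h2, Matrix.mul_assoc, ← he2, ← Matrix.mul_assoc, h2]
        rfl
      rw [SetLike.mem_coe, this]
      exact hmem (Submodule.sub_mem _ (mul_diag_mem h1 hz'.2.1) (diag_mul_mem h1 hz.2.1))
  have hW : U.map (homMoment vt z z') ≤ corner (diagSub vt) 1 e := by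
    rintro _ ⟨⟨A, B⟩, ⟨hA, hB⟩, rfl⟩
    obtain ⟨hA1, hA2⟩ := hmem' hA
    obtain ⟨hB1, hB2⟩ := hmem' hB
    refine mem_corner.2 ⟨homMoment vt z z' (A, B), maskPr_mem _, ?_⟩
    rw [Matrix.one_mul]
    change diagPr vt (z'.1 * B + A * z.2 - z'.2 * A - B * z.1) * e = diagPr vt _
    rw [← maskPr_mul_diag hd]
    congr 1
    simp only at hA2 hB2
    simp only [Matrix.sub_mul, Matrix.add_mul, Matrix.mul_assoc, ← he1, ← he2, hA2, hB2]
    simp only [← Matrix.mul_assoc, hA2, hB2]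
  have h1 := finrank_map_add (homMoment vt z z') U
  have h2 := Submodule.finrank_mono hP
  have h3 : Module.finrank ℂ U = Module.finrank ℂ (corner (maskSub vt R) 1 e) +
      Module.finrank ℂ (corner (maskSub vt fun v w => R w v) 1 e) :=
    finrank_submodule_prod _ _
  have h4 := finrank_map_add (homPair z z') (corner (diagSub vt) 1 e)
  have h5 : corner (diagSub vt) 1 e ⊓ LinearMap.ker (homPair z z') = ⊥ := by
    rw [Submodule.eq_bot_iff]
    rintro φ ⟨h, hk⟩
    obtain ⟨h1, h2⟩ := hmem' h
    have hk' : (z'.1 * φ - φ * z.1, z'.2 * φ - φ * z.2) = (0 : MatPair N) := hk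
    rw [Prod.mk_eq_zero, sub_eq_zero, sub_eq_zero] at hk'
    exact hφ φ h1 h2 hk'.1 hk'.2
  rw [h5, finrank_bot] at h4
  have h6 := finrank_orthogonal_corner hd he _ hW (by
    intro ψ h1 h2 h3
    have h3' : ∀ A ∈ corner (maskSub vt R) 1 e, ∀ B ∈ corner (maskSub vt fun v w => R w v) 1 e,
        (ψ * (z'.1 * B + A * z.2 - z'.2 * A - B * z.1)).trace = 0 := by
      intro A hA B hB
      have := h3 (homMoment vt z z' (A, B)) ⟨(A, B), ⟨hA, hB⟩, rfl⟩
      change (ψ * diagPr vt _).trace = 0 at this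
      rwa [← trace_diagPr_mul, maskPr_of_mem h1] at this
    have hm2 : ψ * z'.2 - z.2 * ψ ∈ maskSub vt fun v w => R w v :=
      Submodule.sub_mem _ (diag_mul_mem h1 hz'.2.1) (mul_diag_mem h1 hz.2.1)
    have hm1 : ψ * z'.1 - z.1 * ψ ∈ maskSub vt R :=
      Submodule.sub_mem _ (diag_mul_mem h1 hz'.1) (mul_diag_mem h1 hz.1)
    have e1 : e * (ψ * z'.1 - z.1 * ψ) = ψ * z'.1 - z.1 * ψ := by
      rw [Matrix.mul_sub, ← Matrix.mul_assoc, h2, ← Matrix.mul_assoc, he1, Matrix.mul_assoc, h2]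
    have e2 : e * (ψ * z'.2 - z.2 * ψ) = ψ * z'.2 - z.2 * ψ := by
      rw [Matrix.mul_sub, ← Matrix.mul_assoc, h2, ← Matrix.mul_assoc, he2, Matrix.mul_assoc, h2]
    refine hψ ψ h1 h2 (sub_eq_zero.1 ?_) (sub_eq_zero.1 ?_)
    · refine eq_zero_of_pairing hm1 fun B hB => ?_
      have := h3' 0 (Submodule.zero_mem _) (B * e) (hmem hB)
      rw [← e1, Matrix.mul_assoc, Matrix.trace_mul_comm, Matrix.mul_assoc, Matrix.sub_mul,
        Matrix.trace_sub, Matrix.mul_assoc z.1, Matrix.trace_mul_comm z.1, sub_eq_zero]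
      simpa [Matrix.mul_sub, Matrix.trace_sub, sub_eq_zero, Matrix.mul_assoc] using this
    · refine eq_zero_of_pairing (S := fun v w => R w v) hm2 fun A hA => ?_
      have := h3' (A * e) (hmem hA) 0 (Submodule.zero_mem _)
      rw [← e2, Matrix.mul_assoc, Matrix.trace_mul_comm, Matrix.mul_assoc, Matrix.sub_mul,
        Matrix.trace_sub, Matrix.mul_assoc z.2, Matrix.trace_mul_comm z.2, sub_eq_zero]
      have h7 := this
      simp only [Matrix.mul_zero, zero_add, Matrix.zero_mul, sub_zero, Matrix.mul_sub,
        Matrix.trace_sub, sub_eq_zero] at h7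
      simpa [Matrix.mul_assoc] using h7.symm)
  have h7 : Module.finrank ℂ (corner (diagSub vt) e 1) =
      Module.finrank ℂ (corner (diagSub vt) 1 e) := by
    rw [finrank_corner_flip _ hd he one_mem_diagSub (one_mul 1), maskSub_flip_eq]
  omega

/-- The Euler form bound for bricks. -/
lemma two_mul_finrank_diagSub_le [Nonempty N] {z : MatPair N} (hz : z ∈ momentSet vt R Λ)
    (hΛ : ∀ Z ∈ diagSub vt, Z * Λ = Λ * Z) (hb : IsBrick vt z) :
    2 * Module.finrank ℂ (diagSub vt) ≤
      Module.finrank ℂ (maskSub vt R) + Module.finrank ℂ (maskSub vt fun v w => R w v) + 2 := by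
  let U : Submodule ℂ (MatPair N) := (maskSub vt R).prod (maskSub vt fun v w => R w v)
  have hP : (diagSub vt).map (homPair z z) ≤ U ⊓ LinearMap.ker (homMoment vt z z) := by
    rintro _ ⟨φ, hφ, rfl⟩
    exact ⟨⟨Submodule.sub_mem _ (mul_diag_mem hφ hz.1) (diag_mul_mem hφ hz.1),
      Submodule.sub_mem _ (mul_diag_mem hφ hz.2.1) (diag_mul_mem hφ hz.2.1)⟩,
      LinearMap.mem_ker.2 (homMoment_homPair hz hz hΛ hφ)⟩
  have h1 := finrank_map_add (homMoment vt z z) U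
  have h2 := Submodule.finrank_mono hP
  have h3 : Module.finrank ℂ U = Module.finrank ℂ (maskSub vt R) +
      Module.finrank ℂ (maskSub vt fun v w => R w v) := finrank_submodule_prod _ _
  have h4 := finrank_map_add (homPair z z) (diagSub vt)
  have h5 : diagSub vt ⊓ LinearMap.ker (homPair z z) = endSub vt z := by
    ext Z
    rw [mem_endSub]
    constructor
    · rintro ⟨h, hk⟩
      have hk' : (z.1 * Z - Z * z.1, z.2 * Z - Z * z.2) = (0 : MatPair N) := hk
      rw [Prod.mk_eq_zero, sub_eq_zero, sub_eq_zero] at hk'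
      exact ⟨h, hk'.1.symm, hk'.2.symm⟩
    · rintro ⟨h, h1, h2⟩
      refine ⟨h, ?_⟩
      change (z.1 * Z - Z * z.1, z.2 * Z - Z * z.2) = (0 : MatPair N)
      rw [Prod.mk_eq_zero, h1, h2, sub_self, sub_self]
      exact ⟨rfl, rfl⟩
  rw [h5, finrank_endSub_of_isBrick hb] at h4
  have h6 := finrank_map_add (Matrix.traceLinearMap N ℂ ℂ) (diagSub vt)
  have h7 : diagSub vt ⊓ LinearMap.ker (Matrix.traceLinearMap N ℂ ℂ) ≤ U.map (homMoment vt z z) := by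
    rintro D ⟨hD, htr⟩
    obtain ⟨u, hu1, hu2, hu⟩ := mem_range_linM hb hz.1 hz.2.1 hD htr
    exact ⟨u, ⟨hu1, hu2⟩, hu⟩
  have h8 := Submodule.finrank_mono h7
  have h9 := Submodule.finrank_le ((diagSub vt).map (Matrix.traceLinearMap N ℂ ℂ))
  rw [Module.finrank_self] at h9
  omega

end HomComplex

section FunctionAlgebra

/-- Subalgebras of finite products of lines are spanned by orthogonal idempotents. -/
lemma exists_idem_functions {T : Type} [Fintype T] (W : Submodule ℂ (T → ℂ))
    (h1 : (1 : T → ℂ) ∈ W) (hmul : ∀ f ∈ W, ∀ g ∈ W, f * g ∈ W) :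
    ∃ (k : ℕ) (f : Fin k → T → ℂ), (∀ a, f a ∈ W) ∧ (∀ a, f a ≠ 0) ∧
      (∀ a b, f a * f b = if a = b then f a else 0) ∧ ∑ a, f a = 1 ∧ Module.finrank ℂ W ≤ k := by
  classical
  let s : Setoid T := ⟨fun i j => ∀ f ∈ W, f i = f j, fun i f _ => rfl,
    fun h f hf => (h f hf).symm, fun h h' f hf => (h f hf).trans (h' f hf)⟩
  have hs : ∀ i j, s i j ↔ ∀ f ∈ W, f i = f j := fun _ _ => Iff.rfl
  have : Fintype (Quotient s) := Fintype.ofFinite _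
  have hprod : ∀ (U : Finset T) (g : T → T → ℂ), (∀ j ∈ U, g j ∈ W) → ∏ j ∈ U, g j ∈ W := by
    intro U g
    induction U using Finset.induction_on with
    | empty => intro _; simpa using h1
    | insert j U hj ih =>
      intro h
      rw [Finset.prod_insert hj]
      exact hmul _ (h j (Finset.mem_insert_self _ _)) _
        (ih fun i hi => h i (Finset.mem_insert_of_mem hi))
  let χ : Quotient s → T → ℂ := fun c i => if Quotient.mk s i = c then 1 else 0
  have hχ : ∀ c, χ c ∈ W := by
    intro c
    obtain ⟨i, rfl⟩ := Quotient.exists_rep c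
    have hex : ∀ j, ¬ s i j → ∃ g ∈ W, g i = 1 ∧ g j = 0 := by
      intro j hj
      rw [hs] at hj
      push Not at hj
      obtain ⟨f, hf, hne⟩ := hj
      refine ⟨(f i - f j)⁻¹ • (f - (f j) • (1 : T → ℂ)), W.smul_mem _ (W.sub_mem hf (W.smul_mem _ h1)),
        ?_, ?_⟩
      · simp [sub_ne_zero.2 hne]
      · simp
    choose! g hgW hg1 hg0 using hex
    have : χ (Quotient.mk s i) = ∏ j ∈ Finset.univ.filter fun j => ¬ s i j, g j := by
      funext l
      rw [Finset.prod_apply]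
      by_cases hl : s i l
      · have hl' : Quotient.mk s l = Quotient.mk s i := Quotient.sound (s.symm hl)
        simp only [χ, if_pos hl']
        symm
        refine Finset.prod_eq_one fun j hj => ?_
        rw [Finset.mem_filter] at hj
        rw [← hl _ (hgW j hj.2), hg1 j hj.2]
      · have hl' : Quotient.mk s l ≠ Quotient.mk s i := fun h => hl (s.symm (Quotient.exact h))
        simp only [χ, if_neg hl']
        symm
        exact Finset.prod_eq_zero (Finset.mem_filter.2 ⟨Finset.mem_univ _, hl⟩) (hg0 l hl)
    rw [this]
    exact hprod _ _ fun j hj => hgW j (Finset.mem_filter.1 hj).2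
  let eq := Fintype.equivFin (Quotient s)
  refine ⟨Fintype.card (Quotient s), fun a => χ (eq.symm a), fun a => hχ _, ?_, ?_, ?_, ?_⟩
  · intro a ha
    obtain ⟨i, hi⟩ := Quotient.exists_rep (eq.symm a)
    have := congrFun ha i
    simp [χ, hi] at this
  · intro a b
    funext i
    by_cases hab : a = b
    · subst hab
      simp [χ]
    · rw [if_neg hab]
      simp only [χ, Pi.mul_apply, Pi.zero_apply]
      split_ifs with h2 h3
      · exact absurd (eq.symm.injective (h2.symm.trans h3)) hab
      all_goals simp
  · funext i
    rw [Finset.sum_apply, Equiv.sum_comp eq.symm fun c => χ c i]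
    simp [χ]
  · have hle : W ≤ LinearMap.range (LinearMap.funLeft ℂ ℂ (Quotient.mk s)) := by
      intro f hf
      exact ⟨Quotient.lift f fun i j h => h f hf, rfl⟩
    calc Module.finrank ℂ W ≤ Module.finrank ℂ
          (LinearMap.range (LinearMap.funLeft ℂ ℂ (Quotient.mk s))) := Submodule.finrank_mono hle
      _ ≤ Module.finrank ℂ (Quotient s → ℂ) := LinearMap.finrank_range_le _
      _ = _ := Module.finrank_fintype_fun_eq_card ℂ

/-- Matrices with distinct eigenvalues are diagonalizable. -/
lemma exists_diagonalization {T : Type} [Fintype T] [DecidableEq T] {B : Matrix T T ℂ} {ev : T → ℂ}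
    (hev : Function.Injective ev)
    (hB : B.charpoly = ∏ i, (Polynomial.X - Polynomial.C (ev i))) :
    ∃ P Q : Matrix T T ℂ, P * Q = 1 ∧ Q * P = 1 ∧ B * P = P * Matrix.diagonal ev := by
  have hex : ∀ i, ∃ u : T → ℂ, Module.End.HasEigenvector (Matrix.toLin' B) (ev i) u := by
    intro i
    have hroot : B.charpoly.IsRoot (ev i) := by
      rw [hB, Polynomial.IsRoot, Polynomial.eval_prod]
      exact Finset.prod_eq_zero (Finset.mem_univ i) (by simp)
    have : Module.End.HasEigenvalue (Matrix.toLin' B) (ev i) := by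
      rw [Module.End.hasEigenvalue_iff_isRoot_charpoly, Matrix.charpoly_toLin']
      exact hroot
    exact this.exists_hasEigenvector
  choose u hu using hex
  have hli : LinearIndependent ℂ u :=
    Module.End.eigenvectors_linearIndependent' (Matrix.toLin' B) ev hev u hu
  have hinj : Function.Injective (Matrix.of fun i j => u j i : Matrix T T ℂ).mulVec :=
    Matrix.mulVec_injective_iff.2 hli
  have hunit := Matrix.mulVec_injective_iff_isUnit.1 hinj
  obtain ⟨P, hP⟩ := hunit
  refine ⟨P, ↑P⁻¹, by rw [Units.mul_inv], by rw [Units.inv_mul], ?_⟩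
  rw [hP]
  ext i j
  rw [Matrix.mul_diagonal]
  have := congrFun (hu j).apply_eq_smul i
  rw [Matrix.toLin'_apply] at this
  change (B *ᵥ u j) i = u j i * ev j
  rw [this, Pi.smul_apply, smul_eq_mul, mul_comm]

lemma exists_diagonal_of_commute {T : Type} [Fintype T] [DecidableEq T] {B P Q Z : Matrix T T ℂ}
    {ev : T → ℂ} (hev : Function.Injective ev) (hPQ : P * Q = 1) (hQP : Q * P = 1)
    (hB : B * P = P * Matrix.diagonal ev) (hZ : Z * B = B * Z) :
    Q * Z * P = Matrix.diagonal (Q * Z * P).diag := by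
  have h : (Q * Z * P) * Matrix.diagonal ev = Matrix.diagonal ev * (Q * Z * P) := by
    have h2 : Q * B = Matrix.diagonal ev * Q := by
      calc Q * B = Q * (B * P) * Q := by rw [Matrix.mul_assoc, Matrix.mul_assoc, hPQ, Matrix.mul_one]
        _ = _ := by rw [hB, ← Matrix.mul_assoc, hQP, Matrix.one_mul]
    calc _ = Q * Z * (P * Matrix.diagonal ev) := by rw [Matrix.mul_assoc]
      _ = Q * (Z * B) * P := by rw [← hB]; simp only [Matrix.mul_assoc]
      _ = (Q * B) * Z * P := by rw [hZ]; simp only [Matrix.mul_assoc]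
      _ = _ := by rw [h2]; simp only [Matrix.mul_assoc]
  ext i j
  by_cases hij : i = j
  · subst hij; rw [Matrix.diagonal_apply_eq]; rfl
  · rw [Matrix.diagonal_apply_ne _ hij]
    have := congrFun (congrFun h i) j
    rw [Matrix.mul_diagonal, Matrix.diagonal_mul, mul_comm, ← sub_eq_zero, ← sub_mul,
      mul_eq_zero, sub_eq_zero] at this
    rcases this with h1 | h1
    · exact absurd (hev h1).symm hij
    · exact h1

end FunctionAlgebra

section StarEndomorphisms

variable {q n : ℕ} {a : Option (Fin q × Fin n) → ℕ}

/-- The contribution of an arm to the moment map at the centre. -/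
def rootMap (z : MatPair (BlkIdx a)) (j : Fin q) : Matrix (Fin (a none)) (Fin (a none)) ℂ :=
  ∑ i : Fin n, blk z.1 none (some (j, i)) * blk z.2 (some (j, i)) none

lemma rootMap_intertwine {z z' : MatPair (BlkIdx a)} {ψ : Matrix (BlkIdx a) (BlkIdx a) ℂ}
    (hψ : ψ ∈ diagSub (blkVert a)) (h1 : ψ * z.1 = z'.1 * ψ) (h2 : ψ * z.2 = z'.2 * ψ)
    (j : Fin q) : blk ψ none none * rootMap z j = rootMap z' j * blk ψ none none := by
  rw [rootMap, rootMap, Finset.mul_sum, Finset.sum_mul]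
  refine Finset.sum_congr rfl fun i _ => ?_
  rw [← Matrix.mul_assoc, ← blk_diag_mul hψ, h1, blk_mul_diag hψ, Matrix.mul_assoc,
    ← blk_diag_mul hψ, h2, blk_mul_diag hψ, Matrix.mul_assoc]

lemma endSub_mul_mem {N I : Type} [Fintype N] [DecidableEq N] {vt : N → I} {z : MatPair N}
    {A B : Matrix N N ℂ} (hA : A ∈ endSub vt z) (hB : B ∈ endSub vt z) : A * B ∈ endSub vt z := by
  rw [mem_endSub] at *
  refine ⟨diag_mul_mem hA.1 hB.1, ?_, ?_⟩
  · rw [Matrix.mul_assoc, hB.2.1, ← Matrix.mul_assoc, hA.2.1, Matrix.mul_assoc]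
  · rw [Matrix.mul_assoc, hB.2.2, ← Matrix.mul_assoc, hA.2.2, Matrix.mul_assoc]

lemma endSub_eq_zero {z : MatPair (BlkIdx a)} (hx : z.1 ∈ starInj a)
    {Z : Matrix (BlkIdx a) (BlkIdx a) ℂ} (hZ : Z ∈ endSub (blkVert a) z)
    (h0 : blk Z none none = 0) : Z = 0 :=
  eq_zero_of_root (mem_endSub.1 hZ).1 hx (mem_endSub.1 hZ).2.1 h0

/-- The endomorphism algebra is spanned by orthogonal idempotents. -/
lemma exists_idemFam {z : MatPair (BlkIdx a)} (hx : z.1 ∈ starInj a) (j : Fin q)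
    {P Q : Matrix (Fin (a none)) (Fin (a none)) ℂ} {ev : Fin (a none) → ℂ}
    (hev : Function.Injective ev) (hPQ : P * Q = 1) (hQP : Q * P = 1)
    (hB : rootMap z j * P = P * Matrix.diagonal ev) :
    ∃ (k : ℕ) (e : Fin k → Matrix (BlkIdx a) (BlkIdx a) ℂ), IsIdemFam (blkVert a) e ∧
      (∀ c, e c ∈ endSub (blkVert a) z) ∧ (∀ c, e c ≠ 0) ∧
      Module.finrank ℂ (endSub (blkVert a) z) ≤ k := by
  let Φ : Matrix (BlkIdx a) (BlkIdx a) ℂ →ₗ[ℂ] (Fin (a none) → ℂ) :=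
    { toFun := fun Z => (Q * blk Z none none * P).diag
      map_add' := by
        intro A B
        rw [blk_add, Matrix.mul_add, Matrix.add_mul, Matrix.diag_add]
      map_smul' := by
        intro c A
        rw [blk_smul, Matrix.mul_smul, Matrix.smul_mul, Matrix.diag_smul, RingHom.id_apply] }
  have hΦ : ∀ Z ∈ endSub (blkVert a) z, Q * blk Z none none * P = Matrix.diagonal (Φ Z) := by
    intro Z hZ
    obtain ⟨h1, h2, h3⟩ := mem_endSub.1 hZ
    exact exists_diagonal_of_commute hev hPQ hQP hB (rootMap_intertwine h1 h2 h3 j)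
  have hmul : ∀ A ∈ endSub (blkVert a) z, ∀ B ∈ endSub (blkVert a) z, Φ (A * B) = Φ A * Φ B := by
    intro A hA B hB'
    have h1 : Q * blk (A * B) none none * P =
        (Q * blk A none none * P) * (Q * blk B none none * P) := by
      rw [blk_mul_diag (mem_endSub.1 hB').1]
      calc _ = Q * blk A none none * (P * Q) * blk B none none * P := by
            rw [hPQ, Matrix.mul_one]; simp only [Matrix.mul_assoc]
        _ = _ := by simp only [Matrix.mul_assoc]
    rw [hΦ _ (endSub_mul_mem hA hB'), hΦ _ hA, hΦ _ hB', Matrix.diagonal_mul_diagonal] at h1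
    exact Matrix.diagonal_injective h1
  have hinj : ∀ Z ∈ endSub (blkVert a) z, Φ Z = 0 → Z = 0 := by
    intro Z hZ h0
    refine endSub_eq_zero hx hZ ?_
    have h1 := hΦ Z hZ
    rw [h0] at h1
    have h2 : P * (Q * blk Z none none * P) * Q = blk Z none none := by
      calc _ = (P * Q) * blk Z none none * (P * Q) := by simp only [Matrix.mul_assoc]
        _ = _ := by rw [hPQ, Matrix.one_mul, Matrix.mul_one]
    rw [← h2, h1]
    simp
  have hone : Φ 1 = 1 := by
    change (Q * blk 1 none none * P).diag = 1
    rw [blk_one, Matrix.mul_one, hQP, Matrix.diag_one]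
  obtain ⟨k, f, hfW, hf0, hfm, hfs, hk⟩ := exists_idem_functions
    ((endSub (blkVert a) z).map Φ) ⟨1, (one_mem_endSub _), hone⟩ (by
      rintro _ ⟨A, hA, rfl⟩ _ ⟨B, hB, rfl⟩
      exact ⟨A * B, endSub_mul_mem hA hB, hmul A hA B hB⟩)
  choose e heE hef using hfW
  have hee : ∀ c, e c ∈ endSub (blkVert a) z := heE
  have hinj' : ∀ A ∈ endSub (blkVert a) z, ∀ B ∈ endSub (blkVert a) z, Φ A = Φ B → A = B := by
    intro A hA B hB' h
    rw [← sub_eq_zero]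
    exact hinj _ (Submodule.sub_mem _ hA hB') (by rw [map_sub, h, sub_self])
  refine ⟨k, e, ⟨fun c => (mem_endSub.1 (hee c)).1, fun c d => ?_, ?_⟩, hee, ?_, ?_⟩
  · split_ifs with hcd
    · refine hinj' _ (endSub_mul_mem (hee c) (hee d)) _ (hee c) ?_
      rw [hmul _ (hee c) _ (hee d), hef, hef, hfm, if_pos hcd]
    · refine hinj' _ (endSub_mul_mem (hee c) (hee d)) _ (Submodule.zero_mem _) ?_
      rw [hmul _ (hee c) _ (hee d), hef, hef, hfm, if_neg hcd, map_zero]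
  · refine hinj' _ (Submodule.sum_mem _ fun c _ => hee c) _ (one_mem_endSub _) ?_
    rw [map_sum, hone, ← hfs]
    exact Finset.sum_congr rfl fun c _ => hef c
  · intro c hc
    refine hf0 c ?_
    rw [← hef, hc, map_zero]
  · have h1 := finrank_map_add Φ (endSub (blkVert a) z)
    have h2 : endSub (blkVert a) z ⊓ LinearMap.ker Φ = ⊥ := by
      rw [Submodule.eq_bot_iff]
      rintro Z ⟨hZ, hZ'⟩
      exact hinj Z hZ hZ'
    rw [h2, finrank_bot] at h1
    omega

end StarEndomorphisms

section StarIdempotents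

variable {p n : ℕ} {a : Option (Fin (p + 1) × Fin n) → ℕ}

/-- The dimension vector of an idempotent. -/
def idemVec (e : Matrix (BlkIdx a) (BlkIdx a) ℂ) (v : Option (Fin (p + 1) × Fin n)) : ℤ :=
  (vdim (blkVert a) e v : ℤ)

lemma idemVec_one : idemVec (1 : Matrix (BlkIdx a) (BlkIdx a) ℂ) = fun v => (a v : ℤ) := by
  funext v
  rw [idemVec, vdim_eq_rank_blk (one_mem_diagSub) (by simp), blk_one, Matrix.rank_one,
    Fintype.card_fin]

lemma idemVec_le {e : Matrix (BlkIdx a) (BlkIdx a) ℂ} (hd : e ∈ diagSub (blkVert a))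
    (he : e * e = e) (v : Option (Fin (p + 1) × Fin n)) : idemVec e v ≤ a v := by
  rw [idemVec, vdim_eq_rank_blk hd he]
  exact_mod_cast (Matrix.rank_le_width _)

lemma endsZero_idemVec (hend : EndsZero fun v => (a v : ℤ)) {e : Matrix (BlkIdx a) (BlkIdx a) ℂ}
    (hd : e ∈ diagSub (blkVert a)) (he : e * e = e) : EndsZero (idemVec e) := by
  intro j i hi
  have h := hend j i hi
  have h2 := idemVec_le hd he (some (j, i))
  have h3 : 0 ≤ idemVec e (some (j, i)) := by simp [idemVec]
  simp only at h
  omega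

lemma starDrop_idemVec_nonneg {x e : Matrix (BlkIdx a) (BlkIdx a) ℂ}
    (hd : e ∈ diagSub (blkVert a)) (he : e * e = e) (hx : x ∈ starInj a) (h : e * x = x * e)
    (j : Fin (p + 1)) (i : Fin n) : 0 ≤ starDrop (idemVec e) j i := by
  have := vdim_antitone hd he hx h (j, i)
  simp only [starDrop, idemVec]
  omega

lemma idemVec_pairing (hn : 1 ≤ n) (hend : EndsZero fun v => (a v : ℤ))
    {e f : Matrix (BlkIdx a) (BlkIdx a) ℂ} (hd : e ∈ diagSub (blkVert a)) (he : e * e = e)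
    (hd' : f ∈ diagSub (blkVert a)) (hf : f * f = f) :
    2 * (Module.finrank ℂ (corner (diagSub (blkVert a)) e f) : ℤ) -
      (Module.finrank ℂ (corner (maskSub (blkVert a) starRel) e f) +
        Module.finrank ℂ (corner (maskSub (blkVert a) fun v w => starRel w v) e f)) =
    (∑ i, starDrop (idemVec e) (Fin.last p) i * starDrop (idemVec f) (Fin.last p) i) -
      starForm (toStar (idemVec e)) (toStar (idemVec f)) := by
  classical

  have hdiag : Module.finrank ℂ (corner (diagSub (blkVert a)) e f) =
      ∑ v, vdim (blkVert a) e v * vdim (blkVert a) f v := by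
    refine (finrank_corner (fun v w => v = w) hd he hd' hf).trans ?_
    refine Finset.sum_congr rfl fun v _ => ?_
    refine (Finset.sum_eq_single v (fun w _ h => if_neg h.symm) (by simp)).trans (if_pos rfl)
  rw [← star_pairing (endsZero_idemVec hend hd he) hn, hdiag, finrank_corner _ hd he hd' hf,
    finrank_corner _ hd he hd' hf]
  simp only [idemVec]
  push_cast
  rfl

lemma toStar_sum {ι : Type} (s : Finset ι) (b : ι → Option (Fin (p + 1) × Fin n) → ℤ) :
    ∑ c ∈ s, toStar (b c) = toStar (∑ c ∈ s, b c) := by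
  ext <;> simp [toStar, starDrop, Prod.fst_sum, Prod.snd_sum, Finset.sum_apply, Finset.sum_sub_distrib]

lemma sum_idemVec {ι : Type} (s : Finset ι) {e : ι → Matrix (BlkIdx a) (BlkIdx a) ℂ}
    {f : Matrix (BlkIdx a) (BlkIdx a) ℂ}
    (hd : ∀ c ∈ s, e c ∈ diagSub (blkVert a)) (he : ∀ c ∈ s, e c * e c = e c)
    (hd' : f ∈ diagSub (blkVert a)) (hf : f * f = f) (hsum : ∑ c ∈ s, e c = f) :
    ∑ c ∈ s, idemVec (e c) = idemVec f := by
  funext v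
  have := vdim_add_of_sum s hd he hd' hf hsum v
  simp only [idemVec, Finset.sum_apply]
  exact_mod_cast this

lemma idemVec_add_one_sub {e : Matrix (BlkIdx a) (BlkIdx a) ℂ} (hd : e ∈ diagSub (blkVert a))
    (he : e * e = e) : idemVec e + idemVec (1 - e) = fun v => (a v : ℤ) := by
  rw [← idemVec_one]
  funext v
  have := vdim_one_sub hd he v
  simp only [idemVec, Pi.add_apply]
  exact_mod_cast this

lemma eq_zero_of_mulVecLin {l m : Type} [Fintype m] {M : Matrix l m ℂ} (h : M.mulVecLin = 0) :
    M = 0 := by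
  classical
  ext i j
  have := congrFun (LinearMap.congr_fun h (Pi.single j 1)) i
  simpa using this

lemma idemVec_none_pos {z : MatPair (BlkIdx a)} (hx : z.1 ∈ starInj a)
    {e : Matrix (BlkIdx a) (BlkIdx a) ℂ} (he' : e ∈ endSub (blkVert a) z)
    (he : e * e = e) (h0 : e ≠ 0) : 1 ≤ idemVec e none := by
  rw [idemVec, vdim_eq_rank_blk (mem_endSub.1 he').1 he]
  by_contra h
  have h1 : (blk e none none).rank = 0 := by omega
  exact h0 (endSub_eq_zero hx he' (by
    rw [Matrix.rank, Module.finrank_eq_zero_iff_of_free, Submodule.subsingleton_iff_eq_bot,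
      LinearMap.range_eq_bot] at h1
    exact eq_zero_of_mulVecLin h1))

end StarIdempotents

section Schur

variable {T T' : Type} [Fintype T] [Fintype T'] {q : ℕ}

lemma range_eq_of_irredTuple {C' : Fin q → Matrix T' T' ℂ} {C : Fin q → Matrix T T ℂ}
    (h : IrredTuple C') {M : Matrix T' T ℂ} (hM : ∀ j, M * C j = C' j * M) :
    M = 0 ∨ M.rank = Fintype.card T' := by
  classical
  rcases h (LinearMap.range M.mulVecLin) (by
    rintro j _ ⟨v, rfl⟩
    refine ⟨(C j).mulVec v, ?_⟩
    simp only [Matrix.mulVecLin_apply, Matrix.mulVec_mulVec, hM]) with h0 | h0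
  · left
    rw [LinearMap.range_eq_bot] at h0
    exact eq_zero_of_mulVecLin h0 
  · right
    rw [Matrix.rank, h0, finrank_top, Module.finrank_fintype_fun_eq_card]

lemma injective_of_irredTuple {C' : Fin q → Matrix T' T' ℂ} {C : Fin q → Matrix T T ℂ}
    (h : IrredTuple C) {M : Matrix T' T ℂ} (hM : ∀ j, M * C j = C' j * M) :
    M = 0 ∨ M.rank = Fintype.card T := by
  classical
  have hrn := LinearMap.finrank_range_add_finrank_ker M.mulVecLin
  rw [Module.finrank_fintype_fun_eq_card] at hrn
  rcases h (LinearMap.ker M.mulVecLin) (by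
    intro j v hv
    simp only [LinearMap.mem_ker, Matrix.mulVecLin_apply] at hv ⊢
    rw [Matrix.mulVec_mulVec, hM, ← Matrix.mulVec_mulVec, hv, Matrix.mulVec_zero]) with h0 | h0
  · right
    rw [h0, finrank_bot] at hrn
    exact hrn
  · left
    rw [LinearMap.ker_eq_top] at h0
    exact eq_zero_of_mulVecLin h0

end Schur

section StarHypotheses

variable {p n : ℕ} {a : Option (Fin (p + 1) × Fin n) → ℕ}

/-- Star-shaped moment map data whose last arm has multiplicity-free eigenvalues. -/
structure StarHyp (a : Option (Fin (p + 1) × Fin n) → ℕ)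
    (Λ : Matrix (BlkIdx a) (BlkIdx a) ℂ) : Prop where
  one_le_p : 1 ≤ p
  one_le_n : 1 ≤ n
  ends : EndsZero fun v => (a v : ℤ)
  last : ∀ i, starDrop (fun v => (a v : ℤ)) (Fin.last p) i = 1
  central : ∀ Z ∈ diagSub (blkVert a), Z * Λ = Λ * Z
  nonneg : 2 ≤ a none → ∀ v, IsDimVec v → 0 ≤ starForm (toStar fun v => (a v : ℤ)) v
  irred : ∃ z ∈ momentSet (blkVert a) starRel Λ, z.1 ∈ starInj a ∧ IrredTuple (rootMap z)
  diag : ∀ z ∈ momentSet (blkVert a) starRel Λ, z.1 ∈ starInj a →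
    ∃ (P Q : Matrix (Fin (a none)) (Fin (a none)) ℂ) (ev : Fin (a none) → ℂ),
      Function.Injective ev ∧ P * Q = 1 ∧ Q * P = 1 ∧
        rootMap z (Fin.last p) * P = P * Matrix.diagonal ev

variable {Λ : Matrix (BlkIdx a) (BlkIdx a) ℂ}

lemma StarHyp.root_dim (h : StarHyp a Λ) : a none = n := by
  have h1 := sum_starDrop h.ends h.one_le_n (Fin.last p)
  simp only [h.last, Finset.sum_const, Finset.card_univ, Fintype.card_fin, nsmul_eq_mul, mul_one] at h1
  exact_mod_cast h1.symm

lemma StarHyp.nonempty (h : StarHyp a Λ) : Nonempty (BlkIdx a) :=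
  ⟨⟨none, ⟨0, by rw [h.root_dim]; exact h.one_le_n⟩⟩⟩

lemma scalar_of_commute_irredTuple {m q : ℕ} (hm : 1 ≤ m) {C : Fin q → Matrix (Fin m) (Fin m) ℂ}
    (hC : IrredTuple C) {M : Matrix (Fin m) (Fin m) ℂ} (hM : ∀ j, M * C j = C j * M) :
    ∃ c : ℂ, M = c • 1 := by
  have : Nonempty (Fin m) := ⟨⟨0, hm⟩⟩
  obtain ⟨c, hc⟩ := Module.End.exists_eigenvalue M.mulVecLin
  obtain ⟨v, hv⟩ := hc.exists_hasEigenvector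
  refine ⟨c, ?_⟩
  have h1 : ∀ j, (M - c • 1) * C j = C j * (M - c • 1) := fun j => by
    simp [sub_mul, mul_sub, hM j]
  rcases injective_of_irredTuple hC h1 with h0 | h0
  · exact sub_eq_zero.1 h0
  · exfalso
    have hker : (M - c • 1).mulVec v = 0 := by
      have := hv.apply_eq_smul
      rw [Matrix.mulVecLin_apply] at this
      rw [Matrix.sub_mulVec, this, Matrix.smul_mulVec, Matrix.one_mulVec, sub_self]
    have hrn := LinearMap.finrank_range_add_finrank_ker (M - c • 1).mulVecLin
    rw [Module.finrank_fintype_fun_eq_card] at hrn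
    have h2 : Module.finrank ℂ (LinearMap.ker (M - c • 1).mulVecLin) = 0 := by
      rw [Matrix.rank] at h0; omega
    rw [Submodule.finrank_eq_zero] at h2
    have h3 : v ∈ LinearMap.ker (M - c • 1).mulVecLin := hker
    rw [h2, Submodule.mem_bot] at h3
    exact hv.2 h3

lemma isBrick_of_irredTuple (hn : 1 ≤ a none) {z : MatPair (BlkIdx a)} (hx : z.1 ∈ starInj a)
    (hz : IrredTuple (rootMap z)) : IsBrick (blkVert a) z := by
  intro Z hZ
  obtain ⟨hd, h1, h2⟩ := mem_endSub.1 hZ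
  obtain ⟨c, hc⟩ := scalar_of_commute_irredTuple hn hz
    (M := blk Z none none) (rootMap_intertwine hd h1 h2)
  refine ⟨c, ?_⟩
  have h3 : Z - c • 1 ∈ endSub (blkVert a) z :=
    Submodule.sub_mem _ hZ (Submodule.smul_mem _ _ (one_mem_endSub _))
  refine sub_eq_zero.1 (endSub_eq_zero hx h3 ?_)
  rw [blk_sub, blk_smul, blk_one, hc, sub_self]

lemma StarHyp.le_starForm (h : StarHyp a Λ) :
    (n : ℤ) - 2 ≤ starForm (toStar fun v => (a v : ℤ)) (toStar fun v => (a v : ℤ)) := by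
  obtain ⟨z, hz, hx, hirr⟩ := h.irred
  have := h.nonempty
  have hb := isBrick_of_irredTuple (by rw [h.root_dim]; exact h.one_le_n) hx hirr
  have h1 := two_mul_finrank_diagSub_le hz h.central hb
  have h2 := idemVec_pairing h.one_le_n h.ends (one_mem_diagSub (vt := blkVert a)) (mul_one _)
    (one_mem_diagSub (vt := blkVert a)) (mul_one _)
  rw [corner_eq_self, corner_eq_self, corner_eq_self, idemVec_one] at h2
  change 2 * (Module.finrank ℂ (diagSub (blkVert a)) : ℤ) - _ = _ at h2
  simp only [h.last, mul_one, Finset.sum_const, Finset.card_univ, Fintype.card_fin,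
    nsmul_eq_mul] at h2
  omega

lemma StarHyp.le_starForm_idem (h : StarHyp a Λ) {z : MatPair (BlkIdx a)}
    (hz : z ∈ momentSet (blkVert a) starRel Λ) (hx : z.1 ∈ starInj a)
    {e : Matrix (BlkIdx a) (BlkIdx a) ℂ} (hend : e ∈ endSub (blkVert a) z) (he : e * e = e)
    (hlt : idemVec e none < n) :
    idemVec e none ≤ starForm (toStar fun v => (a v : ℤ)) (toStar (idemVec e)) := by
  obtain ⟨z', hz', hx', hirr⟩ := h.irred
  have hd := (mem_endSub.1 hend).1
  have hrk : (blk e none none).rank < Fintype.card (Fin (a none)) := by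
    rw [idemVec, vdim_eq_rank_blk hd he] at hlt
    have h0 := h.root_dim
    rw [Fintype.card_fin]
    omega
  have h1 := two_mul_finrank_corner_le hz hz' h.central hend he
    (fun φ hφ hφe h1 h2 => by
      refine eq_zero_of_root hφ hx' h1.symm ?_
      rcases range_eq_of_irredTuple hirr (rootMap_intertwine hφ h1.symm h2.symm) with h0 | h0
      · exact h0
      · exfalso
        rw [← hφe, blk_mul_diag hd] at h0
        have := Matrix.rank_mul_le_right (blk φ none none) (blk e none none)
        omega)
    (fun ψ hψ hψe h1 h2 => by
      refine eq_zero_of_root hψ hx h1 ?_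
      rcases injective_of_irredTuple hirr (rootMap_intertwine hψ h1 h2) with h0 | h0
      · exact h0
      · exfalso
        rw [← hψe, blk_diag_mul hd] at h0
        have := Matrix.rank_mul_le_left (blk e none none) (blk ψ none none)
        omega)
  have h2 := idemVec_pairing h.one_le_n h.ends (one_mem_diagSub (vt := blkVert a)) (mul_one _) hd he
  rw [idemVec_one] at h2
  simp only [h.last, one_mul] at h2
  rw [sum_starDrop (endsZero_idemVec h.ends hd he) h.one_le_n] at h2
  omega

end StarHypotheses

section StarFamilies

variable {p n : ℕ} {a : Option (Fin (p + 1) × Fin n) → ℕ} {Λ : Matrix (BlkIdx a) (BlkIdx a) ℂ}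

lemma endSub_one_sub {z : MatPair (BlkIdx a)} {e : Matrix (BlkIdx a) (BlkIdx a) ℂ}
    (he : e ∈ endSub (blkVert a) z) : 1 - e ∈ endSub (blkVert a) z :=
  Submodule.sub_mem _ (one_mem_endSub _) he

lemma one_sub_mul_self {e : Matrix (BlkIdx a) (BlkIdx a) ℂ} (he : e * e = e) :
    (1 - e) * (1 - e) = 1 - e := by
  simp [sub_mul, mul_sub, he]

lemma starDrop_add (b c : Option (Fin (p + 1) × Fin n) → ℤ) (j : Fin (p + 1)) (i : Fin n) :
    starDrop (b + c) j i = starDrop b j i + starDrop c j i := by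
  simp [starDrop]; ring

lemma toStar_add (b c : Option (Fin (p + 1) × Fin n) → ℤ) :
    toStar (b + c) = toStar b + toStar c := by
  ext <;> simp [toStar, starDrop_add]

lemma StarHyp.starDrop_last (h : StarHyp a Λ) {z : MatPair (BlkIdx a)} (hx : z.1 ∈ starInj a)
    {e : Matrix (BlkIdx a) (BlkIdx a) ℂ} (hend : e ∈ endSub (blkVert a) z) (he : e * e = e)
    (i : Fin n) :
    0 ≤ starDrop (idemVec e) (Fin.last p) i ∧
      starDrop (idemVec (1 - e)) (Fin.last p) i = 1 - starDrop (idemVec e) (Fin.last p) i ∧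
      starDrop (idemVec e) (Fin.last p) i ≤ 1 := by
  obtain ⟨hd, h1, -⟩ := mem_endSub.1 hend
  obtain ⟨hd', h1', -⟩ := mem_endSub.1 (endSub_one_sub hend)
  have h2 := starDrop_idemVec_nonneg hd he hx h1 (Fin.last p) i
  have h3 := starDrop_idemVec_nonneg hd' (one_sub_mul_self he) hx h1' (Fin.last p) i
  have h4 := h.last i
  rw [← idemVec_add_one_sub hd he, starDrop_add] at h4
  omega

lemma StarHyp.two_le_starForm (h : StarHyp a Λ) {z : MatPair (BlkIdx a)}
    (hz : z ∈ momentSet (blkVert a) starRel Λ) (hx : z.1 ∈ starInj a)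
    {e : Matrix (BlkIdx a) (BlkIdx a) ℂ} (hend : e ∈ endSub (blkVert a) z) (he : e * e = e)
    (h0 : e ≠ 0) (h1 : 1 - e ≠ 0) :
    2 ≤ starForm (toStar (idemVec e)) (toStar (idemVec (1 - e))) := by
  have : Nonempty (Fin p) := ⟨⟨0, h.one_le_p⟩⟩
  have hend' := endSub_one_sub hend
  have he' := one_sub_mul_self he
  obtain ⟨hd, hc, -⟩ := mem_endSub.1 hend
  obtain ⟨hd', hc', -⟩ := mem_endSub.1 hend'
  have hp := idemVec_none_pos hx hend he h0
  have hp' := idemVec_none_pos hx hend' he' h1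
  have hsum := idemVec_add_one_sub hd he
  have hn : idemVec e none + idemVec (1 - e) none = n := by
    have := congrFun hsum none
    simp only [Pi.add_apply] at this
    rw [this, h.root_dim]
  have hl := h.le_starForm_idem hz hx hend he (by omega)
  have hl' := h.le_starForm_idem hz hx hend' he' (by omega)
  rw [← hsum, toStar_add] at hl hl'
  exact _root_.two_le_starForm
    (isDimVec_toStar (endsZero_idemVec h.ends hd he) h.one_le_n
      (starDrop_idemVec_nonneg hd he hx hc))
    (isDimVec_toStar (endsZero_idemVec h.ends hd' he') h.one_le_n
      (starDrop_idemVec_nonneg hd' he' hx hc')) hp hp' hl hl'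

lemma StarHyp.exists_family (h : StarHyp a Λ) {z : MatPair (BlkIdx a)}
    (hz : z ∈ momentSet (blkVert a) starRel Λ) (hx : z.1 ∈ starInj a)
    (hb : ¬ IsBrick (blkVert a) z) :
    ∃ (k : ℕ) (e : Fin k → Matrix (BlkIdx a) (BlkIdx a) ℂ), IsIdemFam (blkVert a) e ∧
      (∀ c, e c ∈ endSub (blkVert a) z) ∧ (∀ c, e c ≠ 0) ∧ (∀ c, 1 - e c ≠ 0) ∧ 0 < k ∧
      Module.finrank ℂ (endSub (blkVert a) z) ≤ k := by
  obtain ⟨P, Q, ev, hev, hPQ, hQP, hB⟩ := h.diag z hz hx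
  obtain ⟨k, e, he, hend, h0, hk⟩ := exists_idemFam hx _ hev hPQ hQP hB
  have hk2 : 2 ≤ k := by
    by_contra hlt
    exact hb (isBrick_of_finrank_le (by omega))
  refine ⟨k, e, he, hend, h0, fun c h1 => ?_, by omega, hk⟩
  have : Nontrivial (Fin k) := Fin.nontrivial_iff_two_le.2 hk2
  obtain ⟨d, hd⟩ := exists_ne c
  have h2 := he.mul d c
  rw [if_neg hd, ← sub_eq_zero.1 h1, mul_one] at h2
  exact h0 d h2

lemma StarHyp.exists_idem (h : StarHyp a Λ) (z : MatPair (BlkIdx a))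
    (hz : z ∈ momentSet (blkVert a) starRel Λ) (hx : z.1 ∈ starInj a)
    (hb : ¬ IsBrick (blkVert a) z) : ∃ e ∈ endSub (blkVert a) z, e * e = e ∧
      2 * Module.finrank ℂ (corner (diagSub (blkVert a)) e (1 - e)) <
        Module.finrank ℂ (corner (maskSub (blkVert a) starRel) e (1 - e)) +
        Module.finrank ℂ (corner (maskSub (blkVert a) fun v w => starRel w v) e (1 - e)) := by
  obtain ⟨k, e, he, hend, h0, h1, hk, -⟩ := h.exists_family hz hx hb
  refine ⟨e ⟨0, hk⟩, hend _, by simpa using he.mul ⟨0, hk⟩ ⟨0, hk⟩, ?_⟩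
  have hee : e ⟨0, hk⟩ * e ⟨0, hk⟩ = e ⟨0, hk⟩ := by simpa using he.mul ⟨0, hk⟩ ⟨0, hk⟩
  have h2 := h.two_le_starForm hz hx (hend ⟨0, hk⟩) hee (h0 _) (h1 _)
  have h3 := idemVec_pairing h.one_le_n h.ends (he.mem ⟨0, hk⟩) hee
    (mem_endSub.1 (endSub_one_sub (hend ⟨0, hk⟩))).1 (one_sub_mul_self hee)
  rw [Finset.sum_eq_zero] at h3
  · omega
  · intro i _
    obtain ⟨h4, h5, h6⟩ := h.starDrop_last hx (hend ⟨0, hk⟩) hee i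
    rw [h5]
    have : starDrop (idemVec (e ⟨0, hk⟩)) (Fin.last p) i = 0 ∨
      starDrop (idemVec (e ⟨0, hk⟩)) (Fin.last p) i = 1 := by omega
    rcases this with h7 | h7 <;> rw [h7] <;> norm_num

lemma StarHyp.familyCondition (h : StarHyp a Λ) :
    FamilyCondition (blkVert a) starRel Λ (starInj a) := by
  intro z hz hx hb
  obtain ⟨k, e, he, hend, h0, h1, -, hk⟩ := h.exists_family hz hx hb
  refine ⟨k, e, he, hend, hk, ?_⟩
  have hee : ∀ c, e c * e c = e c := fun c => by simpa using he.mul c c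
  have hA := idemVec_pairing h.one_le_n h.ends (one_mem_diagSub (vt := blkVert a)) (mul_one _)
    (one_mem_diagSub (vt := blkVert a)) (mul_one _)
  rw [corner_eq_self, corner_eq_self, corner_eq_self, idemVec_one] at hA
  change 2 * (Module.finrank ℂ (diagSub (blkVert a)) : ℤ) - _ = _ at hA
  simp only [h.last, mul_one, Finset.sum_const, Finset.card_univ, Fintype.card_fin,
    nsmul_eq_mul] at hA
  have hflip : Module.finrank ℂ (maskSub (blkVert a) fun v w => starRel w v) =
      Module.finrank ℂ (maskSub (blkVert a) starRel) := finrank_maskSub_flip _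
  have hE : ∀ c, 2 * (Module.finrank ℂ (corner (diagSub (blkVert a)) (e c) (e c)) : ℤ) -
      2 * Module.finrank ℂ (corner (maskSub (blkVert a) starRel) (e c) (e c)) =
      idemVec (e c) none - starForm (toStar (idemVec (e c))) (toStar (idemVec (e c))) := by
    intro c
    have h2 := idemVec_pairing h.one_le_n h.ends (he.mem c) (hee c) (he.mem c) (hee c)
    have hfl := finrank_corner_flip starRel (he.mem c) (hee c) (he.mem c) (hee c)
    rw [← hfl] at h2
    have h3 : ∑ i, starDrop (idemVec (e c)) (Fin.last p) i * starDrop (idemVec (e c)) (Fin.last p) i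
        = idemVec (e c) none := by
      rw [← sum_starDrop (endsZero_idemVec h.ends (he.mem c) (hee c)) h.one_le_n (Fin.last p)]
      refine Finset.sum_congr rfl fun i _ => ?_
      obtain ⟨h4, h5, h6⟩ := h.starDrop_last hx (hend c) (hee c) i
      have : starDrop (idemVec (e c)) (Fin.last p) i = 0 ∨
        starDrop (idemVec (e c)) (Fin.last p) i = 1 := by omega
      rcases this with h7 | h7 <;> rw [h7] <;> norm_num
    rw [h3] at h2
    linarith
  have hsumv : ∑ c, idemVec (e c) = fun v => (a v : ℤ) := by
    rw [← idemVec_one]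
    exact sum_idemVec _ (fun c _ => he.mem c) (fun c _ => hee c) one_mem_diagSub (mul_one _) he.sum
  have hroot : ∑ c, idemVec (e c) none = n := by
    have := congrFun hsumv none
    rw [Finset.sum_apply] at this
    rw [this, h.root_dim]
  have hQ : 2 * (k : ℤ) + ∑ c, starForm (toStar (idemVec (e c))) (toStar (idemVec (e c))) ≤
      starForm (toStar fun v => (a v : ℤ)) (toStar fun v => (a v : ℤ)) := by
    nth_rewrite 2 [← hsumv]
    rw [← toStar_sum, starForm_sum_right]
    have : ∀ c ∈ (Finset.univ : Finset (Fin k)),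
        2 + starForm (toStar (idemVec (e c))) (toStar (idemVec (e c))) ≤
        starForm (toStar fun v => (a v : ℤ)) (toStar (idemVec (e c))) := by
      intro c _
      have h2 := h.two_le_starForm hz hx (hend c) (hee c) (h0 c) (h1 c)
      rw [← idemVec_add_one_sub (he.mem c) (hee c), toStar_add, starForm_comm (_ + _),
        starForm_add_right]
      linarith
    have h3 := Finset.sum_le_sum this
    rw [Finset.sum_add_distrib] at h3
    simp only [Finset.sum_const, Finset.card_univ, Fintype.card_fin, nsmul_eq_mul] at h3
    linarith
  have hS := Finset.sum_congr (rfl : (Finset.univ : Finset (Fin k)) = _) fun c _ => hE c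
  rw [Finset.sum_sub_distrib, Finset.sum_sub_distrib, ← Finset.mul_sum, ← Finset.mul_sum,
    hroot] at hS
  rw [finrank_commIn_famGen he, finrank_commIn_famGen he]
  zify
  linarith

end StarFamilies

section JordanDimensions

lemma jordanDim_le {U : Type*} [AddCommGroup U] [Module ℂ U] [FiniteDimensional ℂ U]
    (Z : U →ₗ[ℂ] U) (s : ℕ) : jordanDim Z s ≤ Module.finrank ℂ U :=
  Submodule.finrank_le _

lemma jordanDim_lt {U : Type*} [AddCommGroup U] [Module ℂ U] [FiniteDimensional ℂ U]
    {Z : U →ₗ[ℂ] U} (hZ : Z ≠ 0) (s : ℕ) : jordanDim Z s < Module.finrank ℂ U := by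
  refine Submodule.finrank_lt fun h => hZ ?_
  rw [← LinearMap.ker_eq_top, eq_top_iff, ← h]
  exact inf_le_left

lemma sum_jordanDim {U : Type*} [AddCommGroup U] [Module ℂ U] [FiniteDimensional ℂ U]
    (Z : U →ₗ[ℂ] U) (M : ℕ) : (∑ s ∈ Finset.range M, jordanDim Z s) +
      Module.finrank ℂ (LinearMap.range (Z ^ M)) = Module.finrank ℂ U := by
  induction M with
  | zero =>
    have : LinearMap.range (Z ^ 0) = ⊤ := by
      rw [pow_zero]
      exact LinearMap.range_id
    rw [this, Finset.sum_range_zero, zero_add, finrank_top]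
  | succ M ih =>
    rw [Finset.sum_range_succ, add_assoc, jordanDim_add_finrank, ih]

lemma jordanDim_mono {U W : Type*} [AddCommGroup U] [Module ℂ U] [AddCommGroup W] [Module ℂ W]
    [FiniteDimensional ℂ W] {Z : U →ₗ[ℂ] U} {Y : W →ₗ[ℂ] W} {f : U →ₗ[ℂ] W}
    (hf : Function.Injective f) (h : ∀ u, f (Z u) = Y (f u)) (s : ℕ) :
    jordanDim Z s ≤ jordanDim Y s := by
  have hpow : ∀ (k : ℕ) u, f ((Z ^ k) u) = (Y ^ k) (f u) := by
    intro k
    induction k with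
    | zero => intro u; rfl
    | succ k ih => intro u; rw [pow_succ, pow_succ, Module.End.mul_apply, Module.End.mul_apply, ih, h]
  refine LinearMap.finrank_le_finrank_of_injective
    (f := (f.domRestrict (LinearMap.ker Z ⊓ LinearMap.range (Z ^ s))).codRestrict
      (LinearMap.ker Y ⊓ LinearMap.range (Y ^ s)) ?_) ?_
  · rintro ⟨u, hu, ⟨w, rfl⟩⟩
    refine ⟨?_, ⟨f w, (hpow s w).symm⟩⟩
    rw [SetLike.mem_coe, LinearMap.mem_ker] at hu ⊢
    rw [LinearMap.domRestrict_apply, ← h, hu, map_zero]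
  · intro u w huw
    exact Subtype.ext (hf (congrArg Subtype.val huw))

end JordanDimensions

section BlockCommutants

variable {I : Type} [Fintype I] [DecidableEq I] {a : I → ℕ}

/-- The blocks of an element commuting with a block diagonal matrix. -/
def blkHom (S : I → I → Prop) {Z : Matrix (BlkIdx a) (BlkIdx a) ℂ} (hZ : Z ∈ diagSub (blkVert a)) :
    commIn (maskSub (blkVert a) S) Z →ₗ[ℂ] ∀ vw : {vw : I × I // S vw.1 vw.2},
      homComm (blk Z vw.1.2 vw.1.2).mulVecLin (blk Z vw.1.1 vw.1.1).mulVecLin where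
  toFun A vw := ⟨(blk A.1 vw.1.1 vw.1.2).mulVecLin, by
    rw [mem_homComm]
    intro u
    rw [Matrix.mulVecLin_apply, Matrix.mulVecLin_apply, Matrix.mulVecLin_apply,
      Matrix.mulVecLin_apply, Matrix.mulVec_mulVec, Matrix.mulVec_mulVec, ← blk_mul_diag hZ,
      (mem_commIn.1 A.2).2, blk_diag_mul hZ]⟩
  map_add' A B := by
    funext vw
    exact Subtype.ext (by simp [blk_add, Matrix.mulVecLin_add])
  map_smul' c A := by
    funext vw
    refine Subtype.ext ?_
    ext1 u
    simp [blk_smul]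

lemma finrank_commIn_diag (S : I → I → Prop) {Z : Matrix (BlkIdx a) (BlkIdx a) ℂ}
    (hZ : Z ∈ diagSub (blkVert a)) {M : ℕ} (hM : Z ^ M = 0) :
    Module.finrank ℂ (commIn (maskSub (blkVert a) S) Z) = ∑ s ∈ Finset.range M, ∑ v, ∑ w,
      open Classical in if S v w then jordanDim (blk Z v v).mulVecLin s *
        jordanDim (blk Z w w).mulVecLin s else 0 := by
  classical
  have hbij : Function.Bijective (blkHom S hZ) := by
    constructor
    · intro A B h
      refine Subtype.ext (blk_ext fun v w => ?_)
      by_cases hvw : S v w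
      · have h1 := congrArg Subtype.val (congrFun h ⟨(v, w), hvw⟩)
        refine sub_eq_zero.1 (eq_zero_of_mulVecLin (LinearMap.ext fun u => ?_))
        rw [Matrix.mulVecLin_apply, Matrix.sub_mulVec]
        exact sub_eq_zero.2 (LinearMap.congr_fun h1 u)
      · rw [mem_maskSub_iff_blk.1 (mem_commIn.1 A.2).1 v w hvw,
          mem_maskSub_iff_blk.1 (mem_commIn.1 B.2).1 v w hvw]
    · intro f
      let A : Matrix (BlkIdx a) (BlkIdx a) ℂ := Matrix.of fun k l =>
        if h : S k.1 l.1 then LinearMap.toMatrix' (f ⟨(k.1, l.1), h⟩).1 k.2 l.2 else 0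
      have hA : ∀ v w (h : S v w), blk A v w = LinearMap.toMatrix' (f ⟨(v, w), h⟩).1 := by
        intro v w h
        ext k l
        exact dif_pos h
      have hA0 : ∀ v w, ¬ S v w → blk A v w = 0 := by
        intro v w h
        ext k l
        exact dif_neg h
      refine ⟨⟨A, mem_commIn.2 ⟨mem_maskSub_iff_blk.2 hA0, blk_ext fun v w => ?_⟩⟩, ?_⟩
      · rw [blk_mul_diag hZ, blk_diag_mul hZ]
        by_cases h : S v w
        · rw [hA v w h]
          have h1 : (f ⟨(v, w), h⟩).1 ∘ₗ (blk Z w w).mulVecLin =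
            (blk Z v v).mulVecLin ∘ₗ (f ⟨(v, w), h⟩).1 := (f ⟨(v, w), h⟩).2
          generalize (f ⟨(v, w), h⟩).1 = g at h1 ⊢
          have h2 := congrArg LinearMap.toMatrix' h1
          rwa [LinearMap.toMatrix'_comp, LinearMap.toMatrix'_comp, ← Matrix.toLin'_apply',
            ← Matrix.toLin'_apply', LinearMap.toMatrix'_toLin', LinearMap.toMatrix'_toLin'] at h2
        · rw [hA0 v w h, Matrix.zero_mul, Matrix.mul_zero]
      · funext vw
        refine Subtype.ext ?_
        change (blk A vw.1.1 vw.1.2).mulVecLin = _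
        rw [hA _ _ vw.2, ← Matrix.toLin'_apply', Matrix.toLin'_toMatrix']
  rw [(LinearEquiv.ofBijective _ hbij).finrank_eq, Module.finrank_pi_fintype]
  have h1 : ∀ vw : {vw : I × I // S vw.1 vw.2},
      Module.finrank ℂ (homComm (blk Z vw.1.2 vw.1.2).mulVecLin (blk Z vw.1.1 vw.1.1).mulVecLin) =
      ∑ s ∈ Finset.range M, jordanDim (blk Z vw.1.1 vw.1.1).mulVecLin s *
        jordanDim (blk Z vw.1.2 vw.1.2).mulVecLin s := by
    intro vw
    rw [finrank_homComm _ _ M]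
    · exact Finset.sum_congr rfl fun s _ => mul_comm _ _
    · rw [← Matrix.toLin'_apply', ← Matrix.toLin'_pow, ← blk_pow_diag hZ, hM, blk_zero, map_zero]
  rw [Finset.sum_congr rfl fun vw _ => h1 vw, Finset.sum_comm]
  refine Finset.sum_congr rfl fun s _ => ?_
  rw [← Finset.sum_product', Finset.univ_product_univ, ← Finset.sum_filter]
  exact (Finset.sum_subtype (p := fun vw : I × I => S vw.1 vw.2) _ (fun vw => by simp)
    (fun vw => jordanDim (blk Z vw.1 vw.1).mulVecLin s *
      jordanDim (blk Z vw.2 vw.2).mulVecLin s)).symm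

end BlockCommutants

section StarNilpotents

variable {p n : ℕ} {a : Option (Fin (p + 1) × Fin n) → ℕ} {Λ : Matrix (BlkIdx a) (BlkIdx a) ℂ}

/-- The Jordan dimension vectors of a block diagonal matrix. -/
def jordanVec (Z : Matrix (BlkIdx a) (BlkIdx a) ℂ) (s : ℕ) (v : Option (Fin (p + 1) × Fin n)) : ℤ :=
  (jordanDim (blk Z v v).mulVecLin s : ℤ)

lemma endsZero_jordanVec (hend : EndsZero fun v => (a v : ℤ)) (Z : Matrix (BlkIdx a) (BlkIdx a) ℂ)
    (s : ℕ) : EndsZero (jordanVec Z s) := by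
  intro j i hi
  have h := hend j i hi
  have h2 := jordanDim_le (blk Z (some (j, i)) (some (j, i))).mulVecLin s
  rw [Module.finrank_fintype_fun_eq_card, Fintype.card_fin] at h2
  simp only [jordanVec] at h ⊢
  omega

lemma sum_jordanVec {Z : Matrix (BlkIdx a) (BlkIdx a) ℂ} (hZ : Z ∈ diagSub (blkVert a)) {M : ℕ}
    (hM : Z ^ M = 0) : ∑ s ∈ Finset.range M, jordanVec Z s = fun v => (a v : ℤ) := by
  funext v
  have h := sum_jordanDim (blk Z v v).mulVecLin M
  have h1 : (blk Z v v).mulVecLin ^ M = 0 := by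
    rw [← Matrix.toLin'_apply', ← Matrix.toLin'_pow, ← blk_pow_diag hZ, hM, blk_zero, map_zero]
  rw [h1, LinearMap.range_zero, finrank_bot, Module.finrank_fintype_fun_eq_card,
    Fintype.card_fin, add_zero] at h
  rw [Finset.sum_apply]
  simp only [jordanVec]
  exact_mod_cast h

lemma starDrop_jordanVec_nonneg {x Z : Matrix (BlkIdx a) (BlkIdx a) ℂ}
    (hZ : Z ∈ diagSub (blkVert a)) (hx : x ∈ starInj a) (h : Z * x = x * Z) (s : ℕ)
    (j : Fin (p + 1)) (i : Fin n) : 0 ≤ starDrop (jordanVec Z s) j i := by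
  have h1 : jordanDim (blk Z (some (j, i)) (some (j, i))).mulVecLin s ≤
      jordanDim (blk Z (starPar (j, i)) (starPar (j, i))).mulVecLin s := by
    refine jordanDim_mono (f := (blk x (starPar (j, i)) (some (j, i))).mulVecLin) (hx (j, i))
      (fun u => ?_) s
    rw [Matrix.mulVecLin_apply, Matrix.mulVecLin_apply, Matrix.mulVecLin_apply,
      Matrix.mulVecLin_apply, Matrix.mulVec_mulVec, Matrix.mulVec_mulVec, ← blk_mul_diag hZ,
      ← h, blk_diag_mul hZ]
  simp only [starDrop, jordanVec]
  omega

lemma StarHyp.finrank_commIn_lt (h : StarHyp a Λ) (x : Matrix (BlkIdx a) (BlkIdx a) ℂ)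
    (hx : x ∈ starInj a) (Z : Matrix (BlkIdx a) (BlkIdx a) ℂ)
    (hZ : Z ∈ commIn (diagSub (blkVert a)) x) (hnil : IsNilpotent Z) (h0 : Z ≠ 0) :
    Module.finrank ℂ (commIn (maskSub (blkVert a) starRel) Z) +
        Module.finrank ℂ (diagSub (blkVert a)) <
      Module.finrank ℂ (maskSub (blkVert a) starRel) +
        Module.finrank ℂ (commIn (diagSub (blkVert a)) Z) := by
  classical
  have : Nonempty (Fin p) := ⟨⟨0, h.one_le_p⟩⟩
  obtain ⟨hd, hc⟩ := mem_commIn.1 hZ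
  have hM := pow_card_eq_zero_of_isNilpotent hnil
  set M := Fintype.card (BlkIdx a) with hMdef
  have hA := idemVec_pairing h.one_le_n h.ends (one_mem_diagSub (vt := blkVert a)) (mul_one _)
    (one_mem_diagSub (vt := blkVert a)) (mul_one _)
  rw [corner_eq_self, corner_eq_self, corner_eq_self, idemVec_one] at hA
  change 2 * (Module.finrank ℂ (diagSub (blkVert a)) : ℤ) - _ = _ at hA
  simp only [h.last, mul_one, Finset.sum_const, Finset.card_univ, Fintype.card_fin,
    nsmul_eq_mul] at hA
  have hflip : Module.finrank ℂ (maskSub (blkVert a) fun v w => starRel w v) =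
      Module.finrank ℂ (maskSub (blkVert a) starRel) := finrank_maskSub_flip _
  have hdiag : (Module.finrank ℂ (commIn (diagSub (blkVert a)) Z) : ℤ) =
      ∑ s ∈ Finset.range M, ∑ v, jordanVec Z s v * jordanVec Z s v := by
    have h1 : Module.finrank ℂ (commIn (diagSub (blkVert a)) Z) = _ :=
      finrank_commIn_diag (fun v w => v = w) hd hM
    rw [h1]
    push_cast
    refine Finset.sum_congr rfl fun s _ => Finset.sum_congr rfl fun v _ => ?_
    exact (Finset.sum_eq_single v (fun w _ h => if_neg h.symm) (by simp)).trans (if_pos rfl)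
  have hR : (Module.finrank ℂ (commIn (maskSub (blkVert a) starRel) Z) : ℤ) =
      ∑ s ∈ Finset.range M, ∑ v, ∑ w,
        if starRel v w then jordanVec Z s v * jordanVec Z s w else 0 := by
    rw [finrank_commIn_diag _ hd hM]
    push_cast
    rfl
  have hpair : ∀ s, 2 * (∑ v, jordanVec Z s v * jordanVec Z s v) -
      2 * (∑ v, ∑ w, if starRel v w then jordanVec Z s v * jordanVec Z s w else 0) =
      (∑ i, starDrop (jordanVec Z s) (Fin.last p) i * starDrop (jordanVec Z s) (Fin.last p) i) -
        starForm (toStar (jordanVec Z s)) (toStar (jordanVec Z s)) := by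
    intro s
    rw [← star_pairing (endsZero_jordanVec h.ends Z s) h.one_le_n]
    have h1 : (∑ v, ∑ w, if starRel w v then jordanVec Z s v * jordanVec Z s w else 0) =
        ∑ v, ∑ w, if starRel v w then jordanVec Z s v * jordanVec Z s w else 0 := by
      rw [Finset.sum_comm]
      refine Finset.sum_congr rfl fun v _ => Finset.sum_congr rfl fun w _ => ?_
      rw [mul_comm]
    rw [h1]
    ring
  have hsum := sum_jordanVec hd hM
  have hdrop : ∀ i, ∑ s ∈ Finset.range M, starDrop (jordanVec Z s) (Fin.last p) i = 1 := by
    intro i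
    rw [← h.last i, ← hsum]
    simp [starDrop, Finset.sum_apply, Finset.sum_sub_distrib]
  have hsq : ∑ s ∈ Finset.range M, ∑ i, starDrop (jordanVec Z s) (Fin.last p) i *
      starDrop (jordanVec Z s) (Fin.last p) i = n := by
    rw [Finset.sum_comm]
    have h1 : ∀ i, ∑ s ∈ Finset.range M, starDrop (jordanVec Z s) (Fin.last p) i *
        starDrop (jordanVec Z s) (Fin.last p) i = 1 := by
      intro i
      rw [← hdrop i]
      refine Finset.sum_congr rfl fun s hs => ?_
      have h2 := starDrop_jordanVec_nonneg hd hx hc s (Fin.last p) i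
      have h3 := Finset.single_le_sum
        (fun s _ => starDrop_jordanVec_nonneg hd hx hc s (Fin.last p) i) hs
      rw [hdrop i] at h3
      have : starDrop (jordanVec Z s) (Fin.last p) i = 0 ∨
        starDrop (jordanVec Z s) (Fin.last p) i = 1 := by omega
      rcases this with h7 | h7 <;> rw [h7] <;> norm_num
    rw [Finset.sum_congr rfl fun i _ => h1 i]
    simp
  have hS := Finset.sum_congr (rfl : Finset.range M = _) fun s _ => hpair s
  rw [Finset.sum_sub_distrib, Finset.sum_sub_distrib, ← Finset.mul_sum, ← Finset.mul_sum,
    hsq, ← hdiag, ← hR] at hS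
  have hroot : blk Z none none ≠ 0 := fun h1 => h0 (eq_zero_of_root hd hx hc h1)
  have hlt := _root_.sum_starForm_lt (Finset.range M) (κ := fun s => toStar (jordanVec Z s))
    (α := toStar fun v => (a v : ℤ))
    (fun s _ => isDimVec_toStar (endsZero_jordanVec h.ends Z s) h.one_le_n
      (starDrop_jordanVec_nonneg hd hx hc s))
    (by rw [toStar_sum, hsum])
    (fun s _ => by
      have h1 := jordanDim_lt (Z := (blk Z none none).mulVecLin)
        (fun h2 => hroot (eq_zero_of_mulVecLin h2)) s
      rw [Module.finrank_fintype_fun_eq_card, Fintype.card_fin] at h1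
      change (jordanDim (blk Z none none).mulVecLin s : ℤ) < (a none : ℤ)
      exact_mod_cast h1)
    (by
      change 1 ≤ (a none : ℤ)
      have := h.root_dim
      have := h.one_le_n
      omega)
    (fun h2 => h.nonneg (by
      change 2 ≤ (a none : ℤ) at h2
      exact_mod_cast h2))
    (by
      have h1 := h.le_starForm
      have := h.root_dim
      change (a none : ℤ) - 2 ≤ _
      omega)
  zify
  linarith

end StarNilpotents

section StarDensity

variable {p n : ℕ} {a : Option (Fin (p + 1) × Fin n) → ℕ}
  {Λ : Matrix (BlkIdx a) (BlkIdx a) ℂ}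

/-- Near every point of the moment fibre there is one whose first component has only scalar
endomorphisms. -/
theorem StarHyp.exists_near (h : StarHyp a Λ) {O : Set (MatPair (BlkIdx a))} (hO : IsOpen O)
    {z0 : MatPair (BlkIdx a)} (hz0 : z0 ∈ momentSet (blkVert a) starRel Λ)
    (hx0 : z0.1 ∈ starInj a) (hzO : z0 ∈ O) :
    ∃ z ∈ momentSet (blkVert a) starRel Λ, z.1 ∈ starInj a ∧ z ∈ O ∧
      Module.finrank ℂ (commIn (diagSub (blkVert a)) z.1) ≤ 1 := by
  have := h.nonempty
  obtain ⟨z, hz, hx, hzO', hb⟩ := exists_brick isOpen_starInj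
    (fun z hz hx hb => h.exists_idem z hz hx hb) hO hz0 hx0 hzO
  obtain ⟨z', ⟨hz', hx', hzO'', -⟩, hle⟩ := exists_brick_fst h.familyCondition isOpen_starInj hO
    h.central (fun x hx _ Z hZ hnil h0 => h.finrank_commIn_lt x hx Z hZ hnil h0)
    ⟨z, hz, hx, hzO', hb⟩
  exact ⟨z', hz', hx', hzO'', hle⟩

end StarDensity

section PolynomialPaths

open Filter Topology

/-- Polynomial functions on `ℂ`. -/
def PolyFun (f : ℂ → ℂ) : Prop := ∃ P : ℂ[X], ∀ s, f s = P.eval s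

lemma PolyFun.const (c : ℂ) : PolyFun fun _ => c := ⟨Polynomial.C c, by simp⟩

lemma PolyFun.id : PolyFun fun s => s := ⟨Polynomial.X, by simp⟩

lemma PolyFun.add {f g : ℂ → ℂ} : PolyFun f → PolyFun g → PolyFun fun s => f s + g s := by
  rintro ⟨P, hP⟩ ⟨Q, hQ⟩
  exact ⟨P + Q, by simp [hP, hQ]⟩

lemma PolyFun.mul {f g : ℂ → ℂ} : PolyFun f → PolyFun g → PolyFun fun s => f s * g s := by
  rintro ⟨P, hP⟩ ⟨Q, hQ⟩
  exact ⟨P * Q, by simp [hP, hQ]⟩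

lemma PolyFun.sum {ι : Type*} {f : ι → ℂ → ℂ} (S : Finset ι) (h : ∀ i ∈ S, PolyFun (f i)) :
    PolyFun fun s => ∑ i ∈ S, f i s := by
  classical
  induction S using Finset.induction_on with
  | empty => simpa using PolyFun.const 0
  | insert i S hi ih =>
    simp only [Finset.sum_insert hi]
    exact (h i (by simp)).add (ih fun j hj => h j (by simp [hj]))

lemma PolyFun.prod {ι : Type*} {f : ι → ℂ → ℂ} (S : Finset ι) (h : ∀ i ∈ S, PolyFun (f i)) :
    PolyFun fun s => ∏ i ∈ S, f i s := by
  classical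
  induction S using Finset.induction_on with
  | empty => simpa using PolyFun.const 1
  | insert i S hi ih =>
    simp only [Finset.prod_insert hi]
    exact (h i (by simp)).mul (ih fun j hj => h j (by simp [hj]))

lemma PolyFun.finite_zeros {f : ℂ → ℂ} (hf : PolyFun f) {s0 : ℂ} (h0 : f s0 ≠ 0) :
    {s | f s = 0}.Finite := by
  obtain ⟨P, hP⟩ := hf
  have hP0 : P ≠ 0 := by
    rintro rfl
    exact h0 (by simp [hP])
  simp only [hP]
  exact Polynomial.finite_setOfPred_isRoot hP0

lemma PolyFun.isPreconnected {f : ℂ → ℂ} (hf : PolyFun f) {s0 : ℂ} (h0 : f s0 ≠ 0) :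
    IsPreconnected {s | f s ≠ 0} := by
  have h1 : 1 < Module.rank ℝ ℂ := by rw [Complex.rank_real_complex]; norm_num
  exact ((hf.finite_zeros h0).countable.isPathConnected_compl_of_one_lt_rank
    h1).isConnected.isPreconnected

lemma PolyFun.mem_closure {f : ℂ → ℂ} (hf : PolyFun f) {s0 : ℂ} (h0 : f s0 ≠ 0) (s : ℂ) :
    s ∈ closure {s | f s ≠ 0} := by
  have h1 : 1 < Module.rank ℝ ℂ := by rw [Complex.rank_real_complex]; norm_num
  exact (hf.finite_zeros h0).countable.dense_compl ℝ s

variable {V W U : Type*} [AddCommGroup V] [Module ℂ V] [AddCommGroup W] [Module ℂ W]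
  [AddCommGroup U] [Module ℂ U]

/-- Polynomial maps from `ℂ` to a vector space. -/
def PolyMap (f : ℂ → V) : Prop := ∀ φ : V →ₗ[ℂ] ℂ, PolyFun fun s => φ (f s)

lemma PolyMap.const (v : V) : PolyMap fun _ => v := fun φ => PolyFun.const (φ v)

lemma PolyMap.add {f g : ℂ → V} (hf : PolyMap f) (hg : PolyMap g) :
    PolyMap fun s => f s + g s := fun φ => by
  simp only [map_add]; exact (hf φ).add (hg φ)

lemma PolyMap.sum {ι : Type*} {f : ι → ℂ → V} (S : Finset ι) (h : ∀ i ∈ S, PolyMap (f i)) :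
    PolyMap fun s => ∑ i ∈ S, f i s := fun φ => by
  simp only [map_sum]; exact PolyFun.sum S fun i hi => h i hi φ

lemma PolyMap.map {f : ℂ → V} (hf : PolyMap f) (L : V →ₗ[ℂ] W) : PolyMap fun s => L (f s) :=
  fun φ => hf (φ ∘ₗ L)

lemma PolyMap.smul {c : ℂ → ℂ} {f : ℂ → V} (hc : PolyFun c) (hf : PolyMap f) :
    PolyMap fun s => c s • f s := fun φ => by
  simp only [map_smul, smul_eq_mul]; exact hc.mul (hf φ)

lemma PolyMap.sub {f g : ℂ → V} (hf : PolyMap f) (hg : PolyMap g) :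
    PolyMap fun s => f s - g s := by
  simpa [sub_eq_add_neg] using hf.add (PolyMap.smul (PolyFun.const (-1)) hg)

/-- The line through two points. -/
def linePath (u v : V) (s : ℂ) : V := u + s • (v - u)

lemma polyMap_linePath (u v : V) : PolyMap (linePath u v) :=
  (PolyMap.const u).add (PolyMap.smul PolyFun.id (PolyMap.const (v - u)))

@[simp] lemma linePath_zero (u v : V) : linePath u v 0 = u := by simp [linePath]

@[simp] lemma linePath_one (u v : V) : linePath u v 1 = v := by simp [linePath]

lemma linePath_mem {S : Submodule ℂ V} {u v : V} (hu : u ∈ S) (hv : v ∈ S) (s : ℂ) :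
    linePath u v s ∈ S := S.add_mem hu (S.smul_mem _ (S.sub_mem hv hu))

variable [FiniteDimensional ℂ V] [FiniteDimensional ℂ W]

lemma PolyMap.bilin {f : ℂ → V} {g : ℂ → W} (hf : PolyMap f) (hg : PolyMap g)
    (β : V →ₗ[ℂ] W →ₗ[ℂ] U) : PolyMap fun s => β (f s) (g s) := by
  let b := Module.finBasis ℂ V
  have h1 : ∀ s, β (f s) (g s) = ∑ i, b.coord i (f s) • β (b i) (g s) := fun s => by
    conv_lhs => rw [← b.sum_repr (f s)]
    simp only [map_sum, map_smul, LinearMap.sum_apply, LinearMap.smul_apply]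
    rfl
  simp only [h1]
  exact PolyMap.sum _ fun i _ => PolyMap.smul (hf _) (hg.map _)

lemma PolyMap.apply {f : ℂ → V →ₗ[ℂ] W} {g : ℂ → V} (hf : PolyMap f) (hg : PolyMap g) :
    PolyMap fun s => f s (g s) := hf.bilin hg LinearMap.id

lemma PolyMap.comp {f : ℂ → V →ₗ[ℂ] W} {g : ℂ → V →ₗ[ℂ] V} (hf : PolyMap f) (hg : PolyMap g) :
    PolyMap fun s => f s ∘ₗ g s := hf.bilin hg (LinearMap.llcomp ℂ V V W)

variable {m l k : Type*} [Fintype m] [Fintype l] [Fintype k]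

lemma PolyMap.entry {f : ℂ → Matrix m l ℂ} (hf : PolyMap f) (i : m) (j : l) :
    PolyFun fun s => f s i j := hf (Matrix.entryLinearMap ℂ ℂ i j)

lemma PolyMap.of_entries {f : ℂ → Matrix m l ℂ} (h : ∀ i j, PolyFun fun s => f s i j) :
    PolyMap f := by
  classical
  have h1 : ∀ s, f s = ∑ i, ∑ j, f s i j • Matrix.single i j (1 : ℂ) := fun s => by
    conv_lhs => rw [Matrix.matrix_eq_sum_single (f s)]
    simp
  rw [funext h1]
  exact PolyMap.sum _ fun i _ => PolyMap.sum _ fun j _ => PolyMap.smul (h i j) (PolyMap.const _)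

lemma PolyMap.matMul {f : ℂ → Matrix m l ℂ} {g : ℂ → Matrix l k ℂ} (hf : PolyMap f)
    (hg : PolyMap g) : PolyMap fun s => f s * g s := by
  refine PolyMap.of_entries fun i j => ?_
  simp only [Matrix.mul_apply]
  exact PolyFun.sum _ fun x _ => (hf.entry _ _).mul (hg.entry _ _)

lemma PolyMap.det [DecidableEq m] {f : ℂ → Matrix m m ℂ} (hf : PolyMap f) :
    PolyFun fun s => (f s).det := by
  simp only [Matrix.det_apply']
  exact PolyFun.sum _ fun σ _ => (PolyFun.const _).mul (PolyFun.prod _ fun i _ => hf.entry _ _)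

lemma PolyMap.adjugate [DecidableEq m] {f : ℂ → Matrix m m ℂ} (hf : PolyMap f) :
    PolyMap fun s => (f s).adjugate := by
  refine PolyMap.of_entries fun i j => ?_
  simp only [Matrix.adjugate_apply]
  refine PolyMap.det (PolyMap.of_entries fun x y => ?_)
  by_cases h : x = j
  · subst h; simpa using PolyFun.const _
  · simpa [Matrix.updateRow_ne h] using hf.entry _ _

lemma PolyMap.continuous {f : ℂ → Matrix m l ℂ} (hf : PolyMap f) : Continuous f := by
  refine continuous_matrix fun i j => ?_
  obtain ⟨P, hP⟩ := hf.entry i j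
  simpa [hP] using P.continuous

lemma PolyFun.continuous {f : ℂ → ℂ} (hf : PolyFun f) : Continuous f := by
  obtain ⟨P, hP⟩ := hf
  simpa [funext hP] using P.continuous

/-- Polynomial families of endomorphisms have polynomial adjugates. -/
lemma PolyMap.exists_adjugate {T : ℂ → V →ₗ[ℂ] V} (hT : PolyMap T) :
    ∃ (d : ℂ → ℂ) (Adj : ℂ → V →ₗ[ℂ] V), PolyFun d ∧ PolyMap Adj ∧
      (∀ s v, T s (Adj s v) = d s • v) ∧ ∀ s, T s = LinearMap.id → d s = 1 := by
  let b := Module.finBasis ℂ V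
  have h1 : PolyMap fun s => LinearMap.toMatrix b b (T s) :=
    hT.map (LinearMap.toMatrix b b).toLinearMap
  refine ⟨fun s => (LinearMap.toMatrix b b (T s)).det,
    fun s => Matrix.toLin b b (LinearMap.toMatrix b b (T s)).adjugate, h1.det,
    h1.adjugate.map (Matrix.toLin b b).toLinearMap, fun s v => ?_, fun s h => ?_⟩
  · have h2 := Matrix.mul_adjugate (LinearMap.toMatrix b b (T s))
    have h3 := congrArg (Matrix.toLin b b) h2
    rw [Matrix.toLin_mul b b b, Matrix.toLin_toMatrix, map_smul, Matrix.toLin_one] at h3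
    exact congrArg (fun L : V →ₗ[ℂ] V => L v) h3
  · simp only
    rw [h, LinearMap.toMatrix_id, Matrix.det_one]

end PolynomialPaths

section MomentPaths

variable {N : Type} [Fintype N] [DecidableEq N] {I : Type} {vt : N → I} {R : I → I → Prop}

variable (vt R) in
/-- The moment map `(x, A) ↦ [x, A]` restricted to second components supported on the opposite
graph. -/
def momMap : Matrix N N ℂ →ₗ[ℂ] Matrix N N ℂ →ₗ[ℂ] Matrix N N ℂ :=
  LinearMap.mk₂ ℂ (fun x A => diagPr vt (x * maskPr vt (fun v w => R w v) A -
      maskPr vt (fun v w => R w v) A * x))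
    (by intro a b c; rw [← map_add]; congr 1; noncomm_ring)
    (by intro c a b; rw [← map_smul]; simp [smul_sub])
    (by intro a b c; rw [← map_add, map_add]; congr 1; noncomm_ring)
    (by intro c a b; rw [← map_smul, map_smul]; simp [smul_sub])

lemma momMap_apply (x A : Matrix N N ℂ) : momMap vt R x A =
    diagPr vt (x * maskPr vt (fun v w => R w v) A - maskPr vt (fun v w => R w v) A * x) := rfl

lemma momMap_of_mem (x : Matrix N N ℂ) {y : Matrix N N ℂ}
    (hy : y ∈ maskSub vt fun v w => R w v) : momMap vt R x y = diagPr vt (x * y - y * x) := by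
  rw [momMap_apply, maskPr_of_mem hy]

lemma momMap_maskPr (x A : Matrix N N ℂ) :
    momMap vt R x (maskPr vt (fun v w => R w v) A) = momMap vt R x A := by
  rw [momMap_of_mem _ (maskPr_mem _), momMap_apply]

lemma trace_momMap (x A : Matrix N N ℂ) : (momMap vt R x A).trace = 0 := by
  rw [momMap_apply, trace_diagPr, Matrix.trace_sub, Matrix.trace_mul_comm, sub_self]

lemma momMap_mem (x A : Matrix N N ℂ) : momMap vt R x A ∈ diagSub vt := maskPr_mem _

/-- The moment map in the second variable is onto the traceless block diagonal matrices. -/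
lemma exists_momMap_eq [Nonempty N] {x : Matrix N N ℂ} (hx : x ∈ maskSub vt R)
    (h1 : Module.finrank ℂ (commIn (diagSub vt) x) ≤ 1) {D : Matrix N N ℂ} (hD : D ∈ diagSub vt)
    (htr : D.trace = 0) : ∃ A, momMap vt R x A = D := by
  have : D ∈ (⊤ : Submodule ℂ (Matrix N N ℂ)).map (momMap vt R x) := by
    apply mem_of_trace_orthogonal
    intro Y hY
    have hg : diagPr vt Y ∈ diagSub vt := maskPr_mem _
    have e1 : diagPr vt Y * x - x * diagPr vt Y = 0 := by
      apply eq_zero_of_pairing (S := R) (ad_mem hg hx)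
      intro B hB
      have h2 := hY _ (Submodule.mem_map_of_mem (f := momMap vt R x) (Submodule.mem_top (x := B)))
      rw [momMap_of_mem _ hB, ← trace_diagPr_mul] at h2
      rw [← h2, Matrix.sub_mul, Matrix.mul_sub, Matrix.trace_sub, Matrix.trace_sub,
        Matrix.mul_assoc, ← Matrix.mul_assoc _ B x, Matrix.trace_mul_comm _ x, Matrix.mul_assoc]
    have h1' : (1 : Matrix N N ℂ) ∈ commIn (diagSub vt) x := mem_commIn.2 ⟨one_mem_diagSub, by simp⟩
    have hne : (⟨1, h1'⟩ : commIn (diagSub vt) x) ≠ 0 := fun h =>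
      one_ne_zero (congrArg Subtype.val h)
    obtain ⟨c, hc⟩ := (finrank_eq_one_iff_of_nonzero' _ hne).1
      (le_antisymm h1 (Module.finrank_pos_iff_exists_ne_zero.2 ⟨_, hne⟩))
      ⟨_, mem_commIn.2 ⟨hg, sub_eq_zero.1 e1⟩⟩
    have hc' : diagPr vt Y = c • 1 := (congrArg Subtype.val hc).symm
    rw [← maskPr_of_mem hD, ← trace_diagPr_mul, hc', Matrix.smul_mul, Matrix.one_mul,
      Matrix.trace_smul, htr, smul_zero]
  obtain ⟨A, -, h⟩ := this
  exact ⟨A, h⟩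

variable (vt) in
/-- The projection onto the traceless block diagonal matrices. -/
def slPr : Matrix N N ℂ →ₗ[ℂ] Matrix N N ℂ :=
  diagPr vt - ((Fintype.card N : ℂ)⁻¹ • Matrix.traceLinearMap N ℂ ℂ).smulRight 1

lemma slPr_apply (A : Matrix N N ℂ) :
    slPr vt A = diagPr vt A - ((Fintype.card N : ℂ)⁻¹ * A.trace) • 1 := rfl

lemma slPr_mem (A : Matrix N N ℂ) : slPr vt A ∈ diagSub vt :=
  Submodule.sub_mem _ (maskPr_mem _) (Submodule.smul_mem _ _ one_mem_diagSub)

lemma trace_slPr [Nonempty N] (A : Matrix N N ℂ) : (slPr vt A).trace = 0 := by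
  rw [slPr_apply, Matrix.trace_sub, trace_diagPr, Matrix.trace_smul, Matrix.trace_one, smul_eq_mul,
    mul_right_comm, inv_mul_cancel₀ (by simp), one_mul, sub_self]

lemma slPr_of_mem {D : Matrix N N ℂ} (hD : D ∈ diagSub vt) (htr : D.trace = 0) :
    slPr vt D = D := by
  rw [slPr_apply, maskPr_of_mem hD, htr, mul_zero, zero_smul, sub_zero]

lemma exists_comp_eq {V : Type*} [AddCommGroup V] [Module ℂ V] [FiniteDimensional ℂ V]
    {M E : V →ₗ[ℂ] V} (h : ∀ v, ∃ w, M w = E v) : ∃ C : V →ₗ[ℂ] V, ∀ v, M (C v) = E v := by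
  let b := Module.finBasis ℂ V
  choose w hw using fun i => h (b i)
  refine ⟨b.constr ℂ w, fun v => ?_⟩
  have h1 : M ∘ₗ b.constr ℂ w = E := b.ext fun i => by simp [hw]
  exact congrArg (fun L : V →ₗ[ℂ] V => L v) h1

/-- Two points of the moment fibre with scalar endomorphisms of their first components are joined
by a polynomial path in the union of the rescaled moment fibres. -/
theorem exists_polyPath [Nonempty N] {Λ : Matrix N N ℂ} {z0 z1 : MatPair N}
    (hz0 : z0 ∈ momentSet vt R Λ) (hz1 : z1 ∈ momentSet vt R Λ)
    (h0 : Module.finrank ℂ (commIn (diagSub vt) z0.1) ≤ 1)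
    (h1 : Module.finrank ℂ (commIn (diagSub vt) z1.1) ≤ 1) :
    ∃ (d : ℂ → ℂ) (x y : ℂ → Matrix N N ℂ), PolyFun d ∧ PolyMap x ∧ PolyMap y ∧
      d 0 = 1 ∧ d 1 = 1 ∧ x 0 = z0.1 ∧ y 0 = z0.2 ∧ x 1 = z1.1 ∧ y 1 = z1.2 ∧
      ∀ s, x s ∈ maskSub vt R ∧ y s ∈ maskSub vt (fun v w => R w v) ∧
        diagPr vt (x s * y s - y s * x s) = d s • Λ := by
  obtain ⟨C0, hC0⟩ := exists_comp_eq (M := momMap vt R z0.1) (E := slPr vt) fun A =>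
    exists_momMap_eq hz0.1 h0 (slPr_mem A) (trace_slPr A)
  obtain ⟨C1, hC1⟩ := exists_comp_eq (M := momMap vt R z1.1) (E := slPr vt) fun A =>
    exists_momMap_eq hz1.1 h1 (slPr_mem A) (trace_slPr A)
  have hM0 : momMap vt R z0.1 z0.2 = Λ := (momMap_of_mem _ hz0.2.1).trans hz0.2.2
  have hM1 : momMap vt R z1.1 z1.2 = Λ := (momMap_of_mem _ hz1.2.1).trans hz1.2.2
  let x := linePath z0.1 z1.1
  let w := linePath z0.2 z1.2
  let C := linePath C0 C1
  have hx : PolyMap x := polyMap_linePath _ _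
  have hw : PolyMap w := polyMap_linePath _ _
  have hC : PolyMap C := polyMap_linePath _ _
  have hM : PolyMap fun s => momMap vt R (x s) := hx.map _
  let T : ℂ → Matrix N N ℂ →ₗ[ℂ] Matrix N N ℂ := fun s =>
    momMap vt R (x s) ∘ₗ C s + (LinearMap.id - slPr vt)
  have hT : PolyMap T := (hM.comp hC).add (PolyMap.const _)
  have hTs : ∀ s v, T s v = momMap vt R (x s) (C s v) + (v - slPr vt v) := fun s v => rfl
  obtain ⟨d, Adj, hd, hAdj, hadj, hd1⟩ := hT.exists_adjugate
  let r : ℂ → Matrix N N ℂ := fun s => Λ - momMap vt R (x s) (w s)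
  have hr : PolyMap r := (PolyMap.const _).sub (hM.apply hw)
  have hr0 : r 0 = 0 := by simp [r, x, w, hM0]
  have hr1 : r 1 = 0 := by simp [r, x, w, hM1]
  have hsl : ∀ s v, slPr vt (momMap vt R (x s) v) = momMap vt R (x s) v := fun s v =>
    slPr_of_mem (momMap_mem _ _) (trace_momMap _ _)
  have hslr : ∀ s, slPr vt (r s) = r s := fun s => by
    have h2 : slPr vt Λ = Λ := by
      rw [← hM0]
      exact slPr_of_mem (momMap_mem _ _) (trace_momMap _ _)
    simp only [r, map_sub, h2, hsl]
  let y : ℂ → Matrix N N ℂ := fun s =>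
    d s • w s + maskPr vt (fun v w => R w v) (C s (Adj s (r s)))
  have hd0' : d 0 = 1 := hd1 0 (LinearMap.ext fun v => by
    rw [hTs]; simp [x, C, hC0])
  have hd1' : d 1 = 1 := hd1 1 (LinearMap.ext fun v => by
    rw [hTs]; simp [x, C, hC1])
  refine ⟨d, x, y, hd, hx, (PolyMap.smul hd hw).add ((hC.apply (hAdj.apply hr)).map _),
    hd0', hd1', by simp [x], by simp [y, hr0, hd0', w], by simp [x], by simp [y, hr1, hd1', w],
    fun s => ⟨linePath_mem hz0.1 hz1.1 s, ?_⟩⟩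
  have hy : y s ∈ maskSub vt (fun v w => R w v) :=
    Submodule.add_mem _ (Submodule.smul_mem _ _ (linePath_mem hz0.2.1 hz1.2.1 s)) (maskPr_mem _)
  refine ⟨hy, ?_⟩
  rw [← momMap_of_mem _ hy]
  change momMap vt R (x s) (d s • w s + maskPr vt (fun v w => R w v) (C s (Adj s (r s)))) = _
  rw [map_add, map_smul, momMap_maskPr]
  have h2 := hadj s (r s)
  rw [hTs] at h2
  generalize Adj s (r s) = u at h2 ⊢
  have h3 := congrArg (slPr vt) h2
  have hidem : ∀ v, slPr vt (slPr vt v) = slPr vt v := fun v =>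
    slPr_of_mem (slPr_mem v) (trace_slPr v)
  rw [map_add, map_sub, hidem, sub_self, add_zero, map_smul, hslr, hsl] at h3
  rw [h3]
  simp [r, smul_sub]

end MomentPaths

section Burnside

variable {q : ℕ} {T : Type} [Fintype T] [DecidableEq T]

lemma endAdjoin_eq_top [Nonempty T] {ι : Type} {b : ι → Module.End ℂ (T → ℂ)}
    (h : ∀ U : Submodule ℂ (T → ℂ), (∀ j, ∀ v ∈ U, b j v ∈ U) → U = ⊥ ∨ U = ⊤) :
    Algebra.adjoin ℂ (Set.range b) = ⊤ := by
  set S := Algebra.adjoin ℂ (Set.range b) with hS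
  have hsimple : IsSimpleModule S (T → ℂ) := by
    rw [isSimpleModule_iff_toSpanSingleton_surjective]
    refine ⟨inferInstance, fun v hv w => ?_⟩
    let U : Submodule ℂ (T → ℂ) := (LinearMap.range (LinearMap.toSpanSingleton S (T → ℂ) v)).restrictScalars ℂ
    have hvU : v ∈ U := ⟨1, by simp⟩
    rcases h U (by
      rintro j _ ⟨r, rfl⟩
      refine ⟨⟨b j, Algebra.subset_adjoin ⟨j, rfl⟩⟩ * r, ?_⟩
      simp only [LinearMap.toSpanSingleton_apply, mul_smul]
      rfl) with h1 | h1
    · rw [h1, Submodule.mem_bot] at hvU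
      exact absurd hvU hv
    · have hw : w ∈ U := by rw [h1]; trivial
      exact hw
  rw [eq_top_iff]
  intro f _
  let F : Module.End (Module.End S (T → ℂ)) (T → ℂ) :=
    { toFun := f
      map_add' := f.map_add
      map_smul' := fun g v => by
        obtain ⟨c, rfl⟩ := (IsSimpleModule.algebraMap_end_bijective_of_isAlgClosed ℂ
          (A := S) (V := T → ℂ)).2 g
        simp }
  obtain ⟨r, hr⟩ := jacobson_density (R := S) (M := T → ℂ) F
    (Finset.univ.image fun i => Pi.single i (1 : ℂ))
  have h1 : f = (r : Module.End ℂ (T → ℂ)) := by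
    refine (Pi.basisFun ℂ T).ext fun i => ?_
    rw [Pi.basisFun_apply]
    exact hr _ (by simp)
  rw [h1]
  exact r.2

/-- Burnside: an irreducible tuple generates the full matrix algebra. -/
lemma lift_surjective_of_irredTuple {B : Fin q → Matrix T T ℂ} (hB : IrredTuple B) :
    Function.Surjective (FreeAlgebra.lift ℂ B) := by
  rcases isEmpty_or_nonempty T with hT | hT
  · exact fun M => ⟨0, Subsingleton.elim _ _⟩
  · have h1 := endAdjoin_eq_top (b := fun j => Matrix.toLinAlgEquiv' (B j)) (by
      intro U hU
      exact hB U fun j v hv => hU j v hv)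
    intro M
    have h2 : Matrix.toLinAlgEquiv' M ∈ Algebra.adjoin ℂ (Set.range fun j => Matrix.toLinAlgEquiv' (B j)) := by
      rw [h1]; trivial
    rw [Algebra.adjoin_range_eq_range_freeAlgebra_lift] at h2
    obtain ⟨P, hP⟩ := h2
    refine ⟨P, Matrix.toLinAlgEquiv'.injective ?_⟩
    rw [← hP]
    have h3 : (Matrix.toLinAlgEquiv' (R := ℂ) (n := T)).toAlgHom.comp (FreeAlgebra.lift ℂ B) =
        FreeAlgebra.lift ℂ fun j => Matrix.toLinAlgEquiv' (B j) := by
      ext j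
      simp
    exact congrArg (fun L => L P) h3

lemma lift_mulVec_mem {B : Fin q → Matrix T T ℂ} {U : Submodule ℂ (T → ℂ)}
    (hU : ∀ j, ∀ v ∈ U, (B j).mulVec v ∈ U) (P : FreeAlgebra ℂ (Fin q)) :
    ∀ v ∈ U, (FreeAlgebra.lift ℂ B P).mulVec v ∈ U := by
  induction P using FreeAlgebra.induction with
  | grade0 r =>
    intro v hv
    rw [AlgHom.commutes, Algebra.algebraMap_eq_smul_one, Matrix.smul_mulVec, Matrix.one_mulVec]
    exact U.smul_mem r hv
  | grade1 j => intro v hv; rw [FreeAlgebra.lift_ι_apply]; exact hU j v hv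
  | mul a b ha hb =>
    intro v hv
    rw [map_mul, ← Matrix.mulVec_mulVec]
    exact ha _ (hb v hv)
  | add a b ha hb =>
    intro v hv
    rw [map_add, Matrix.add_mulVec]
    exact U.add_mem (ha v hv) (hb v hv)

lemma polyMap_lift {B : ℂ → Fin q → Matrix T T ℂ} (hB : ∀ j, PolyMap fun s => B s j)
    (P : FreeAlgebra ℂ (Fin q)) : PolyMap fun s => FreeAlgebra.lift ℂ (B s) P := by
  induction P using FreeAlgebra.induction with
  | grade0 r => simp only [AlgHom.commutes]; exact PolyMap.const _
  | grade1 j => simp only [FreeAlgebra.lift_ι_apply]; exact hB j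
  | mul a b ha hb => simp only [map_mul]; exact ha.matMul hb
  | add a b ha hb => simp only [map_add]; exact ha.add hb

lemma continuous_lift (P : FreeAlgebra ℂ (Fin q)) :
    Continuous fun B : Fin q → Matrix T T ℂ => FreeAlgebra.lift ℂ B P := by
  induction P using FreeAlgebra.induction with
  | grade0 r => simp only [AlgHom.commutes]; exact continuous_const
  | grade1 j => simp only [FreeAlgebra.lift_ι_apply]; exact continuous_apply j
  | mul a b ha hb => simp only [map_mul]; exact ha.matrix_mul hb
  | add a b ha hb => simp only [map_add]; exact ha.add hb

/-- Irreducibility at a point is witnessed by the nonvanishing of a polynomial. -/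
lemma exists_irred_certificate {B0 : Fin q → Matrix T T ℂ} (h0 : IrredTuple B0) :
    ∃ c : (Fin q → Matrix T T ℂ) → ℂ, Continuous c ∧ c B0 ≠ 0 ∧ (∀ B, c B ≠ 0 → IrredTuple B) ∧
      ∀ B : ℂ → Fin q → Matrix T T ℂ, (∀ j, PolyMap fun s => B s j) → PolyFun fun s => c (B s) := by
  choose P hP using fun e : T × T =>
    lift_surjective_of_irredTuple h0 (Matrix.single e.1 e.2 1)
  let G : (Fin q → Matrix T T ℂ) → Matrix (T × T) (T × T) ℂ := fun B =>
    Matrix.of fun e f => FreeAlgebra.lift ℂ B (P e) f.1 f.2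
  refine ⟨fun B => (G B).det, ?_, ?_, fun B hB U hU => ?_, fun B hB => ?_⟩
  · refine Continuous.matrix_det (continuous_matrix fun e f => ?_)
    exact (continuous_lift (P e)).matrix_elem _ _
  · have h1 : G B0 = 1 := by
      ext e f
      simp only [G, Matrix.of_apply, hP, Matrix.single_apply, Matrix.one_apply, Prod.ext_iff]
    simp only [h1, Matrix.det_one]
    exact one_ne_zero
  · have hinv : (G B)⁻¹ * G B = 1 := Matrix.nonsing_inv_mul _ (isUnit_iff_ne_zero.2 hB)
    have hsingle : ∀ k l : T, Matrix.single k l (1 : ℂ) =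
        ∑ e, (G B)⁻¹ (k, l) e • FreeAlgebra.lift ℂ B (P e) := fun k l => by
      ext i j
      have h1 := congrFun (congrFun hinv (k, l)) (i, j)
      rw [Matrix.mul_apply] at h1
      simp only [Matrix.sum_apply, Matrix.smul_apply, smul_eq_mul]
      rw [show ∑ e, (G B)⁻¹ (k, l) e * FreeAlgebra.lift ℂ B (P e) i j = _ from h1]
      simp only [Matrix.single_apply, Matrix.one_apply, Prod.ext_iff]
    rw [or_iff_not_imp_left]
    intro hU0
    obtain ⟨v, hv, hv0⟩ := Submodule.exists_mem_ne_zero_of_ne_bot hU0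
    obtain ⟨l, hl⟩ := Function.ne_iff.1 hv0
    have hk : ∀ k, Pi.single k (1 : ℂ) ∈ U := fun k => by
      have h1 : (Matrix.single k l (1 : ℂ)).mulVec v ∈ U := by
        rw [hsingle, Matrix.sum_mulVec]
        refine U.sum_mem fun e _ => ?_
        rw [Matrix.smul_mulVec]
        exact U.smul_mem _ (lift_mulVec_mem hU _ v hv)
      have h2 : Pi.single k (1 : ℂ) = (v l)⁻¹ • (Matrix.single k l (1 : ℂ)).mulVec v := by
        have hl' : v l ≠ 0 := hl
        ext i
        simp [Matrix.single_mulVec, Pi.single_apply, Function.update_apply]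
        rw [inv_mul_cancel₀ hl']
      rw [h2]
      exact U.smul_mem _ h1
    rw [eq_top_iff]
    intro w _
    rw [pi_eq_sum_univ' w]
    refine U.sum_mem fun i _ => U.smul_mem _ ?_
    convert hk i using 1
  · exact PolyMap.det (PolyMap.of_entries fun e f => (polyMap_lift hB (P e)).entry _ _)

end Burnside

section PolynomiallyOpen

open Topology

variable {N : Type} [Fintype N] [DecidableEq N]

/-- Sets of pairs in which every point is separated from the complement by a polynomial. -/
def PolyOpen (G : Set (MatPair N)) : Prop :=
  ∀ z0 ∈ G, ∃ c : MatPair N → ℂ, Continuous c ∧ c z0 ≠ 0 ∧ (∀ z, c z ≠ 0 → z ∈ G) ∧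
    ∀ x y : ℂ → Matrix N N ℂ, PolyMap x → PolyMap y → PolyFun fun s => c (x s, y s)

lemma PolyOpen.isOpen {G : Set (MatPair N)} (hG : PolyOpen G) : IsOpen G := by
  rw [isOpen_iff_mem_nhds]
  intro z hz
  obtain ⟨c, hc, h0, h1, -⟩ := hG z hz
  filter_upwards [hc.continuousAt.eventually_ne h0] with z' hz' using h1 z' hz'

lemma PolyOpen.inter {G G' : Set (MatPair N)} (hG : PolyOpen G) (hG' : PolyOpen G') :
    PolyOpen (G ∩ G') := by
  rintro z ⟨hz, hz'⟩
  obtain ⟨c, hc, h0, h1, h2⟩ := hG z hz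
  obtain ⟨c', hc', h0', h1', h2'⟩ := hG' z hz'
  exact ⟨fun z => c z * c' z, hc.mul hc', mul_ne_zero h0 h0',
    fun z h => ⟨h1 z (left_ne_zero_of_mul h), h1' z (right_ne_zero_of_mul h)⟩,
    fun x y hx hy => (h2 x y hx hy).mul (h2' x y hx hy)⟩

lemma PolyOpen.iInter {ι : Type} [Fintype ι] {G : ι → Set (MatPair N)} (hG : ∀ i, PolyOpen (G i)) :
    PolyOpen (⋂ i, G i) := by
  intro z hz
  rw [Set.mem_iInter] at hz
  choose c hc h0 h1 h2 using fun i => hG i z (hz i)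
  refine ⟨fun z => ∏ i, c i z, continuous_finsetProd _ fun i _ => hc i,
    Finset.prod_ne_zero_iff.2 fun i _ => h0 i, fun z h => Set.mem_iInter.2 fun i =>
      h1 i z (Finset.prod_ne_zero_iff.1 h i (Finset.mem_univ i)),
    fun x y hx hy => PolyFun.prod _ fun i _ => h2 i x y hx hy⟩

variable {I : Type} {vt : N → I} {R : I → I → Prop}

/-- From a point of a polynomially open set one can move inside it, within the moment fibre,
arbitrarily close to any other point with scalar endomorphisms. -/
lemma exists_preconnected_path [Nonempty N] {Λ : Matrix N N ℂ} {G : Set (MatPair N)}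
    (hG : PolyOpen G) (hsc : ∀ z ∈ G, ∀ t : ℂ, t ≠ 0 → ((z.1, t • z.2) : MatPair N) ∈ G)
    {z0 z1 : MatPair N}
    (hz0 : z0 ∈ momentSet vt R Λ) (hz1 : z1 ∈ momentSet vt R Λ)
    (h0 : Module.finrank ℂ (commIn (diagSub vt) z0.1) ≤ 1)
    (h1 : Module.finrank ℂ (commIn (diagSub vt) z1.1) ≤ 1) (hG0 : z0 ∈ G) :
    ∃ K ⊆ momentSet vt R Λ ∩ G, IsPreconnected K ∧ z0 ∈ K ∧ z1 ∈ closure K := by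
  obtain ⟨d, x, y, hd, hx, hy, hd0, hd1, hx0, hy0, hx1, hy1, hs⟩ := exists_polyPath hz0 hz1 h0 h1
  obtain ⟨c, hc, hc0, hcG, hcP⟩ := hG z0 hG0
  let f : ℂ → MatPair N := fun s => (x s, (d s)⁻¹ • y s)
  have hf0 : f 0 = z0 := by simp [f, hd0, hx0, hy0]
  have hf1 : f 1 = z1 := by simp [f, hd1, hx1, hy1]
  have hF : PolyFun fun s => d s * c (x s, y s) := hd.mul (hcP x y hx hy)
  have hF0 : d 0 * c (x 0, y 0) ≠ 0 := by
    rw [hd0, hx0, hy0, one_mul]; exact hc0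
  have hcont : ∀ s, d s ≠ 0 → ContinuousAt f s := fun s hs =>
    hx.continuous.continuousAt.prodMk
      ((hd.continuous.continuousAt.inv₀ hs).smul hy.continuous.continuousAt)
  refine ⟨f '' {s | d s * c (x s, y s) ≠ 0}, ?_, ?_, ⟨0, hF0, hf0⟩, ?_⟩
  · rintro _ ⟨s, hs', rfl⟩
    have hds := left_ne_zero_of_mul hs'
    obtain ⟨h2, h3, h4⟩ := hs s
    refine ⟨⟨h2, Submodule.smul_mem _ _ h3, ?_⟩,
      hsc _ (hcG _ (right_ne_zero_of_mul hs')) _ (inv_ne_zero hds)⟩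
    simp only [f]
    rw [Matrix.mul_smul, Matrix.smul_mul, ← smul_sub, map_smul, h4, smul_smul,
      inv_mul_cancel₀ hds, one_smul]
  · exact (hF.isPreconnected hF0).image _ fun s hs' =>
      (hcont s (left_ne_zero_of_mul hs')).continuousWithinAt
  · rw [← hf1]
    exact (hcont 1 (by rw [hd1]; exact one_ne_zero)).continuousWithinAt.mem_closure_image
      (hF.mem_closure hF0 1)

end PolynomiallyOpen

section StarGood

variable {p n : ℕ} {a : Option (Fin (p + 1) × Fin n) → ℕ}

variable (a) in
/-- Pairs with injective first components, surjective second components, and irreducible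
induced tuple at the root. -/
def goodSet : Set (MatPair (BlkIdx a)) :=
  {z | z.1 ∈ starInj a ∧ (∀ α, Function.Surjective (blk z.2 (some α) (starPar α)).mulVec) ∧
    IrredTuple (rootMap z)}

lemma exists_left_inverse_of_injective {l m : Type} [Fintype l] [Fintype m] [DecidableEq m]
    {M : Matrix l m ℂ} (h : Function.Injective M.mulVec) : ∃ L : Matrix m l ℂ, L * M = 1 := by
  classical
  obtain ⟨g, hg⟩ := M.mulVecLin.exists_leftInverse_of_injective (LinearMap.ker_eq_bot.2 h)
  refine ⟨LinearMap.toMatrix' g, ?_⟩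
  rw [← LinearMap.toMatrix'_id, ← hg, LinearMap.toMatrix'_comp, ← Matrix.toLin'_apply',
    LinearMap.toMatrix'_toLin']

lemma polyMap_blk {x : ℂ → Matrix (BlkIdx a) (BlkIdx a) ℂ} (hx : PolyMap x)
    (v w : Option (Fin (p + 1) × Fin n)) : PolyMap fun s => blk (x s) v w :=
  PolyMap.of_entries fun _ _ => hx.entry _ _

lemma polyOpen_injective (v w : Option (Fin (p + 1) × Fin n)) :
    PolyOpen {z : MatPair (BlkIdx a) | Function.Injective (blk z.1 v w).mulVec} := by
  intro z hz
  obtain ⟨L, hL⟩ := exists_left_inverse_of_injective hz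
  refine ⟨fun z => (L * blk z.1 v w).det, ?_, ?_, fun z hz => ?_, fun x y hx hy => ?_⟩
  · exact (continuous_const.matrix_mul ((continuous_blk v w).comp continuous_fst)).matrix_det
  · simp only [hL, Matrix.det_one]; exact one_ne_zero
  · have h1 := Matrix.mulVec_injective_of_isUnit
      ((Matrix.isUnit_iff_isUnit_det _).2 (isUnit_iff_ne_zero.2 hz))
    intro u u' huu
    apply h1
    rw [← Matrix.mulVec_mulVec, ← Matrix.mulVec_mulVec]
    exact congrArg _ huu
  · exact ((PolyMap.const L).matMul (polyMap_blk hx v w)).det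

lemma polyOpen_surjective (v w : Option (Fin (p + 1) × Fin n)) :
    PolyOpen {z : MatPair (BlkIdx a) | Function.Surjective (blk z.2 v w).mulVec} := by
  intro z hz
  obtain ⟨L, hL⟩ := Matrix.mulVec_surjective_iff_exists_right_inverse.1 hz
  refine ⟨fun z => (blk z.2 v w * L).det, ?_, ?_, fun z hz => ?_, fun x y hx hy => ?_⟩
  · exact (((continuous_blk v w).comp continuous_snd).matrix_mul continuous_const).matrix_det
  · simp only [hL, Matrix.det_one]; exact one_ne_zero
  · have h1 := Matrix.mulVec_surjective_iff_isUnit.2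
      ((Matrix.isUnit_iff_isUnit_det _).2 (isUnit_iff_ne_zero.2 hz))
    intro u
    obtain ⟨w', hw'⟩ := h1 u
    exact ⟨L.mulVec w', by rw [Matrix.mulVec_mulVec]; exact hw'⟩
  · exact ((polyMap_blk hy v w).matMul (PolyMap.const L)).det

lemma polyMap_rootMap {x y : ℂ → Matrix (BlkIdx a) (BlkIdx a) ℂ} (hx : PolyMap x) (hy : PolyMap y)
    (j : Fin (p + 1)) : PolyMap fun s => rootMap ((x s, y s) : MatPair (BlkIdx a)) j :=
  PolyMap.sum _ fun _ _ => (polyMap_blk hx _ _).matMul (polyMap_blk hy _ _)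

lemma continuous_rootMap : Continuous fun z : MatPair (BlkIdx a) => rootMap z :=
  continuous_pi fun _ => continuous_finsetSum _ fun _ _ =>
    ((continuous_blk _ _).comp continuous_fst).matrix_mul
      ((continuous_blk _ _).comp continuous_snd)

lemma polyOpen_irred : PolyOpen {z : MatPair (BlkIdx a) | IrredTuple (rootMap z)} := by
  intro z hz
  obtain ⟨c, hc, h0, h1, h2⟩ := exists_irred_certificate hz
  exact ⟨fun z => c (rootMap z), hc.comp continuous_rootMap, h0, fun z hz => h1 _ hz,
    fun x y hx hy => h2 _ fun j => polyMap_rootMap hx hy j⟩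

lemma polyOpen_goodSet : PolyOpen (goodSet a) := by
  have h1 : goodSet a =
      (⋂ α, {z : MatPair (BlkIdx a) | Function.Injective (blk z.1 (starPar α) (some α)).mulVec}) ∩
      ((⋂ α, {z : MatPair (BlkIdx a) |
        Function.Surjective (blk z.2 (some α) (starPar α)).mulVec}) ∩
        {z : MatPair (BlkIdx a) | IrredTuple (rootMap z)}) := by
    ext z
    simp [goodSet, starInj]
  rw [h1]
  exact (PolyOpen.iInter fun α => polyOpen_injective _ _).inter
    ((PolyOpen.iInter fun α => polyOpen_surjective _ _).inter polyOpen_irred)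

lemma rootMap_smul (z : MatPair (BlkIdx a)) (t : ℂ) (j : Fin (p + 1)) :
    rootMap ((z.1, t • z.2) : MatPair (BlkIdx a)) j = t • rootMap z j := by
  simp only [rootMap, Finset.smul_sum, blk_smul, Matrix.mul_smul]

lemma irredTuple_smul {T : Type} [Fintype T] {q : ℕ} {B : Fin q → Matrix T T ℂ} (h : IrredTuple B)
    {t : ℂ} (ht : t ≠ 0) : IrredTuple fun j => t • B j := by
  intro U hU
  refine h U fun j v hv => ?_
  have h1 := U.smul_mem t⁻¹ (hU j v hv)
  rwa [Matrix.smul_mulVec, smul_smul, inv_mul_cancel₀ ht, one_smul] at h1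

lemma goodSet_smul {z : MatPair (BlkIdx a)} (hz : z ∈ goodSet a) {t : ℂ} (ht : t ≠ 0) :
    ((z.1, t • z.2) : MatPair (BlkIdx a)) ∈ goodSet a := by
  obtain ⟨h1, h2, h3⟩ := hz
  refine ⟨h1, fun α u => ?_, ?_⟩
  · obtain ⟨u', hu'⟩ := h2 α (t⁻¹ • u)
    refine ⟨u', ?_⟩
    rw [blk_smul, Matrix.smul_mulVec, hu', smul_smul, mul_inv_cancel₀ ht, one_smul]
  · rw [funext (rootMap_smul z t)]
    exact irredTuple_smul h3 ht

variable {Λ : Matrix (BlkIdx a) (BlkIdx a) ℂ}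

/-- The good part of the moment fibre contains a connected set dense in the whole fibre. -/
theorem StarHyp.exists_connected (h : StarHyp a Λ)
    (hne : (momentSet (blkVert a) starRel Λ ∩ goodSet a).Nonempty) :
    ∃ H ⊆ momentSet (blkVert a) starRel Λ ∩ goodSet a, IsConnected H ∧
      ∀ z ∈ momentSet (blkVert a) starRel Λ, z.1 ∈ starInj a → z ∈ closure H := by
  have := h.nonempty
  obtain ⟨zg, hzg, hzgG⟩ := hne
  obtain ⟨z0, hz0, -, hz0G, hz0r⟩ := h.exists_near polyOpen_goodSet.isOpen hzg hzgG.1 hzgG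
  let G := momentSet (blkVert a) starRel Λ ∩ goodSet a
  refine ⟨connectedComponentIn G z0, connectedComponentIn_subset _ _,
    isConnected_connectedComponentIn_iff.2 ⟨hz0, hz0G⟩, fun z hz hx => ?_⟩
  rw [← closure_closure, mem_closure_iff]
  intro O hO hzO
  obtain ⟨z1, hz1, -, hz1O, hz1r⟩ := h.exists_near hO hz hx hzO
  obtain ⟨K, hKG, hK, hK0, hK1⟩ := exists_preconnected_path polyOpen_goodSet
    (fun z hz t ht => goodSet_smul hz ht) hz0 hz1 hz0r hz1r hz0G
  exact ⟨z1, hz1O, closure_mono (hK.subset_connectedComponentIn hK0 hKG) hK1⟩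

end StarGood

section StarMoment

variable {q n : ℕ} {a : Option (Fin q × Fin n) → ℕ}

lemma starRel_par (α : Fin q × Fin n) : starRel (starPar α) (some α) := ⟨α, rfl, rfl⟩

lemma not_starRel_none (v : Option (Fin q × Fin n)) : ¬ starRel v none := by
  rintro ⟨α, h, -⟩; cases h

lemma starRel_some {v : Option (Fin q × Fin n)} {α : Fin q × Fin n} :
    starRel v (some α) ↔ v = starPar α := by
  constructor
  · rintro ⟨β, h, h'⟩
    cases h
    exact h'
  · rintro rfl; exact starRel_par α

lemma starRel_from_some {j : Fin q} {i : Fin n} {w : Option (Fin q × Fin n)}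
    (h : starRel (some (j, i)) w) : ∃ hi : (i : ℕ) + 1 < n, w = some (j, ⟨i + 1, hi⟩) := by
  obtain ⟨⟨j', ⟨_ | i', hi'⟩⟩, rfl, h2⟩ := h
  · simp [starPar] at h2
  · simp only [starPar, Option.some.injEq, Prod.mk.injEq] at h2
    obtain ⟨rfl, rfl⟩ := h2
    exact ⟨hi', rfl⟩

variable {x y : Matrix (BlkIdx a) (BlkIdx a) ℂ}

lemma blk_moment_none (hx : x ∈ maskSub (blkVert a) starRel)
    (hy : y ∈ maskSub (blkVert a) fun v w => starRel w v) :
    blk (x * y - y * x) none none = ∑ j, rootMap ((x, y) : MatPair (BlkIdx a)) j := by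
  rw [blk_sub, blk_mul, blk_mul, Fintype.sum_option, Fintype.sum_prod_type]
  have h1 : ∀ w, blk y none w = 0 := fun w =>
    mem_maskSub_iff_blk.1 hy _ _ (not_starRel_none w)
  have h2 : blk x none none = 0 := mem_maskSub_iff_blk.1 hx _ _ (not_starRel_none _)
  simp [h1, h2, rootMap]

lemma sum_blk_par (hx : x ∈ maskSub (blkVert a) starRel) (α : Fin q × Fin n) :
    ∑ w, blk y (some α) w * blk x w (some α) =
      blk y (some α) (starPar α) * blk x (starPar α) (some α) := by
  refine Finset.sum_eq_single _ (fun w _ hw => ?_) (by simp)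
  rw [mem_maskSub_iff_blk.1 hx w (some α) (fun h => hw (starRel_some.1 h)), Matrix.mul_zero]

lemma blk_moment_some (hx : x ∈ maskSub (blkVert a) starRel) (j : Fin q) (i : ℕ)
    (hi : i + 1 < n) (hi' : i < n) :
    blk (x * y - y * x) (some (j, ⟨i, hi'⟩)) (some (j, ⟨i, hi'⟩)) =
      blk x (some (j, ⟨i, hi'⟩)) (some (j, ⟨i + 1, hi⟩)) *
          blk y (some (j, ⟨i + 1, hi⟩)) (some (j, ⟨i, hi'⟩)) -
        blk y (some (j, ⟨i, hi'⟩)) (starPar (j, ⟨i, hi'⟩)) *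
          blk x (starPar (j, ⟨i, hi'⟩)) (some (j, ⟨i, hi'⟩)) := by
  rw [blk_sub, blk_mul, blk_mul, sum_blk_par hx]
  congr 1
  refine Finset.sum_eq_single _ (fun w _ hw => ?_) (by simp)
  rw [mem_maskSub_iff_blk.1 hx _ w, Matrix.zero_mul]
  intro h
  obtain ⟨h1, h2⟩ := starRel_from_some h
  exact hw h2

/-- The scalars of the moment map equation attached to eigenvalues along the arms. -/
def starLamVal (ξ : Fin q → ℕ → ℂ) : Option (Fin q × Fin n) → ℂ
  | none => -∑ j, ξ j 0
  | some (j, i) => ξ j i - ξ j (i + 1)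

variable (a) in
/-- The right hand side of the moment map equation. -/
def starLam (ξ : Fin q → ℕ → ℂ) : Matrix (BlkIdx a) (BlkIdx a) ℂ :=
  Matrix.diagonal fun k => starLamVal ξ (blkVert a k)

lemma starLam_mem (ξ : Fin q → ℕ → ℂ) : starLam a ξ ∈ diagSub (blkVert a) := by
  intro k l hkl
  exact Matrix.diagonal_apply_ne _ fun h => hkl (by rw [h])

lemma blk_starLam (ξ : Fin q → ℕ → ℂ) (v : Option (Fin q × Fin n)) :
    blk (starLam a ξ) v v = starLamVal ξ v • 1 := by
  ext k l
  simp only [blk_apply, starLam, Matrix.diagonal_apply, Matrix.smul_apply, Matrix.one_apply,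
    smul_eq_mul, mul_ite, mul_one, mul_zero]
  simp

lemma starLam_central (ξ : Fin q → ℕ → ℂ) (Z : Matrix (BlkIdx a) (BlkIdx a) ℂ)
    (hZ : Z ∈ diagSub (blkVert a)) : Z * starLam a ξ = starLam a ξ * Z := by
  ext k l
  rw [starLam, Matrix.mul_diagonal, Matrix.diagonal_mul]
  by_cases h : blkVert a k = blkVert a l
  · rw [h, mul_comm]
  · rw [hZ k l h]; simp

lemma mem_momentSet_starLam {ξ : Fin q → ℕ → ℂ} {z : MatPair (BlkIdx a)} :
    z ∈ momentSet (blkVert a) starRel (starLam a ξ) ↔ z.1 ∈ maskSub (blkVert a) starRel ∧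
      z.2 ∈ maskSub (blkVert a) (fun v w => starRel w v) ∧
      ∀ v, blk (z.1 * z.2 - z.2 * z.1) v v = starLamVal ξ v • 1 := by
  refine and_congr_right fun _ => and_congr_right fun _ => ⟨fun h v => ?_, fun h => ?_⟩
  · rw [← blk_starLam, ← h, blk_diagPr]
  · refine diag_ext (maskPr_mem _) (starLam_mem ξ) fun v => ?_
    rw [blk_diagPr, h, blk_starLam]

variable (a) in
/-- The matrix with prescribed blocks on the edges towards the centre. -/
def starUp (F : ∀ α : Fin q × Fin n, Matrix (Fin (a (starPar α))) (Fin (a (some α))) ℂ) :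
    Matrix (BlkIdx a) (BlkIdx a) ℂ :=
  Matrix.of fun
    | ⟨_, _⟩, ⟨none, _⟩ => 0
    | ⟨v, k⟩, ⟨some α, l⟩ => if h : v = starPar α then F α (h ▸ k) l else 0

lemma starUp_mem (F : ∀ α : Fin q × Fin n, Matrix (Fin (a (starPar α))) (Fin (a (some α))) ℂ) :
    starUp a F ∈ maskSub (blkVert a) starRel := by
  rintro ⟨v, k⟩ ⟨_ | α, l⟩ h
  · rfl
  · exact dif_neg fun h' => h (starRel_some.2 h')

lemma blk_starUp (F : ∀ α : Fin q × Fin n, Matrix (Fin (a (starPar α))) (Fin (a (some α))) ℂ)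
    (α : Fin q × Fin n) : blk (starUp a F) (starPar α) (some α) = F α := by
  ext k l
  exact dif_pos rfl

lemma exists_star_pair (X : ∀ α : Fin q × Fin n, Matrix (Fin (a (starPar α))) (Fin (a (some α))) ℂ)
    (Y : ∀ α : Fin q × Fin n, Matrix (Fin (a (some α))) (Fin (a (starPar α))) ℂ) :
    ∃ z : MatPair (BlkIdx a), z.1 ∈ maskSub (blkVert a) starRel ∧
      z.2 ∈ maskSub (blkVert a) (fun v w => starRel w v) ∧
      (∀ α, blk z.1 (starPar α) (some α) = X α) ∧ ∀ α, blk z.2 (some α) (starPar α) = Y α := by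
  refine ⟨(starUp a X, (starUp a fun α => (Y α)ᵀ)ᵀ), starUp_mem X, ?_, blk_starUp X, fun α => ?_⟩
  · intro k l h
    exact starUp_mem (fun α => (Y α)ᵀ) l k h
  · have h1 := blk_starUp (fun α => (Y α)ᵀ) α
    have h2 := congrArg Matrix.transpose h1
    rw [Matrix.transpose_transpose] at h2
    exact h2

/-- On the masked subspaces only the first edge of an arm contributes to the map at the centre. -/
lemma rootMap_eq (hx : x ∈ maskSub (blkVert a) starRel) (hn : 0 < n) (j : Fin q) :
    rootMap ((x, y) : MatPair (BlkIdx a)) j =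
      blk x none (some (j, ⟨0, hn⟩)) * blk y (some (j, ⟨0, hn⟩)) none := by
  refine Finset.sum_eq_single _ (fun i _ hi => ?_) (by simp)
  rw [mem_maskSub_iff_blk.1 hx none (some (j, i)), Matrix.zero_mul]
  rw [starRel_some]
  obtain ⟨_ | i, h⟩ := i
  · exact absurd rfl hi
  · simp [starPar]

end StarMoment

section Chain

/-- The relations along an arm. -/
def ChainEq {b : ℕ → ℕ} (X : ∀ i, Matrix (Fin (b i)) (Fin (b (i + 1))) ℂ)
    (Y : ∀ i, Matrix (Fin (b (i + 1))) (Fin (b i)) ℂ) (ξ : ℕ → ℂ) : Prop :=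
  ∀ i, X (i + 1) * Y (i + 1) + ξ (i + 1) • 1 = Y i * X i + ξ i • 1

lemma charpoly_add_smul_one {T : Type} [Fintype T] [DecidableEq T] (M : Matrix T T ℂ) (c : ℂ) :
    (M + c • 1).charpoly = M.charpoly.comp (Polynomial.X - Polynomial.C c) := by
  have h := Matrix.charpoly_sub_scalar M (-c)
  rw [map_neg, sub_neg_eq_add, map_neg, ← sub_eq_add_neg] at h
  rwa [Matrix.scalar_apply, ← Matrix.smul_one_eq_diagonal] at h

lemma charpoly_step {k l : ℕ} (X : Matrix (Fin k) (Fin l) ℂ) (Y : Matrix (Fin l) (Fin k) ℂ)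
    (c : ℂ) (h : l ≤ k) : (X * Y + c • 1).charpoly =
      (Polynomial.X - Polynomial.C c) ^ (k - l) * (Y * X + c • 1).charpoly := by
  rw [charpoly_add_smul_one, charpoly_add_smul_one,
    Matrix.charpoly_mul_comm_of_le _ _ (by simpa using h)]
  simp

variable {b : ℕ → ℕ} {X : ∀ i, Matrix (Fin (b i)) (Fin (b (i + 1))) ℂ}
  {Y : ∀ i, Matrix (Fin (b (i + 1))) (Fin (b i)) ℂ} {ξ : ℕ → ℂ}

lemma ChainEq.charpoly_eq (h : ChainEq X Y ξ) (hb : Antitone b) (m : ℕ) :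
    (X 0 * Y 0 + ξ 0 • 1).charpoly =
      (∏ i ∈ Finset.range m, (Polynomial.X - Polynomial.C (ξ i)) ^ (b i - b (i + 1))) *
        (X m * Y m + ξ m • 1).charpoly := by
  induction m with
  | zero => simp
  | succ m ih =>
    rw [ih, Finset.prod_range_succ, charpoly_step _ _ _ (hb (Nat.le_succ m)), h m, mul_assoc]

end Chain

section ArmChain

variable {q n : ℕ} {a : Option (Fin q × Fin n) → ℕ}

/-- The vertices along an arm, starting at the centre and stopping at the last vertex. -/
def armVert (hn : 0 < n) (j : Fin q) : ℕ → Option (Fin q × Fin n)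
  | 0 => none
  | i + 1 => some (j, ⟨min i (n - 1), by omega⟩)

lemma armVert_succ (hn : 0 < n) (j : Fin q) {i : ℕ} (hi : i < n) :
    armVert hn j (i + 1) = some (j, ⟨i, hi⟩) := by
  have : min i (n - 1) = i := by omega
  simp [armVert, this]

lemma armVert_par (hn : 0 < n) (j : Fin q) {i : ℕ} (hi : i < n) :
    armVert hn j i = starPar (j, ⟨i, hi⟩) := by
  cases i with
  | zero => rfl
  | succ i => exact armVert_succ hn j (Nat.lt_of_succ_lt hi)

lemma EndsZero.armVert_eq_zero (h : EndsZero fun v => (a v : ℤ)) (hn : 0 < n) (j : Fin q) {i : ℕ}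
    (hi : n ≤ i) : a (armVert hn j i) = 0 := by
  obtain ⟨i, rfl⟩ : ∃ k, i = k + 1 := ⟨i - 1, by omega⟩
  have : min i (n - 1) = n - 1 := by omega
  simp only [armVert, this]
  have h1 := h j ⟨n - 1, by omega⟩ (by simp; omega)
  exact Int.ofNat_eq_zero.1 h1

lemma chainEq_of_mem (ha : EndsZero fun v => (a v : ℤ)) {ξ : Fin q → ℕ → ℂ}
    {z : MatPair (BlkIdx a)} (hz : z ∈ momentSet (blkVert a) starRel (starLam a ξ)) (hn : 0 < n)
    (j : Fin q) : ChainEq (b := fun i => a (armVert hn j i))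
      (fun i => blk z.1 (armVert hn j i) (armVert hn j (i + 1)))
      (fun i => blk z.2 (armVert hn j (i + 1)) (armVert hn j i)) (ξ j) := by
  intro i
  rcases Nat.lt_or_ge (i + 1) n with hi | hi
  · obtain ⟨hx, -, h⟩ := mem_momentSet_starLam.1 hz
    have h1 := blk_moment_some (y := z.2) hx j i hi (by omega)
    rw [h] at h1
    have key : ∀ u v w, u = starPar (j, ⟨i, by omega⟩) → v = some (j, ⟨i, by omega⟩) →
        w = some (j, ⟨i + 1, hi⟩) → blk z.1 v w * blk z.2 w v + ξ j (i + 1) • 1 =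
          blk z.2 v u * blk z.1 u v + ξ j i • 1 := by
      rintro _ _ _ rfl rfl rfl
      have h2 : ((ξ j i - ξ j (i + 1)) • 1 : Matrix (Fin (a (some (j, ⟨i, by omega⟩)))) _ ℂ) = _ :=
        h1
      rw [sub_smul, sub_eq_sub_iff_add_eq_add] at h2
      rw [← add_comm (ξ j i • 1), h2]
    exact key _ _ _ (armVert_par hn j (by omega)) (armVert_succ hn j (by omega))
      (armVert_succ hn j hi)
  · have h0 := ha.armVert_eq_zero hn j hi
    ext k
    exact (Fin.cast h0 k).elim0

lemma rootMap_eq_armVert {z : MatPair (BlkIdx a)} (hx : z.1 ∈ maskSub (blkVert a) starRel)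
    (hn : 0 < n) (j : Fin q) : rootMap z j =
      blk z.1 (armVert hn j 0) (armVert hn j 1) * blk z.2 (armVert hn j 1) (armVert hn j 0) := by
  obtain ⟨x, y⟩ := z
  rw [rootMap_eq hx hn]
  have key : ∀ v, v = some (j, ⟨0, hn⟩) →
      blk x none (some (j, ⟨0, hn⟩)) * blk y (some (j, ⟨0, hn⟩)) none =
        blk x none v * blk y v none := by
    rintro _ rfl; rfl
  exact key _ (armVert_succ hn j hn)

lemma armVert_injective (ha : EndsZero fun v => (a v : ℤ)) {x : Matrix (BlkIdx a) (BlkIdx a) ℂ}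
    (hx : x ∈ starInj a) (hn : 0 < n) (j : Fin q) (i : ℕ) :
    Function.Injective (blk x (armVert hn j i) (armVert hn j (i + 1))).mulVec := by
  rcases Nat.lt_or_ge i n with hi | hi
  · rw [armVert_succ hn j hi, armVert_par hn j hi]
    exact hx _
  · have h0 := ha.armVert_eq_zero hn j (Nat.le_succ_of_le hi)
    intro u v _
    ext k
    exact (Fin.cast h0 k).elim0

lemma armVert_surjective (ha : EndsZero fun v => (a v : ℤ)) {y : Matrix (BlkIdx a) (BlkIdx a) ℂ}
    (hy : ∀ α, Function.Surjective (blk y (some α) (starPar α)).mulVec) (hn : 0 < n) (j : Fin q)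
    (i : ℕ) : Function.Surjective (blk y (armVert hn j (i + 1)) (armVert hn j i)).mulVec := by
  rcases Nat.lt_or_ge i n with hi | hi
  · rw [armVert_succ hn j hi, armVert_par hn j hi]
    exact hy _
  · have h0 := ha.armVert_eq_zero hn j (Nat.le_succ_of_le hi)
    intro u
    refine ⟨0, ?_⟩
    ext k
    exact (Fin.cast h0 k).elim0

lemma armVert_antitone (ha : EndsZero fun v => (a v : ℤ)) {x : Matrix (BlkIdx a) (BlkIdx a) ℂ}
    (hx : x ∈ starInj a) (hn : 0 < n) (j : Fin q) : Antitone fun i => a (armVert hn j i) := by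
  refine antitone_nat_of_succ_le fun i => ?_
  have h := LinearMap.finrank_le_finrank_of_injective
    (f := (blk x (armVert hn j i) (armVert hn j (i + 1))).mulVecLin)
    (armVert_injective ha hx hn j i)
  simpa using h

end ArmChain

section ArmDiagonalization

variable {q n : ℕ} {a : Option (Fin q × Fin n) → ℕ}

lemma exists_diagonalization_rootMap (ha : EndsZero fun v => (a v : ℤ)) (hn : 0 < n) (j : Fin q)
    (hlast : ∀ i, starDrop (fun v => (a v : ℤ)) j i = 1) {ξ : Fin q → ℕ → ℂ}
    (hξ : ∀ i < n, ∀ k < n, ξ j i = ξ j k → i = k) {z : MatPair (BlkIdx a)}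
    (hz : z ∈ momentSet (blkVert a) starRel (starLam a ξ)) (hi : z.1 ∈ starInj a) :
    ∃ (P Q : Matrix (Fin (a none)) (Fin (a none)) ℂ) (ev : Fin (a none) → ℂ),
      Function.Injective ev ∧ P * Q = 1 ∧ Q * P = 1 ∧
        rootMap z j * P = P * Matrix.diagonal ev := by
  have hdim : a none = n := by
    have h := sum_starDrop ha hn j
    simp only [hlast] at h
    simp at h
    exact_mod_cast h.symm
  have hch := (chainEq_of_mem ha hz hn j).charpoly_eq (armVert_antitone ha hi hn j) n
  rw [← rootMap_eq_armVert hz.1 hn j] at hch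
  have hone : ∀ i ∈ Finset.range n,
      (Polynomial.X - Polynomial.C (ξ j i)) ^ (a (armVert hn j i) - a (armVert hn j (i + 1))) =
        Polynomial.X - Polynomial.C (ξ j i) := fun i hi => by
    rw [Finset.mem_range] at hi
    have h := hlast ⟨i, hi⟩
    have h1 : (a (starPar (j, ⟨i, hi⟩)) : ℤ) - a (some (j, ⟨i, hi⟩)) = 1 := h
    rw [armVert_par hn j hi, armVert_succ hn j hi,
      show a (starPar (j, ⟨i, hi⟩)) - a (some (j, ⟨i, hi⟩)) = 1 by omega, pow_one]
  have : IsEmpty (Fin (a (armVert hn j n))) := by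
    rw [ha.armVert_eq_zero hn j le_rfl]; infer_instance
  rw [Finset.prod_congr rfl hone, Matrix.charpoly, Matrix.charpoly,
    Matrix.det_isEmpty (A := charmatrix (_ * _ + _)), mul_one] at hch
  have hch' : (rootMap z j + ξ j 0 • 1).charpoly =
      ∏ i : Fin (a none), (Polynomial.X - Polynomial.C (ξ j i)) := by
    rw [Fin.prod_univ_eq_prod_range (fun i => Polynomial.X - Polynomial.C (ξ j i))]
    exact hch.trans (by rw [hdim])
  obtain ⟨P, Q, h1, h2, h3⟩ := exists_diagonalization (ev := fun i : Fin (a none) => ξ j i)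
    (fun i k hik => Fin.ext (hξ _ (by omega) _ (by omega) hik)) hch'
  refine ⟨P, Q, fun i => ξ j i - ξ j 0, fun i k hik => ?_, h1, h2, ?_⟩
  · exact Fin.ext (hξ _ (by omega) _ (by omega) (sub_left_injective hik))
  · rw [← Matrix.diagonal_sub, Matrix.mul_sub, ← h3, Matrix.add_mul,
      ← Matrix.smul_one_eq_diagonal]
    simp

end ArmDiagonalization

section ConjugationOfChains

variable {U V : Type} [AddCommGroup U] [Module ℂ U] [AddCommGroup V] [Module ℂ V]
  [FiniteDimensional ℂ U] [FiniteDimensional ℂ V]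

lemma exists_ker_complement {X : U →ₗ[ℂ] V} (Y : V →ₗ[ℂ] U) (hX : Function.Injective X) :
    ∃ K ≤ LinearMap.ker Y, Disjoint K (LinearMap.range X) ∧
      K ⊔ LinearMap.range X ⊓ LinearMap.ker Y = LinearMap.ker Y ∧
      Module.finrank ℂ K + Module.finrank ℂ (LinearMap.ker (Y ∘ₗ X)) =
        Module.finrank ℂ (LinearMap.ker Y) := by
  set S := LinearMap.range X ⊓ LinearMap.ker Y with hS
  obtain ⟨C, hC⟩ := Submodule.exists_isCompl S
  have hle : S ≤ LinearMap.ker Y := inf_le_right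
  have hsup : C ⊓ LinearMap.ker Y ⊔ S = LinearMap.ker Y := by
    rw [inf_comm, inf_sup_assoc_of_le _ hle, sup_comm, hC.sup_eq_top, inf_top_eq]
  have hdis : Disjoint (C ⊓ LinearMap.ker Y) S := hC.disjoint.symm.mono_left inf_le_left
  refine ⟨C ⊓ LinearMap.ker Y, inf_le_right, ?_, hsup, ?_⟩
  · rw [disjoint_iff_inf_le, inf_assoc, inf_comm (LinearMap.ker Y), ← hS]
    exact hC.disjoint.symm.le_bot
  · have h1 := Submodule.finrank_sup_add_finrank_inf_eq (C ⊓ LinearMap.ker Y) S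
    rw [hsup, hdis.eq_bot, finrank_bot, add_zero] at h1
    rw [h1]
    congr 1
    have h2 : (LinearMap.ker (Y ∘ₗ X)).map X = S := by
      rw [LinearMap.ker_comp, Submodule.map_comap_eq]
    rw [← h2]
    exact (LinearEquiv.finrank_eq
      (Submodule.equivMapOfInjective X hX (LinearMap.ker (Y ∘ₗ X))))

lemma exists_equiv_of_comp_eq {X X' : U →ₗ[ℂ] V} {Y Y' : V →ₗ[ℂ] U} (hX : Function.Injective X)
    (hX' : Function.Injective X') (hY : Function.Surjective Y) (hY' : Function.Surjective Y')
    (h : Y ∘ₗ X = Y' ∘ₗ X') :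
    ∃ g : V ≃ₗ[ℂ] V, (∀ u, g (X u) = X' u) ∧ ∀ v, Y' (g v) = Y v := by
  have hc : ∀ u, Y (X u) = Y' (X' u) := fun u => LinearMap.congr_fun h u
  obtain ⟨K, hK, hKX, hKs, hKf⟩ := exists_ker_complement Y hX
  obtain ⟨K', hK', hKX', hKs', hKf'⟩ := exists_ker_complement Y' hX'
  have hker : Module.finrank ℂ (LinearMap.ker Y) = Module.finrank ℂ (LinearMap.ker Y') := by
    have h1 := Y.finrank_range_add_finrank_ker
    have h2 := Y'.finrank_range_add_finrank_ker
    rw [LinearMap.range_eq_top.2 hY, finrank_top] at h1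
    rw [LinearMap.range_eq_top.2 hY', finrank_top] at h2
    omega
  rw [← h] at hKf'
  let φ : K ≃ₗ[ℂ] K' := LinearEquiv.ofFinrankEq _ _ (by omega)
  obtain ⟨L, hL⟩ := X.exists_leftInverse_of_injective (LinearMap.ker_eq_bot.2 hX)
  obtain ⟨R, hR⟩ := Y'.exists_rightInverse_of_surjective (LinearMap.range_eq_top.2 hY')
  have hL' : ∀ u, L (X u) = u := fun u => LinearMap.congr_fun hL u
  have hR' : ∀ u, Y' (R u) = u := fun u => LinearMap.congr_fun hR u
  obtain ⟨C, hXC, hC⟩ := hKX.symm.exists_isCompl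
  let π : V →ₗ[ℂ] K := K.projectionOnto C hC.symm
  have hπX : ∀ u, π (X u) = 0 := fun u =>
    Submodule.projectionOnto_apply_of_mem_right _ (hXC ⟨u, rfl⟩)
  have hπK : ∀ k : K, π k = k := fun k => Submodule.projectionOnto_apply_left _ k
  let g₀ : V →ₗ[ℂ] V := X' ∘ₗ L + R ∘ₗ Y ∘ₗ (LinearMap.id - X ∘ₗ L)
  have hg₀ : ∀ v, g₀ v = X' (L v) + R (Y v - Y (X (L v))) := fun v => by simp [g₀]
  have hg₀X : ∀ u, g₀ (X u) = X' u := fun u => by simp [hg₀, hL']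
  have hg₀Y : ∀ v, Y' (g₀ v) = Y v := fun v => by simp [hg₀, hR', ← hc]
  let g : V →ₗ[ℂ] V := g₀ + (K'.subtype ∘ₗ φ.toLinearMap - g₀ ∘ₗ K.subtype) ∘ₗ π
  have hg : ∀ v, g v = g₀ v + ((φ (π v) : V) - g₀ (π v)) := fun v => by simp [g]
  have hgX : ∀ u, g (X u) = X' u := fun u => by simp [hg, hπX, hg₀X]
  have hgY : ∀ v, Y' (g v) = Y v := fun v => by
    have h1 : Y' (φ (π v)) = 0 := hK' (φ (π v)).2
    have h2 : Y (π v) = 0 := hK (π v).2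
    simp [hg, hg₀Y, h1, h2]
  have hinj : Function.Injective g := by
    rw [← LinearMap.ker_eq_bot, LinearMap.ker_eq_bot']
    intro v hv
    have hYv : v ∈ LinearMap.ker Y := by rw [LinearMap.mem_ker, ← hgY, hv, map_zero]
    rw [← hKs, Submodule.mem_sup] at hYv
    obtain ⟨k, hk, _, ⟨⟨u, rfl⟩, hu⟩, rfl⟩ := hYv
    have hgk : g k = φ ⟨k, hk⟩ := by
      have h1 : π k = ⟨k, hk⟩ := hπK ⟨k, hk⟩
      simp [hg, h1]
    rw [map_add, hgX, hgk] at hv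
    have h1 : (φ ⟨k, hk⟩ : V) = 0 := by
      refine (Submodule.disjoint_def.1 hKX') _ (φ ⟨k, hk⟩).2 ⟨-u, ?_⟩
      rw [map_neg, eq_comm]
      exact eq_neg_of_add_eq_zero_left hv
    have h2 : X' u = 0 := by rwa [h1, zero_add] at hv
    have h3 : u = 0 := hX' (by rw [h2, map_zero])
    have h4 : (⟨k, hk⟩ : K) = 0 := φ.injective (by rw [map_zero]; exact Subtype.ext h1)
    rw [h3, map_zero, add_zero]
    exact congrArg Subtype.val h4
  exact ⟨LinearEquiv.ofInjectiveEndo g hinj, hgX, hgY⟩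

/-- Similarity of square matrices. -/
def MatSim {T : Type} [Fintype T] [DecidableEq T] (M M' : Matrix T T ℂ) : Prop :=
  ∃ P Q : Matrix T T ℂ, P * Q = 1 ∧ Q * P = 1 ∧ P * M = M' * P

lemma matSim_mul_comm {k l : ℕ} {X X' : Matrix (Fin k) (Fin l) ℂ} {Y Y' : Matrix (Fin l) (Fin k) ℂ}
    (hX : Function.Injective X.mulVec) (hX' : Function.Injective X'.mulVec)
    (hY : Function.Surjective Y.mulVec) (hY' : Function.Surjective Y'.mulVec)
    (h : MatSim (Y * X) (Y' * X')) : MatSim (X * Y) (X' * Y') := by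
  obtain ⟨P, Q, hPQ, hQP, h⟩ := h
  have hQinj : Function.Injective P.mulVec := fun u v huv => by
    have h1 := congrArg Q.mulVec huv
    simpa [Matrix.mulVec_mulVec, hQP] using h1
  have hQsur : Function.Surjective Q.mulVec := fun u => ⟨P.mulVec u, by simp [hQP]⟩
  obtain ⟨g, hg1, hg2⟩ := exists_equiv_of_comp_eq (X := X.mulVecLin) (X' := (X' * P).mulVecLin)
    (Y := Y.mulVecLin) (Y' := (Q * Y').mulVecLin) hX
    (by
      rw [Matrix.mulVecLin_mul]
      exact hX'.comp hQinj) hY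
    (by
      rw [Matrix.mulVecLin_mul]
      exact hQsur.comp hY')
    (by
      rw [← Matrix.mulVecLin_mul, ← Matrix.mulVecLin_mul]
      congr 1
      rw [Matrix.mul_assoc, ← Matrix.mul_assoc Y', ← h, ← Matrix.mul_assoc, hQP, Matrix.one_mul])
  have h1 : LinearMap.toMatrix' g.toLinearMap * X = X' * P := by
    refine Matrix.toLin'.injective (LinearMap.ext fun u => ?_)
    rw [Matrix.toLin'_mul, Matrix.toLin'_toMatrix']
    exact hg1 u
  have h2 : Q * Y' * LinearMap.toMatrix' g.toLinearMap = Y := by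
    refine Matrix.toLin'.injective (LinearMap.ext fun u => ?_)
    rw [Matrix.toLin'_mul, Matrix.toLin'_toMatrix']
    exact hg2 u
  refine ⟨LinearMap.toMatrix' g.toLinearMap, LinearMap.toMatrix' g.symm.toLinearMap, ?_, ?_, ?_⟩
  · rw [← LinearMap.toMatrix'_comp]; simp
  · rw [← LinearMap.toMatrix'_comp]; simp
  · rw [← Matrix.mul_assoc, h1, ← h2]
    simp only [← Matrix.mul_assoc]
    rw [Matrix.mul_assoc X' P Q, hPQ, Matrix.mul_one]

lemma MatSim.add_smul_one {T : Type} [Fintype T] [DecidableEq T] {M M' : Matrix T T ℂ}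
    (h : MatSim M M') (c : ℂ) : MatSim (M + c • 1) (M' + c • 1) := by
  obtain ⟨P, Q, h1, h2, h3⟩ := h
  exact ⟨P, Q, h1, h2, by rw [Matrix.mul_add, Matrix.add_mul, h3]; simp⟩

variable {b : ℕ → ℕ} {X X' : ∀ i, Matrix (Fin (b i)) (Fin (b (i + 1))) ℂ}
  {Y Y' : ∀ i, Matrix (Fin (b (i + 1))) (Fin (b i)) ℂ} {ξ : ℕ → ℂ}

lemma ChainEq.matSim (h : ChainEq X Y ξ) (h' : ChainEq X' Y' ξ)
    (hX : ∀ i, Function.Injective (X i).mulVec) (hX' : ∀ i, Function.Injective (X' i).mulVec)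
    (hY : ∀ i, Function.Surjective (Y i).mulVec) (hY' : ∀ i, Function.Surjective (Y' i).mulVec)
    {m : ℕ} (hm : b m = 0) : MatSim (X 0 * Y 0) (X' 0 * Y' 0) := by
  have key : ∀ k i, i + k = m → MatSim (X i * Y i) (X' i * Y' i) := by
    intro k
    induction k with
    | zero =>
      rintro i rfl
      have : IsEmpty (Fin (b i)) := by rw [show b i = 0 from hm]; infer_instance
      exact ⟨1, 1, by simp, by simp, Subsingleton.elim _ _⟩
    | succ k ih =>
      intro i hik
      refine matSim_mul_comm (hX i) (hX' i) (hY i) (hY' i) ?_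
      have h1 := (ih (i + 1) (by omega)).add_smul_one (ξ (i + 1))
      rw [h i, h' i] at h1
      simpa [add_assoc] using h1.add_smul_one (-ξ i)
  exact key m 0 (zero_add m)

end ConjugationOfChains

section Flags

variable {n : ℕ}

/-- The partial products of the factors `B - ξ i`. -/
def prefProd (B : Matrix (Fin n) (Fin n) ℂ) (ξ : ℕ → ℂ) : ℕ → Matrix (Fin n) (Fin n) ℂ
  | 0 => 1
  | i + 1 => (B - ξ i • 1) * prefProd B ξ i

lemma prefProd_comm (B : Matrix (Fin n) (Fin n) ℂ) (ξ : ℕ → ℂ) (i : ℕ) :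
    Commute B (prefProd B ξ i) := by
  induction i with
  | zero => exact Commute.one_right B
  | succ i ih =>
    refine Commute.mul_right ((Commute.refl B).sub_right ?_) ih
    exact (Commute.one_right B).smul_right _

lemma prefProd_conj {A B : Matrix (Fin n) (Fin n) ℂ} {P Q : Matrix (Fin n) (Fin n) ℂ}
    (hPQ : P * Q = 1) (hQP : Q * P = 1) (hB : B = P * A * Q) (ξ : ℕ → ℂ) (i : ℕ) :
    prefProd B ξ i = P * prefProd A ξ i * Q := by
  induction i with
  | zero => simp [prefProd, hPQ]
  | succ i ih =>
    have h1 : B - ξ i • 1 = P * (A - ξ i • 1) * Q := by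
      rw [Matrix.mul_sub, Matrix.sub_mul, ← hB]; simp [hPQ]
    simp only [prefProd]
    rw [ih, h1]
    calc _ = P * (A - ξ i • 1) * (Q * P) * prefProd A ξ i * Q := by simp only [Matrix.mul_assoc]
      _ = _ := by rw [hQP]; simp only [Matrix.mul_assoc, Matrix.one_mul]

lemma rank_prefProd_of_mem {A B : Matrix (Fin n) (Fin n) ℂ} (h : B ∈ conjClass A) (ξ : ℕ → ℂ)
    (i : ℕ) : (prefProd B ξ i).rank = (prefProd A ξ i).rank := by
  obtain ⟨g, hg⟩ := h
  rw [prefProd_conj g.mul_inv g.inv_mul hg ξ i, Matrix.rank_mul_eq_left_of_isUnit_det,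
    Matrix.rank_mul_eq_right_of_isUnit_det]
  · exact (Matrix.isUnit_iff_isUnit_det _).1 g.isUnit
  · exact (Matrix.isUnit_iff_isUnit_det _).1 g⁻¹.isUnit

lemma trace_eq_rank_of_idem {P : Matrix (Fin n) (Fin n) ℂ} (h : P * P = P) :
    P.trace = P.rank := by
  have h1 : IsIdempotentElem (Matrix.toLin' P) := by
    rw [IsIdempotentElem, Module.End.mul_eq_comp, ← Matrix.toLin'_mul, h]
  rw [← Matrix.trace_toLin'_eq, (LinearMap.IsIdempotentElem.isProj_range _ h1).trace]
  rfl

lemma exists_mul_eq_of_range_le {M P : Matrix (Fin n) (Fin n) ℂ}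
    (h : ∀ u, ∃ w, M *ᵥ w = P *ᵥ u) : ∃ N, P = M * N := by
  choose f hf using h
  refine ⟨(Matrix.of fun k => f (Pi.single k 1))ᵀ, ?_⟩
  ext i k
  have h1 := congrFun (hf (Pi.single k 1)) i
  rw [Matrix.mulVec_single_one] at h1
  exact h1.symm

lemma exists_orthogonal_projection (M : Matrix (Fin n) (Fin n) ℂ) :
    ∃ P : Matrix (Fin n) (Fin n) ℂ, P.IsHermitian ∧ P * P = P ∧ P.trace = M.rank ∧
      P * M = M ∧ ∃ N, P = M * N := by
  set T := Matrix.toEuclideanCLM (n := Fin n) (𝕜 := ℂ) with hT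
  set S : Submodule ℂ (EuclideanSpace ℂ (Fin n)) := LinearMap.range (T M).toLinearMap with hS
  set P := T.symm S.starProjection with hP
  have hTP : T P = S.starProjection := T.apply_symm_apply _
  have hidem : P * P = P := by
    apply EquivLike.injective T
    rw [map_mul, hTP]
    exact S.isIdempotentElem_starProjection
  have hM : P * M = M := by
    apply EquivLike.injective T
    rw [map_mul, hTP]
    ext1 u
    exact S.starProjection_mem_subspace_eq_self ⟨T M u, u, rfl⟩
  have hN : ∃ N, P = M * N := by
    refine exists_mul_eq_of_range_le fun u => ?_
    obtain ⟨w, hw⟩ : S.starProjection (WithLp.toLp 2 u) ∈ S := S.starProjection_apply_mem _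
    rw [← hTP] at hw
    exact ⟨w.ofLp, congrArg WithLp.ofLp hw⟩
  refine ⟨P, ?_, hidem, ?_, hM, hN⟩
  · apply EquivLike.injective T
    rw [← Matrix.star_eq_conjTranspose, map_star, hTP]
    exact isSelfAdjoint_starProjection S
  · rw [trace_eq_rank_of_idem hidem]
    congr 1
    obtain ⟨N, hN⟩ := hN
    refine le_antisymm ?_ ?_
    · rw [hN]; exact Matrix.rank_mul_le_left _ _
    · conv_lhs => rw [← hM]
      exact Matrix.rank_mul_le_left _ _

lemma exists_idem_factorization {P : Matrix (Fin n) (Fin n) ℂ} (h : P * P = P) {r : ℕ}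
    (hr : P.trace = r) : ∃ (X : Matrix (Fin n) (Fin r) ℂ) (Y : Matrix (Fin r) (Fin n) ℂ),
      Y * X = 1 ∧ X * Y = P := by
  have hf : Module.finrank ℂ (LinearMap.range (Matrix.toLin' P)) = r := by
    rw [trace_eq_rank_of_idem h] at hr
    exact_mod_cast hr
  let e : LinearMap.range (Matrix.toLin' P) ≃ₗ[ℂ] (Fin r → ℂ) :=
    LinearEquiv.ofFinrankEq _ _ (by simpa using hf)
  refine ⟨LinearMap.toMatrix' ((LinearMap.range (Matrix.toLin' P)).subtype ∘ₗ e.symm.toLinearMap),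
    LinearMap.toMatrix' (e.toLinearMap ∘ₗ (Matrix.toLin' P).rangeRestrict), ?_, ?_⟩
  · rw [← LinearMap.toMatrix'_comp, ← LinearMap.toMatrix'_id]
    congr 1
    refine LinearMap.ext fun u => ?_
    have : (Matrix.toLin' P).rangeRestrict (e.symm u) = e.symm u := by
      apply Subtype.ext
      obtain ⟨w, hw⟩ := (e.symm u).2
      simp only [LinearMap.codRestrict_apply, LinearMap.rangeRestrict]
      rw [← hw]
      simp [h]
    simp [this]
  · rw [← LinearMap.toMatrix'_comp]
    refine Matrix.toLin'.injective (LinearMap.ext fun u => ?_)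
    rw [Matrix.toLin'_toMatrix']
    simp

/-- Sequences of Hermitian idempotents. -/
def hermIdem (n : ℕ) : Set (Matrix (Fin n) (Fin n) ℂ) := {P | P.IsHermitian ∧ P * P = P}

lemma isCompact_hermIdem : IsCompact (hermIdem n) := by
  have hcl : IsClosed (hermIdem n) := by
    refine IsClosed.inter (isClosed_eq ?_ continuous_id)
      (isClosed_eq (continuous_id.matrix_mul continuous_id) continuous_id)
    exact continuous_id.matrix_conjTranspose
  have hK : IsCompact (Set.pi Set.univ fun _ : Fin n => Set.pi Set.univ fun _ : Fin n =>
      Metric.closedBall (0 : ℂ) 1) :=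
    isCompact_univ_pi fun _ => isCompact_univ_pi fun _ => isCompact_closedBall _ _
  refine hK.of_isClosed_subset hcl ?_
  rintro (P : Matrix (Fin n) (Fin n) ℂ) ⟨hP, hPP⟩ i - k -
  rw [mem_closedBall_zero_iff]
  have h1 : ∀ i, (∑ k, ‖P i k‖ ^ 2 : ℝ) = ‖P i i‖ := fun i => by
    have h2 := congrFun (congrFun hPP i) i
    rw [Matrix.mul_apply] at h2
    have h3 : ((∑ k, ‖P i k‖ ^ 2 : ℝ) : ℂ) = P i i := by
      rw [← h2]
      push_cast
      refine Finset.sum_congr rfl fun k _ => ?_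
      rw [← hP.apply k i, ← Complex.mul_conj']
      rfl
    rw [← h3, Complex.norm_real, Real.norm_of_nonneg (Finset.sum_nonneg fun _ _ => by positivity)]
  have h2 : ∀ k, ‖P i k‖ ^ 2 ≤ ‖P i i‖ := fun k => by
    rw [← h1 i]
    exact Finset.single_le_sum (f := fun k => ‖P i k‖ ^ 2) (fun _ _ => by positivity)
      (Finset.mem_univ k)
  have h3 : ‖P i i‖ ≤ 1 := by nlinarith [h2 i, norm_nonneg (P i i)]
  nlinarith [h2 k, norm_nonneg (P i k)]

/-- Matrices compatible with a decreasing flag of the given dimensions. -/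
def flagSet (n : ℕ) (ξ : ℕ → ℂ) (r : ℕ → ℕ) : Set (Matrix (Fin n) (Fin n) ℂ) :=
  {B | ∃ P : ℕ → Matrix (Fin n) (Fin n) ℂ, P 0 = 1 ∧ ∀ i, P i ∈ hermIdem n ∧ (P i).trace = r i ∧
    P i * P (i + 1) = P (i + 1) ∧ P (i + 1) * ((B - ξ i • 1) * P i) = (B - ξ i • 1) * P i}

lemma isClosed_flagSet (ξ : ℕ → ℂ) (r : ℕ → ℕ) : IsClosed (flagSet n ξ r) := by
  have hK : IsCompact (Set.pi Set.univ fun _ : ℕ => hermIdem n) :=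
    isCompact_univ_pi fun _ => isCompact_hermIdem
  have : CompactSpace (Set.pi Set.univ fun _ : ℕ => hermIdem n) := isCompact_iff_compactSpace.1 hK
  let F : Set (Matrix (Fin n) (Fin n) ℂ × (Set.pi Set.univ fun _ : ℕ => hermIdem n)) :=
    {w | w.2.1 0 = 1 ∧ ∀ i, (w.2.1 i).trace = r i ∧ w.2.1 i * w.2.1 (i + 1) = w.2.1 (i + 1) ∧
      w.2.1 (i + 1) * ((w.1 - ξ i • 1) * w.2.1 i) = (w.1 - ξ i • 1) * w.2.1 i}
  have hc : ∀ i, Continuous fun w : Matrix (Fin n) (Fin n) ℂ ×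
      (Set.pi Set.univ fun _ : ℕ => hermIdem n) => w.2.1 i := fun i =>
    (continuous_apply i).comp (continuous_subtype_val.comp continuous_snd)
  have hB : ∀ i, Continuous fun w : Matrix (Fin n) (Fin n) ℂ ×
      (Set.pi Set.univ fun _ : ℕ => hermIdem n) => (w.1 - ξ i • 1) * w.2.1 i := fun i =>
    (continuous_fst.sub continuous_const).matrix_mul (hc i)
  have hF : IsClosed F := by
    have hF' : F = {w | w.2.1 0 = 1} ∩ ⋂ i, {w | (w.2.1 i).trace = (r i : ℂ) ∧
        w.2.1 i * w.2.1 (i + 1) = w.2.1 (i + 1) ∧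
        w.2.1 (i + 1) * ((w.1 - ξ i • 1) * w.2.1 i) = (w.1 - ξ i • 1) * w.2.1 i} := by
      ext w
      simp [F]
    rw [hF']
    refine (isClosed_eq (hc 0) continuous_const).inter (isClosed_iInter fun i => ?_)
    exact (isClosed_eq (hc i).matrix_trace continuous_const).inter
      ((isClosed_eq ((hc i).matrix_mul (hc (i + 1))) (hc (i + 1))).inter
        (isClosed_eq ((hc (i + 1)).matrix_mul (hB i)) (hB i)))
  have h := isClosedMap_fst_of_compactSpace F hF
  convert h using 1
  ext B
  constructor
  · rintro ⟨P, h0, hP⟩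
    exact ⟨(B, ⟨P, fun i _ => (hP i).1⟩), ⟨h0, fun i => (hP i).2⟩, rfl⟩
  · rintro ⟨⟨_, P, hPm⟩, ⟨h0, hP⟩, rfl⟩
    exact ⟨P, h0, fun i => ⟨hPm i trivial, hP i⟩⟩

lemma mem_flagSet_self (B : Matrix (Fin n) (Fin n) ℂ) (ξ : ℕ → ℂ) :
    B ∈ flagSet n ξ fun i => (prefProd B ξ i).rank := by
  choose P h1 h2 h3 h4 N h5 using fun i => exists_orthogonal_projection (prefProd B ξ i)
  refine ⟨P, ?_, fun i => ⟨⟨h1 i, h2 i⟩, h3 i, ?_, ?_⟩⟩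
  · have := h4 0
    rwa [prefProd, Matrix.mul_one] at this
  · have hc : prefProd B ξ (i + 1) = prefProd B ξ i * (B - ξ i • 1) :=
      (((prefProd_comm B ξ i).sub_left ((Commute.one_left _).smul_left _)) : _)
    rw [h5 (i + 1), hc, ← Matrix.mul_assoc, ← Matrix.mul_assoc, h4 i]
  · have h6 : (B - ξ i • 1) * P i = prefProd B ξ (i + 1) * N i := by
      rw [prefProd, Matrix.mul_assoc, ← h5 i]
    rw [h6, ← Matrix.mul_assoc, h4 (i + 1)]

lemma closure_conjClass_subset_flagSet (A : Matrix (Fin n) (Fin n) ℂ) (ξ : ℕ → ℂ) :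
    closure (conjClass A) ⊆ flagSet n ξ fun i => (prefProd A ξ i).rank := by
  refine closure_minimal (fun B hB => ?_) (isClosed_flagSet _ _)
  have h := mem_flagSet_self B ξ
  simp only [rank_prefProd_of_mem hB] at h
  exact h

end Flags

section Lifting

variable {q n : ℕ} {a : Option (Fin q × Fin n) → ℕ}

lemma mulVec_injective_of_left_inverse {k l : ℕ} {X : Matrix (Fin k) (Fin l) ℂ}
    {Y : Matrix (Fin l) (Fin k) ℂ} (h : Y * X = 1) : Function.Injective X.mulVec :=
  fun u v huv => by
    have h1 := congrArg Y.mulVec huv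
    simpa [Matrix.mulVec_mulVec, h] using h1

lemma exists_lift_of_frames (ha : EndsZero fun v => (a v : ℤ)) (hn : 0 < n) {ξ : Fin q → ℕ → ℂ}
    {B : Fin q → Matrix (Fin (a none)) (Fin (a none)) ℂ} (hsum : ∑ j, B j = 0)
    (X : ∀ v, Matrix (Fin (a none)) (Fin (a v)) ℂ) (Y : ∀ v, Matrix (Fin (a v)) (Fin (a none)) ℂ)
    (hX : X none = 1) (hY : Y none = 1) (hYX : ∀ v, Y v * X v = 1)
    (h1 : ∀ α, X (starPar α) * (Y (starPar α) * X (some α)) = X (some α))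
    (h2 : ∀ j (i : Fin n), X (some (j, i)) * (Y (some (j, i)) *
      ((B j - ξ j i • 1) * X (starPar (j, i)))) = (B j - ξ j i • 1) * X (starPar (j, i))) :
    ∃ z ∈ momentSet (blkVert a) starRel (starLam a ξ), z.1 ∈ starInj a ∧
      ∀ j, rootMap z j + ξ j 0 • 1 = B j := by
  obtain ⟨z, hz1, hz2, hx, hy⟩ := exists_star_pair
    (fun α : Fin q × Fin n => Y (starPar α) * X (some α))
    (fun α => Y (some α) * ((B α.1 - ξ α.1 α.2 • 1) * X (starPar α)))
  have hroot : ∀ j, rootMap z j = B j - ξ j 0 • 1 := fun j => by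
    have e1 : blk z.1 none (some (j, ⟨0, hn⟩)) = Y none * X (some (j, ⟨0, hn⟩)) :=
      hx (j, ⟨0, hn⟩)
    have e2 : blk z.2 (some (j, ⟨0, hn⟩)) none =
        Y (some (j, ⟨0, hn⟩)) * ((B j - ξ j 0 • 1) * X none) := hy (j, ⟨0, hn⟩)
    have e3 : X (some (j, ⟨0, hn⟩)) * (Y (some (j, ⟨0, hn⟩)) * ((B j - ξ j 0 • 1) * X none)) =
        (B j - ξ j 0 • 1) * X none := h2 j ⟨0, hn⟩
    rw [show rootMap z j = _ from rootMap_eq (x := z.1) (y := z.2) hz1 hn j, e1, e2, hY,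
      Matrix.one_mul, e3, hX, Matrix.mul_one]
  refine ⟨z, mem_momentSet_starLam.2 ⟨hz1, hz2, ?_⟩, fun α => ?_, fun j => by
    rw [hroot, sub_add_cancel]⟩
  · rintro (_ | ⟨j, i, hi⟩)
    · rw [blk_moment_none hz1 hz2, Finset.sum_congr rfl fun j _ => hroot j,
        Finset.sum_sub_distrib, hsum, ← Finset.sum_smul]
      simp [starLamVal]
    · rcases Nat.lt_or_ge (i + 1) n with hi' | hi'
      · rw [blk_moment_some hz1 j i hi' hi, hx, hy]
        have e1 : blk z.1 (some (j, ⟨i, hi⟩)) (some (j, ⟨i + 1, hi'⟩)) =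
            Y (some (j, ⟨i, hi⟩)) * X (some (j, ⟨i + 1, hi'⟩)) := hx (j, ⟨i + 1, hi'⟩)
        have e2 : blk z.2 (some (j, ⟨i + 1, hi'⟩)) (some (j, ⟨i, hi⟩)) =
            Y (some (j, ⟨i + 1, hi'⟩)) * ((B j - ξ j (i + 1) • 1) * X (some (j, ⟨i, hi⟩))) :=
          hy (j, ⟨i + 1, hi'⟩)
        have e3 : X (some (j, ⟨i + 1, hi'⟩)) * (Y (some (j, ⟨i + 1, hi'⟩)) *
            ((B j - ξ j (i + 1) • 1) * X (some (j, ⟨i, hi⟩)))) =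
              (B j - ξ j (i + 1) • 1) * X (some (j, ⟨i, hi⟩)) := h2 j ⟨i + 1, hi'⟩
        have e4 := h1 (j, ⟨i, hi⟩)
        rw [e1, e2, Matrix.mul_assoc (Y _) (X _), e3]
        simp only [Matrix.mul_assoc]
        rw [e4, ← Matrix.mul_sub, ← Matrix.sub_mul, sub_sub_sub_cancel_left, ← sub_smul,
          Matrix.smul_mul, Matrix.one_mul, Matrix.mul_smul, hYX]
        rfl
      · have h0 : a (some (j, ⟨i, hi⟩)) = 0 :=
          Int.ofNat_eq_zero.1 (ha j ⟨i, hi⟩ (by simp; omega))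
        ext k
        exact (Fin.cast h0 k).elim0
  · have h3 : Function.Injective (X (starPar α) * blk z.1 (starPar α) (some α)).mulVec := by
      rw [hx, h1]
      exact mulVec_injective_of_left_inverse (hYX _)
    intro u v huv
    apply h3
    rw [← Matrix.mulVec_mulVec, huv, Matrix.mulVec_mulVec]

lemma exists_lift (ha : EndsZero fun v => (a v : ℤ)) (hn : 0 < n) {ξ : Fin q → ℕ → ℂ}
    {r : Fin q → ℕ → ℕ} (hr : ∀ j (i : Fin n), a (some (j, i)) = r j (i + 1))
    {B : Fin q → Matrix (Fin (a none)) (Fin (a none)) ℂ} (hsum : ∑ j, B j = 0)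
    (hB : ∀ j, B j ∈ flagSet (a none) (ξ j) (r j)) :
    ∃ z ∈ momentSet (blkVert a) starRel (starLam a ξ), z.1 ∈ starInj a ∧
      ∀ j, rootMap z j + ξ j 0 • 1 = B j := by
  choose P hP0 hP using hB
  have hex : ∀ v, ∃ (X : Matrix (Fin (a none)) (Fin (a v)) ℂ)
      (Y : Matrix (Fin (a v)) (Fin (a none)) ℂ), Y * X = 1 ∧
      (∀ h : v = none, HEq X (1 : Matrix (Fin (a none)) (Fin (a none)) ℂ) ∧
        HEq Y (1 : Matrix (Fin (a none)) (Fin (a none)) ℂ)) ∧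
      ∀ j (i : Fin n), v = some (j, i) → X * Y = P j (i + 1) := by
    rintro (_ | ⟨j, i⟩)
    · exact ⟨1, 1, Matrix.one_mul 1, fun _ => ⟨HEq.rfl, HEq.rfl⟩, by simp⟩
    · obtain ⟨X, Y, h1, h2⟩ := exists_idem_factorization (hP j (i + 1)).1.2
        (r := a (some (j, i))) (by rw [hr]; exact (hP j (i + 1)).2.1)
      refine ⟨X, Y, h1, by simp, ?_⟩
      rintro _ _ ⟨⟩
      exact h2
  choose X Y hYX hnone hXY using hex
  have hX : X none = 1 := eq_of_heq (hnone none rfl).1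
  have hY : Y none = 1 := eq_of_heq (hnone none rfl).2
  have hpar : ∀ j (i : Fin n), X (starPar (j, i)) * Y (starPar (j, i)) = P j i := by
    rintro j ⟨_ | i, hi⟩
    · have h3 : X none * Y none = P j 0 := by rw [hX, hY, hP0, Matrix.one_mul]
      exact h3
    · exact hXY _ j ⟨i, by omega⟩ rfl
  have hsucc : ∀ j (i : Fin n), X (some (j, i)) * Y (some (j, i)) = P j (i + 1) :=
    fun j i => hXY _ j i rfl
  refine exists_lift_of_frames ha hn hsum X Y hX hY hYX ?_ ?_
  · rintro ⟨j, i⟩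
    have h3 : X (some (j, i)) = P j (i + 1) * X (some (j, i)) := by
      rw [← hsucc, Matrix.mul_assoc, hYX, Matrix.mul_one]
    rw [← Matrix.mul_assoc, hpar, h3, ← Matrix.mul_assoc, (hP j i).2.2.1]
  · intro j i
    have h3 : X (starPar (j, i)) = P j i * X (starPar (j, i)) := by
      rw [← hpar, Matrix.mul_assoc, hYX, Matrix.mul_one]
    rw [← Matrix.mul_assoc, hsucc, h3, ← Matrix.mul_assoc (B j - _), ← Matrix.mul_assoc,
      (hP j i).2.2.2]

variable {b : ℕ → ℕ} {X : ∀ i, Matrix (Fin (b i)) (Fin (b (i + 1))) ℂ}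
  {Y : ∀ i, Matrix (Fin (b (i + 1))) (Fin (b i)) ℂ} {ξ : ℕ → ℂ}

lemma ChainEq.surjective_of_rank (h : ChainEq X Y ξ)
    (hr : ∀ i, (prefProd (X 0 * Y 0 + ξ 0 • 1) ξ i).rank = b i) (i : ℕ) :
    Function.Surjective (Y i).mulVec := by
  set B := X 0 * Y 0 + ξ 0 • 1 with hBdef
  have key : ∀ i, ∃ (L : Matrix (Fin (b 0)) (Fin (b i)) ℂ) (R : Matrix (Fin (b i)) (Fin (b 0)) ℂ),
      prefProd B ξ i = L * R ∧ B * L = L * (X i * Y i + ξ i • 1) := by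
    intro i
    induction i with
    | zero => exact ⟨1, 1, (Matrix.one_mul 1).symm, by simp [hBdef]⟩
    | succ i ih =>
      obtain ⟨L, R, h1, h2⟩ := ih
      refine ⟨L * X i, Y i * R, ?_, ?_⟩
      · rw [prefProd, h1, ← Matrix.mul_assoc, Matrix.sub_mul, h2, Matrix.mul_add]
        simp [Matrix.mul_assoc]
      · rw [h i, ← Matrix.mul_assoc, h2]
        simp [Matrix.mul_add, Matrix.add_mul, Matrix.mul_assoc]
  obtain ⟨L, R, h1, h2⟩ := key i
  have h3 : prefProd B ξ (i + 1) = L * X i * (Y i * R) := by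
    rw [prefProd, h1, ← Matrix.mul_assoc, Matrix.sub_mul, h2, Matrix.mul_add]
    simp [Matrix.mul_assoc]
  have h4 : b (i + 1) ≤ (Y i).rank := by
    refine (hr (i + 1)).symm.le.trans ?_
    rw [h3]
    exact (Matrix.rank_mul_le_right _ _).trans (Matrix.rank_mul_le_left _ _)
  have h5 : LinearMap.range (Y i).mulVecLin = ⊤ := by
    apply Submodule.eq_top_of_finrank_eq
    refine le_antisymm (Submodule.finrank_le _) ?_
    rw [Module.finrank_fin_fun]
    exact h4
  exact LinearMap.range_eq_top.1 h5

end Lifting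

section StarDimensions

variable {q n p : ℕ}

lemma rank_add_rank_le_rank_mul_add {n : ℕ} (N M : Matrix (Fin n) (Fin n) ℂ) :
    N.rank + M.rank ≤ (N * M).rank + n := by
  have h1 := N.mulVecLin.finrank_range_add_finrank_ker
  have h2 := (N.mulVecLin.domRestrict (LinearMap.range M.mulVecLin)).finrank_range_add_finrank_ker
  have h3 : LinearMap.range (N.mulVecLin.domRestrict (LinearMap.range M.mulVecLin)) =
      LinearMap.range (N * M).mulVecLin := by
    rw [LinearMap.range_domRestrict, Matrix.mulVecLin_mul, LinearMap.range_comp]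
  have h4 : Module.finrank ℂ
      (LinearMap.ker (N.mulVecLin.domRestrict (LinearMap.range M.mulVecLin))) ≤
        Module.finrank ℂ (LinearMap.ker N.mulVecLin) := by
    rw [LinearMap.ker_domRestrict]
    rw [← Submodule.finrank_map_subtype_eq]
    exact Submodule.finrank_mono (Submodule.map_comap_le _ _)
  rw [h3] at h2
  rw [Module.finrank_fin_fun] at h1
  have e1 : (N * M).rank = Module.finrank ℂ (LinearMap.range (N * M).mulVecLin) := rfl
  have e2 : N.rank = Module.finrank ℂ (LinearMap.range N.mulVecLin) := rfl
  have e3 : M.rank = Module.finrank ℂ (LinearMap.range M.mulVecLin) := rfl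
  omega

/-- The dimensions of the ranges of the partial products, arranged along a star. -/
def starDim (A : Fin q → Matrix (Fin n) (Fin n) ℂ) (ξ : Fin q → ℕ → ℂ) :
    Option (Fin q × Fin n) → ℕ
  | none => n
  | some (j, i) => (prefProd (A j) (ξ j) (i + 1)).rank

variable {A : Fin q → Matrix (Fin n) (Fin n) ℂ} {ξ : Fin q → ℕ → ℂ}

lemma starDim_par (j : Fin q) (i : Fin n) :
    starDim A ξ (starPar (j, i)) = (prefProd (A j) (ξ j) i).rank := by
  obtain ⟨_ | i, hi⟩ := i
  · simp [starPar, starDim, prefProd]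
  · rfl

lemma prefProd_eq_aeval (B : Matrix (Fin n) (Fin n) ℂ) (ξ : ℕ → ℂ) (i : ℕ) :
    prefProd B ξ i = Polynomial.aeval B
      (∏ l ∈ Finset.range i, (Polynomial.X - Polynomial.C (ξ l))) := by
  induction i with
  | zero => simp [prefProd]
  | succ i ih =>
    rw [prefProd, ih, Finset.prod_range_succ, mul_comm _ (Polynomial.X - _), map_mul]
    simp [Algebra.algebraMap_eq_smul_one]

lemma prefProd_eq_zero {B : Matrix (Fin n) (Fin n) ℂ} {ξ : ℕ → ℂ}
    (h : B.charpoly = ∏ i : Fin n, (Polynomial.X - Polynomial.C (ξ i))) : prefProd B ξ n = 0 := by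
  rw [prefProd_eq_aeval, ← Fin.prod_univ_eq_prod_range (fun i => Polynomial.X - Polynomial.C (ξ i)),
    ← h, Matrix.aeval_self_charpoly]

lemma endsZero_starDim
    (hξ : ∀ j, (A j).charpoly = ∏ i : Fin n, (Polynomial.X - Polynomial.C (ξ j i))) :
    EndsZero fun v => (starDim A ξ v : ℤ) := by
  intro j i hi
  simp only [starDim]
  rw [hi, prefProd_eq_zero (hξ j), Matrix.rank_zero, Nat.cast_zero]

lemma starDrop_starDim_le (j : Fin q) (i : Fin n) :
    starDrop (fun v => (starDim A ξ v : ℤ)) j i + (A j - ξ j i • 1).rank ≤ n := by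
  have h := rank_add_rank_le_rank_mul_add (A j - ξ j i • 1) (prefProd (A j) (ξ j) i)
  simp only [starDrop, starDim_par]
  have h1 : starDim A ξ (some (j, i)) = ((A j - ξ j i • 1) * prefProd (A j) (ξ j) i).rank := rfl
  rw [h1]
  omega

lemma rank_sub_of_distinct {B : Matrix (Fin n) (Fin n) ℂ} {ev : Fin n → ℂ}
    (hev : Function.Injective ev)
    (hB : B.charpoly = ∏ i, (Polynomial.X - Polynomial.C (ev i))) (k : Fin n) :
    (B - ev k • 1).rank + 1 = n := by
  obtain ⟨P, Q, hPQ, hQP, hBP⟩ := exists_diagonalization hev hB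
  have h1 : B - ev k • 1 = P * Matrix.diagonal (fun i => ev i - ev k) * Q := by
    rw [← Matrix.diagonal_sub, Matrix.mul_sub, ← hBP, Matrix.sub_mul, Matrix.mul_assoc, hPQ,
      ← Matrix.smul_one_eq_diagonal]
    simp [hPQ]
  have hP : IsUnit P.det := Matrix.isUnit_det_of_right_inverse hPQ
  have hQ : IsUnit Q.det := Matrix.isUnit_det_of_right_inverse hQP
  rw [h1, Matrix.rank_mul_eq_left_of_isUnit_det _ _ hQ,
    Matrix.rank_mul_eq_right_of_isUnit_det _ _ hP, Matrix.rank_diagonal]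
  have h2 : Fintype.card {i // ev i - ev k ≠ 0} = Fintype.card {i // i ≠ k} := by
    refine Fintype.card_congr (Equiv.subtypeEquivRight fun i => ?_)
    rw [sub_ne_zero, hev.ne_iff]
  rw [h2, Fintype.card_subtype_compl, Fintype.card_fin, Fintype.card_unique]
  have := k.pos
  omega

lemma starDrop_starDim_eq_one (hn : 0 < n)
    (hξ : ∀ j, (A j).charpoly = ∏ i : Fin n, (Polynomial.X - Polynomial.C (ξ j i))) (j : Fin q)
    (hj : Function.Injective fun i : Fin n => ξ j i) (i : Fin n) :
    starDrop (fun v => (starDim A ξ v : ℤ)) j i = 1 := by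
  have hle : ∀ i : Fin n, starDrop (fun v => (starDim A ξ v : ℤ)) j i ≤ 1 := fun i => by
    have h1 := starDrop_starDim_le (A := A) (ξ := ξ) j i
    have h2 := rank_sub_of_distinct hj (hξ j) i
    omega
  have hsum := sum_starDrop (endsZero_starDim hξ) hn j
  have h3 : ∑ i, starDrop (fun v => (starDim A ξ v : ℤ)) j i = ∑ _i : Fin n, (1 : ℤ) := by
    rw [hsum]; simp [starDim]
  exact (Finset.sum_eq_sum_iff_of_le fun i _ => hle i).1 h3 i (Finset.mem_univ i)

lemma le_sum_rank_of_irredTuple {B : Fin (p + 1) → Matrix (Fin n) (Fin n) ℂ} (hB : IrredTuple B)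
    (hsum : ∑ j, B j = 0) (hn : 2 ≤ n) (c : Fin p → ℂ) :
    n ≤ ∑ j, (B j.castSucc - c j • 1).rank := by
  by_contra! hlt
  let L : (Fin n → ℂ) →ₗ[ℂ] (∀ j, LinearMap.range (B j.castSucc - c j • 1).mulVecLin) :=
    LinearMap.pi fun j => (B j.castSucc - c j • 1).mulVecLin.rangeRestrict
  have hL : LinearMap.ker L ≠ ⊥ := by
    refine L.ker_ne_bot_of_finrank_lt ?_
    rw [Module.finrank_pi_fintype, Module.finrank_fin_fun]
    exact hlt
  obtain ⟨u, hu, hu0⟩ := Submodule.exists_mem_ne_zero_of_ne_bot hL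
  have h1 : ∀ j : Fin p, B j.castSucc *ᵥ u = c j • u := fun j => by
    have h2 := congrArg Subtype.val (congrFun (LinearMap.mem_ker.1 hu) j)
    have h3 : (B j.castSucc - c j • 1) *ᵥ u = 0 := h2
    rw [Matrix.sub_mulVec, Matrix.smul_mulVec, Matrix.one_mulVec] at h3
    exact sub_eq_zero.1 h3
  have h4 : ∀ j, ∃ d : ℂ, B j *ᵥ u = d • u := by
    intro j
    refine Fin.lastCases ?_ (fun j => ⟨c j, h1 j⟩) j
    refine ⟨-∑ j, c j, ?_⟩
    rw [Fin.sum_univ_castSucc] at hsum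
    rw [eq_neg_of_add_eq_zero_right hsum, Matrix.neg_mulVec, neg_smul, Finset.sum_smul,
      Matrix.sum_mulVec]
    simp only [h1]
  have h5 := hB (Submodule.span ℂ {u}) fun j v hv => by
    obtain ⟨t, rfl⟩ := Submodule.mem_span_singleton.1 hv
    obtain ⟨d, hd⟩ := h4 j
    rw [Matrix.mulVec_smul, hd]
    exact Submodule.smul_mem _ _ (Submodule.smul_mem _ _ (Submodule.mem_span_singleton_self u))
  rcases h5 with h5 | h5
  · exact hu0 (Submodule.span_singleton_eq_bot.1 h5)
  · have h6 := finrank_span_singleton (K := ℂ) hu0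
    rw [h5, finrank_top, Module.finrank_fin_fun] at h6
    omega

lemma rank_sub_smul_of_mem_conjClass {M B : Matrix (Fin n) (Fin n) ℂ} (h : B ∈ conjClass M)
    (c : ℂ) : (B - c • 1).rank = (M - c • 1).rank := by
  have h1 := rank_prefProd_of_mem h (fun _ => c) 1
  simpa [prefProd] using h1

lemma starForm_starDim_nonneg (hp : 1 ≤ p) {A : Fin (p + 1) → Matrix (Fin n) (Fin n) ℂ}
    {ξ : Fin (p + 1) → ℕ → ℂ} (hirr : ∃ B ∈ Vset A, IrredTuple B) (hn : 2 ≤ n)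
    {v : StarVec (Fin p) (Fin n)} (hv : IsDimVec v) :
    0 ≤ starForm (toStar fun v => (starDim A ξ v : ℤ)) v := by
  have : Nonempty (Fin n) := ⟨⟨0, by omega⟩⟩
  have : Nonempty (Fin p) := ⟨⟨0, by omega⟩⟩
  refine starForm_nonneg (fun i => ?_) hv
  obtain ⟨B, ⟨hBA, hsum⟩, hB⟩ := hirr
  have h1 := le_sum_rank_of_irredTuple hB hsum hn fun j => ξ j.castSucc (i j)
  simp only [rank_sub_smul_of_mem_conjClass (hBA _)] at h1
  have h2 : ∑ j, ((toStar fun v => (starDim A ξ v : ℤ)).2 j (i j) +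
      ((A j.castSucc - ξ j.castSucc (i j) • 1).rank : ℤ)) ≤ ∑ _j : Fin p, (n : ℤ) :=
    Finset.sum_le_sum fun j _ => starDrop_starDim_le j.castSucc (i j)
  rw [Finset.sum_add_distrib, Finset.sum_const, Finset.card_univ, nsmul_eq_mul] at h2
  have h3 : (n : ℤ) ≤ ∑ j : Fin p, ((A j.castSucc - ξ j.castSucc (i j) • 1).rank : ℤ) := by
    exact_mod_cast h1
  have h4 : (toStar fun v => (starDim A ξ v : ℤ)).1 = n := rfl
  rw [h4, sub_mul, one_mul]
  omega

end StarDimensions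

section Conclusion

variable {q n p : ℕ}

lemma irredTuple_add_smul_one {T : Type} [Fintype T] [DecidableEq T] {B : Fin q → Matrix T T ℂ}
    (h : IrredTuple B) (c : Fin q → ℂ) : IrredTuple fun j => B j + c j • 1 := by
  intro U hU
  refine h U fun j v hv => ?_
  have h1 := U.sub_mem (hU j v hv) (U.smul_mem (c j) hv)
  rwa [Matrix.add_mulVec, Matrix.smul_mulVec, Matrix.one_mulVec, add_sub_cancel_right] at h1

lemma exists_charpoly_eq_prod (B : Matrix (Fin n) (Fin n) ℂ) :
    ∃ e : Fin n → ℂ, B.charpoly = ∏ i, (Polynomial.X - Polynomial.C (e i)) := by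
  have h1 : B.charpoly.Splits := IsAlgClosed.splits _
  have h2 := h1.eq_prod_roots_of_monic B.charpoly_monic
  have h3 : B.charpoly.roots.card = n := by
    rw [← h1.natDegree_eq_card_roots, Matrix.charpoly_natDegree_eq_dim, Fintype.card_fin]
  obtain ⟨l, hl⟩ := Quot.exists_rep B.charpoly.roots
  have hl' : B.charpoly.roots = (l : Multiset ℂ) := hl.symm
  have h4 : l.length = n := by rw [← h3, hl']; rfl
  subst h4
  refine ⟨fun i => l.get i, ?_⟩
  rw [h2, hl']
  rw [Multiset.map_coe, Multiset.prod_coe, ← List.prod_ofFn]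
  conv_lhs => rw [← List.ofFn_get l, List.map_ofFn]
  rfl

lemma MatSim.mem_conjClass {M B C : Matrix (Fin n) (Fin n) ℂ} (h : MatSim B C)
    (hB : B ∈ conjClass M) : C ∈ conjClass M := by
  obtain ⟨P, Q, hPQ, hQP, h⟩ := h
  obtain ⟨g, rfl⟩ := hB
  refine ⟨⟨P, Q, hPQ, hQP⟩ * g, ?_⟩
  rw [_root_.mul_inv_rev, Units.val_mul, Units.val_mul]
  change C = P * (g : Matrix (Fin n) (Fin n) ℂ) * M * ((g⁻¹ : (Matrix (Fin n) (Fin n) ℂ)ˣ) * Q)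
  have h1 : C = C * P * Q := by rw [Matrix.mul_assoc, hPQ, Matrix.mul_one]
  rw [h1, ← h]
  simp only [Matrix.mul_assoc]

lemma prefProd_eq_zero_of_le {B : Matrix (Fin n) (Fin n) ℂ} {ξ : ℕ → ℂ}
    (h : B.charpoly = ∏ i : Fin n, (Polynomial.X - Polynomial.C (ξ i))) {i : ℕ} (hi : n ≤ i) :
    prefProd B ξ i = 0 := by
  induction i, hi using Nat.le_induction with
  | base => exact prefProd_eq_zero h
  | succ i _ ih => rw [prefProd, ih, Matrix.mul_zero]

variable {A : Fin q → Matrix (Fin n) (Fin n) ℂ} {ξ : Fin q → ℕ → ℂ}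

/-- The tuple of matrices attached to a representation of the star. -/
def starTuple (ξ : Fin q → ℕ → ℂ) (z : MatPair (BlkIdx (starDim A ξ))) :
    Fin q → Matrix (Fin n) (Fin n) ℂ :=
  fun j => (rootMap z j + ξ j 0 • 1 : Matrix (Fin (starDim A ξ none)) (Fin (starDim A ξ none)) ℂ)

lemma continuous_starTuple {A : Fin (p + 1) → Matrix (Fin n) (Fin n) ℂ}
    {ξ : Fin (p + 1) → ℕ → ℂ} : Continuous fun z : MatPair (BlkIdx (starDim A ξ)) => starTuple ξ z :=
  continuous_pi fun j => ((continuous_pi_iff.1 continuous_rootMap j).add continuous_const :)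

lemma sum_starTuple {z : MatPair (BlkIdx (starDim A ξ))}
    (hz : z ∈ momentSet (blkVert (starDim A ξ)) starRel (starLam (starDim A ξ) ξ)) :
    ∑ j, starTuple ξ z j = 0 := by
  obtain ⟨hx, hy, h⟩ := mem_momentSet_starLam.1 hz
  have h1 := h none
  rw [blk_moment_none hx hy] at h1
  have h2 : ∑ j, (rootMap z j + ξ j 0 • 1) = 0 := by
    have h3 : ∑ j, rootMap z j = -(∑ j, ξ j 0) • 1 := h1
    rw [Finset.sum_add_distrib, h3, ← Finset.sum_smul, ← add_smul, neg_add_cancel, zero_smul]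
  exact h2

lemma exists_starTuple_eq (hn : 0 < n)
    (hξ : ∀ j, (A j).charpoly = ∏ i : Fin n, (Polynomial.X - Polynomial.C (ξ j i)))
    {B : Fin q → Matrix (Fin n) (Fin n) ℂ} (hB : ∀ j, B j ∈ closure (conjClass (A j)))
    (hsum : ∑ j, B j = 0) :
    ∃ z ∈ momentSet (blkVert (starDim A ξ)) starRel (starLam (starDim A ξ) ξ),
      z.1 ∈ starInj (starDim A ξ) ∧ starTuple ξ z = B := by
  obtain ⟨z, hz, hx, h⟩ := exists_lift (a := starDim A ξ) (endsZero_starDim hξ) hn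
    (r := fun j i => (prefProd (A j) (ξ j) i).rank) (fun j i => rfl) (B := B) hsum
    fun j => closure_conjClass_subset_flagSet (A j) (ξ j) (hB j)
  exact ⟨z, hz, hx, _root_.funext h⟩

lemma rank_prefProd_eq_starDim (hn : 0 < n)
    (hξ : ∀ j, (A j).charpoly = ∏ i : Fin n, (Polynomial.X - Polynomial.C (ξ j i))) (j : Fin q)
    (i : ℕ) : (prefProd (A j) (ξ j) i).rank = starDim A ξ (armVert hn j i) := by
  rcases Nat.lt_or_ge i n with hi | hi
  · rw [armVert_par hn j hi, starDim_par]
  · rw [(endsZero_starDim hξ).armVert_eq_zero hn j hi, prefProd_eq_zero_of_le (hξ j) hi,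
      Matrix.rank_zero]

lemma starTuple_eq_armVert (hn : 0 < n) {z : MatPair (BlkIdx (starDim A ξ))}
    (hz : z ∈ momentSet (blkVert (starDim A ξ)) starRel (starLam (starDim A ξ) ξ)) (j : Fin q) :
    starTuple ξ z j = (blk z.1 (armVert hn j 0) (armVert hn j 1) *
      blk z.2 (armVert hn j 1) (armVert hn j 0) + ξ j 0 • 1 :
        Matrix (Fin (starDim A ξ none)) (Fin (starDim A ξ none)) ℂ) := by
  have h1 := rootMap_eq_armVert hz.1 hn j
  exact congrArg (fun M : Matrix (Fin (starDim A ξ none)) (Fin (starDim A ξ none)) ℂ =>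
    M + ξ j 0 • 1) h1

lemma surjective_of_starTuple_mem (hn : 0 < n)
    (hξ : ∀ j, (A j).charpoly = ∏ i : Fin n, (Polynomial.X - Polynomial.C (ξ j i)))
    {z : MatPair (BlkIdx (starDim A ξ))}
    (hz : z ∈ momentSet (blkVert (starDim A ξ)) starRel (starLam (starDim A ξ) ξ))
    (hc : ∀ j, starTuple ξ z j ∈ conjClass (A j)) (α : Fin q × Fin n) :
    Function.Surjective (blk z.2 (some α) (starPar α)).mulVec := by
  obtain ⟨j, i⟩ := α
  have h1 := (chainEq_of_mem (endsZero_starDim hξ) hz hn j).surjective_of_rank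
    (fun k => by
      rw [← rank_prefProd_eq_starDim hn hξ j k, ← rank_prefProd_of_mem (hc j),
        starTuple_eq_armVert hn hz j]
      rfl) i
  rw [armVert_succ hn j i.2, armVert_par hn j i.2] at h1
  exact h1

lemma starTuple_mem_conjClass (hn : 0 < n)
    (hξ : ∀ j, (A j).charpoly = ∏ i : Fin n, (Polynomial.X - Polynomial.C (ξ j i)))
    {z z' : MatPair (BlkIdx (starDim A ξ))}
    (hz : z ∈ momentSet (blkVert (starDim A ξ)) starRel (starLam (starDim A ξ) ξ))
    (hz' : z' ∈ momentSet (blkVert (starDim A ξ)) starRel (starLam (starDim A ξ) ξ))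
    (hx : z.1 ∈ starInj (starDim A ξ)) (hx' : z'.1 ∈ starInj (starDim A ξ))
    (hy : ∀ α, Function.Surjective (blk z.2 (some α) (starPar α)).mulVec)
    (hy' : ∀ α, Function.Surjective (blk z'.2 (some α) (starPar α)).mulVec) (j : Fin q)
    (hc : starTuple ξ z j ∈ conjClass (A j)) : starTuple ξ z' j ∈ conjClass (A j) := by
  have ha := endsZero_starDim hξ
  have h1 := ((chainEq_of_mem ha hz hn j).matSim (chainEq_of_mem ha hz' hn j)
    (armVert_injective ha hx hn j) (armVert_injective ha hx' hn j)
    (armVert_surjective ha hy hn j) (armVert_surjective ha hy' hn j)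
    (ha.armVert_eq_zero hn j le_rfl)).add_smul_one (ξ j 0)
  rw [starTuple_eq_armVert hn hz] at hc
  rw [starTuple_eq_armVert hn hz']
  exact MatSim.mem_conjClass h1 hc

lemma irredTuple_starTuple {z : MatPair (BlkIdx (starDim A ξ))} :
    IrredTuple (starTuple ξ z) ↔ IrredTuple (rootMap z) := by
  refine ⟨fun h => ?_, fun h => irredTuple_add_smul_one h fun j => ξ j 0⟩
  have h1 := irredTuple_add_smul_one h fun j => -ξ j 0
  have h2 : (fun j => starTuple ξ z j + -ξ j 0 • 1) = rootMap z := by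
    funext j
    have h3 : rootMap z j + ξ j 0 • 1 + -ξ j 0 • 1 = rootMap z j := by
      rw [neg_smul, add_neg_cancel_right]
    exact h3
  rw [h2] at h1
  exact h1

lemma exists_eigenvalues {A : Fin (p + 1) → Matrix (Fin n) (Fin n) ℂ}
    (hdist : HasDistinctEigen (A (Fin.last p))) : ∃ ξ : Fin (p + 1) → ℕ → ℂ,
      (∀ j, (A j).charpoly = ∏ i : Fin n, (Polynomial.X - Polynomial.C (ξ j i))) ∧
        Function.Injective fun i : Fin n => ξ (Fin.last p) i := by
  obtain ⟨ev, hev, hA⟩ := hdist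
  choose e he using fun j => exists_charpoly_eq_prod (A j)
  refine ⟨fun j i => if h : i < n then (if j = Fin.last p then ev else e j) ⟨i, h⟩ else 0,
    fun j => ?_, fun i k hik => ?_⟩
  · by_cases hj : j = Fin.last p
    · subst hj; simp [hA]
    · simp [hj, he]
  · exact hev (by simpa using hik)

lemma exists_connected_dense {A : Fin (p + 1) → Matrix (Fin n) (Fin n) ℂ} (hp : 1 ≤ p)
    (hn : 1 ≤ n) (hdist : HasDistinctEigen (A (Fin.last p)))
    (hirr : ∃ B ∈ Vset A, IrredTuple B) :
    ∃ S ⊆ {B | B ∈ Vset A ∧ IrredTuple B}, IsConnected S ∧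
      {B | (∀ j, B j ∈ closure (conjClass (A j))) ∧ ∑ j, B j = 0} ⊆ closure S := by
  obtain ⟨ξ, hξ, hinj⟩ := exists_eigenvalues hdist
  have ha := endsZero_starDim hξ
  obtain ⟨B, ⟨hBA, hBsum⟩, hBirr⟩ := hirr
  obtain ⟨z, hz, hx, rfl⟩ := exists_starTuple_eq hn hξ (fun j => subset_closure (hBA j)) hBsum
  have hzirr := irredTuple_starTuple.1 hBirr
  have hlast := starDrop_starDim_eq_one hn hξ (Fin.last p) hinj
  have hstar : StarHyp (starDim A ξ) (starLam (starDim A ξ) ξ) :=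
    { one_le_p := hp
      one_le_n := hn
      ends := ha
      last := hlast
      central := starLam_central ξ
      nonneg := fun h _ hv => starForm_starDim_nonneg hp ⟨_, ⟨hBA, hBsum⟩, hBirr⟩ h hv
      irred := ⟨z, hz, hx, hzirr⟩
      diag := fun z' hz' hx' => exists_diagonalization_rootMap ha hn (Fin.last p) hlast
        (fun i hi k hk h => congrArg Fin.val (@hinj ⟨i, hi⟩ ⟨k, hk⟩ h)) hz' hx' }
  have hy := surjective_of_starTuple_mem hn hξ hz hBA
  obtain ⟨H, hH, hHc, hHd⟩ := hstar.exists_connected ⟨z, hz, hx, hy, hzirr⟩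
  refine ⟨starTuple ξ '' H, ?_, hHc.image _ continuous_starTuple.continuousOn, ?_⟩
  · rintro _ ⟨z', hz'H, rfl⟩
    obtain ⟨hz', hx', hy', hirr'⟩ := hH hz'H
    exact ⟨⟨fun j => starTuple_mem_conjClass hn hξ hz hz' hx hx' hy hy' j (hBA j),
      sum_starTuple hz'⟩, irredTuple_starTuple.2 hirr'⟩
  · rintro C ⟨hC, hCsum⟩
    obtain ⟨w, hw, hwx, rfl⟩ := exists_starTuple_eq hn hξ hC hCsum
    exact image_closure_subset_closure_image continuous_starTuple ⟨w, hHd w hw hwx, rfl⟩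

lemma isClosed_closure_Vset (A : Fin q → Matrix (Fin n) (Fin n) ℂ) :
    IsClosed {B : Fin q → Matrix (Fin n) (Fin n) ℂ |
      (∀ j, B j ∈ closure (conjClass (A j))) ∧ ∑ j, B j = 0} := by
  refine IsClosed.and ?_ (isClosed_eq (continuous_finsetSum _ fun j _ => continuous_apply j)
    continuous_const)
  rw [Set.ofPred_forall]
  exact isClosed_iInter fun j => isClosed_closure.preimage (continuous_apply j)

end Conclusion

/-- closure of 𝒱 is connected, equals the closure of the set of irreducible
tuples, the set of irreducible tuples is connected, and the topological closure is
the "algebraic closure". -/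
theorem stmt8 (p n : ℕ) (hp : 2 ≤ p) (hn : 1 ≤ n)
    (A : Fin (p + 1) → Matrix (Fin n) (Fin n) ℂ)
    (htr : ∑ j, (A j).trace = 0)
    (hdist : HasDistinctEigen (A (Fin.last p)))
    (hirr : ∃ B ∈ Vset A, IrredTuple B) :
    IsConnected (closure (Vset A)) ∧
      closure (Vset A) = closure {B | B ∈ Vset A ∧ IrredTuple B} ∧
      IsConnected {B | B ∈ Vset A ∧ IrredTuple B} ∧
      closure (Vset A) =
        {B | (∀ j, B j ∈ closure (conjClass (A j))) ∧ ∑ j, B j = 0} := by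
  obtain ⟨S, hS, hSc, hSd⟩ := exists_connected_dense (by omega) hn hdist hirr
  have hV : Vset A ⊆ {B | (∀ j, B j ∈ closure (conjClass (A j))) ∧ ∑ j, B j = 0} :=
    fun B hB => ⟨fun j => subset_closure (hB.1 j), hB.2⟩
  have hI : {B | B ∈ Vset A ∧ IrredTuple B} ⊆ Vset A := fun B hB => hB.1
  have hVW := closure_minimal hV (isClosed_closure_Vset A)
  have hIc : IsConnected {B | B ∈ Vset A ∧ IrredTuple B} :=
    hSc.subset_closure hS ((hI.trans hV).trans hSd)
  have hWI := hSd.trans (closure_mono hS)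
  have hVI : closure (Vset A) = closure {B | B ∈ Vset A ∧ IrredTuple B} :=
    (hVW.trans hWI).antisymm (closure_mono hI)
  exact ⟨hVI ▸ hIc.closure, hVI, hIc, hVW.antisymm (hWI.trans (closure_mono hI))⟩
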